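/- For every h₂ with 0.25 < h₂ < 0.648 and every K ∈ (−1, 1), one has I₁(h₂) + I₂(h₂, K) > 0; that is, for the confined inhomogeneous Muskat problem with this initial interface, the curve does not undergo a short-time stability shift, independently of the permeability jump K. -/

import Mathlib

open MeasureTheory Real

/-- First component of the initial interface: `z₁(α) = α - sin(α) e^{-10⁻⁴ α²}`. -/
noncomputable def z₁ (α : ℝ) : ℝ := α - Real.sin α * Real.exp (-(1 / 10000) * α ^ 2)

/-- Second component of the initial interface, depending on the height `h₂` of the
permeability jump. -/
noncomputable def z₂ (h₂ α : ℝ) : ℝ :=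
  if |α| ≤ π then
    h₂ * (3 / π) *
      (Real.sin (3 * α) / 3 -
        Real.sin α / 2.5 * (Real.exp (-(α + 2) ^ 2) + Real.exp (-(α - 2) ^ 2)))
  else 0

/-- The homogeneous part `I₁(h₂)` of `∂ₜ RT(0,0)` (up to a positive constant). -/
noncomputable def I₁ (h₂ : ℝ) : ℝ :=
  2 * deriv (z₂ h₂) 0 *
    ∫ β in Set.Ioi (0 : ℝ),
      (deriv z₁ β * Real.sinh (z₁ β) * Real.sin (z₂ h₂ β) /
          (Real.cosh (z₁ β) - Real.cos (z₂ h₂ β)) ^ 2 +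
        deriv z₁ β * Real.sinh (z₁ β) * Real.sin (z₂ h₂ β) /
          (Real.cosh (z₁ β) + Real.cos (z₂ h₂ β)) ^ 2)

/-- The inhomogeneous part `I₂(h₂, K)` of `∂ₜ RT(0,0)` (up to a positive constant),
a double integral over `(0,∞)²` in the variables `(y, γ)`. -/
noncomputable def I₂ (h₂ K : ℝ) : ℝ :=
  4 * deriv (z₂ h₂) 0 * K *
    ∫ p in Set.Ioi (0 : ℝ) ×ˢ Set.Ioi (0 : ℝ),
      deriv (z₂ h₂) p.2 * Real.cos (z₁ p.2 * p.1) /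
          ((Real.sinh (π * p.1) + K * Real.sinh (2 * h₂ * p.1)) *
            Real.cosh (p.1 * π / 2)) *
        (2 * p.1 * Real.cosh (p.1 * π / 2 - p.1 * h₂) * Real.cosh (p.1 * π / 2) -
          2 * Real.sinh (p.1 * h₂) / Real.tan h₂) *
        Real.cosh (p.1 * z₂ h₂ p.2) * Real.cosh (p.1 * (π / 2 - h₂))



noncomputable def ee (β : ℝ) : ℝ := Real.exp (-(1 / 10000) * β ^ 2)
noncomputable def dz (β : ℝ) : ℝ := 1 - (Real.cos β - 1/5000 * β * Real.sin β) * ee β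
noncomputable def ddz (β : ℝ) : ℝ :=
  (Real.sin β + 1/5000 * Real.sin β + 1/2500 * β * Real.cos β - (1/5000)^2 * β^2 * Real.sin β) * ee β
noncomputable def dddz (β : ℝ) : ℝ :=
  (Real.cos β + 3/5000 * Real.cos β - 3/5000 * β * Real.sin β - 3 * (1/5000)^2 * β * Real.sin β
    - 3 * (1/5000)^2 * β^2 * Real.cos β + (1/5000)^3 * β^3 * Real.sin β) * ee β

lemma ee_deriv (β : ℝ) : HasDerivAt ee (-(1/5000) * β * ee β) β := by
  have h : HasDerivAt (fun β : ℝ => -(1 / 10000) * β ^ 2) (-(1/10000) * (2 * β)) β := by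
    simpa using (hasDerivAt_pow 2 β).const_mul (-(1/10000 : ℝ))
  refine h.exp.congr_deriv ?_
  unfold ee; ring

lemma z1_deriv (β : ℝ) : HasDerivAt z₁ (dz β) β := by
  have := (hasDerivAt_id β).sub ((Real.hasDerivAt_sin β).mul (ee_deriv β))
  refine this.congr_deriv ?_
  unfold dz; simp; ring

lemma dz_deriv (β : ℝ) : HasDerivAt dz (ddz β) β := by
  have h2 := ((hasDerivAt_id β).const_mul (1/5000 : ℝ)).mul (Real.hasDerivAt_sin β)
  have h3 := (((Real.hasDerivAt_cos β).sub h2).mul (ee_deriv β)).const_sub 1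
  refine h3.congr_deriv ?_
  unfold ddz; simp; ring

lemma ddz_deriv (β : ℝ) : HasDerivAt ddz (dddz β) β := by
  have hs := Real.hasDerivAt_sin β
  have hc := Real.hasDerivAt_cos β
  have h1 := (((hs.add (hs.const_mul (1/5000))).add (((hasDerivAt_id β).const_mul (1/2500 : ℝ)).mul hc)).sub
    (((hasDerivAt_pow 2 β).const_mul ((1/5000:ℝ)^2)).mul hs)).mul (ee_deriv β)
  refine h1.congr_deriv ?_
  unfold dddz; simp; ring

lemma ee_pos (β : ℝ) : 0 < ee β := Real.exp_pos _
lemma ee_le (β : ℝ) : ee β ≤ 1 := by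
  unfold ee; apply Real.exp_le_one_iff.2; nlinarith [sq_nonneg β]

lemma dz_nonneg {β : ℝ} (h0 : 0 ≤ β) (h1 : β ≤ π) : 0 ≤ dz β := by
  have hs := Real.sin_nonneg_of_nonneg_of_le_pi h0 h1
  have : (Real.cos β - 1/5000 * β * Real.sin β) ≤ 1 := by
    nlinarith [Real.cos_le_one β, mul_nonneg h0 hs]
  unfold dz; nlinarith [ee_pos β, ee_le β]

lemma dz_abs_le {β : ℝ} (h0 : 0 ≤ β) (h1 : β ≤ 3.15) : |ddz β| ≤ 1.01 ∧ |dddz β| ≤ 1.01 := by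
  have hs := Real.abs_sin_le_one β
  have hc := Real.abs_cos_le_one β
  rw [abs_le] at hs hc
  have e0 := ee_pos β
  have e1 := ee_le β
  have hb : |β| = β := abs_of_nonneg h0
  have key : ∀ a : ℝ, |a| ≤ 1.01 → |a * ee β| ≤ 1.01 := by
    intro a ha
    rw [abs_mul, abs_of_pos e0]; nlinarith [abs_nonneg a]
  have p1 : |β * Real.sin β| ≤ 3.15 := by
    rw [abs_mul, hb]; nlinarith [Real.abs_sin_le_one β, abs_nonneg (Real.sin β)]
  have p2 : |β * Real.cos β| ≤ 3.15 := by
    rw [abs_mul, hb]; nlinarith [Real.abs_cos_le_one β, abs_nonneg (Real.cos β)]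
  have hb2 : β^2 ≤ 10 := by nlinarith
  have hb3 : β^3 ≤ 32 := by nlinarith [pow_nonneg h0 2]
  have p3 : |β^2 * Real.sin β| ≤ 10 := by
    rw [abs_mul, abs_of_nonneg (by positivity)]; nlinarith [Real.abs_sin_le_one β, abs_nonneg (Real.sin β)]
  have p4 : |β^2 * Real.cos β| ≤ 10 := by
    rw [abs_mul, abs_of_nonneg (by positivity)]; nlinarith [Real.abs_cos_le_one β, abs_nonneg (Real.cos β)]
  have p5 : |β^3 * Real.sin β| ≤ 32 := by
    rw [abs_mul, abs_of_nonneg (by positivity)]; nlinarith [Real.abs_sin_le_one β, abs_nonneg (Real.sin β), pow_nonneg h0 3]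
  rw [abs_le] at p1 p2 p3 p4 p5
  constructor
  · apply key; rw [abs_le]; constructor <;> linarith
  · apply key; rw [abs_le]; constructor <;> linarith

lemma dz_le {β : ℝ} (h0 : 0 ≤ β) (h1 : β ≤ 3.15) : dz β ≤ 2.01 := by
  have hs := Real.abs_sin_le_one β
  have hc := Real.abs_cos_le_one β
  rw [abs_le] at hs hc
  have e0 := ee_pos β
  have e1 := ee_le β
  have : -1.01 ≤ (Real.cos β - 1/5000 * β * Real.sin β) := by nlinarith
  unfold dz; nlinarith


noncomputable def bu (a α : ℝ) : ℝ := Real.exp (-(α - a) ^ 2)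
noncomputable def gg (α : ℝ) : ℝ :=
  Real.sin (3 * α) / 3 - 2/5 * (Real.sin α * (bu (-2) α + bu 2 α))
noncomputable def ff (α : ℝ) : ℝ := 3 / π * gg α
noncomputable def b1 (a α : ℝ) : ℝ := (Real.cos α - 2 * (α - a) * Real.sin α) * bu a α
noncomputable def b2 (a α : ℝ) : ℝ :=
  ((4 * (α - a)^2 - 3) * Real.sin α - 4 * (α - a) * Real.cos α) * bu a α
noncomputable def df (α : ℝ) : ℝ := 3 / π * (Real.cos (3 * α) - 2/5 * (b1 (-2) α + b1 2 α))
noncomputable def ddf (α : ℝ) : ℝ := 3 / π * (-3 * Real.sin (3 * α) - 2/5 * (b2 (-2) α + b2 2 α))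

lemma bu_deriv (a α : ℝ) : HasDerivAt (bu a) (-2 * (α - a) * bu a α) α := by
  have h : HasDerivAt (fun α : ℝ => -(α - a) ^ 2) (-(2 * (α - a))) α := by
    exact (((hasDerivAt_id α).sub_const a).pow 2).neg.congr_deriv (by simp)
  refine h.exp.congr_deriv ?_
  unfold bu; ring

lemma sb_deriv (a α : ℝ) : HasDerivAt (fun α => Real.sin α * bu a α) (b1 a α) α := by
  refine ((Real.hasDerivAt_sin α).mul (bu_deriv a α)).congr_deriv ?_
  unfold b1; ring

lemma b1_deriv (a α : ℝ) : HasDerivAt (b1 a) (b2 a α) α := by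
  have h := (((Real.hasDerivAt_cos α).sub ((((hasDerivAt_id α).sub_const a).const_mul 2).mul
    (Real.hasDerivAt_sin α))).mul (bu_deriv a α))
  refine h.congr_deriv ?_
  unfold b2; simp; ring

lemma s3_deriv (α : ℝ) : HasDerivAt (fun α : ℝ => Real.sin (3 * α)) (3 * Real.cos (3 * α)) α := by
  have h : HasDerivAt (fun α : ℝ => 3 * α) 3 α := by simpa using (hasDerivAt_id α).const_mul (3:ℝ)
  refine h.sin.congr_deriv ?_
  ring
lemma c3_deriv (α : ℝ) : HasDerivAt (fun α : ℝ => Real.cos (3 * α)) (-3 * Real.sin (3 * α)) α := by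
  have h : HasDerivAt (fun α : ℝ => 3 * α) 3 α := by simpa using (hasDerivAt_id α).const_mul (3:ℝ)
  refine h.cos.congr_deriv ?_
  ring

lemma ff_deriv (α : ℝ) : HasDerivAt ff (df α) α := by
  have h := ((((s3_deriv α).div_const 3).sub (((sb_deriv (-2) α).add (sb_deriv 2 α)).const_mul (2/5))).const_mul (3/π))
  have e : ff = fun α => 3 / π * (Real.sin (3 * α) / 3 - 2/5 * (Real.sin α * bu (-2) α + Real.sin α * bu 2 α)) := by
    funext α; unfold ff gg; ring
  rw [e]
  refine HasDerivAt.congr_deriv (f' := _) h ?_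
  unfold df; ring

lemma df_deriv (α : ℝ) : HasDerivAt df (ddf α) α := by
  have h := (((c3_deriv α).sub (((b1_deriv (-2) α).add (b1_deriv 2 α)).const_mul (2/5))).const_mul (3/π))
  refine HasDerivAt.congr_deriv (f' := _) h ?_
  unfold ddf; ring

lemma z2_eq {h α : ℝ} (ha : |α| ≤ π) : z₂ h α = h * ff α := by
  unfold z₂ ff gg bu
  rw [if_pos ha]
  have : α - -2 = α + 2 := by ring
  rw [this]; norm_num; ring

lemma bu_pos (a α : ℝ) : 0 < bu a α := Real.exp_pos _
lemma bu_le (a α : ℝ) : bu a α ≤ 1 := by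
  unfold bu; apply Real.exp_le_one_iff.2; nlinarith [sq_nonneg (α - a)]

lemma exp_neg_four : Real.exp (-4) ≤ 0.0184 := by
  have h : Real.exp (-4) = (Real.exp (-1))^4 := by rw [← Real.exp_nat_mul]; norm_num
  have h1 : Real.exp (-1) ≤ 0.36788 := Real.exp_neg_one_lt_d9.le.trans (by norm_num)
  rw [h]
  calc (Real.exp (-1))^4 ≤ 0.36788^4 := by gcongr
    _ ≤ _ := by norm_num

-- far bump
lemma far (α : ℝ) (h : 0 ≤ α) : bu (-2) α * (α^2 + 4 * α + 1) ≤ 0.0184 := by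
  have e : bu (-2) α = Real.exp (-4) * Real.exp (-(α^2 + 4*α)) := by
    unfold bu; rw [← Real.exp_add]; congr 1; ring
  have h1 : Real.exp (-(α^2 + 4*α)) * (α^2+4*α+1) ≤ 1 := by
    rw [Real.exp_neg, inv_mul_le_iff₀ (Real.exp_pos _)]
    linarith [Real.add_one_le_exp (α^2+4*α)]
  rw [e, mul_assoc]
  calc _ ≤ Real.exp (-4) * 1 := by gcongr
    _ ≤ _ := by rw [mul_one]; exact exp_neg_four

lemma far0 (α : ℝ) (h : 0 ≤ α) : bu (-2) α ≤ 0.0184 := by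
  nlinarith [far α h, bu_pos (-2) α, mul_nonneg (bu_pos (-2) α).le (by positivity : 0 ≤ α^2+4*α)]
lemma far1 (α : ℝ) (h : 0 ≤ α) : |b1 (-2) α| ≤ 0.092 := by
  have hb := bu_pos (-2) α
  have hf := far α h
  unfold b1
  rw [abs_mul, abs_of_pos hb]
  have : |Real.cos α - 2 * (α - -2) * Real.sin α| ≤ 5 * (α^2+4*α+1) := by
    have h1 := Real.neg_one_le_sin α
    have h2 := Real.sin_le_one α
    have h3 := Real.neg_one_le_cos α
    have h4 := Real.cos_le_one α
    rw [abs_le]; constructor <;> nlinarith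
  nlinarith
lemma far2 (α : ℝ) (h : 0 ≤ α) : |b2 (-2) α| ≤ 0.3864 := by
  have hb := bu_pos (-2) α
  have hf := far α h
  unfold b2
  rw [abs_mul, abs_of_pos hb]
  have : |(4 * (α - -2)^2 - 3) * Real.sin α - 4 * (α - -2) * Real.cos α| ≤ 21 * (α^2+4*α+1) := by
    have h1 := Real.neg_one_le_sin α
    have h2 := Real.sin_le_one α
    have h3 := Real.neg_one_le_cos α
    have h4 := Real.cos_le_one α
    have k1 : |(4 * (α - -2)^2 - 3) * Real.sin α| ≤ (4 * (α - -2)^2 - 3) := by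
      rw [abs_mul, abs_of_nonneg (by nlinarith)]
      nlinarith [Real.abs_sin_le_one α, abs_nonneg (Real.sin α)]
    have k2 : |4 * (α - -2) * Real.cos α| ≤ 4 * (α - -2) := by
      rw [abs_mul, abs_of_nonneg (by nlinarith)]
      nlinarith [Real.abs_cos_le_one α, abs_nonneg (Real.cos α)]
    refine (abs_sub _ _).trans ?_
    nlinarith
  nlinarith
lemma bsq (a α : ℝ) : (bu a α)^2 = Real.exp (-(2 * (α-a)^2)) := by
  unfold bu; rw [← Real.exp_nat_mul]; congr 1; push_cast; ring
lemma near1 (α : ℝ) : |b1 2 α| ≤ 1.1015 := by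
  have hb := bu_pos 2 α
  apply abs_le_of_sq_le_sq _ (by norm_num)
  have h1 : (1 + 4*(α-2)^2) * (bu 2 α)^2 ≤ 2 * Real.exp (-(1/2)) := by
    rw [bsq]
    have := Real.add_one_le_exp (2*(α-2)^2 - 1/2)
    have e : Real.exp (-(1/2)) = Real.exp (2*(α-2)^2 - 1/2) * Real.exp (-(2 * (α-2)^2)) := by
      rw [← Real.exp_add]; congr 1; ring
    rw [e]; nlinarith [Real.exp_pos (-(2 * (α-2)^2))]
  have h2 : Real.exp (-(1/2)) ≤ 0.60655 := by
    apply le_of_sq_le_sq _ (by norm_num)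
    rw [← Real.exp_nat_mul]; norm_num
    exact Real.exp_neg_one_lt_d9.le.trans (by norm_num)
  have h3 : (Real.cos α - 2 * (α - 2) * Real.sin α)^2 ≤ 1 + 4 * (α-2)^2 := by
    nlinarith [Real.sin_sq_add_cos_sq α, sq_nonneg (Real.sin α + 2 * (α-2) * Real.cos α)]
  unfold b1; rw [mul_pow]
  nlinarith [sq_nonneg (bu 2 α)]
lemma near2 (α : ℝ) : |b2 2 α| ≤ 3 := by
  have hb := bu_pos 2 α
  apply abs_le_of_sq_le_sq _ (by norm_num)
  set w := (α-2)^2 with hw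
  have w0 : 0 ≤ w := sq_nonneg _
  have h1 : ((4*w-3)^2+16*w) * (bu 2 α)^2 ≤ 9 := by
    rw [bsq, Real.exp_neg, mul_inv_le_iff₀ (Real.exp_pos _)]
    have := Real.quadratic_le_exp_of_nonneg (by positivity : 0 ≤ 2 * w)
    nlinarith
  have h3 : ((4 * (α - 2)^2 - 3) * Real.sin α - 4 * (α - 2) * Real.cos α)^2 ≤ (4*w-3)^2+16*w := by
    nlinarith [Real.sin_sq_add_cos_sq α, sq_nonneg ((4*w-3) * Real.cos α + 4 * (α-2) * Real.sin α)]
  unfold b2; rw [mul_pow]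
  nlinarith [sq_nonneg (bu 2 α)]

lemma pi3 : 0 < 3 / π ∧ 3 / π ≤ 0.95493 := by
  refine ⟨by positivity, ?_⟩
  rw [div_le_iff₀ Real.pi_pos]; nlinarith [Real.pi_gt_d6]

lemma ff_bd {α : ℝ} (h : 0 ≤ α) : |ff α| ≤ 0.71 := by
  have hp := pi3
  unfold ff gg
  rw [abs_mul, abs_of_pos hp.1]
  have : |Real.sin (3 * α) / 3 - 2/5 * (Real.sin α * (bu (-2) α + bu 2 α))| ≤ 0.742 := by
    have h1 := Real.abs_sin_le_one α
    have h2 := Real.abs_sin_le_one (3*α)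
    have h3 : |Real.sin α * (bu (-2) α + bu 2 α)| ≤ 1.0184 := by
      rw [abs_mul, abs_of_pos (add_pos (bu_pos _ _) (bu_pos _ _))]
      nlinarith [far0 α h, bu_le 2 α, bu_pos 2 α, bu_pos (-2) α, abs_nonneg (Real.sin α)]
    rw [abs_le] at *; constructor <;> linarith
  nlinarith
lemma df_bd {α : ℝ} (h : 0 ≤ α) : |df α| ≤ 1.42 := by
  have hp := pi3
  unfold df
  rw [abs_mul, abs_of_pos hp.1]
  have : |Real.cos (3 * α) - 2/5 * (b1 (-2) α + b1 2 α)| ≤ 1.48 := by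
    have h1 := Real.abs_cos_le_one (3*α)
    have h2 := far1 α h
    have h3 := near1 α
    rw [abs_le] at *; constructor <;> linarith
  nlinarith
lemma ddf_bd {α : ℝ} (h : 0 ≤ α) : |ddf α| ≤ 4.2 := by
  have hp := pi3
  unfold ddf
  rw [abs_mul, abs_of_pos hp.1]
  have : |-3 * Real.sin (3 * α) - 2/5 * (b2 (-2) α + b2 2 α)| ≤ 4.37 := by
    have h1 := Real.abs_sin_le_one (3*α)
    have h2 := far2 α h
    have h3 := near2 α
    rw [abs_le] at *; constructor <;> linarith
  nlinarith


lemma midpoint_lower {F F1 F2 : ℝ → ℝ} {m r M : ℝ} (hr : 0 ≤ r)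
    (h1 : ∀ β ∈ Set.Icc (m-r) (m+r), HasDerivAt F (F1 β) β)
    (h2 : ∀ β ∈ Set.Icc (m-r) (m+r), HasDerivAt F1 (F2 β) β)
    (hM : ∀ β ∈ Set.Icc (m-r) (m+r), -M ≤ F2 β) :
    2 * r * F m - M * r^3 / 3 ≤ ∫ β in (m-r)..(m+r), F β := by
  have hm : m ∈ Set.Icc (m-r) (m+r) := ⟨by linarith, by linarith⟩
  set G1 : ℝ → ℝ := fun β => F1 β - F1 m + M * (β - m) with hG1
  have dG1 : ∀ β ∈ Set.Icc (m-r) (m+r), HasDerivAt G1 (F2 β + M) β := by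
    intro β hβ
    have := ((h2 β hβ).sub_const (F1 m)).add (((hasDerivAt_id β).sub_const m).const_mul M)
    exact this.congr_deriv (by simp)
  have mono1 : MonotoneOn G1 (Set.Icc (m-r) (m+r)) := by
    apply monotoneOn_of_deriv_nonneg (convex_Icc _ _)
    · exact fun β hβ => (dG1 β hβ).continuousAt.continuousWithinAt
    · exact fun β hβ => (dG1 β (interior_subset hβ)).differentiableAt.differentiableWithinAt
    · intro β hβ; rw [(dG1 β (interior_subset hβ)).deriv]; linarith [hM β (interior_subset hβ)]
  have G1m : G1 m = 0 := by simp [hG1]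
  set G : ℝ → ℝ := fun β => F β - F m - F1 m * (β - m) + M * (β - m)^2 / 2 with hG
  have dG : ∀ β ∈ Set.Icc (m-r) (m+r), HasDerivAt G (G1 β) β := by
    intro β hβ
    have := (((h1 β hβ).sub_const (F m)).sub (((hasDerivAt_id β).sub_const m).const_mul (F1 m))).add
      (((((hasDerivAt_id β).sub_const m).pow 2).const_mul M).div_const 2)
    refine this.congr_deriv ?_
    simp [hG1]; ring
  have Gm : G m = 0 := by simp [hG]
  have Gnn : ∀ β ∈ Set.Icc (m-r) (m+r), 0 ≤ G β := by
    intro β hβ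
    rcases le_total m β with hle | hle
    · have sub : Set.Icc m β ⊆ Set.Icc (m-r) (m+r) := Set.Icc_subset_Icc hm.1 hβ.2
      have : MonotoneOn G (Set.Icc m β) := by
        apply monotoneOn_of_deriv_nonneg (convex_Icc _ _)
        · exact fun x hx => (dG x (sub hx)).continuousAt.continuousWithinAt
        · exact fun x hx => (dG x (sub (interior_subset hx))).differentiableAt.differentiableWithinAt
        · intro x hx; have hx' := interior_subset hx
          rw [(dG x (sub hx')).deriv, ← G1m]; exact mono1 hm (sub hx') hx'.1
      rw [← Gm]; exact this ⟨le_refl _, hle⟩ ⟨hle, le_refl _⟩ hle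
    · have sub : Set.Icc β m ⊆ Set.Icc (m-r) (m+r) := Set.Icc_subset_Icc hβ.1 hm.2
      have : AntitoneOn G (Set.Icc β m) := by
        apply antitoneOn_of_deriv_nonpos (convex_Icc _ _)
        · exact fun x hx => (dG x (sub hx)).continuousAt.continuousWithinAt
        · exact fun x hx => (dG x (sub (interior_subset hx))).differentiableAt.differentiableWithinAt
        · intro x hx; have hx' := interior_subset hx
          rw [(dG x (sub hx')).deriv, ← G1m]; exact mono1 (sub hx') hm hx'.2
      rw [← Gm]; exact this ⟨le_refl _, hle⟩ ⟨hle, le_refl _⟩ hle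
  have hFint : IntervalIntegrable F volume (m-r) (m+r) := by
    apply ContinuousOn.intervalIntegrable
    rw [Set.uIcc_of_le (by linarith)]
    exact fun x hx => (h1 x hx).continuousAt.continuousWithinAt
  have key : ∫ β in (m-r)..(m+r), (F m + F1 m * (β - m) - M * (β - m)^2 / 2) ≤ ∫ β in (m-r)..(m+r), F β := by
    apply intervalIntegral.integral_mono_on (by linarith)
    · apply Continuous.intervalIntegrable; fun_prop
    · exact hFint
    · intro x hx; have := Gnn x hx; simp only [hG] at this; linarith
  refine le_trans (le_of_eq ?_) key
  have e := intervalIntegral.integral_comp_sub_right (a := m-r) (b := m+r)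
    (fun β => F m + F1 m * β - M * β^2/2) m
  rw [e]
  have A : ∀ x : ℝ, HasDerivAt (fun x : ℝ => F m * x + F1 m * x^2/2 - M * x^3/6) (F m + F1 m * x - M * x^2/2) x := by
    intro x
    have := ((((hasDerivAt_id x).const_mul (F m))).add (((hasDerivAt_pow 2 x).const_mul (F1 m)).div_const 2)).sub
      (((hasDerivAt_pow 3 x).const_mul M).div_const 6)
    refine this.congr_deriv ?_
    simp; ring
  rw [intervalIntegral.integral_eq_sub_of_hasDerivAt (fun x _ => A x)]
  · ring
  · apply Continuous.intervalIntegrable; fun_prop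

noncomputable def zc (h β : ℝ) : ℂ := (z₁ β : ℂ) + ((h * ff β : ℝ) : ℂ) * Complex.I
noncomputable def zc1 (h β : ℝ) : ℂ := (dz β : ℂ) + ((h * df β : ℝ) : ℂ) * Complex.I
noncomputable def zc2 (h β : ℝ) : ℂ := (ddz β : ℂ) + ((h * ddf β : ℝ) : ℂ) * Complex.I

lemma zc_deriv (h β : ℝ) : HasDerivAt (zc h) (zc1 h β) β :=
  (z1_deriv β).ofReal_comp.add ((((ff_deriv β).const_mul h).ofReal_comp).mul_const Complex.I)
lemma zc1_deriv (h β : ℝ) : HasDerivAt (zc1 h) (zc2 h β) β :=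
  (dz_deriv β).ofReal_comp.add ((((df_deriv β).const_mul h).ofReal_comp).mul_const Complex.I)

noncomputable def FF (Ψ : ℂ → ℂ) (h β : ℝ) : ℝ := dz β * (Ψ (zc h β)).im
noncomputable def FF1 (Ψ Ψ1 : ℂ → ℂ) (h β : ℝ) : ℝ :=
  ddz β * (Ψ (zc h β)).im + dz β * (Ψ1 (zc h β) * zc1 h β).im
noncomputable def FF2 (Ψ Ψ1 Ψ2 : ℂ → ℂ) (h β : ℝ) : ℝ :=
  dddz β * (Ψ (zc h β)).im + 2 * (ddz β * (Ψ1 (zc h β) * zc1 h β).im)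
   + dz β * (Ψ2 (zc h β) * zc1 h β * zc1 h β + Ψ1 (zc h β) * zc2 h β).im

lemma im_deriv {g : ℝ → ℂ} {g' : ℂ} {β : ℝ} (h : HasDerivAt g g' β) :
    HasDerivAt (fun β => (g β).im) g'.im β := by
  have := (Complex.imCLM.hasFDerivAt.comp_hasDerivAt β h)
  exact this

lemma FF_deriv {Ψ Ψ1 : ℂ → ℂ} {h β : ℝ} (H : HasDerivAt Ψ (Ψ1 (zc h β)) (zc h β)) :
    HasDerivAt (FF Ψ h) (FF1 Ψ Ψ1 h β) β := by
  have h1 : HasDerivAt (fun β => Ψ (zc h β)) (Ψ1 (zc h β) * zc1 h β) β := by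
    exact (HasDerivAt.comp_of_eq (h₂ := Ψ) β H (zc_deriv h β) rfl)
  exact (dz_deriv β).mul (im_deriv h1)

lemma FF1_deriv {Ψ Ψ1 Ψ2 : ℂ → ℂ} {h β : ℝ} (H : HasDerivAt Ψ (Ψ1 (zc h β)) (zc h β))
    (H1 : HasDerivAt Ψ1 (Ψ2 (zc h β)) (zc h β)) :
    HasDerivAt (FF1 Ψ Ψ1 h) (FF2 Ψ Ψ1 Ψ2 h β) β := by
  have h1 : HasDerivAt (fun β => Ψ (zc h β)) (Ψ1 (zc h β) * zc1 h β) β := by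
    exact (HasDerivAt.comp_of_eq (h₂ := Ψ) β H (zc_deriv h β) rfl)
  have h2 : HasDerivAt (fun β => Ψ1 (zc h β)) (Ψ2 (zc h β) * zc1 h β) β := by
    exact (HasDerivAt.comp_of_eq (h₂ := Ψ1) β H1 (zc_deriv h β) rfl)
  have := ((ddz_deriv β).mul (im_deriv h1)).add ((dz_deriv β).mul (im_deriv (h2.mul (zc1_deriv h β))))
  refine this.congr_deriv ?_
  simp only [Pi.mul_apply]; unfold FF2; ring

lemma FF2_bd {Ψ Ψ1 Ψ2 : ℂ → ℂ} {h β Z1 P0 P1 P2 N1 : ℝ} (hb : 0 ≤ β) (hb1 : β ≤ π)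
    (h0 : 0 < h) (hh : h ≤ 0.648) (hz : dz β ≤ Z1)
    (p0 : ‖Ψ (zc h β)‖ ≤ P0) (p1 : ‖Ψ1 (zc h β)‖ ≤ P1) (p2 : ‖Ψ2 (zc h β)‖ ≤ P2)
    (n1 : ‖zc1 h β‖ ≤ N1) :
    |FF2 Ψ Ψ1 Ψ2 h β| ≤ 1.01 * P0 + 2.02 * (P1 * N1) + Z1 * (P2 * N1^2 + P1 * 3.75) := by
  have hb2 : β ≤ 3.15 := hb1.trans (by linarith [Real.pi_lt_d2])
  obtain ⟨z2, z3⟩ := dz_abs_le hb hb2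
  have z1 := dz_nonneg hb hb1
  have n2 : ‖zc2 h β‖ ≤ 3.75 := by
    unfold zc2
    refine (norm_add_le _ _).trans ?_
    simp only [Complex.norm_real, Complex.norm_I, mul_one, norm_mul, Real.norm_eq_abs]
    rw [abs_of_pos h0]
    nlinarith [ddf_bd hb, abs_nonneg (ddf β)]
  have q0 := norm_nonneg (Ψ (zc h β))
  have q1 := norm_nonneg (Ψ1 (zc h β))
  have q2 := norm_nonneg (Ψ2 (zc h β))
  have r1 := norm_nonneg (zc1 h β)
  have r2 := norm_nonneg (zc2 h β)
  have i0 : |(Ψ (zc h β)).im| ≤ P0 := (Complex.abs_im_le_norm _).trans p0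
  have i1 : |(Ψ1 (zc h β) * zc1 h β).im| ≤ P1 * N1 := by
    refine (Complex.abs_im_le_norm _).trans ?_
    rw [norm_mul]; gcongr; linarith
  have i2 : |(Ψ2 (zc h β) * zc1 h β * zc1 h β + Ψ1 (zc h β) * zc2 h β).im| ≤ P2 * N1^2 + P1 * 3.75 := by
    refine (Complex.abs_im_le_norm _).trans ((norm_add_le _ _).trans ?_)
    rw [norm_mul, norm_mul, norm_mul, mul_assoc, ← sq]; gcongr <;> linarith
  unfold FF2
  refine (abs_add_three _ _ _).trans ?_
  rw [abs_mul, abs_mul 2, abs_mul, abs_mul (dz β), abs_of_nonneg z1, abs_of_pos (by norm_num : (0:ℝ) < 2)]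
  have a1 : |dddz β| * |(Ψ (zc h β)).im| ≤ 1.01 * P0 := by gcongr
  have a2 : |ddz β| * |(Ψ1 (zc h β) * zc1 h β).im| ≤ 1.01 * (P1 * N1) := by gcongr
  have a3 : dz β * |(Ψ2 (zc h β) * zc1 h β * zc1 h β + Ψ1 (zc h β) * zc2 h β).im| ≤ Z1 * (P2 * N1^2 + P1 * 3.75) := by
    gcongr; linarith
  linarith


noncomputable def Pc (z : ℂ) : ℂ := -2 * Complex.cosh z / Complex.sinh z ^ 2
noncomputable def Pc1 (z : ℂ) : ℂ := 2 * (Complex.cosh z ^ 2 + 1) / Complex.sinh z ^ 3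
noncomputable def Pc2 (z : ℂ) : ℂ := -2 * Complex.cosh z * (Complex.cosh z ^ 2 + 5) / Complex.sinh z ^ 4

lemma Pc_deriv {z : ℂ} (hz : Complex.sinh z ≠ 0) : HasDerivAt Pc (Pc1 z) z := by
  have h := ((Complex.hasDerivAt_cosh z).const_mul (-2)).div ((Complex.hasDerivAt_sinh z).pow 2) (pow_ne_zero 2 hz)
  refine h.congr_deriv ?_
  unfold Pc1
  have e := Complex.cosh_sq z
  simp only [Pi.pow_apply]
  rw [div_eq_div_iff (by positivity) (by positivity)]
  push_cast
  have e2 : Complex.sinh z ^ 2 = Complex.cosh z ^ 2 - 1 := by rw [e]; ring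
  have e3 : Complex.sinh z ^ 4 = (Complex.cosh z ^ 2 - 1)^2 := by rw [← e2]; ring
  linear_combination (-2 * Complex.sinh z ^ 4) * e2

lemma Pc1_deriv {z : ℂ} (hz : Complex.sinh z ≠ 0) : HasDerivAt Pc1 (Pc2 z) z := by
  have h := ((((Complex.hasDerivAt_cosh z).pow 2).add_const 1).const_mul 2).div ((Complex.hasDerivAt_sinh z).pow 3) (pow_ne_zero 3 hz)
  refine h.congr_deriv ?_
  unfold Pc2
  have e := Complex.cosh_sq z
  simp only [Pi.pow_apply]
  rw [div_eq_div_iff (by positivity) (by positivity)]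
  push_cast
  have e2 : Complex.sinh z ^ 2 = Complex.cosh z ^ 2 - 1 := by rw [e]; ring
  linear_combination (4 * Complex.cosh z * Complex.sinh z ^ 6) * e2

noncomputable def pp (x v : ℝ) : ℝ :=
  2 * Real.sinh x * Real.sin v * (2 + Real.sinh x ^ 2 - Real.sin v ^ 2) / (Real.sinh x ^ 2 + Real.sin v ^ 2)^2

lemma sinh_re_im (x v : ℝ) : Complex.sinh (x + v * Complex.I) =
    ((Real.sinh x * Real.cos v : ℝ) : ℂ) + ((Real.cosh x * Real.sin v : ℝ) : ℂ) * Complex.I := by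
  rw [Complex.sinh_add, Complex.sinh_mul_I, Complex.cosh_mul_I]; push_cast; ring
lemma cosh_re_im (x v : ℝ) : Complex.cosh (x + v * Complex.I) =
    ((Real.cosh x * Real.cos v : ℝ) : ℂ) + ((Real.sinh x * Real.sin v : ℝ) : ℂ) * Complex.I := by
  rw [Complex.cosh_add, Complex.sinh_mul_I, Complex.cosh_mul_I]; push_cast; ring

lemma normsq_sinh (x v : ℝ) : ‖Complex.sinh (x + v * Complex.I)‖^2 = Real.sinh x ^ 2 + Real.sin v ^ 2 := by
  rw [sinh_re_im, ← Complex.normSq_eq_norm_sq, Complex.normSq_add_mul_I]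
  rw [mul_pow, mul_pow, Real.cosh_sq, Real.cos_sq']; ring
lemma norm_cosh_le (x v : ℝ) : ‖Complex.cosh (x + v * Complex.I)‖ ≤ Real.cosh x := by
  apply le_of_sq_le_sq _ (Real.cosh_pos x).le
  rw [cosh_re_im, ← Complex.normSq_eq_norm_sq, Complex.normSq_add_mul_I]
  rw [mul_pow, mul_pow, Real.cosh_sq, Real.cos_sq']; nlinarith [sq_nonneg (Real.sin v)]

lemma Pc_im (x v : ℝ) (h : 0 < Real.sinh x ^ 2 + Real.sin v ^ 2) :
    (Pc (x + v * Complex.I)).im = pp x v := by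
  have hs : Complex.sinh (x + v * Complex.I) ≠ 0 := by
    intro h0; have := normsq_sinh x v; rw [h0] at this; simp at this; linarith
  have e : Pc (x + v * Complex.I) = (-2 * Complex.cosh (x + v * Complex.I) * (starRingEnd ℂ (Complex.sinh (x + v * Complex.I)))^2)
      / (((Real.sinh x ^ 2 + Real.sin v ^ 2)^2 : ℝ) : ℂ) := by
    rw [← normsq_sinh, ← Complex.normSq_eq_norm_sq]
    unfold Pc
    push_cast
    rw [← Complex.mul_conj]
    have hc : starRingEnd ℂ (Complex.sinh (x + v * Complex.I)) ≠ 0 := by simpa using hs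
    field_simp
  rw [e, Complex.div_ofReal_im, sinh_re_im, cosh_re_im]
  unfold pp
  congr 1
  have hC := Real.cosh_sq x
  have hc := Real.cos_sq' v
  simp [pow_two]
  simp [Complex.sinh_ofReal_re, Complex.cosh_ofReal_re, Complex.sin_ofReal_re, Complex.cos_ofReal_re, -Complex.ofReal_sinh, -Complex.ofReal_cosh, -Complex.ofReal_sin, -Complex.ofReal_cos]
  linear_combination (-2*Real.sinh x * Real.sin v * (-Real.sin v^2 - 2 *Real.cos v^2)) * hC + (-2*Real.sinh x*Real.sin v*(-2-Real.sinh x^2)) * hc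

noncomputable def JJ (c x : ℝ) : ℝ := 2 * c * x / (c^2 + x^2)^2
noncomputable def Pq (h : ℝ) (z : ℂ) : ℂ := ((z - (2*h:ℝ) * Complex.I)^2)⁻¹ + ((z + (2*h:ℝ) * Complex.I)^2)⁻¹
noncomputable def Pq1 (h : ℝ) (z : ℂ) : ℂ := -2 * ((z - (2*h:ℝ) * Complex.I)^3)⁻¹ + -2 * ((z + (2*h:ℝ) * Complex.I)^3)⁻¹
noncomputable def Pq2 (h : ℝ) (z : ℂ) : ℂ := 6 * ((z - (2*h:ℝ) * Complex.I)^4)⁻¹ + 6 * ((z + (2*h:ℝ) * Complex.I)^4)⁻¹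

lemma inv2_deriv (a z : ℂ) (h : z - a ≠ 0) : HasDerivAt (fun z => ((z - a)^2)⁻¹) (-2 * ((z-a)^3)⁻¹) z := by
  have := ((((hasDerivAt_id z).sub_const a).pow 2)).inv (pow_ne_zero 2 h)
  refine this.congr_deriv ?_
  simp; field_simp
lemma inv3_deriv (a z : ℂ) (h : z - a ≠ 0) : HasDerivAt (fun z => -2 * ((z - a)^3)⁻¹) (6 * ((z-a)^4)⁻¹) z := by
  have := (((((hasDerivAt_id z).sub_const a).pow 3)).inv (pow_ne_zero 3 h)).const_mul (-2)
  refine this.congr_deriv ?_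
  simp; field_simp; norm_num
lemma Pq_deriv {h : ℝ} {z : ℂ} (h1 : z - (2*h:ℝ) * Complex.I ≠ 0) (h2 : z + (2*h:ℝ) * Complex.I ≠ 0) :
    HasDerivAt (Pq h) (Pq1 h z) z := by
  have := (inv2_deriv _ z h1).add (inv2_deriv (-((2*h:ℝ) * Complex.I)) z (by rwa [sub_neg_eq_add]))
  simp only [sub_neg_eq_add] at this
  exact this
lemma Pq1_deriv {h : ℝ} {z : ℂ} (h1 : z - (2*h:ℝ) * Complex.I ≠ 0) (h2 : z + (2*h:ℝ) * Complex.I ≠ 0) :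
    HasDerivAt (Pq1 h) (Pq2 h z) z := by
  have := (inv3_deriv _ z h1).add (inv3_deriv (-((2*h:ℝ) * Complex.I)) z (by rwa [sub_neg_eq_add]))
  simp only [sub_neg_eq_add] at this
  exact this

lemma inv2_im (x c : ℝ) : (((x + c * Complex.I)^2)⁻¹ : ℂ).im = - JJ c x := by
  rw [← inv_pow, pow_two, Complex.mul_im, Complex.inv_re, Complex.inv_im, Complex.normSq_add_mul_I]
  unfold JJ
  simp
  by_cases h : x^2 + c^2 = 0
  · have h' : c^2 + x^2 = 0 := by linarith
    simp [h, h']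
  · have h' : c^2 + x^2 ≠ 0 := by rwa [add_comm]
    field_simp; ring

lemma Pq_im (h x v : ℝ) : (Pq h (x + v * Complex.I)).im = JJ (2*h - v) x - JJ (2*h+v) x := by
  unfold Pq
  have e1 : (x + v * Complex.I - (2*h:ℝ) * Complex.I : ℂ) = x + ((v - 2*h : ℝ):ℂ) * Complex.I := by push_cast; ring
  have e2 : (x + v * Complex.I + (2*h:ℝ) * Complex.I : ℂ) = x + ((2*h + v : ℝ):ℂ) * Complex.I := by push_cast; ring
  rw [e1, e2, Complex.add_im, inv2_im, inv2_im]
  unfold JJ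
  have : (v - 2*h)^2 = (2*h - v)^2 := by ring
  rw [this]; ring


/-- combined kernel -/
noncomputable def Ps (h σ : ℝ) (z : ℂ) : ℂ := Pc z + (σ:ℂ) * Pq h z
noncomputable def Ps1 (h σ : ℝ) (z : ℂ) : ℂ := Pc1 z + (σ:ℂ) * Pq1 h z
noncomputable def Ps2 (h σ : ℝ) (z : ℂ) : ℂ := Pc2 z + (σ:ℂ) * Pq2 h z

noncomputable def qN (Z1 C : ℝ) : ℝ := (1.01 * (Z1^2 + 1.85) + 3.75 * Z1) * (C^2+1)
noncomputable def a4 (Z1 C : ℝ) : ℝ := 0.2 * qN Z1 C + 2 * Z1 * (Z1^2+0.85) * (C * (C^2+5))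
noncomputable def a2 (Z1 C : ℝ) : ℝ := 2.02 * C + 5 * qN Z1 C

lemma amgm {r : ℝ} (hr : 0 < r) : 2 / r^3 ≤ 0.2 / (r^2)^2 + 5 / r^2 := by
  have : 0.2 / (r^2)^2 + 5 / r^2 - 2 / r^3 = (1 - 5 * r)^2 / (5 * r^4) := by field_simp; ring
  have h2 : 0 ≤ (1 - 5 * r)^2 / (5 * r^4) := by positivity
  linarith

lemma w_bd {h β : ℝ} (hb : 0 ≤ β) (h0 : 0 < h) :
    1.29 * h ≤ ‖zc h β - (2*h:ℝ) * Complex.I‖ ∧ 1.29 * h ≤ ‖zc h β + (2*h:ℝ) * Complex.I‖ := by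
  have hf := abs_le.1 (ff_bd hb)
  constructor
  · refine le_trans ?_ (Complex.abs_im_le_norm _)
    unfold zc; simp
    rw [abs_sub_comm]
    refine le_trans ?_ (le_abs_self _); nlinarith
  · refine le_trans ?_ (Complex.abs_im_le_norm _)
    unfold zc; simp
    refine le_trans ?_ (le_abs_self _); nlinarith

lemma inv_pow_bd {z : ℂ} {w : ℝ} (n : ℕ) (hw : 0 < w) (h : w ≤ ‖z‖) : ‖(z^n)⁻¹‖ ≤ (w^n)⁻¹ := by
  rw [norm_inv, norm_pow]
  gcongr

lemma winv2 {w : ℝ} (w0 : 0 < w) (w84 : w ≤ 0.836) : (w^2)⁻¹ ≤ 0.7 * (w^4)⁻¹ := by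
  rw [← div_eq_mul_inv, inv_eq_one_div, div_le_div_iff₀ (by positivity) (by positivity)]
  have h1 : w^2 ≤ 0.7 := by nlinarith
  have h2 : w^4 = w^2 * w^2 := by ring
  rw [h2]; nlinarith [pow_pos w0 2]
lemma winv3 {w : ℝ} (w0 : 0 < w) (w84 : w ≤ 0.836) : (w^3)⁻¹ ≤ 0.836 * (w^4)⁻¹ := by
  rw [← div_eq_mul_inv, inv_eq_one_div, div_le_div_iff₀ (by positivity) (by positivity)]
  have h2 : w^4 = w^3 * w := by ring
  rw [h2]; nlinarith [pow_pos w0 3]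
lemma winv4 {h : ℝ} (h0 : 0 < h) : 160 * ((1.29 * h)^4)⁻¹ ≤ 58 / h^4 := by
  rw [← div_eq_mul_inv, div_le_div_iff₀ (by positivity) (by positivity), mul_pow]
  have := pow_pos h0 4
  norm_num; linarith

lemma hv_bd {h β : ℝ} (hb : 0 ≤ β) (h0 : 0 < h) (hh : h ≤ 0.648) : (h * df β)^2 ≤ 0.85 := by
  have hdf := df_bd hb
  have : |h * df β| ≤ 0.9202 := by
    rw [abs_mul, abs_of_pos h0]; nlinarith [abs_nonneg (df β)]
  rw [← sq_abs]; nlinarith [abs_nonneg (h * df β)]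
lemma nbd {N d v Z : ℝ} (n0 : 0 ≤ N) (ns : N^2 = d^2+v^2) (hd : 0 ≤ d) (hd2 : d ≤ 2.01) (hv : v^2 ≤ 0.85) (hz : d^2 ≤ Z^2) :
    N ≤ (Z^2 + 1.85)/2 ∧ N^2 ≤ 4.9 ∧ N ≤ 2.22 := by
  have h2 : N^2 ≤ 4.9 := by nlinarith
  refine ⟨by nlinarith [sq_nonneg (N - 1)], h2, ?_⟩
  nlinarith

set_option maxHeartbeats 1000000 in
lemma FF2_total {h σ β Z1 C ρ : ℝ} (hb : 0 ≤ β) (hb1 : β ≤ π) (h0 : 0 < h) (hh : h ≤ 0.648)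
    (hσ : |σ| ≤ 1) (hz : dz β ≤ Z1) (hC : Real.cosh (z₁ β) ≤ C) (hρ : 0 < ρ)
    (hr : ρ ≤ Real.sinh (z₁ β)^2 + Real.sin (h * ff β)^2) :
    |FF2 (Ps h σ) (Ps1 h σ) (Ps2 h σ) h β| ≤ a4 Z1 C / ρ^2 + a2 Z1 C / ρ + 58 / h^4 := by
  have hz0 := dz_nonneg hb hb1
  have hb2 : β ≤ 3.15 := hb1.trans (by linarith [Real.pi_lt_d2])
  have hz2 := dz_le hb hb2
  have hns := normsq_sinh (z₁ β) (h * ff β)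
  have hnc := (norm_cosh_le (z₁ β) (h * ff β)).trans hC
  change ‖Complex.sinh (zc h β)‖^2 = _ at hns
  change ‖Complex.cosh (zc h β)‖ ≤ _ at hnc
  set S := ‖Complex.sinh (zc h β)‖ with hS
  have hS2 : ρ ≤ S^2 := by rw [hns]; exact hr
  have hSpos : 0 < S := by
    rcases (norm_nonneg (Complex.sinh (zc h β))).eq_or_lt with h | h
    · rw [← hS] at h; rw [← h] at hS2; norm_num at hS2; linarith
    · exact h
  have hC0 : 0 ≤ C := (norm_nonneg _).trans hnc
  have c0 : ‖Pc (zc h β)‖ ≤ 2 * C / ρ := by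
    unfold Pc
    rw [norm_div, norm_mul, norm_pow, norm_neg, Complex.norm_ofNat, ← hS]
    gcongr
  have e1 : (S^3)⁻¹ * 2 ≤ 0.2 / ρ^2 + 5 / ρ := by
    have := amgm hSpos
    have t1 : 0.2 / (S^2)^2 ≤ 0.2 / ρ^2 := by gcongr
    have t2 : 5 / S^2 ≤ 5 / ρ := by gcongr
    rw [mul_comm, ← div_eq_mul_inv]; linarith
  have c1 : ‖Pc1 (zc h β)‖ ≤ (C^2+1) * (0.2 / ρ^2 + 5 / ρ) := by
    unfold Pc1
    rw [norm_div, norm_mul, norm_pow, Complex.norm_ofNat, ← hS, div_eq_mul_inv, mul_comm 2, mul_assoc, mul_comm 2]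
    have : ‖Complex.cosh (zc h β) ^ 2 + 1‖ ≤ C^2+1 := by
      refine (norm_add_le _ _).trans ?_
      rw [norm_pow, norm_one]; gcongr
    gcongr
  have c2 : ‖Pc2 (zc h β)‖ ≤ 2 * (C * (C^2+5)) / ρ^2 := by
    unfold Pc2
    rw [norm_div, norm_mul, norm_mul, norm_pow, norm_neg, Complex.norm_ofNat, ← hS, mul_assoc]
    have t : ‖Complex.cosh (zc h β) ^ 2 + 5‖ ≤ C^2+5 := by
      refine (norm_add_le _ _).trans ?_
      rw [norm_pow, Complex.norm_ofNat]; gcongr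
    have t2 : ρ^2 ≤ S^4 := by calc ρ^2 ≤ (S^2)^2 := by gcongr
                              _ = S^4 := by ring
    gcongr
  obtain ⟨w1, w2⟩ := w_bd hb h0
  set w := 1.29 * h with hw
  have w0 : 0 < w := by positivity
  have w84 : w ≤ 0.836 := by rw [hw]; linarith
  have sg : ∀ z : ℂ, ∀ B : ℝ, ‖z‖ ≤ B → ‖(σ:ℂ) * z‖ ≤ B := by
    intro z B hB
    rw [norm_mul, Complex.norm_real, Real.norm_eq_abs]
    nlinarith [norm_nonneg z, abs_nonneg σ]
  have q0 : ‖(σ:ℂ) * Pq h (zc h β)‖ ≤ 2 * (w^2)⁻¹ := by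
    apply sg; refine (norm_add_le _ _).trans ?_
    linarith [inv_pow_bd 2 w0 w1, inv_pow_bd 2 w0 w2]
  have q1 : ‖(σ:ℂ) * Pq1 h (zc h β)‖ ≤ 4 * (w^3)⁻¹ := by
    apply sg; refine (norm_add_le _ _).trans ?_
    rw [norm_mul, norm_mul, norm_neg, Complex.norm_ofNat]
    linarith [inv_pow_bd 3 w0 w1, inv_pow_bd 3 w0 w2]
  have q2 : ‖(σ:ℂ) * Pq2 h (zc h β)‖ ≤ 12 * (w^4)⁻¹ := by
    apply sg; refine (norm_add_le _ _).trans ?_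
    rw [norm_mul, norm_mul, Complex.norm_ofNat]
    linarith [inv_pow_bd 4 w0 w1, inv_pow_bd 4 w0 w2]
  have i2 := winv2 w0 w84
  have i3 := winv3 w0 w84
  have i4 : 160 * (w^4)⁻¹ ≤ 58 / h^4 := winv4 h0
  have ns : ‖zc1 h β‖^2 = dz β^2 + (h * df β)^2 := by
    unfold zc1; rw [← Complex.normSq_eq_norm_sq, Complex.normSq_add_mul_I]
  have hv := hv_bd hb h0 hh
  have hzz : dz β ^ 2 ≤ Z1^2 := by gcongr
  have n0 := norm_nonneg (zc1 h β)
  have nsb : ‖zc1 h β‖^2 ≤ Z1^2 + 0.85 := by linarith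
  obtain ⟨nb, ns2, nb2⟩ := nbd n0 ns hz0 hz2 hv hzz
  have main := FF2_bd (Ψ := Ps h σ) (Ψ1 := Ps1 h σ) (Ψ2 := Ps2 h σ) hb hb1 h0 hh (le_refl (dz β))
    (norm_add_le_of_le c0 q0) (norm_add_le_of_le c1 q1) (norm_add_le_of_le c2 q2) (le_refl _)
  refine main.trans ?_
  set N := ‖zc1 h β‖
  have W0 : 0 < (w^4)⁻¹ := by positivity
  have W3 : 0 < (w^3)⁻¹ := by positivity
  have part2 : 1.01 * (2 * (w^2)⁻¹) + 2.02 * (4 * (w^3)⁻¹ * N) + dz β * (12 * (w^4)⁻¹ * N^2 + 4 * (w^3)⁻¹ * 3.75) ≤ 160 * (w^4)⁻¹ := by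
    have k1 : 4 * (w^3)⁻¹ * N ≤ 4 * (0.836 * (w^4)⁻¹) * 2.22 := by gcongr
    have k2 : dz β * (12 * (w^4)⁻¹ * N^2 + 4 * (w^3)⁻¹ * 3.75) ≤ 2.01 * (12 * (w^4)⁻¹ * 4.9 + 4 * (0.836 * (w^4)⁻¹) * 3.75) := by
      gcongr
    linarith
  set D1 := (0.2 / ρ^2 + 5 / ρ) with hD1
  have D10 : 0 ≤ D1 := by positivity
  have part1 : 1.01 * (2 * C / ρ) + 2.02 * ((C^2+1) * D1 * N) + dz β * (2 * (C * (C^2+5)) / ρ^2 * N^2 + (C^2+1) * D1 * 3.75)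
      ≤ a4 Z1 C / ρ^2 + a2 Z1 C / ρ := by
    have Z0 : 0 ≤ Z1 := hz0.trans hz
    have k1 : (C^2+1) * D1 * N ≤ (C^2+1) * D1 * ((Z1^2 + 1.85)/2) := by gcongr
    have k2 : dz β * (2 * (C * (C^2+5)) / ρ^2 * N^2 + (C^2+1) * D1 * 3.75) ≤
       Z1 * (2 * (C * (C^2+5)) / ρ^2 * (Z1^2 + 0.85) + (C^2+1) * D1 * 3.75) := by gcongr
    have k3 : 1.01 * (2 * C / ρ) + 2.02 * ((C^2+1) * D1 * ((Z1^2 + 1.85)/2)) + Z1 * (2 * (C * (C^2+5)) / ρ^2 * (Z1^2 + 0.85) + (C^2+1) * D1 * 3.75)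
      = a4 Z1 C / ρ^2 + a2 Z1 C / ρ := by
      unfold a4 a2 qN; rw [hD1]; field_simp; ring
    linarith
  linarith

lemma Ps_d {h σ β : ℝ} (hb : 0 ≤ β) (h0 : 0 < h)
    (hr : 0 < Real.sinh (z₁ β)^2 + Real.sin (h * ff β)^2) :
    HasDerivAt (Ps h σ) (Ps1 h σ (zc h β)) (zc h β) ∧ HasDerivAt (Ps1 h σ) (Ps2 h σ (zc h β)) (zc h β) := by
  have hs : Complex.sinh (zc h β) ≠ 0 := by
    intro h0
    have hns := normsq_sinh (z₁ β) (h * ff β)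
    change ‖Complex.sinh (zc h β)‖^2 = _ at hns
    rw [h0] at hns; simp at hns; linarith
  obtain ⟨w1, w2⟩ := w_bd hb h0
  have w0 : 0 < 1.29 * h := by positivity
  have n1 := norm_pos_iff.1 (w0.trans_le w1)
  have n2 := norm_pos_iff.1 (w0.trans_le w2)
  exact ⟨(Pc_deriv hs).add ((Pq_deriv n1 n2).const_mul _), (Pc1_deriv hs).add ((Pq1_deriv n1 n2).const_mul _)⟩

/-- The γ-integrand -/
noncomputable def Fs (h σ β : ℝ) : ℝ :=
  dz β * (pp (z₁ β) (h * ff β) + σ * (JJ (2*h - h * ff β) (z₁ β) - JJ (2*h + h * ff β) (z₁ β)))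

lemma FF_eq {h σ β : ℝ} (hr : 0 < Real.sinh (z₁ β)^2 + Real.sin (h * ff β)^2) :
    FF (Ps h σ) h β = Fs h σ β := by
  unfold FF Fs Ps zc
  rw [Complex.add_im, Pc_im _ _ hr, Complex.im_ofReal_mul, Pq_im]

lemma box_lower {h σ m r Z1 C ρ : ℝ} (hr : 0 ≤ r) (hm : 0 ≤ m - r) (hm1 : m + r ≤ π) (h0 : 0 < h) (hh : h ≤ 0.648)
    (hσ : |σ| ≤ 1) (hz : ∀ β ∈ Set.Icc (m-r) (m+r), dz β ≤ Z1)
    (hC : ∀ β ∈ Set.Icc (m-r) (m+r), Real.cosh (z₁ β) ≤ C) (hρ : 0 < ρ)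
    (hR : ∀ β ∈ Set.Icc (m-r) (m+r), ρ ≤ Real.sinh (z₁ β)^2 + Real.sin (h * ff β)^2) :
    2 * r * Fs h σ m - (a4 Z1 C / ρ^2 + a2 Z1 C / ρ + 58 / h^4) * r^3 / 3 ≤ ∫ β in (m-r)..(m+r), Fs h σ β := by
  have hpos : ∀ β ∈ Set.Icc (m-r) (m+r), 0 < Real.sinh (z₁ β)^2 + Real.sin (h * ff β)^2 :=
    fun β hβ => hρ.trans_le (hR β hβ)
  have key := midpoint_lower (F := FF (Ps h σ) h) (F1 := FF1 (Ps h σ) (Ps1 h σ) h)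
    (F2 := FF2 (Ps h σ) (Ps1 h σ) (Ps2 h σ) h) (M := a4 Z1 C / ρ^2 + a2 Z1 C / ρ + 58 / h^4) hr
    (fun β hβ => FF_deriv (Ps_d (hm.trans hβ.1) h0 (hpos β hβ)).1)
    (fun β hβ => FF1_deriv (Ps_d (hm.trans hβ.1) h0 (hpos β hβ)).1 (Ps_d (hm.trans hβ.1) h0 (hpos β hβ)).2)
    (fun β hβ => (abs_le.1 (FF2_total (hm.trans hβ.1) (hβ.2.trans hm1) h0 hh hσ (hz β hβ) (hC β hβ) hρ (hR β hβ))).1)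
  rw [FF_eq (hpos m ⟨by linarith, by linarith⟩)] at key
  refine key.trans (le_of_eq ?_)
  apply intervalIntegral.integral_congr
  intro β hβ
  rw [Set.uIcc_of_le (by linarith)] at hβ
  exact FF_eq (hpos β hβ)


/-- truncated class sums of the exponential series -/
noncomputable def cls (c : ℕ) (t : ℝ) : ℝ := ∑ j ∈ Finset.range 9, t^(4*j+c) / ((4*j+c).factorial : ℝ)

lemma sum_split (z : ℂ) (n : ℕ) : ∑ m ∈ Finset.range (4*n), z^m / (m.factorial : ℂ) =
    ∑ j ∈ Finset.range n, (z^(4*j+0) / ((4*j+0).factorial : ℂ) + z^(4*j+1) / ((4*j+1).factorial : ℂ)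
      + z^(4*j+2) / ((4*j+2).factorial : ℂ) + z^(4*j+3) / ((4*j+3).factorial : ℂ)) := by
  induction n with
  | zero => simp
  | succ k ih =>
    rw [Finset.sum_range_succ _ k, ← ih, show 4*(k+1) = 4*k+1+1+1+1 by ring]
    simp only [Finset.sum_range_succ, add_zero]; ring

noncomputable def teps : ℝ := 1/10^19

lemma exp_cls {z : ℂ} (hz : ‖z‖ ≤ 4) : ‖Complex.exp z - (∑ j ∈ Finset.range 9,
     (z^(4*j+0) / ((4*j+0).factorial : ℂ) + z^(4*j+1) / ((4*j+1).factorial : ℂ)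
      + z^(4*j+2) / ((4*j+2).factorial : ℂ) + z^(4*j+3) / ((4*j+3).factorial : ℂ)))‖ ≤ teps := by
  rw [← sum_split z 9]
  refine (Complex.exp_bound' (x := z) (n := 36) ?_).trans ?_
  · norm_num; linarith
  · have : ‖z‖^36 ≤ 4^36 := by gcongr
    unfold teps
    have h2 : ((Nat.factorial 36 : ℕ):ℝ) = 371993326789901217467999448150835200000000 := by norm_num [Nat.factorial]
    norm_num [h2]
    norm_num at this
    linarith

lemma sum_I (t : ℝ) : (∑ j ∈ Finset.range 9,
     (((t:ℂ) * Complex.I)^(4*j+0) / ((4*j+0).factorial : ℂ) + ((t:ℂ) * Complex.I)^(4*j+1) / ((4*j+1).factorial : ℂ)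
      + ((t:ℂ) * Complex.I)^(4*j+2) / ((4*j+2).factorial : ℂ) + ((t:ℂ) * Complex.I)^(4*j+3) / ((4*j+3).factorial : ℂ)))
     = ((cls 0 t - cls 2 t : ℝ):ℂ) + ((cls 1 t - cls 3 t : ℝ):ℂ) * Complex.I := by
  unfold cls
  push_cast
  rw [← Finset.sum_sub_distrib, ← Finset.sum_sub_distrib, Finset.sum_mul, ← Finset.sum_add_distrib]
  apply Finset.sum_congr rfl
  intro j _
  have h4 : Complex.I^(4*j) = 1 := by rw [pow_mul, Complex.I_pow_four, one_pow]
  have h3 : Complex.I^3 = -Complex.I := Complex.I_pow_three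
  simp only [mul_pow, pow_add, h4, h3, Complex.I_sq, pow_zero, pow_one]
  ring

lemma sum_R (t : ℝ) : (∑ j ∈ Finset.range 9,
     ((t:ℂ)^(4*j+0) / ((4*j+0).factorial : ℂ) + ((t:ℂ))^(4*j+1) / ((4*j+1).factorial : ℂ)
      + ((t:ℂ))^(4*j+2) / ((4*j+2).factorial : ℂ) + ((t:ℂ))^(4*j+3) / ((4*j+3).factorial : ℂ)))
     = ((cls 0 t + cls 1 t + cls 2 t + cls 3 t : ℝ):ℂ) := by
  unfold cls
  push_cast
  simp only [← Finset.sum_add_distrib]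

lemma cls_neg (t : ℝ) : cls 0 (-t) = cls 0 t ∧ cls 1 (-t) = - cls 1 t ∧ cls 2 (-t) = cls 2 t ∧ cls 3 (-t) = - cls 3 t := by
  unfold cls
  simp only [← Finset.sum_neg_distrib]
  refine ⟨?_, ?_, ?_, ?_⟩ <;> refine Finset.sum_congr rfl fun j _ => ?_ <;>
    simp only [pow_add, pow_mul, neg_pow t 4] <;> ring

lemma tay_trig {t : ℝ} (h0 : 0 ≤ t) (h4 : t ≤ 4) :
    |Real.cos t - (cls 0 t - cls 2 t)| ≤ teps ∧ |Real.sin t - (cls 1 t - cls 3 t)| ≤ teps := by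
  have h := exp_cls (z := (t:ℂ) * Complex.I) (by simp [abs_of_nonneg h0]; exact h4)
  rw [sum_I, Complex.exp_mul_I, ← Complex.ofReal_cos, ← Complex.ofReal_sin] at h
  have e : (Real.cos t : ℂ) + (Real.sin t : ℂ) * Complex.I - (((cls 0 t - cls 2 t : ℝ):ℂ) + ((cls 1 t - cls 3 t : ℝ):ℂ) * Complex.I)
     = ((Real.cos t - (cls 0 t - cls 2 t) : ℝ) : ℂ) + ((Real.sin t - (cls 1 t - cls 3 t) : ℝ) : ℂ) * Complex.I := by
    push_cast; ring
  rw [e] at h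
  have hr := (Complex.abs_re_le_norm _).trans h
  have hi := (Complex.abs_im_le_norm _).trans h
  constructor
  · rwa [Complex.add_re, Complex.ofReal_re, Complex.re_ofReal_mul, Complex.I_re, mul_zero, add_zero] at hr
  · rwa [Complex.add_im, Complex.ofReal_im, Complex.im_ofReal_mul, Complex.I_im, mul_one, zero_add] at hi

lemma tay_exp {t : ℝ} (h4 : |t| ≤ 4) : |Real.exp t - (cls 0 t + cls 1 t + cls 2 t + cls 3 t)| ≤ teps := by
  have h := exp_cls (z := (t:ℂ)) (by simpa using h4)
  rw [sum_R, ← Complex.ofReal_exp, ← Complex.ofReal_sub, Complex.norm_real] at h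
  exact h

lemma tay_expn {t : ℝ} (h0 : 0 ≤ t) (h4 : t ≤ 4) : |Real.exp (-t) - (cls 0 t + cls 2 t - (cls 1 t + cls 3 t))| ≤ teps := by
  have h := tay_exp (t := -t) (by rw [abs_neg, abs_of_nonneg h0]; exact h4)
  obtain ⟨a, b, c, d⟩ := cls_neg t
  rw [a, b, c, d] at h
  convert h using 2; ring

lemma tay_sinh {t : ℝ} (h0 : 0 ≤ t) (h4 : t ≤ 4) : |Real.sinh t - (cls 1 t + cls 3 t)| ≤ teps := by
  have h1 := abs_le.1 (tay_exp (t := t) (by rw [abs_of_nonneg h0]; exact h4))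
  have h2 := abs_le.1 (tay_expn h0 h4)
  rw [Real.sinh_eq, abs_le]
  constructor <;> linarith [h1.1, h1.2, h2.1, h2.2]

/-- homogeneous Horner evaluation -/
def hz (k0 k1 k2 k3 k4 k5 k6 k7 k8 w v : ℕ) : ℕ :=
  (((((((k8*w + k7*v)*w + k6*v^2)*w + k5*v^3)*w + k4*v^4)*w + k3*v^5)*w + k2*v^6)*w + k1*v^7)*w + k0*v^8

def q0 (M D : ℕ) : ℕ := 1000000000000000000 * M^0 * hz 10333147966386144929666651337523200000000 430547831932756038736110472396800000000 256278471388545261152446709760000000 21572261901392698750205952000000 493870464775473872486400000 4247252019052922880000 16654322805120000 33891580800 39270 (M^4) (D^4) / (10333147966386144929666651337523200000000 * D^32)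
def q1 (M D : ℕ) : ℕ := 1000000000000000000 * M^1 * hz 10333147966386144929666651337523200000000 86109566386551207747222094479360000000 28475385709838362350271856640000000 1659404761645592211554304000000 29051203810321992499200000 202250096145377280000 666172912204800 1168675200 1190 (M^4) (D^4) / (10333147966386144929666651337523200000000 * D^33)
def q2 (M D : ℕ) : ℕ := 1000000000000000000 * M^2 * hz 5166573983193072464833325668761600000000 14351594397758534624537015746560000000 2847538570983836235027185664000000 118528911546113729396736000000 1613955767240110694400000 9193186188426240000 25622035084800 38955840 35 (M^4) (D^4) / (10333147966386144929666651337523200000000 * D^34)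
def q3 (M D : ℕ) : ℕ := 1000000000000000000 * M^3 * hz 1722191327731024154944441889587200000000 2050227771108362089219573678080000000 258867142816712385002471424000000 7901927436407581959782400000 84945040381058457600000 399703747322880000 948964262400 1256640 1 (M^4) (D^4) / (10333147966386144929666651337523200000000 * D^35)

lemma div_bd (a b : ℕ) (hb : 0 < b) : ((a / b : ℕ) : ℝ) ≤ (a:ℝ)/b ∧ (a:ℝ)/b ≤ ((a/b : ℕ):ℝ) + 1 := by
  have hb' : (0:ℝ) < b := by exact_mod_cast hb
  refine ⟨Nat.cast_div_le, ?_⟩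
  rw [div_le_iff₀ hb']
  have h := (Nat.lt_div_mul_add (a := a) hb).le
  have : a ≤ (a/b + 1) * b := by linarith
  exact_mod_cast this

lemma q0_spec (M D : ℕ) (hD : 0 < D) : (q0 M D : ℝ) ≤ 10^18 * cls 0 ((M:ℝ)/D) ∧ 10^18 * cls 0 ((M:ℝ)/D) ≤ q0 M D + 1 := by
  have hd : (D:ℝ) ≠ 0 := by positivity
  have h := div_bd (1000000000000000000 * M^0 * hz 10333147966386144929666651337523200000000 430547831932756038736110472396800000000 256278471388545261152446709760000000 21572261901392698750205952000000 493870464775473872486400000 4247252019052922880000 16654322805120000 33891580800 39270 (M^4) (D^4)) (10333147966386144929666651337523200000000 * D^32) (by positivity)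
  have e : ((1000000000000000000 * M^0 * hz 10333147966386144929666651337523200000000 430547831932756038736110472396800000000 256278471388545261152446709760000000 21572261901392698750205952000000 493870464775473872486400000 4247252019052922880000 16654322805120000 33891580800 39270 (M^4) (D^4) : ℕ) : ℝ) / ((10333147966386144929666651337523200000000 * D^32 : ℕ):ℝ) = 10^18 * cls 0 ((M:ℝ)/D) := by
    unfold hz cls
    simp only [Finset.sum_range_succ, Finset.sum_range_zero]
    norm_num [Nat.factorial]
    field_simp
    norm_num
    try ring
  rw [e] at h
  exact h

lemma q1_spec (M D : ℕ) (hD : 0 < D) : (q1 M D : ℝ) ≤ 10^18 * cls 1 ((M:ℝ)/D) ∧ 10^18 * cls 1 ((M:ℝ)/D) ≤ q1 M D + 1 := by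
  have hd : (D:ℝ) ≠ 0 := by positivity
  have h := div_bd (1000000000000000000 * M^1 * hz 10333147966386144929666651337523200000000 86109566386551207747222094479360000000 28475385709838362350271856640000000 1659404761645592211554304000000 29051203810321992499200000 202250096145377280000 666172912204800 1168675200 1190 (M^4) (D^4)) (10333147966386144929666651337523200000000 * D^33) (by positivity)
  have e : ((1000000000000000000 * M^1 * hz 10333147966386144929666651337523200000000 86109566386551207747222094479360000000 28475385709838362350271856640000000 1659404761645592211554304000000 29051203810321992499200000 202250096145377280000 666172912204800 1168675200 1190 (M^4) (D^4) : ℕ) : ℝ) / ((10333147966386144929666651337523200000000 * D^33 : ℕ):ℝ) = 10^18 * cls 1 ((M:ℝ)/D) := by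
    unfold hz cls
    simp only [Finset.sum_range_succ, Finset.sum_range_zero]
    norm_num [Nat.factorial]
    field_simp
    norm_num
    try ring
  rw [e] at h
  exact h

lemma q2_spec (M D : ℕ) (hD : 0 < D) : (q2 M D : ℝ) ≤ 10^18 * cls 2 ((M:ℝ)/D) ∧ 10^18 * cls 2 ((M:ℝ)/D) ≤ q2 M D + 1 := by
  have hd : (D:ℝ) ≠ 0 := by positivity
  have h := div_bd (1000000000000000000 * M^2 * hz 5166573983193072464833325668761600000000 14351594397758534624537015746560000000 2847538570983836235027185664000000 118528911546113729396736000000 1613955767240110694400000 9193186188426240000 25622035084800 38955840 35 (M^4) (D^4)) (10333147966386144929666651337523200000000 * D^34) (by positivity)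
  have e : ((1000000000000000000 * M^2 * hz 5166573983193072464833325668761600000000 14351594397758534624537015746560000000 2847538570983836235027185664000000 118528911546113729396736000000 1613955767240110694400000 9193186188426240000 25622035084800 38955840 35 (M^4) (D^4) : ℕ) : ℝ) / ((10333147966386144929666651337523200000000 * D^34 : ℕ):ℝ) = 10^18 * cls 2 ((M:ℝ)/D) := by
    unfold hz cls
    simp only [Finset.sum_range_succ, Finset.sum_range_zero]
    norm_num [Nat.factorial]
    field_simp
    norm_num
    try ring
  rw [e] at h
  exact h

lemma q3_spec (M D : ℕ) (hD : 0 < D) : (q3 M D : ℝ) ≤ 10^18 * cls 3 ((M:ℝ)/D) ∧ 10^18 * cls 3 ((M:ℝ)/D) ≤ q3 M D + 1 := by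
  have hd : (D:ℝ) ≠ 0 := by positivity
  have h := div_bd (1000000000000000000 * M^3 * hz 1722191327731024154944441889587200000000 2050227771108362089219573678080000000 258867142816712385002471424000000 7901927436407581959782400000 84945040381058457600000 399703747322880000 948964262400 1256640 1 (M^4) (D^4)) (10333147966386144929666651337523200000000 * D^35) (by positivity)
  have e : ((1000000000000000000 * M^3 * hz 1722191327731024154944441889587200000000 2050227771108362089219573678080000000 258867142816712385002471424000000 7901927436407581959782400000 84945040381058457600000 399703747322880000 948964262400 1256640 1 (M^4) (D^4) : ℕ) : ℝ) / ((10333147966386144929666651337523200000000 * D^35 : ℕ):ℝ) = 10^18 * cls 3 ((M:ℝ)/D) := by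
    unfold hz cls
    simp only [Finset.sum_range_succ, Finset.sum_range_zero]
    norm_num [Nat.factorial]
    field_simp
    norm_num
    try ring
  rw [e] at h
  exact h

set_option maxRecDepth 100000

/-- table row -/
structure Bx where
  r : ℕ
  x : ℕ
  X : ℕ
  z : ℕ
  f : ℕ
  s : ℕ
  p : ℕ
  q : ℕ

def tab1 : List Bx := [
  ⟨68, 170105, 170105, 5066983, 93180565, 166191, 85393683, 2192773961⟩,
  ⟨68, 177090, 177090, 5204679, 94396631, 173082, 85562642, 2193317278⟩,
  ⟨68, 184263, 184263, 5344216, 95610990, 180160, 85733862, 2193867899⟩,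
  ⟨68, 191627, 191627, 5485594, 96823621, 187428, 85907343, 2194425828⟩,
  ⟨68, 199184, 199184, 5628812, 98034502, 194888, 86083086, 2194991059⟩,
  ⟨68, 206938, 206938, 5773871, 99243610, 202543, 86261090, 2195563605⟩,
  ⟨68, 214890, 214890, 5920770, 100450924, 210395, 86441355, 2196143459⟩,
  ⟨68, 223043, 223043, 6069508, 101656422, 218447, 86623880, 2196730615⟩,
  ⟨68, 231400, 231400, 6220086, 102860081, 226702, 86808666, 2197325083⟩,
  ⟨68, 239963, 239963, 6372503, 104061880, 235161, 86995712, 2197926864⟩,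
  ⟨68, 248734, 248734, 6526759, 105261797, 243827, 87185018, 2198535955⟩,
  ⟨68, 257716, 257716, 6682853, 106459810, 252703, 87376583, 2199152356⟩,
  ⟨68, 266912, 266912, 6840786, 107655897, 261792, 87570409, 2199776069⟩,
  ⟨68, 276324, 276324, 7000557, 108850036, 271095, 87766494, 2200407099⟩,
  ⟨68, 285955, 285955, 7162166, 110042206, 280616, 87964839, 2201045441⟩,
  ⟨68, 295806, 295806, 7325612, 111232385, 290356, 88165443, 2201691097⟩,
  ⟨68, 305881, 305881, 7490895, 112420551, 300319, 88368305, 2202344065⟩,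
  ⟨67, 316105, 316105, 7656780, 113597968, 310520, 84709636, 2107192074⟩,
  ⟨67, 326477, 326477, 7823225, 114764660, 320781, 84905051, 2107821151⟩,
  ⟨67, 337073, 337073, 7991453, 115929335, 331264, 85102563, 2108457026⟩,
  ⟨67, 347895, 347895, 8161463, 117091973, 341972, 85302172, 2109099696⟩,
  ⟨67, 358946, 358946, 8333256, 118252552, 352908, 85503879, 2109749165⟩,
  ⟨67, 370229, 370229, 8506830, 119411053, 364075, 85707681, 2110405427⟩,
  ⟨67, 381745, 381745, 8682185, 120567455, 375473, 85913579, 2111068489⟩,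
  ⟨67, 393498, 393498, 8859321, 121721737, 387107, 86121573, 2111738350⟩,
  ⟨67, 405489, 405489, 9038239, 122873878, 398978, 86331665, 2112415013⟩,
  ⟨67, 417721, 417721, 9218936, 124023859, 411089, 86543850, 2113098470⟩,
  ⟨67, 430196, 430196, 9401414, 125171659, 423442, 86758132, 2113788730⟩,
  ⟨67, 442918, 442918, 9585671, 126317256, 436041, 86974508, 2114485789⟩,
  ⟨67, 455887, 455887, 9771708, 127460632, 448885, 87192980, 2115189653⟩,
  ⟨67, 469107, 469107, 9959524, 128601765, 461979, 87413548, 2115900323⟩,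
  ⟨67, 482579, 482579, 10149119, 129740635, 475324, 87636210, 2116617794⟩,
  ⟨67, 496307, 496307, 10340492, 130877223, 488924, 87860966, 2117342069⟩,
  ⟨67, 510292, 510293, 10533644, 132011507, 502781, 88087817, 2118073151⟩,
  ⟨67, 524538, 524538, 10728573, 133143467, 516895, 88316762, 2118811040⟩,
  ⟨67, 539046, 539046, 10925279, 134273084, 531271, 88547801, 2119555734⟩,
  ⟨67, 553819, 553819, 11123762, 135400337, 545911, 88780933, 2120307236⟩,
  ⟨67, 568858, 568858, 11324023, 136525206, 560816, 89016161, 2121065549⟩,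
  ⟨67, 584168, 584168, 11526059, 137647671, 575991, 89253480, 2121830668⟩,
  ⟨67, 599749, 599749, 11729871, 138767711, 591435, 89492893, 2122602599⟩,
  ⟨67, 615605, 615605, 11935459, 139885308, 607153, 89734400, 2123381344⟩,
  ⟨67, 631737, 631737, 12142823, 141000440, 623146, 89978000, 2124166903⟩,
  ⟨67, 648148, 648148, 12351961, 142113088, 639417, 90223692, 2124959272⟩,
  ⟨67, 664841, 664841, 12562873, 143223233, 655969, 90471476, 2125758451⟩,
  ⟨67, 681817, 681817, 12775560, 144330853, 672802, 90721354, 2126564451⟩,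
  ⟨67, 699080, 699080, 12990020, 145435929, 689922, 90973323, 2127377260⟩,
  ⟨67, 716631, 716632, 13206254, 146538443, 707329, 91227385, 2128196891⟩,
  ⟨67, 734474, 734474, 13424260, 147638372, 725025, 91483537, 2129023336⟩,
  ⟨67, 752609, 752609, 13644039, 148735699, 743013, 91741782, 2129856601⟩,
  ⟨67, 771041, 771041, 13865590, 149830403, 761296, 92002119, 2130696687⟩,
  ⟨67, 789770, 789770, 14088913, 150922465, 779876, 92264547, 2131543588⟩,
  ⟨67, 808800, 808800, 14314008, 152011865, 798755, 92529067, 2132397320⟩,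
  ⟨67, 828132, 828132, 14540873, 153098583, 817935, 92795677, 2133257865⟩,
  ⟨67, 847770, 847770, 14769509, 154182600, 837420, 93064379, 2134125238⟩,
  ⟨67, 867715, 867715, 14999915, 155263897, 857210, 93335171, 2134999437⟩,
  ⟨67, 887970, 887971, 15232090, 156342453, 877311, 93608053, 2135880453⟩,
  ⟨67, 908538, 908538, 15466035, 157418250, 897721, 93883027, 2136768300⟩,
  ⟨67, 929420, 929420, 15701749, 158491268, 918445, 94160090, 2137662974⟩,
  ⟨67, 950620, 950620, 15939231, 159561488, 939486, 94439244, 2138564475⟩,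
  ⟨67, 972138, 972138, 16178481, 160628891, 960844, 94720487, 2139472804⟩,
  ⟨67, 993979, 993979, 16419499, 161693457, 982523, 95003821, 2140387966⟩,
  ⟨67, 1016143, 1016143, 16662284, 162755167, 1004524, 95289245, 2141309961⟩,
  ⟨67, 1038634, 1038635, 16906836, 163814002, 1026853, 95576758, 2142238782⟩,
  ⟨67, 1061454, 1061455, 17153154, 164869943, 1049507, 95866360, 2143174442⟩,
  ⟨67, 1084606, 1084606, 17401238, 165922970, 1072492, 96158052, 2144116933⟩,
  ⟨67, 1108090, 1108091, 17651087, 166973065, 1095810, 96451833, 2145066255⟩,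
  ⟨67, 1131911, 1131912, 17902701, 168020209, 1119462, 96747703, 2146022418⟩,
  ⟨67, 1156070, 1156071, 18156079, 169064382, 1143452, 97045661, 2146985412⟩,
  ⟨67, 1180570, 1180571, 18411222, 170105566, 1167781, 97345709, 2147955249⟩,
  ⟨67, 1205413, 1205414, 18668128, 171143742, 1192451, 97647846, 2148931930⟩,
  ⟨67, 1230602, 1230602, 18926798, 172178891, 1217466, 97952072, 2149915448⟩,
  ⟨67, 1256138, 1256138, 19187230, 173210995, 1242828, 98258385, 2150905803⟩,
  ⟨67, 1282024, 1282025, 19449424, 174240034, 1268539, 98566787, 2151903005⟩,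
  ⟨67, 1308263, 1308264, 19713379, 175265989, 1294601, 98877277, 2152907046⟩,
  ⟨67, 1334857, 1334857, 19979097, 176288843, 1321016, 99189856, 2153917939⟩,
  ⟨67, 1361808, 1361808, 20246574, 177308576, 1347788, 99504522, 2154935671⟩,
  ⟨67, 1389119, 1389119, 20515812, 178325171, 1374919, 99821277, 2155960250⟩,
  ⟨67, 1416791, 1416792, 20786810, 179338608, 1402410, 100140119, 2156991682⟩,
  ⟨67, 1444828, 1444829, 21059568, 180348869, 1430264, 100461051, 2158029965⟩,
  ⟨67, 1473232, 1473232, 21334084, 181355935, 1458483, 100784069, 2159075097⟩,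
  ⟨67, 1502004, 1502005, 21610358, 182359789, 1487071, 101109175, 2160127077⟩,
  ⟨67, 1531148, 1531149, 21888390, 183360411, 1516029, 101436368, 2161185908⟩,
  ⟨67, 1560666, 1560666, 22168179, 184357785, 1545358, 101765649, 2162251595⟩,
  ⟨67, 1590560, 1590560, 22449726, 185351890, 1575064, 102097018, 2163324138⟩,
  ⟨67, 1620832, 1620833, 22733028, 186342710, 1605147, 102430474, 2164403536⟩,
  ⟨67, 1651485, 1651486, 23018087, 187330225, 1635609, 102766018, 2165489794⟩,
  ⟨67, 1682521, 1682522, 23304900, 188314419, 1666453, 103103648, 2166582907⟩,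
  ⟨67, 1713943, 1713944, 23593469, 189295272, 1697681, 103443367, 2167682886⟩,
  ⟨67, 1745752, 1745753, 23883791, 190272768, 1729296, 103785171, 2168789716⟩,
  ⟨67, 1777952, 1777953, 24175868, 191246887, 1761300, 104129065, 2169903418⟩,
  ⟨67, 1810545, 1810545, 24469697, 192217612, 1793695, 104475044, 2171023979⟩,
  ⟨67, 1843532, 1843533, 24765280, 193184926, 1826485, 104823112, 2172151407⟩,
  ⟨67, 1876916, 1876917, 25062614, 194148810, 1859670, 105173265, 2173285696⟩,
  ⟨67, 1910700, 1910701, 25361700, 195109246, 1893254, 105525507, 2174426853⟩,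
  ⟨67, 1944886, 1944888, 25662537, 196066217, 1927239, 105879835, 2175574882⟩,
  ⟨67, 1979477, 1979478, 25965125, 197019706, 1961626, 106236251, 2176729781⟩,
  ⟨67, 2014474, 2014475, 26269463, 197969694, 1996420, 106594755, 2177891547⟩,
  ⟨67, 2049880, 2049881, 26575550, 198916165, 2031620, 106955345, 2179060191⟩,
  ⟨67, 2085697, 2085698, 26883386, 199859100, 2067231, 107318022, 2180235703⟩,
  ⟨67, 2121928, 2121930, 27192970, 200798482, 2103256, 107682786, 2181418088⟩,
  ⟨67, 2158575, 2158577, 27504302, 201734294, 2139694, 108049638, 2182607353⟩,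
  ⟨67, 2195640, 2195642, 27817382, 202666518, 2176549, 108418577, 2183803499⟩,
  ⟨67, 2233126, 2233128, 28132208, 203595138, 2213825, 108789604, 2185006515⟩,
  ⟨67, 2271035, 2271037, 28448780, 204520135, 2251521, 109162717, 2186216418⟩,
  ⟨67, 2309370, 2309372, 28767097, 205441493, 2289643, 109537918, 2187433197⟩,
  ⟨67, 2348132, 2348134, 29087160, 206359194, 2328191, 109915207, 2188656861⟩,
  ⟨67, 2387324, 2387326, 29408967, 207273223, 2367167, 110294584, 2189887412⟩,
  ⟨67, 2426949, 2426951, 29732517, 208183560, 2406575, 110676047, 2191124845⟩,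
  ⟨67, 2467008, 2467011, 30057811, 209090190, 2446417, 111059599, 2192369166⟩,
  ⟨67, 2507504, 2507507, 30384848, 209993096, 2486694, 111445238, 2193620374⟩,
  ⟨67, 2548440, 2548443, 30713627, 210892260, 2527410, 111832966, 2194878474⟩,
  ⟨67, 2589818, 2589821, 31044147, 211787666, 2568567, 112222782, 2196143460⟩,
  ⟨67, 2631639, 2631642, 31376408, 212679297, 2610165, 112614685, 2197415342⟩,
  ⟨67, 2673907, 2673910, 31710409, 213567137, 2652209, 113008677, 2198694117⟩,
  ⟨67, 2716624, 2716627, 32046150, 214451168, 2694701, 113404758, 2199979790⟩,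
  ⟨67, 2759792, 2759795, 32383630, 215331375, 2737643, 113802926, 2201272355⟩,
  ⟨67, 2803413, 2803417, 32722848, 216207740, 2781038, 114203183, 2202571816⟩,
  ⟨67, 2847490, 2847494, 33063804, 217080247, 2824886, 114605530, 2203878182⟩,
  ⟨67, 2892025, 2892029, 33406497, 217948880, 2869192, 115009964, 2205191440⟩,
  ⟨67, 2937020, 2937024, 33750927, 218813623, 2913956, 115416489, 2206511609⟩,
  ⟨67, 2982478, 2982482, 34097093, 219674458, 2959182, 115825102, 2207838678⟩,
  ⟨67, 3028401, 3028406, 34444995, 220531370, 3004873, 116235806, 2209172655⟩,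
  ⟨67, 3074791, 3074796, 34794631, 221384343, 3051029, 116648599, 2210513535⟩,
  ⟨67, 3121651, 3121656, 35146001, 222233361, 3097653, 117063482, 2211861326⟩,
  ⟨67, 3168983, 3168989, 35499105, 223078406, 3144750, 117480455, 2213216023⟩,
  ⟨67, 3216790, 3216795, 35853941, 223919464, 3192318, 117899518, 2214577631⟩,
  ⟨67, 3265073, 3265078, 36210510, 224756519, 3240362, 118320672, 2215946155⟩,
  ⟨67, 3313835, 3313841, 36568811, 225589553, 3288885, 118743917, 2217321593⟩,
  ⟨67, 3363078, 3363084, 36928842, 226418553, 3337887, 119169253, 2218703944⟩,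
  ⟨67, 3412805, 3412811, 37290603, 227243501, 3387371, 119596679, 2220093212⟩,
  ⟨67, 3463017, 3463024, 37654094, 228064382, 3437341, 120026197, 2221489396⟩,
  ⟨67, 3513718, 3513726, 38019315, 228881181, 3487798, 120457809, 2222892508⟩,
  ⟨67, 3564910, 3564918, 38386263, 229693881, 3538744, 120891511, 2224302535⟩,
  ⟨67, 3616594, 3616602, 38754939, 230502468, 3590181, 121327305, 2225719485⟩,
  ⟨67, 3668774, 3668782, 39125342, 231306926, 3642113, 121765193, 2227143360⟩,
  ⟨67, 3721451, 3721460, 39497472, 232107238, 3694542, 122205174, 2228574164⟩,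
  ⟨67, 3774628, 3774637, 39871327, 232903391, 3747468, 122647248, 2230011895⟩,
  ⟨67, 3828307, 3828316, 40246907, 233695368, 3800896, 123091416, 2231456554⟩,
  ⟨67, 3882490, 3882500, 40624211, 234483155, 3854827, 123537677, 2232908142⟩,
  ⟨67, 3937181, 3937191, 41003239, 235266736, 3909264, 123986033, 2234366666⟩,
  ⟨67, 3992380, 3992391, 41383990, 236046095, 3964209, 124436484, 2235832123⟩,
  ⟨67, 4048091, 4048102, 41766463, 236821219, 4019664, 124889029, 2237304514⟩,
  ⟨67, 4104315, 4104326, 42150658, 237592092, 4075630, 125343671, 2238783847⟩,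
  ⟨67, 4161055, 4161067, 42536574, 238358698, 4132113, 125800408, 2240270116⟩,
  ⟨67, 4218314, 4218326, 42924209, 239121024, 4189112, 126259241, 2241763324⟩,
  ⟨67, 4276093, 4276106, 43313565, 239879054, 4246631, 126720172, 2243263478⟩,
  ⟨67, 4334395, 4334408, 43704639, 240632774, 4304671, 127183199, 2244770574⟩,
  ⟨67, 4393222, 4393236, 44097431, 241382168, 4363236, 127648324, 2246284614⟩,
  ⟨67, 4452577, 4452591, 44491941, 242127222, 4422327, 128115547, 2247805602⟩,
  ⟨90, 4522793, 4522809, 44956349, 242994619, 4481529, 312538676, 5454937518⟩,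
  ⟨90, 4604196, 4604212, 45491689, 243981701, 4562450, 314076174, 5459944794⟩,
  ⟨90, 4686565, 4686582, 46030124, 244960860, 4644335, 315622861, 5464982503⟩,
  ⟨90, 4769906, 4769924, 46571651, 245932061, 4727190, 317178735, 5470050629⟩,
  ⟨90, 4854225, 4854244, 47116269, 246895271, 4811020, 318743803, 5475149206⟩,
  ⟨90, 4939527, 4939547, 47663976, 247850454, 4895830, 320318068, 5480278239⟩,
  ⟨90, 5025817, 5025838, 48214771, 248797577, 4981625, 321901534, 5485437745⟩,
  ⟨90, 5113102, 5113124, 48768651, 249736606, 5068413, 323494201, 5490627716⟩,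
  ⟨90, 5201386, 5201410, 49325614, 250667506, 5156197, 325096073, 5495848175⟩,
  ⟨90, 5290676, 5290701, 49885660, 251590245, 5244984, 326707159, 5501099130⟩,
  ⟨90, 5380976, 5381002, 50448786, 252504788, 5334778, 328327458, 5506380598⟩,
  ⟨90, 5472293, 5472321, 51014990, 253411104, 5425588, 329956973, 5511692573⟩,
  ⟨90, 5564632, 5564661, 51584270, 254309159, 5517416, 331595709, 5517035068⟩,
  ⟨90, 5657999, 5658029, 52156625, 255198921, 5610268, 333243673, 5522408123⟩,
  ⟨90, 5752398, 5752430, 52732053, 256080357, 5704152, 334900866, 5527811712⟩,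
  ⟨90, 5847836, 5847869, 53310551, 256953435, 5799070, 336567292, 5533245860⟩,
  ⟨90, 5944318, 5944353, 53892119, 257818123, 5895030, 338242959, 5538710596⟩,
  ⟨90, 6041849, 6041886, 54476753, 258674389, 5992037, 339927866, 5544205896⟩,
  ⟨90, 6140436, 6140474, 55064453, 259522202, 6090096, 341622023, 5549731793⟩,
  ⟨90, 6240083, 6240124, 55655216, 260361531, 6189215, 343325430, 5555288287⟩,
  ⟨90, 6340796, 6340839, 56249041, 261192344, 6289394, 345038098, 5560875422⟩,
  ⟨90, 6442581, 6442626, 56845925, 262014610, 6390644, 346760026, 5566493159⟩,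
  ⟨90, 6545444, 6545490, 57445866, 262828300, 6492968, 348491219, 5572141534⟩,
  ⟨90, 6649388, 6649437, 58048863, 263633381, 6596372, 350231687, 5577820566⟩,
  ⟨90, 6754421, 6754473, 58654914, 264429826, 6700863, 351981432, 5583530252⟩,
  ⟨90, 6860548, 6860602, 59264016, 265217602, 6806444, 353740459, 5589270603⟩,
  ⟨90, 6967774, 6967830, 59876168, 265996681, 6913121, 355508776, 5595041649⟩,
  ⟨90, 7076104, 7076163, 60491367, 266767033, 7020900, 357286385, 5600843383⟩,
  ⟨90, 7185544, 7185606, 61109612, 267528629, 7129787, 359073295, 5606675814⟩,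
  ⟨90, 7296100, 7296165, 61730901, 268281440, 7239787, 360869513, 5612538980⟩,
  ⟨90, 7407777, 7407845, 62355232, 269025437, 7350905, 362675044, 5618432872⟩,
  ⟨90, 7520581, 7520652, 62982602, 269760592, 7463147, 364489891, 5624357502⟩,
  ⟨89, 7633881, 7633955, 63609499, 270482865, 7576540, 354200154, 5444582051⟩,
  ⟨89, 7747663, 7747740, 64235871, 271192376, 7689768, 355953401, 5450306112⟩,
  ⟨89, 7862562, 7862643, 64865209, 271893158, 7804110, 357715479, 5456059288⟩,
  ⟨89, 7978584, 7978669, 65497512, 272585185, 7919574, 359486393, 5461841565⟩,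
  ⟨89, 8095735, 8095823, 66132777, 273268429, 8036162, 361266151, 5467652982⟩,
  ⟨89, 8214019, 8214111, 66771003, 273942864, 8153881, 363054758, 5473493534⟩,
  ⟨89, 8333441, 8333538, 67412187, 274608464, 8272738, 364852220, 5479363222⟩,
  ⟨89, 8454008, 8454109, 68056327, 275265204, 8392735, 366658546, 5485262083⟩,
  ⟨89, 8575724, 8575829, 68703422, 275913058, 8513879, 368473742, 5491190119⟩,
  ⟨89, 8698594, 8698704, 69353469, 276552000, 8636176, 370297815, 5497147325⟩,
  ⟨89, 8822624, 8822738, 70006467, 277182005, 8759629, 372130774, 5503133741⟩,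
  ⟨89, 8947819, 8947938, 70662412, 277803049, 8884245, 373972623, 5509149360⟩,
  ⟨89, 9074184, 9074308, 71321304, 278415106, 9010029, 375823372, 5515194199⟩,
  ⟨89, 9201724, 9201854, 71983140, 279018153, 9136985, 377683031, 5521268286⟩,
  ⟨89, 9330445, 9330581, 72647918, 279612165, 9265121, 379551602, 5527371593⟩,
  ⟨89, 9460353, 9460494, 73315635, 280197118, 9394440, 381429095, 5533504160⟩,
  ⟨89, 9591451, 9591598, 73986290, 280772988, 9524946, 383315520, 5539666006⟩,
  ⟨89, 9723746, 9723899, 74659881, 281339752, 9656647, 385210886, 5545857136⟩,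
  ⟨89, 9857242, 9857401, 75336405, 281897386, 9789547, 387115198, 5552077547⟩,
  ⟨89, 9991945, 9992111, 76015861, 282445868, 9923652, 389028469, 5558327274⟩,
  ⟨89, 10127860, 10128033, 76698245, 282985174, 10058967, 390950701, 5564606305⟩,
  ⟨89, 10264992, 10265173, 77383557, 283515282, 10195497, 392881909, 5570914675⟩,
  ⟨89, 10403347, 10403535, 78071793, 284036170, 10333247, 394822098, 5577252377⟩,
  ⟨89, 10542930, 10543125, 78762952, 284547816, 10472221, 396771282, 5583619452⟩,
  ⟨89, 10683745, 10683948, 79457031, 285050197, 10612426, 398729464, 5590015882⟩,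
  ⟨89, 10825798, 10826010, 80154028, 285543293, 10753867, 400696658, 5596441699⟩,
  ⟨89, 10969095, 10969315, 80853942, 286027081, 10896549, 402672874, 5602896909⟩,
  ⟨89, 11113640, 11113869, 81556769, 286501541, 11040478, 404658119, 5609381525⟩,
  ⟨89, 11259439, 11259677, 82262508, 286966651, 11185658, 406652405, 5615895559⟩,
  ⟨89, 11406496, 11406744, 82971156, 287422392, 11332094, 408655740, 5622439024⟩,
  ⟨89, 11554818, 11555075, 83682711, 287868742, 11479791, 410668136, 5629011938⟩,
  ⟨89, 11704409, 11704676, 84397171, 288305681, 11628756, 412689604, 5635614313⟩,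
  ⟨89, 11855274, 11855551, 85114533, 288733190, 11778993, 414720152, 5642246151⟩,
  ⟨89, 12007418, 12007707, 85834796, 289151248, 11930508, 416759794, 5648907486⟩,
  ⟨89, 12160847, 12161147, 86557957, 289559837, 12083304, 418808541, 5655598321⟩,
  ⟨89, 12315566, 12315878, 87284013, 289958937, 12237389, 420866400, 5662318659⟩,
  ⟨89, 12471580, 12471903, 88012963, 290348529, 12392764, 422933387, 5669068539⟩,
  ⟨89, 12628894, 12629230, 88744803, 290728595, 12549440, 425009507, 5675847933⟩,
  ⟨89, 12787513, 12787862, 89479533, 291099115, 12707418, 427094782, 5682656906⟩,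
  ⟨89, 12947443, 12947805, 90217149, 291460073, 12866704, 429189216, 5689495442⟩,
  ⟨89, 13108688, 13109063, 90957649, 291811448, 13027302, 431292823, 5696363558⟩,
  ⟨89, 13271254, 13271643, 91701030, 292153225, 13189221, 433405612, 5703261253⟩,
  ⟨89, 13435145, 13435550, 92447291, 292485386, 13352463, 435527602, 5710188579⟩,
  ⟨89, 13600368, 13600787, 93196429, 292807913, 13517034, 437658801, 5717145511⟩,
  ⟨89, 13766926, 13767361, 93948442, 293120789, 13682937, 439799226, 5724132108⟩,
  ⟨89, 13934826, 13935277, 94703326, 293423997, 13850182, 441948880, 5731148314⟩,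
  ⟨89, 14104072, 14104540, 95461081, 293717522, 14018770, 444107789, 5738194230⟩,
  ⟨89, 14274669, 14275154, 96221703, 294001346, 14188707, 446275958, 5745269805⟩,
  ⟨89, 14446623, 14447125, 96985190, 294275455, 14359998, 448453403, 5752375071⟩,
  ⟨89, 14619938, 14620459, 97751540, 294539831, 14532650, 450640138, 5759510052⟩,
  ⟨89, 14794620, 14795160, 98520749, 294794461, 14706666, 452836175, 5766674763⟩,
  ⟨89, 14970674, 14971233, 99292817, 295039327, 14882052, 455041531, 5773869207⟩,
  ⟨89, 15148104, 15148684, 100067740, 295274416, 15058812, 457256220, 5781093420⟩,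
  ⟨89, 15326917, 15327517, 100845515, 295499713, 15236953, 459480252, 5788347384⟩,
  ⟨89, 15507116, 15507737, 101626141, 295715203, 15416478, 461713646, 5795631136⟩,
  ⟨89, 15688707, 15689351, 102409615, 295920872, 15597394, 463956417, 5802944691⟩,
  ⟨89, 15871696, 15872362, 103195934, 296116706, 15779705, 466208578, 5810288061⟩,
  ⟨89, 16056087, 16056776, 103985096, 296302691, 15963416, 468470146, 5817661262⟩,
  ⟨89, 16241884, 16242599, 104777099, 296478814, 16148534, 470741136, 5825064308⟩,
  ⟨89, 16429095, 16429834, 105571939, 296645062, 16335061, 473021562, 5832497213⟩,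
  ⟨89, 16617722, 16618487, 106369614, 296801422, 16523004, 475311440, 5839959982⟩,
  ⟨89, 16807772, 16808564, 107170123, 296947880, 16712368, 477610791, 5847452661⟩,
  ⟨89, 16999250, 17000068, 107973461, 297084426, 16903156, 479919625, 5854975238⟩,
  ⟨89, 17192159, 17193006, 108779628, 297211045, 17095377, 482237962, 5862527731⟩,
  ⟨89, 17386507, 17387383, 109588619, 297327727, 17289034, 484565817, 5870110168⟩,
  ⟨89, 17582297, 17583203, 110400434, 297434461, 17484130, 486903212, 5877722578⟩,
  ⟨89, 17779534, 17780471, 111215068, 297531233, 17680673, 489250157, 5885364942⟩,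
  ⟨89, 17978224, 17979192, 112032520, 297618034, 17878666, 491606674, 5893037292⟩,
  ⟨89, 18178371, 18179373, 112852786, 297694852, 18078116, 493972778, 5900739655⟩,
  ⟨89, 18379982, 18381016, 113675865, 297761677, 18279026, 496348489, 5908472026⟩,
  ⟨89, 18583059, 18584129, 114501753, 297818499, 18481404, 498733822, 5916234435⟩,
  ⟨89, 18787609, 18788715, 115330448, 297865306, 18685251, 501128799, 5924026901⟩,
  ⟨89, 18993637, 18994779, 116161948, 297902091, 18890575, 503533438, 5931849437⟩,
  ⟨89, 19201148, 19202327, 116996250, 297928842, 19097380, 505947757, 5939702055⟩,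
  ⟨89, 19410146, 19411364, 117833350, 297945550, 19305672, 508371771, 5947584772⟩,
  ⟨89, 19620636, 19621895, 118673247, 297952207, 19515454, 510805506, 5955497619⟩,
  ⟨89, 19832624, 19833924, 119515938, 297948804, 19726732, 513248980, 5963440605⟩,
  ⟨89, 20046114, 20047457, 120361420, 297935332, 19939513, 515702208, 5971413731⟩,
  ⟨89, 20261112, 20262499, 121209690, 297911782, 20153799, 518165213, 5979417029⟩,
  ⟨89, 20477623, 20479054, 122060746, 297878148, 20369596, 520638016, 5987450522⟩,
  ⟨134, 20751010, 20752500, 123130884, 297821766, 20585655, 1792339402, 20486948302⟩,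
  ⟨134, 21082731, 21084293, 124422740, 297733028, 20915714, 1805182228, 20528657910⟩,
  ⟨134, 21417922, 21419559, 125720889, 297621364, 21249239, 1818101595, 20570601893⟩,
  ⟨134, 21756600, 21758317, 127025319, 297486753, 21586248, 1831097732, 20612780417⟩,
  ⟨134, 22098783, 22100582, 128336023, 297329172, 21926755, 1844170911, 20655193710⟩,
  ⟨134, 22444487, 22446372, 129652991, 297148601, 22270778, 1857321396, 20697842069⟩,
  ⟨134, 22793729, 22795703, 130976212, 296945022, 22618334, 1870549427, 20740725597⟩,
  ⟨134, 23146525, 23148592, 132305678, 296718417, 22969440, 1883855286, 20783844537⟩,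
  ⟨134, 23502893, 23505057, 133641380, 296468770, 23324113, 1897239254, 20827199163⟩,
  ⟨134, 23862849, 23865113, 134983307, 296196065, 23682368, 1910701593, 20870789647⟩,
  ⟨134, 24226409, 24228779, 136331450, 295900290, 24044226, 1924242586, 20914616183⟩,
  ⟨134, 24593591, 24596070, 137685799, 295581433, 24409700, 1937862523, 20958679063⟩,
  ⟨134, 24964410, 24967004, 139046344, 295239483, 24778809, 1951561687, 21002978454⟩,
  ⟨134, 25338885, 25341596, 140413076, 294874430, 25151567, 1965340385, 21047514641⟩,
  ⟨134, 25717030, 25719865, 141785985, 294486267, 25527994, 1979198906, 21092287776⟩,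
  ⟨134, 26098863, 26101826, 143165061, 294074987, 25908105, 1993137564, 21137298179⟩,
  ⟨134, 26484400, 26487496, 144550294, 293640585, 26291916, 2007156663, 21182546047⟩,
  ⟨134, 26873658, 26876893, 145941673, 293183056, 26679445, 2021256507, 21228031589⟩,
  ⟨134, 27266653, 27270032, 147339190, 292702399, 27070708, 2035437438, 21273755112⟩,
  ⟨134, 27663402, 27666930, 148742834, 292198612, 27465724, 2049699756, 21319716724⟩,
  ⟨134, 28063920, 28067604, 150152595, 291671695, 27864505, 2064043814, 21365916864⟩,
  ⟨134, 28468225, 28472070, 151568463, 291121651, 28267070, 2078469931, 21412355633⟩,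
  ⟨134, 28876333, 28880346, 152990427, 290548482, 28673438, 2092978439, 21459033271⟩,
  ⟨134, 29288259, 29292447, 154418477, 289952192, 29083622, 2107569691, 21505950097⟩,
  ⟨134, 29704021, 29708389, 155852604, 289332787, 29497639, 2122244045, 21553106357⟩,
  ⟨133, 30122062, 30126617, 157287411, 288692715, 29915542, 2089351611, 21119945177⟩,
  ⟨133, 30542354, 30547103, 158722821, 288032241, 30334115, 2103754231, 21166172141⟩,
  ⟨133, 30966472, 30971422, 160164186, 287349022, 30756513, 2118237922, 21212630473⟩,
  ⟨133, 31394433, 31399590, 161611497, 286643066, 31182753, 2132803045, 21259320412⟩,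
  ⟨133, 31826251, 31831624, 163064742, 285914388, 31612850, 2147449943, 21306242187⟩,
  ⟨133, 32261942, 32267539, 164523911, 285163000, 32046820, 2162178984, 21353396051⟩,
  ⟨133, 32701523, 32707352, 165988995, 284388917, 32484680, 2176990545, 21400782272⟩,
  ⟨133, 33145009, 33151078, 167459983, 283592156, 32926445, 2191885002, 21448401160⟩,
  ⟨133, 33592415, 33598734, 168936863, 282772735, 33372133, 2206862710, 21496252848⟩,
  ⟨133, 34043758, 34050335, 170419627, 281930671, 33821757, 2221924084, 21544337726⟩,
  ⟨133, 34499053, 34505897, 171908263, 281065985, 34275334, 2237069501, 21592656037⟩,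
  ⟨133, 34958315, 34965436, 173402761, 280178700, 34732880, 2252299358, 21641208028⟩,
  ⟨133, 35421561, 35428969, 174903110, 279268837, 35194413, 2267614047, 21689993934⟩,
  ⟨133, 35888805, 35896510, 176409300, 278336421, 35659946, 2283013987, 21739014093⟩,
  ⟨133, 36360064, 36368076, 177921319, 277381477, 36129496, 2298499577, 21788268757⟩,
  ⟨133, 36835352, 36843682, 179439158, 276404033, 36603077, 2314071248, 21837758234⟩,
  ⟨133, 37314685, 37323345, 180962805, 275404116, 37080708, 2329729413, 21887482781⟩,
  ⟨133, 37798079, 37807080, 182492250, 274381756, 37562403, 2345474500, 21937442659⟩,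
  ⟨133, 38285549, 38294903, 184027482, 273336984, 38048178, 2361306949, 21987638204⟩,
  ⟨133, 38777110, 38786829, 185568489, 272269831, 38538049, 2377227182, 22038069637⟩,
  ⟨133, 39272778, 39282875, 187115262, 271180332, 39032031, 2393235669, 22088737345⟩,
  ⟨133, 39772569, 39783055, 188667789, 270068521, 39530140, 2409332847, 22139641575⟩,
  ⟨133, 40276496, 40287386, 190226059, 268934434, 40032391, 2425519179, 22190782675⟩,
  ⟨133, 40784576, 40795884, 191790061, 267778108, 40538802, 2441795119, 22242160887⟩,
  ⟨133, 41296824, 41308564, 193359783, 266599582, 41049387, 2458161125, 22293776486⟩,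
  ⟨133, 41813256, 41825441, 194935216, 265398897, 41564161, 2474617698, 22345629871⟩,
  ⟨133, 42333885, 42346531, 196516347, 264176093, 42083141, 2491165299, 22397721315⟩,
  ⟨133, 42858728, 42871850, 198103166, 262931213, 42606342, 2507804420, 22450051123⟩,
  ⟨133, 43387799, 43401413, 199695661, 261664301, 43133779, 2524535554, 22502619648⟩,
  ⟨133, 43921113, 43935236, 201293821, 260375403, 43665467, 2541359200, 22555427212⟩,
  ⟨133, 44458687, 44473334, 202897635, 259064564, 44201424, 2558275858, 22608474096⟩,
  ⟨133, 45000534, 45015723, 204507090, 257731832, 44741663, 2575286029, 22661760630⟩,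
  ⟨133, 45546670, 45562419, 206122177, 256377257, 45286202, 2592390251, 22715287208⟩,
  ⟨133, 46097109, 46113436, 207742883, 255000889, 45835055, 2609589025, 22769054075⟩,
  ⟨133, 46651867, 46668791, 209369197, 253602780, 46388237, 2626882895, 22823061658⟩,
  ⟨133, 47210958, 47228498, 211001107, 252182982, 46945764, 2644272385, 22877310239⟩,
  ⟨133, 47774398, 47792573, 212638603, 250741551, 47507651, 2661758053, 22931800215⟩,
  ⟨133, 48342200, 48361031, 214281671, 249278541, 48073913, 2679340423, 22986531877⟩,
  ⟨133, 48914381, 48933889, 215930301, 247794009, 48644569, 2697020061, 23041505581⟩,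
  ⟨133, 49490954, 49511160, 217584481, 246288014, 49219629, 2714797535, 23096721758⟩,
  ⟨133, 50071935, 50092861, 219244199, 244760614, 49799110, 2732673407, 23152180751⟩,
  ⟨133, 50657338, 50679007, 220909444, 243211871, 50383030, 2750648249, 23207882869⟩,
  ⟨133, 51247178, 51269613, 222580203, 241641846, 50971402, 2768722633, 23263828473⟩,
  ⟨133, 51841470, 51864694, 224256465, 240050603, 51564242, 2786897157, 23320017993⟩,
  ⟨133, 52440228, 52464266, 225938218, 238438206, 52161564, 2805172413, 23376451783⟩,
  ⟨133, 53043466, 53068344, 227625450, 236804720, 52763386, 2823548995, 23433130200⟩,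
  ⟨133, 53651200, 53676942, 229318149, 235150214, 53369720, 2842027515, 23490053651⟩,
  ⟨133, 54263444, 54290077, 231016303, 233474754, 53980582, 2860608588, 23547222545⟩,
  ⟨133, 54880211, 54907764, 232719900, 231778411, 54595989, 2879292833, 23604637248⟩,
  ⟨133, 55501518, 55530017, 234428928, 230061254, 55215955, 2898080871, 23662298129⟩,
  ⟨90, 56025896, 56055211, 235865861, 228605698, 55841778, 901219485, 7341178798⟩,
  ⟨90, 56451501, 56481489, 237028489, 227420207, 56267003, 905191379, 7353343552⟩,
  ⟨90, 56879200, 56909875, 238193591, 226225269, 56694333, 909178199, 7365543338⟩,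
  ⟨90, 57308999, 57340375, 239361162, 225020908, 57123775, 913180007, 7377778197⟩,
  ⟨90, 57740902, 57772992, 240531199, 223807147, 57555332, 917196866, 7390048163⟩,
  ⟨90, 58174913, 58207732, 241703696, 222584010, 57989010, 921228829, 7402353245⟩,
  ⟨90, 58611037, 58644600, 242878652, 221351520, 58424813, 925275972, 7414693519⟩,
  ⟨90, 59049278, 59083599, 244056062, 220109703, 58862745, 929338357, 7427069027⟩,
  ⟨90, 59489640, 59524735, 245235921, 218858583, 59302811, 933416042, 7439479790⟩,
  ⟨90, 59932128, 59968013, 246418227, 217598183, 59745017, 937509099, 7451925861⟩,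
  ⟨90, 60376747, 60413436, 247602976, 216328530, 60189366, 941617591, 7464407276⟩,
  ⟨90, 60823501, 60861010, 248790163, 215049649, 60635863, 945741585, 7476924088⟩,
  ⟨90, 61272393, 61310740, 249979785, 213761564, 61084515, 949881144, 7489476309⟩,
  ⟨90, 61723429, 61762629, 251171837, 212464303, 61535323, 954036337, 7502064012⟩,
  ⟨90, 62176613, 62216683, 252366317, 211157890, 61988293, 958207234, 7514687227⟩,
  ⟨90, 62631949, 62672906, 253563220, 209842352, 62443431, 962393900, 7527346000⟩,
  ⟨89, 63086895, 63128750, 254755873, 208525101, 62900763, 934670693, 7291280681⟩,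
  ⟨89, 63541417, 63584184, 255944231, 207206312, 63355130, 938704442, 7303453612⟩,
  ⟨89, 63998058, 64041753, 257134948, 205878677, 63811631, 942753299, 7315660285⟩,
  ⟨89, 64456819, 64501461, 258328019, 204542224, 64270269, 946817323, 7327900727⟩,
  ⟨89, 64917707, 64963313, 259523441, 203196979, 64731047, 950896589, 7340175023⟩,
  ⟨89, 65380724, 65427314, 260721210, 201842969, 65193973, 954991156, 7352483174⟩,
  ⟨89, 65845876, 65893467, 261921322, 200480220, 65659049, 959101096, 7364825247⟩,
  ⟨89, 66313165, 66361777, 263123773, 199108760, 66126278, 963226473, 7377201281⟩,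
  ⟨89, 66782598, 66832249, 264328559, 197728617, 66595668, 967367352, 7389611300⟩,
  ⟨89, 67254176, 67304888, 265535678, 196339819, 67067223, 971523809, 7402055377⟩,
  ⟨89, 67727906, 67779697, 266745124, 194942392, 67540945, 975695905, 7414533531⟩,
  ⟨89, 68203790, 68256681, 267956894, 193536367, 68016841, 979883711, 7427045804⟩,
  ⟨89, 68681834, 68735844, 269170984, 192121770, 68494913, 984087299, 7439592265⟩,
  ⟨89, 69162041, 69217192, 270387391, 190698632, 68975168, 988306735, 7452172926⟩,
  ⟨89, 69644414, 69700728, 271606110, 189266980, 69457608, 992542094, 7464787871⟩,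
  ⟨89, 70128960, 70186457, 272827138, 187826845, 69942239, 996793446, 7477437126⟩,
  ⟨89, 70615680, 70674383, 274050470, 186378255, 70429066, 1001060854, 7490120706⟩,
  ⟨89, 71104581, 71164512, 275276103, 184921240, 70918093, 1005344399, 7502838694⟩,
  ⟨89, 71595665, 71656846, 276504033, 183455830, 71409323, 1009644152, 7515591136⟩,
  ⟨89, 72088936, 72151391, 277734256, 181982055, 71902761, 1013960184, 7528378066⟩,
  ⟨89, 72584400, 72648152, 278966768, 180499945, 72398413, 1018292570, 7541199541⟩,
  ⟨89, 73082059, 73147132, 280201566, 179009532, 72896282, 1022641383, 7554055597⟩,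
  ⟨89, 73581919, 73648336, 281438645, 177510845, 73396373, 1027006695, 7566946282⟩,
  ⟨89, 74083982, 74151769, 282678001, 176003916, 73898691, 1031388582, 7579871652⟩,
  ⟨89, 74588254, 74657434, 283919630, 174488776, 74403238, 1035787118, 7592831742⟩,
  ⟨89, 75094738, 75165337, 285163529, 172965457, 74910021, 1040202383, 7605826619⟩,
  ⟨89, 75603437, 75675481, 286409694, 171433990, 75419043, 1044634450, 7618856320⟩,
  ⟨89, 76114357, 76187872, 287658120, 169894406, 75930310, 1049083393, 7631920884⟩,
  ⟨89, 76627502, 76702514, 288908804, 168346739, 76443826, 1053549296, 7645020388⟩,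
  ⟨89, 77142874, 77219410, 290161742, 166791021, 76959593, 1058032233, 7658154867⟩,
  ⟨89, 77660479, 77738566, 291416929, 165227284, 77477617, 1062532283, 7671324387⟩,
  ⟨89, 78180320, 78259986, 292674362, 163655561, 77997904, 1067049521, 7684528963⟩,
  ⟨89, 78702401, 78783674, 293934037, 162075885, 78520457, 1071584029, 7697768669⟩,
  ⟨89, 79226726, 79309635, 295195949, 160488289, 79045281, 1076135887, 7711043556⟩,
  ⟨89, 79753300, 79837873, 296460095, 158892806, 79572379, 1080705173, 7724353671⟩,
  ⟨89, 80282126, 80368393, 297726471, 157289471, 80101757, 1085291972, 7737699075⟩,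
  ⟨89, 80813207, 80901198, 298995073, 155678317, 80633418, 1089896362, 7751079812⟩,
  ⟨89, 81346549, 81436294, 300265896, 154059379, 81167368, 1094518427, 7764495950⟩,
  ⟨89, 81882155, 81973685, 301538937, 152432690, 81703610, 1099158246, 7777947521⟩,
  ⟨89, 82420029, 82513375, 302814191, 150798285, 82242149, 1103815903, 7791434591⟩,
  ⟨67, 82893292, 82988256, 303933647, 149359569, 82783464, 472250500, 3327712845⟩,
  ⟨67, 83301208, 83397581, 304896584, 148119056, 83192134, 473755501, 3332062075⟩,
  ⟨67, 83710416, 83808216, 305860769, 146874222, 83602113, 475264862, 3336419908⟩,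
  ⟨67, 84120916, 84220162, 306826201, 145625083, 84013404, 476778599, 3340786355⟩,
  ⟨67, 84532710, 84633422, 307792878, 144371653, 84426006, 478296729, 3345161443⟩,
  ⟨67, 84945801, 85047997, 308760798, 143113948, 84839923, 479819266, 3349545166⟩,
  ⟨67, 85360190, 85463889, 309729960, 141851982, 85255156, 481346227, 3353937543⟩,
  ⟨67, 85775878, 85881100, 310700361, 140585772, 85671707, 482877625, 3358338571⟩,
  ⟨67, 86192868, 86299631, 311672001, 139315333, 86089577, 484413480, 3362748280⟩,
  ⟨67, 86611160, 86719486, 312644876, 138040679, 86508770, 485953803, 3367166664⟩,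
  ⟨67, 87030756, 87140665, 313618987, 136761827, 86929286, 487498615, 3371593750⟩,
  ⟨67, 87451659, 87563170, 314594330, 135478792, 87351128, 489047927, 3376029528⟩,
  ⟨67, 87873870, 87987004, 315570904, 134191591, 87774297, 490601758, 3380474021⟩,
  ⟨67, 88297390, 88412168, 316548707, 132900237, 88198795, 492160124, 3384927243⟩,
  ⟨67, 88722221, 88838665, 317527738, 131604748, 88624626, 493723039, 3389389191⟩,
  ⟨67, 89148365, 89266495, 318507995, 130305139, 89051788, 495290524, 3393859894⟩,
  ⟨67, 89575823, 89695661, 319489475, 129001427, 89480286, 496862589, 3398339346⟩,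
  ⟨67, 90004597, 90126165, 320472178, 127693626, 89910121, 498439255, 3402827566⟩,
  ⟨67, 90434689, 90558008, 321456101, 126381753, 90341294, 500020537, 3407324565⟩,
  ⟨67, 90866100, 90991193, 322441243, 125065825, 90773806, 501606453, 3411830362⟩,
  ⟨67, 91298832, 91425721, 323427602, 123745857, 91207663, 503197017, 3416344949⟩,
  ⟨67, 91732886, 91861595, 324415176, 122421865, 91642863, 504792248, 3420868353⟩,
  ⟨67, 92168265, 92298815, 325403964, 121093867, 92079409, 506392163, 3425400582⟩,
  ⟨67, 92604969, 92737385, 326393963, 119761878, 92517304, 507996776, 3429941638⟩,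
  ⟨67, 93043001, 93177305, 327385171, 118425914, 92956548, 509606105, 3434491539⟩,
  ⟨67, 93482362, 93618578, 328377588, 117085993, 93397144, 511220170, 3439050302⟩,
  ⟨67, 93923054, 94061206, 329371211, 115742131, 93839094, 512838985, 3443617932⟩,
  ⟨67, 94365078, 94505190, 330366039, 114394343, 94282400, 514462568, 3448194437⟩,
  ⟨67, 94808435, 94950532, 331362069, 113042648, 94727063, 516090935, 3452779835⟩,
  ⟨67, 95253129, 95397235, 332359300, 111687062, 95173084, 517724108, 3457374147⟩,
  ⟨67, 95699159, 95845300, 333357730, 110327601, 95620468, 519362099, 3461977363⟩,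
  ⟨67, 96146528, 96294729, 334357358, 108964283, 96069215, 521004929, 3466589510⟩,
  ⟨67, 96595237, 96745523, 335358181, 107597124, 96519325, 522652614, 3471210600⟩,
  ⟨67, 97045288, 97197685, 336360197, 106226142, 96970803, 524305170, 3475840632⟩,
  ⟨67, 97496683, 97651217, 337363406, 104851353, 97423650, 525962619, 3480479631⟩,
  ⟨67, 97949423, 98106120, 338367805, 103472774, 97877866, 527624976, 3485127607⟩,
  ⟨67, 98403509, 98562397, 339373392, 102090424, 98333456, 529292260, 3489784573⟩,
  ⟨67, 98858944, 99020049, 340380165, 100704318, 98790419, 530964487, 3494450536⟩,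
  ⟨67, 99315729, 99479078, 341388123, 99314474, 99248759, 532641677, 3499125507⟩,
  ⟨67, 99773865, 99939486, 342397264, 97920910, 99708478, 534323847, 3503809502⟩,
  ⟨67, 100233354, 100401274, 343407586, 96523643, 100169575, 536011017, 3508502539⟩,
  ⟨67, 100694198, 100864446, 344419087, 95122691, 100632054, 537703205, 3513204625⟩,
  ⟨67, 101156397, 101329002, 345431766, 93718071, 101095918, 539400427, 3517915767⟩,
  ⟨67, 101619955, 101794944, 346445620, 92309800, 101561167, 541102703, 3522635986⟩,
  ⟨67, 102084872, 102262275, 347460648, 90897896, 102027802, 542810054, 3527365303⟩,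
  ⟨67, 102551150, 102730995, 348476848, 89482378, 102495827, 544522493, 3532103704⟩,
  ⟨67, 103018791, 103201108, 349494217, 88063262, 102965243, 546240042, 3536851226⟩,
  ⟨67, 103487795, 103672615, 350512756, 86640566, 103436053, 547962722, 3541607873⟩,
  ⟨67, 103958165, 104145518, 351532460, 85214309, 103908257, 549690550, 3546373666⟩,
  ⟨67, 104429903, 104619818, 352553330, 83784509, 104381857, 551423545, 3551148612⟩,
  ⟨67, 104903009, 105095518, 353575362, 82351183, 104856858, 553161723, 3555932713⟩,
  ⟨67, 105377485, 105572619, 354598555, 80914349, 105333257, 554905109, 3560726003⟩,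
  ⟨67, 105853334, 106051124, 355622907, 79474026, 105811060, 556653716, 3565528474⟩,
  ⟨67, 106330555, 106531034, 356648416, 78030232, 106290267, 558407568, 3570340159⟩,
  ⟨67, 106809152, 107012351, 357675081, 76582984, 106770880, 560166683, 3575161063⟩,
  ⟨67, 107289125, 107495077, 358702899, 75132302, 107252900, 561931081, 3579991201⟩,
  ⟨67, 107770476, 107979214, 359731870, 73678203, 107736332, 563700781, 3584830588⟩,
  ⟨67, 108253207, 108464763, 360761989, 72220707, 108221174, 565475800, 3589679225⟩,
  ⟨67, 108737319, 108951727, 361793257, 70759830, 108707430, 567256163, 3594537145⟩,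
  ⟨67, 109222813, 109440107, 362825672, 69295593, 109195101, 569041888, 3599404358⟩,
  ⟨67, 109709692, 109929906, 363859230, 67828013, 109684190, 570832993, 3604280874⟩,
  ⟨67, 110197957, 110421125, 364893931, 66357110, 110174698, 572629499, 3609166700⟩,
  ⟨67, 110687608, 110913766, 365929772, 64882901, 110666628, 574431425, 3614061854⟩,
  ⟨67, 111178649, 111407831, 366966753, 63405405, 111159980, 576238796, 3618966366⟩,
  ⟨67, 111671080, 111903322, 368004870, 61924642, 111654758, 578051625, 3623880224⟩,
  ⟨67, 112164902, 112400241, 369044122, 60440630, 112150963, 579869937, 3628803460⟩,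
  ⟨67, 112660118, 112898589, 370084507, 58953388, 112648594, 581693753, 3633736091⟩,
  ⟨67, 113156729, 113398369, 371126024, 57462935, 113147659, 583523091, 3638678120⟩,
  ⟨67, 113654737, 113899582, 372168669, 55969290, 113648154, 585357972, 3643629564⟩,
  ⟨67, 114154142, 114402230, 373212443, 54472472, 114150084, 587198419, 3648590446⟩,
  ⟨67, 114654947, 114906316, 374257342, 52972500, 114653451, 589044450, 3653560771⟩,
  ⟨67, 115157152, 115411841, 375303365, 51469393, 115158256, 590896089, 3658540567⟩,
  ⟨67, 115660760, 115918806, 376350509, 49963170, 115664499, 592753353, 3663529835⟩,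
  ⟨67, 116165772, 116427215, 377398774, 48453852, 116172187, 594616267, 3668528597⟩,
  ⟨67, 116672189, 116937068, 378448157, 46941456, 116681317, 596484850, 3673536869⟩,
  ⟨67, 117180014, 117448367, 379498656, 45426003, 117191892, 598359124, 3678554661⟩,
  ⟨67, 117689246, 117961115, 380550269, 43907511, 117703914, 600239110, 3683581998⟩,
  ⟨67, 118199889, 118475314, 381602995, 42386001, 118217388, 602124829, 3688618885⟩,
  ⟨67, 118711943, 118990964, 382656831, 40861491, 118732311, 604016302, 3693665336⟩,
  ⟨67, 119225410, 119508069, 383711776, 39334002, 119248688, 605913554, 3698721384⟩,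
  ⟨67, 119740291, 120026630, 384767827, 37803552, 119766521, 607816602, 3703787022⟩,
  ⟨67, 120256588, 120546649, 385824984, 36270162, 120285810, 609725473, 3708862291⟩,
  ⟨67, 120774302, 121068127, 386883244, 34733852, 120806557, 611640186, 3713947187⟩,
  ⟨67, 121293435, 121591068, 387942604, 33194640, 121328768, 613560761, 3719041726⟩,
  ⟨67, 121813989, 122115472, 389003064, 31652548, 121852439, 615487225, 3724145941⟩,
  ⟨67, 122335964, 122641341, 390064621, 30107593, 122377575, 617419596, 3729259831⟩,
  ⟨67, 122859363, 123168678, 391127273, 28559798, 122904177, 619357898, 3734383421⟩,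
  ⟨67, 123384186, 123697484, 392191019, 27009181, 123432248, 621302154, 3739516730⟩,
  ⟨67, 123910435, 124227761, 393255856, 25455763, 123961789, 623252386, 3744659766⟩,
  ⟨67, 124438112, 124759511, 394321783, 23899563, 124492802, 625208616, 3749812550⟩,
  ⟨67, 124967218, 125292737, 395388797, 22340602, 125025290, 627170867, 3754975101⟩,
  ⟨67, 125497754, 125827439, 396456898, 20778900, 125559252, 629139164, 3760147439⟩,
  ⟨67, 126029723, 126363620, 397526082, 19214477, 126094693, 631113526, 3765329569⟩,
  ⟨67, 126563125, 126901282, 398596348, 17647353, 126631614, 633093977, 3770521514⟩,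
  ⟨67, 127097961, 127440426, 399667694, 16077549, 127170016, 635080543, 3775723297⟩,
  ⟨67, 127634235, 127981055, 400740118, 14505084, 127709902, 637073245, 3780934931⟩,
  ⟨67, 128171945, 128523170, 401813618, 12929980, 128251273, 639072104, 3786156423⟩,
  ⟨67, 128711096, 129066773, 402888193, 11352257, 128794131, 641077149, 3791387812⟩,
  ⟨67, 129251686, 129611867, 403963840, 9771934, 129338479, 643088400, 3796629101⟩,
  ⟨67, 129793719, 130158453, 405040557, 8189033, 129884319, 645105879, 3801880303⟩,
  ⟨67, 130337196, 130706532, 406118342, 6603575, 130431650, 647129611, 3807141442⟩,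
  ⟨66, 130878045, 131252001, 407189139, 5027439, 130980497, 620485887, 3644130336⟩,
  ⟨66, 131416237, 131794828, 408252922, 3460702, 131522597, 622403163, 3649102822⟩,
  ⟨66, 131955833, 132339110, 409317736, 1891543, 132066150, 624326308, 3654084586⟩,
  ⟨66, 132496836, 132884849, 410383579, 319982, 132611159, 626255339, 3659075626⟩]

def tab2 : List Bx := [
  ⟨67, 133043361, 133436198, 411458536, 1265894, 133157608, 657220033, 3833279507⟩,
  ⟨67, 133595441, 133993192, 412542628, 2866121, 133713849, 659281408, 3838600054⟩,
  ⟨67, 134148975, 134551694, 413627775, 4468762, 134271597, 661349206, 3843930673⟩,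
  ⟨67, 134703964, 135111705, 414713975, 6073795, 134830852, 663423448, 3849271374⟩,
  ⟨67, 135260409, 135673227, 415801226, 7681201, 135391617, 665504162, 3854622181⟩,
  ⟨67, 135818312, 136236262, 416889527, 9290958, 135953895, 667591370, 3859983105⟩,
  ⟨67, 136377674, 136800812, 417978874, 10903045, 136517687, 669685097, 3865354170⟩,
  ⟨67, 136938496, 137366879, 419069266, 12517441, 137082995, 671785366, 3870735382⟩,
  ⟨67, 137500780, 137934465, 420160702, 14134126, 137649820, 673892210, 3876126792⟩,
  ⟨67, 138064527, 138503572, 421253179, 15753077, 138218166, 676005646, 3881528387⟩,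
  ⟨67, 138629739, 139074201, 422346695, 17374273, 138788034, 678125700, 3886940196⟩,
  ⟨67, 139196417, 139646356, 423441248, 18997694, 139359425, 680252403, 3892362254⟩,
  ⟨67, 139764562, 140220036, 424536837, 20623319, 139932341, 682385776, 3897794562⟩,
  ⟨67, 140334176, 140795246, 425633459, 22251125, 140506786, 684525843, 3903237139⟩,
  ⟨67, 140905260, 141371985, 426731113, 23881091, 141082759, 686672637, 3908690026⟩,
  ⟨67, 141477816, 141950258, 427829795, 25513197, 141660265, 688826174, 3914153218⟩,
  ⟨67, 142051844, 142530064, 428929506, 27147420, 142239303, 690986488, 3919626749⟩,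
  ⟨67, 142627347, 143111407, 430030242, 28783740, 142819877, 693153600, 3925110635⟩,
  ⟨67, 143204326, 143694288, 431132001, 30422134, 143401989, 695327538, 3930604895⟩,
  ⟨67, 143782781, 144278709, 432234782, 32062582, 143985639, 697508330, 3936109559⟩,
  ⟨67, 144362715, 144864672, 433338582, 33705061, 144570829, 699696000, 3941624638⟩,
  ⟨67, 144944129, 145452180, 434443400, 35349551, 145157565, 701890575, 3947150155⟩,
  ⟨67, 145527024, 146041233, 435549233, 36996028, 145745844, 704092082, 3952686133⟩,
  ⟨67, 146111402, 146631834, 436656080, 38644473, 146335670, 706300546, 3958232586⟩,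
  ⟨67, 146697263, 147223986, 437763939, 40294862, 146927046, 708516000, 3963789555⟩,
  ⟨67, 147284609, 147817689, 438872807, 41947175, 147519972, 710738461, 3969357032⟩,
  ⟨67, 147873443, 148412946, 439982682, 43601389, 148114452, 712967962, 3974935054⟩,
  ⟨67, 148463763, 149009759, 441093564, 45257483, 148710485, 715204533, 3980523656⟩,
  ⟨67, 149055574, 149608129, 442205449, 46915434, 149308076, 717448195, 3986122834⟩,
  ⟨67, 149648875, 150208059, 443318335, 48575222, 149907226, 719698976, 3991732613⟩,
  ⟨67, 150243667, 150809551, 444432221, 50236823, 150507936, 721956908, 3997353031⟩,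
  ⟨67, 150839953, 151412607, 445547105, 51900217, 151110209, 724222017, 4002984107⟩,
  ⟨67, 151437734, 152017228, 446662984, 53565380, 151714046, 726494329, 4008625856⟩,
  ⟨67, 152037011, 152623417, 447779857, 55232292, 152319451, 728773873, 4014278302⟩,
  ⟨67, 152637784, 153231175, 448897721, 56900929, 152926423, 731060676, 4019941465⟩,
  ⟨67, 153240057, 153840505, 450016575, 58571270, 153534966, 733354769, 4025615376⟩,
  ⟨67, 153843829, 154451409, 451136417, 60243293, 154145083, 735656178, 4031300054⟩,
  ⟨67, 154449103, 155063887, 452257244, 61916976, 154756772, 737964929, 4036995511⟩,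
  ⟨67, 155055879, 155677944, 453379054, 63592296, 155370039, 740281055, 4042701786⟩,
  ⟨67, 155664159, 156293580, 454501846, 65269231, 155984885, 742604581, 4048418890⟩,
  ⟨67, 156273945, 156910797, 455625618, 66947759, 156601310, 744935541, 4054146862⟩,
  ⟨67, 156885236, 157529598, 456750367, 68627857, 157219318, 747273958, 4059885710⟩,
  ⟨67, 157498036, 158149984, 457876091, 70309504, 157838910, 749619861, 4065635454⟩,
  ⟨67, 158112345, 158771957, 459002789, 71992677, 158460089, 751973283, 4071396134⟩,
  ⟨67, 158728164, 159395520, 460130458, 73677353, 159082856, 754334251, 4077167762⟩,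
  ⟨67, 159345495, 160020675, 461259097, 75363510, 159707215, 756702795, 4082950368⟩,
  ⟨67, 159964339, 160647422, 462388703, 77051126, 160333164, 759078944, 4088743972⟩,
  ⟨67, 160584697, 161275766, 463519274, 78740179, 160960709, 761462729, 4094548607⟩,
  ⟨67, 161206571, 161905706, 464650809, 80430645, 161589849, 763854178, 4100364284⟩,
  ⟨67, 161829962, 162537246, 465783304, 82122503, 162220588, 766253321, 4106191037⟩,
  ⟨67, 162454870, 163170388, 466916759, 83815729, 162852929, 768660187, 4112028882⟩,
  ⟨67, 163081299, 163805132, 468051171, 85510301, 163486870, 771074808, 4117877852⟩,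
  ⟨67, 163709248, 164441483, 469186539, 87206197, 164122417, 773497216, 4123737978⟩,
  ⟨67, 164338719, 165079441, 470322859, 88903394, 164759571, 775927437, 4129609269⟩,
  ⟨67, 164969714, 165719008, 471460131, 90601869, 165398332, 778365505, 4135491761⟩,
  ⟨67, 165602233, 166360187, 472598351, 92301600, 166038704, 780811448, 4141385478⟩,
  ⟨67, 166236278, 167002979, 473737518, 94002563, 166680688, 783265297, 4147290439⟩,
  ⟨67, 166871850, 167647387, 474877631, 95704737, 167324287, 785727087, 4153206683⟩,
  ⟨67, 167508950, 168293413, 476018686, 97408098, 167969504, 788196841, 4159134213⟩,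
  ⟨67, 168147580, 168941058, 477160682, 99112623, 168616337, 790674600, 4165073088⟩,
  ⟨67, 168787741, 169590324, 478303616, 100818291, 169264792, 793160384, 4171023297⟩,
  ⟨67, 169429434, 170241215, 479447488, 102525077, 169914869, 795654238, 4176984905⟩,
  ⟨67, 170072661, 170893731, 480592294, 104232959, 170566571, 798156182, 4182957908⟩,
  ⟨67, 170717422, 171547875, 481738032, 105941915, 171219901, 800666249, 4188942333⟩,
  ⟨67, 171363719, 172203649, 482884701, 107651921, 171874858, 803184479, 4194938238⟩,
  ⟨67, 172011554, 172861055, 484032299, 109362954, 172531446, 805710899, 4200945627⟩,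
  ⟨67, 172660926, 173520095, 485180823, 111074991, 173189669, 808245537, 4206964516⟩,
  ⟨67, 173311839, 174180770, 486330271, 112788010, 173849525, 810788430, 4212994951⟩,
  ⟨67, 173964292, 174843084, 487480641, 114501988, 174511018, 813339610, 4219036957⟩,
  ⟨67, 174618287, 175507038, 488631932, 116216901, 175174151, 815899109, 4225090557⟩,
  ⟨67, 175273826, 176172634, 489784141, 117932726, 175838925, 818466959, 4231155779⟩,
  ⟨67, 175930909, 176839874, 490937266, 119649440, 176505341, 821043196, 4237232662⟩,
  ⟨67, 176589538, 177508761, 492091305, 121367021, 177173404, 823627848, 4243321218⟩,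
  ⟨67, 177249714, 178179296, 493246256, 123085445, 177843113, 826220952, 4249421487⟩,
  ⟨67, 177911438, 178851481, 494402116, 124804689, 178514472, 828822537, 4255533485⟩,
  ⟨67, 178574712, 179525319, 495558885, 126524729, 179187483, 831432642, 4261657256⟩,
  ⟨67, 179239537, 180200812, 496716559, 128245544, 179862147, 834051297, 4267792821⟩,
  ⟨67, 179905913, 180877961, 497875136, 129967108, 180538466, 836678534, 4273940202⟩,
  ⟨67, 180573842, 181556769, 499034615, 131689401, 181216443, 839314392, 4280099443⟩,
  ⟨67, 181243326, 182237239, 500194994, 133412397, 181896081, 841958902, 4286270567⟩,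
  ⟨67, 181914365, 182919371, 501356270, 135136074, 182577380, 844612099, 4292453603⟩,
  ⟨67, 182586961, 183603168, 502518441, 136860408, 183260344, 847274013, 4298648571⟩,
  ⟨67, 183261115, 184288632, 503681505, 138585377, 183944973, 849944683, 4304855513⟩,
  ⟨67, 183936828, 184975766, 504845461, 140310957, 184631271, 852624144, 4311074462⟩,
  ⟨67, 184614101, 185664571, 506010305, 142037125, 185319238, 855312429, 4317305444⟩,
  ⟨67, 185292936, 186355050, 507176036, 143763857, 186008879, 858009572, 4323548483⟩,
  ⟨67, 185973334, 187047204, 508342652, 145491130, 186700195, 860715608, 4329803609⟩,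
  ⟨67, 186655295, 187741036, 509510151, 147218920, 187393185, 863430578, 4336070877⟩,
  ⟨67, 187338821, 188436548, 510678530, 148947205, 188087856, 866154509, 4342350288⟩,
  ⟨67, 188023914, 189133742, 511847788, 150675961, 188784208, 868887441, 4348641882⟩,
  ⟨67, 188710574, 189832620, 513017922, 152405164, 189482242, 871629407, 4354945692⟩,
  ⟨67, 189398802, 190533184, 514188931, 154134792, 190181962, 874380447, 4361261758⟩,
  ⟨67, 190088600, 191235437, 515360811, 155864820, 190883368, 877140594, 4367590105⟩,
  ⟨67, 190779970, 191939381, 516533562, 157595225, 191586466, 879909883, 4373930756⟩,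
  ⟨67, 191472911, 192645017, 517707181, 159325984, 192291254, 882688355, 4380283762⟩,
  ⟨67, 192167425, 193352348, 518881665, 161057073, 192997736, 885476040, 4386649137⟩,
  ⟨67, 192863514, 194061376, 520057014, 162788469, 193705914, 888272981, 4393026928⟩,
  ⟨67, 193561178, 194772103, 521233224, 164520148, 194415790, 891079209, 4399417155⟩,
  ⟨67, 194260419, 195484531, 522410293, 166252087, 195127365, 893894764, 4405819859⟩,
  ⟨67, 194961238, 196198663, 523588220, 167984262, 195840644, 896719683, 4412235070⟩,
  ⟨67, 195663636, 196914501, 524767002, 169716649, 196555627, 899554003, 4418662825⟩,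
  ⟨67, 196367614, 197632047, 525946637, 171449226, 197272318, 902397762, 4425103154⟩,
  ⟨67, 197073174, 198351302, 527127123, 173181969, 197990716, 905250994, 4431556087⟩,
  ⟨67, 197780315, 199072270, 528308459, 174914853, 198710826, 908113746, 4438021678⟩,
  ⟨67, 198489041, 199794952, 529490641, 176647856, 199432649, 910986045, 4444499937⟩,
  ⟨67, 199199351, 200519351, 530673667, 178380954, 200156188, 913867932, 4450990900⟩,
  ⟨67, 199911246, 201245469, 531857537, 180114123, 200881445, 916759451, 4457494617⟩,
  ⟨67, 200624729, 201973307, 533042246, 181847339, 201608421, 919660633, 4464011111⟩,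
  ⟨67, 201339800, 202702869, 534227794, 183580579, 202337119, 922571523, 4470540429⟩,
  ⟨67, 202056460, 203434156, 535414178, 185313820, 203067542, 925492154, 4477082585⟩,
  ⟨67, 202774710, 204167171, 536601396, 187047038, 203799691, 928422571, 4483637642⟩,
  ⟨67, 203494552, 204901916, 537789446, 188780208, 204533569, 931362806, 4490205607⟩,
  ⟨67, 204215987, 205638392, 538978326, 190513309, 205269178, 934312904, 4496786536⟩,
  ⟨67, 204939015, 206376603, 540168033, 192246314, 206006520, 937272901, 4503380456⟩,
  ⟨67, 205663637, 207116551, 541358566, 193979202, 206745597, 940242842, 4509987415⟩,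
  ⟨66, 206384430, 207852695, 542541028, 195699018, 207486432, 901559544, 4317231549⟩,
  ⟨66, 207101360, 208585001, 543715400, 197405743, 208217891, 904374677, 4323477054⟩,
  ⟨66, 207819839, 209318998, 544890566, 199112284, 208951041, 907199135, 4329734731⟩,
  ⟨66, 208539871, 210054689, 546066526, 200818620, 209685884, 910032964, 4336004641⟩,
  ⟨113, 209518758, 211055039, 547662460, 203132146, 210421077, 4595130701, 21827349591⟩,
  ⟨113, 210758754, 212322514, 549679508, 206052448, 211686056, 4619750799, 21881598765⟩,
  ⟨113, 212003311, 213594980, 551698856, 208971877, 212956019, 4644511315, 21936030288⟩,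
  ⟨113, 213252435, 214872447, 553720492, 211890320, 214230978, 4669413175, 21990644977⟩,
  ⟨113, 214506130, 216154926, 555744407, 214807663, 215510944, 4694457365, 22045443788⟩,
  ⟨113, 215764401, 217442428, 557770591, 217723792, 216795926, 4719644860, 22100427643⟩,
  ⟨113, 217027254, 218734965, 559799032, 220638593, 218085938, 4744976612, 22155597396⟩,
  ⟨113, 218294695, 220032547, 561829722, 223551953, 219380989, 4770453639, 22210954050⟩,
  ⟨113, 219566726, 221335186, 563862648, 226463757, 220681092, 4796076884, 22266498405⟩,
  ⟨113, 220843355, 222642892, 565897802, 229373892, 221986255, 4821847395, 22322231544⟩,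
  ⟨113, 222124586, 223955677, 567935172, 232282244, 223296493, 4847766146, 22378154326⟩,
  ⟨113, 223410424, 225273553, 569974748, 235188699, 224611815, 4873834173, 22434267778⟩,
  ⟨113, 224700874, 226596529, 572016520, 238093143, 225932232, 4900052486, 22490572820⟩,
  ⟨113, 225995940, 227924618, 574060477, 240995463, 227257755, 4926422123, 22547070469⟩,
  ⟨113, 227295629, 229257831, 576106608, 243895544, 228588398, 4952944104, 22603761658⟩,
  ⟨113, 228599944, 230596179, 578154904, 246793273, 229924169, 4979619505, 22660647465⟩,
  ⟨113, 229908891, 231939675, 580205354, 249688535, 231265083, 5006449366, 22717728862⟩,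
  ⟨113, 231222474, 233288328, 582257947, 252581219, 232611146, 5033434767, 22775006937⟩,
  ⟨113, 232540698, 234642152, 584312673, 255471209, 233962377, 5060576738, 22832482564⟩,
  ⟨113, 233863569, 236001157, 586369521, 258358392, 235318780, 5087876419, 22890157006⟩,
  ⟨113, 235191090, 237365355, 588428481, 261242654, 236680372, 5115334847, 22948031129⟩,
  ⟨113, 236523267, 238734757, 590489542, 264123883, 238047162, 5142953141, 23006106076⟩,
  ⟨113, 237860104, 240109377, 592552694, 267001964, 239419163, 5170732418, 23064382953⟩,
  ⟨113, 239201607, 241489224, 594617926, 269876784, 240796386, 5198673765, 23122862760⟩,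
  ⟨113, 240547779, 242874312, 596685228, 272748230, 242178843, 5226778337, 23181546689⟩,
  ⟨113, 241898625, 244264651, 598754589, 275616188, 243566544, 5255047277, 23240435892⟩,
  ⟨113, 243254151, 245660255, 600825998, 278480546, 244959505, 5283481676, 23299531323⟩,
  ⟨113, 244614360, 247061134, 602899446, 281341190, 246357735, 5312082738, 23358834269⟩,
  ⟨113, 245979258, 248467302, 604974920, 284198007, 247761248, 5340851574, 23418345741⟩,
  ⟨113, 247348849, 249878769, 607052411, 287050884, 249170053, 5369789385, 23478066975⟩,
  ⟨113, 248723136, 251295549, 609131908, 289899709, 250584165, 5398897355, 23537999165⟩,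
  ⟨113, 250102126, 252717653, 611213401, 292744369, 252003595, 5428176671, 23598143468⟩,
  ⟨112, 251479690, 254138765, 613287655, 295572192, 253428392, 5313674644, 23035144480⟩,
  ⟨112, 252855769, 255558828, 615354634, 298383126, 254845815, 5342262610, 23093596775⟩,
  ⟨112, 254236480, 256984158, 617423541, 301189637, 256268500, 5371017896, 23152255359⟩,
  ⟨112, 255621828, 258414766, 619494368, 303991618, 257696456, 5399941709, 23211121485⟩,
  ⟨112, 257011816, 259850665, 621567102, 306788958, 259129696, 5429035195, 23270196299⟩,
  ⟨112, 258406450, 261291867, 623641734, 309581548, 260568233, 5458299531, 23329480931⟩,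
  ⟨112, 259805732, 262738384, 625718254, 312369280, 262012079, 5487735934, 23388976660⟩,
  ⟨112, 261209669, 264190230, 627796651, 315152045, 263461247, 5517345598, 23448684682⟩,
  ⟨112, 262618263, 265647415, 629876914, 317929734, 264915748, 5547129718, 23508606174⟩,
  ⟨112, 264031519, 267109952, 631959033, 320702239, 266375595, 5577089541, 23568742444⟩,
  ⟨112, 265449441, 268577854, 634042997, 323469451, 267840800, 5607226285, 23629094711⟩,
  ⟨112, 266872033, 270051134, 636128797, 326231262, 269311376, 5637541206, 23689664253⟩,
  ⟨112, 268299299, 271529804, 638216421, 328987565, 270787336, 5668035552, 23750452356⟩,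
  ⟨112, 269731244, 273013876, 640305860, 331738250, 272268692, 5698710596, 23811460316⟩,
  ⟨112, 271167871, 274503364, 642397102, 334483211, 273755456, 5729567604, 23872689436⟩,
  ⟨112, 272609184, 275998279, 644490137, 337222340, 275247642, 5760607855, 23934141008⟩,
  ⟨112, 274055188, 277498636, 646584955, 339955529, 276745261, 5791832682, 23995816476⟩,
  ⟨112, 275505886, 279004447, 648681545, 342682671, 278248329, 5823243350, 24057717053⟩,
  ⟨112, 276961282, 280515725, 650779896, 345403660, 279756856, 5854841190, 24119844153⟩,
  ⟨112, 278421381, 282032482, 652879999, 348118389, 281270856, 5886627541, 24182199156⟩,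
  ⟨112, 279886186, 283554733, 654981842, 350826750, 282790343, 5918603743, 24244783472⟩,
  ⟨112, 281355701, 285082489, 657085414, 353528638, 284315329, 5950771127, 24307598449⟩,
  ⟨112, 282829930, 286615765, 659190707, 356223946, 285845827, 5983131100, 24370645594⟩,
  ⟨112, 284308877, 288154574, 661297708, 358912568, 287381851, 6015685010, 24433926299⟩,
  ⟨112, 285792545, 289698928, 663406407, 361594399, 288923412, 6048434249, 24497442017⟩,
  ⟨112, 287280939, 291248842, 665516793, 364269332, 290470528, 6081380191, 24561194139⟩,
  ⟨112, 288774062, 292804329, 667628857, 366937263, 292023208, 6114524308, 24625184311⟩,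
  ⟨112, 290271917, 294365403, 669742587, 369598086, 293581470, 6147867968, 24689413869⟩,
  ⟨112, 291774510, 295932076, 671857973, 372251697, 295145322, 6181412643, 24753884433⟩,
  ⟨112, 293281842, 297504364, 673975004, 374897991, 296714783, 6215159757, 24818597461⟩,
  ⟨112, 294793919, 299082278, 676093669, 377536863, 298289862, 6249110778, 24883554521⟩,
  ⟨112, 296310743, 300665835, 678213959, 380168209, 299870576, 6283267212, 24948757241⟩,
  ⟨112, 297832319, 302255046, 680335861, 382791926, 301456937, 6317630497, 25014207088⟩,
  ⟨112, 299358649, 303849927, 682459366, 385407909, 303048962, 6352202153, 25079905688⟩,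
  ⟨112, 300889738, 305450491, 684584463, 388016055, 304646661, 6386983702, 25145854682⟩,
  ⟨112, 302425588, 307056753, 686711141, 390616262, 306250051, 6421976669, 25212055694⟩,
  ⟨112, 303966205, 308668726, 688839390, 393208425, 307859144, 6457182595, 25278510364⟩,
  ⟨112, 305511590, 310286425, 690969198, 395792443, 309473957, 6492603007, 25345220291⟩,
  ⟨112, 307061748, 311909865, 693100556, 398368213, 311094502, 6528239520, 25412187263⟩,
  ⟨112, 308616682, 313539059, 695233452, 400935633, 312720793, 6564093683, 25479412905⟩,
  ⟨112, 310176395, 315174023, 697367876, 403494602, 314352848, 6600167089, 25546898904⟩,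
  ⟨112, 311740891, 316814770, 699503816, 406045017, 315990676, 6636461369, 25614647088⟩,
  ⟨112, 313310173, 318461316, 701641263, 408586778, 317634296, 6672978149, 25682659169⟩,
  ⟨112, 314884245, 320113675, 703780206, 411119784, 319283722, 6709719043, 25750936847⟩,
  ⟨112, 316463110, 321771862, 705920633, 413643933, 320938967, 6746685732, 25819482016⟩,
  ⟨112, 318046770, 323435892, 708062534, 416159127, 322600048, 6783879863, 25888296402⟩,
  ⟨112, 319635231, 325105780, 710205899, 418665265, 324266978, 6821303158, 25957381923⟩,
  ⟨112, 321228494, 326781541, 712350716, 421162246, 325939774, 6858957268, 26026740309⟩,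
  ⟨112, 322826563, 328463190, 714496974, 423649973, 327618449, 6896843927, 26096373481⟩,
  ⟨112, 324429442, 330150743, 716644664, 426128346, 329303021, 6934964885, 26166283348⟩,
  ⟨112, 326037132, 331844214, 718793774, 428597265, 330993502, 6973321881, 26236471810⟩,
  ⟨112, 327649639, 333543619, 720944293, 431056634, 332689908, 7011916679, 26306940805⟩,
  ⟨112, 329266964, 335248974, 723096211, 433506353, 334392256, 7050751042, 26377692208⟩,
  ⟨112, 330889111, 336960294, 725249516, 435946325, 336100561, 7089826784, 26448728066⟩,
  ⟨112, 332516083, 338677595, 727404198, 438376453, 337814838, 7129145705, 26520050308⟩,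
  ⟨112, 334147883, 340400893, 729560247, 440796640, 339535104, 7168709661, 26591661011⟩,
  ⟨112, 335784514, 342130202, 731717650, 443206789, 341261372, 7208520444, 26663562082⟩,
  ⟨225, 338255875, 344743249, 734965917, 446813650, 342985890, 59213035066, 217683859420⟩,
  ⟨225, 341572989, 348253850, 739308045, 451593604, 346484111, 59877417224, 218874864835⟩,
  ⟨225, 344909655, 351789009, 743655445, 456331306, 350006819, 60550213775, 220075750574⟩,
  ⟨225, 348265896, 355348859, 748008028, 461025991, 353554144, 61231554489, 221286661157⟩,
  ⟨225, 351641735, 358933533, 752365708, 465676899, 357126221, 61921570891, 222507741528⟩,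
  ⟨225, 355037195, 362543169, 756728394, 470283279, 360723184, 62620398058, 223739143550⟩,
  ⟨225, 358452298, 366177903, 761096000, 474844384, 364345171, 63328172729, 224981018710⟩,
  ⟨225, 361887066, 369837874, 765468436, 479359474, 367992317, 64045034923, 226233524224⟩,
  ⟨225, 365341521, 373523224, 769845613, 483827818, 371664766, 64771126966, 227496819275⟩,
  ⟨225, 368815683, 377234095, 774227443, 488248690, 375362657, 65506594667, 228771068228⟩,
  ⟨225, 372309575, 380970630, 778613837, 492621371, 379086131, 66251586232, 230056437780⟩,
  ⟨225, 375823215, 384732977, 783004706, 496945150, 382835337, 67006252857, 231353098367⟩,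
  ⟨225, 379356623, 388521281, 787399962, 501219324, 386610416, 67770749202, 232661225147⟩,
  ⟨225, 382909821, 392335692, 791799514, 505443197, 390411520, 68545232209, 233980995353⟩,
  ⟨225, 386482825, 396176363, 796203274, 509616080, 394238800, 69329862718, 235312591524⟩,
  ⟨225, 390075656, 400043444, 800611153, 513737291, 398092404, 70124804971, 236656200720⟩,
  ⟨225, 393688332, 403937092, 805023061, 517806159, 401972488, 70930226082, 238012012962⟩,
  ⟨225, 397320870, 407857463, 809438908, 521822018, 405879207, 71746296692, 239380222692⟩,
  ⟨225, 400973288, 411804715, 813858606, 525784212, 409812717, 72573191446, 240761029544⟩,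
  ⟨225, 404645603, 415779009, 818282065, 529692092, 413773178, 73411088302, 242154637073⟩,
  ⟨225, 408337832, 419780508, 822709194, 533545018, 417760752, 74260168844, 243561253291⟩,
  ⟨225, 412049991, 423809375, 827139905, 537342358, 421775600, 75120618729, 244981090936⟩,
  ⟨225, 415782096, 427865777, 831574107, 541083490, 425817888, 75992627387, 246414367657⟩,
  ⟨225, 419534163, 431949884, 836011710, 544767800, 429887785, 76876388471, 247861306299⟩,
  ⟨225, 423306207, 436061864, 840452625, 548394682, 433985457, 77772099586, 249322134007⟩,
  ⟨225, 427098242, 440201892, 844896761, 551963539, 438111078, 78679962555, 250797083362⟩,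
  ⟨225, 430910282, 444370141, 849344029, 555473786, 442264818, 79600184191, 252286393411⟩,
  ⟨225, 434742342, 448566789, 853794338, 558924844, 446446855, 80532974971, 253790306866⟩,
  ⟨225, 438594436, 452792015, 858247598, 562316143, 450657366, 81478550314, 255309072634⟩,
  ⟨225, 442466575, 457046000, 862703719, 565647126, 454896531, 82437130737, 256842946219⟩,
  ⟨225, 446358773, 461328929, 867162610, 568917243, 459164533, 83408940905, 258392187322⟩,
  ⟨225, 450271043, 465640986, 871624182, 572125953, 463461553, 84394211579, 259957063967⟩,
  ⟨225, 454203395, 469982361, 876088342, 575272726, 467787781, 85393177065, 261537847129⟩,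
  ⟨225, 458155841, 474353243, 880555002, 578357043, 472143404, 86406078660, 263134817325⟩,
  ⟨225, 462128393, 478753827, 885024071, 581378393, 476528614, 87433162153, 264748259789⟩,
  ⟨225, 466121062, 483184307, 889495457, 584336275, 480943605, 88474678602, 266378465821⟩,
  ⟨225, 470133856, 487644881, 893969071, 587230200, 485388572, 89530886060, 268025735989⟩,
  ⟨225, 474166786, 492135750, 898444822, 590059688, 489863715, 90602047103, 269690374863⟩,
  ⟨225, 478219862, 496657117, 902922618, 592824270, 494369233, 91688431315, 271372696689⟩,
  ⟨225, 482293093, 501209187, 907402369, 595523487, 498905332, 92790313817, 273073020932⟩,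
  ⟨225, 486386487, 505792168, 911883985, 598156890, 503472217, 93907976822, 274791676226⟩,
  ⟨225, 490500051, 510406270, 916367374, 600724042, 508070096, 95041708302, 276528997358⟩,
  ⟨225, 494633795, 515051708, 920852446, 603224517, 512699180, 96191804527, 278285330213⟩,
  ⟨225, 498787726, 519728696, 925339109, 605657897, 517359683, 97358566703, 280061024411⟩,
  ⟨225, 502961850, 524437455, 929827273, 608023778, 522051825, 98542304582, 281856440735⟩,
  ⟨225, 507156173, 529178204, 934316847, 610321767, 526775820, 99743335276, 283671948688⟩,
  ⟨225, 511370703, 533951169, 938807740, 612551480, 531531894, 100961982679, 285507924671⟩,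
  ⟨225, 515605445, 538756577, 943299860, 614712544, 536320270, 102198579390, 287364756402⟩,
  ⟨225, 519860404, 543594657, 947793117, 616804601, 541141176, 103453465470, 289242839082⟩,
  ⟨225, 524135585, 548465643, 952287419, 618827301, 545994844, 104726989299, 291142577969⟩,
  ⟨225, 528430992, 553369770, 956782676, 620780305, 550881504, 106019508391, 293064389040⟩,
  ⟨225, 532746630, 558307277, 961278796, 622663289, 555801396, 107331388026, 295008696464⟩,
  ⟨225, 537082502, 563278405, 965775689, 624475936, 560754757, 108663003338, 296975936126⟩,
  ⟨225, 541438612, 568283400, 970273262, 626217945, 565741832, 110014737851, 298966553140⟩,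
  ⟨225, 545814963, 573322510, 974771425, 627889024, 570762863, 111386986210, 300981006250⟩,
  ⟨225, 550211556, 578395985, 979270087, 629488893, 575818100, 112780151609, 303019762642⟩,
  ⟨225, 554628394, 583504080, 983769157, 631017285, 580907795, 114194647708, 305083301669⟩,
  ⟨225, 559065479, 588647052, 988268542, 632473944, 586032202, 115630898346, 307172114293⟩,
  ⟨225, 563522811, 593825161, 992768153, 633858627, 591191579, 117089338903, 309286704318⟩,
  ⟨225, 568000392, 599038672, 997267898, 635171101, 596386188, 118570415022, 311427586823⟩,
  ⟨225, 572498222, 604287852, 1001767685, 636411147, 601616291, 120074584713, 313595291663⟩,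
  ⟨225, 577016301, 609572972, 1006267424, 637578557, 606882160, 121602316744, 315790359090⟩,
  ⟨225, 581554629, 614894304, 1010767023, 638673136, 612184061, 123154092579, 318013344491⟩,
  ⟨225, 586113204, 620252128, 1015266391, 639694701, 617522272, 124730406451, 320264817360⟩,
  ⟨224, 590681828, 625634694, 1019755439, 640641055, 622897332, 124645223328, 318248487027⟩,
  ⟨224, 595260365, 631042040, 1024234080, 641512527, 628284869, 126243208718, 320517650766⟩,
  ⟨224, 599858965, 636486396, 1028712221, 642311163, 633709229, 127866711909, 322816420763⟩,
  ⟨224, 604477626, 641968052, 1033189772, 643036830, 639170697, 129516266767, 325145409442⟩,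
  ⟨224, 609116344, 647487297, 1037666645, 643689409, 644669557, 131192421525, 327505244544⟩,
  ⟨224, 613775118, 653044426, 1042142748, 644268791, 650206105, 132895736886, 329896566225⟩,
  ⟨224, 618453942, 658639739, 1046617991, 644774882, 655780633, 134626791034, 332320035442⟩,
  ⟨224, 623152813, 664273537, 1051092286, 645207599, 661393442, 136386176208, 334776326312⟩,
  ⟨224, 627871727, 669946126, 1055565541, 645566871, 667044834, 138174500725, 337266131286⟩,
  ⟨224, 632610679, 675657817, 1060037668, 645852640, 672735114, 139992390600, 339790161837⟩,
  ⟨224, 637369663, 681408922, 1064508576, 646064862, 678464595, 141840486718, 342349143946⟩,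
  ⟨224, 642148674, 687199759, 1068978175, 646203501, 684233587, 143719449655, 344943826241⟩,
  ⟨224, 646947705, 693030650, 1073446376, 646268538, 690042409, 145629957266, 347574974494⟩,
  ⟨224, 651766751, 698901919, 1077913089, 646259965, 695891382, 147572706159, 350243374480⟩,
  ⟨224, 656605804, 704813897, 1082378224, 646177785, 701780834, 149548412014, 352949831718⟩,
  ⟨224, 661464858, 710766916, 1086841691, 646022015, 707711093, 151557810500, 355695172618⟩,
  ⟨224, 666343903, 716761314, 1091303401, 645792685, 713682492, 153601658338, 358480245611⟩,
  ⟨224, 671242933, 722797432, 1095763264, 645489837, 719695367, 155680733548, 361305921444⟩,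
  ⟨224, 676161939, 728875617, 1100221191, 645113524, 725750063, 157795836142, 364173093247⟩,
  ⟨224, 681100912, 734996218, 1104677091, 644663814, 731846923, 159947787706, 367082675823⟩,
  ⟨224, 686059843, 741159590, 1109130876, 644140786, 737986300, 162137435032, 370035610487⟩,
  ⟨224, 691038722, 747366091, 1113582457, 643544532, 744168544, 164365648967, 373032863103⟩,
  ⟨224, 696037538, 753616085, 1118031742, 642875157, 750394018, 166633323190, 376075421533⟩,
  ⟨224, 701056282, 759909938, 1122478644, 642132777, 756663081, 168941380068, 379164303662⟩,
  ⟨224, 706094943, 766248023, 1126923073, 641317523, 762976103, 171290767723, 382300553159⟩,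
  ⟨315, 712183462, 773932685, 1132266872, 640240290, 769284861, 486672062579, 1077379348722⟩,
  ⟨315, 719336405, 782997491, 1138507962, 638848109, 778298743, 496320943532, 1090174011743⟩,
  ⟨315, 726528650, 792152497, 1144743524, 637312949, 787402014, 506218993427, 1103252981265⟩,
  ⟨315, 733760162, 801398799, 1150973311, 635635337, 796595750, 516374712823, 1116625476883⟩,
  ⟨315, 741030902, 810737510, 1157197075, 633815849, 805881046, 526796959431, 1130301064709⟩,
  ⟨315, 748340832, 820169765, 1163414569, 631855111, 815259015, 537494971662, 1144289681070⟩,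
  ⟨315, 755689911, 829696716, 1169625547, 629753795, 824730786, 548478385607, 1158601644549⟩,
  ⟨315, 763078099, 839319535, 1175829760, 627512623, 834297511, 559757244392, 1173247656999⟩,
  ⟨315, 770505352, 849039414, 1182026964, 625132364, 843960360, 571342038955, 1188238849072⟩,
  ⟨315, 777971624, 858857565, 1188216911, 622613836, 853720520, 583243710949, 1203586771516⟩,
  ⟨315, 785476869, 868775219, 1194399356, 619957903, 863579198, 595473687678, 1219303428155⟩,
  ⟨315, 793021039, 878793629, 1200574053, 617165477, 873537625, 608043900239, 1235401287325⟩,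
  ⟨315, 800604085, 888914069, 1206740757, 614237517, 883597046, 620966815799, 1251893311134⟩,
  ⟨315, 808225956, 899137835, 1212899223, 611175029, 893758735, 634255456085, 1268792961858⟩,
  ⟨315, 815886598, 909466241, 1219049206, 607979065, 904023979, 647923431737, 1286114233263⟩,
  ⟨315, 823585957, 919900628, 1225190462, 604650724, 914394091, 661984979349, 1303871683266⟩,
  ⟨315, 831323979, 930442354, 1231322748, 601191149, 924870401, 676454979887, 1322080434024⟩,
  ⟨315, 839100605, 941092804, 1237445819, 597601530, 935454266, 691349002915, 1340756216857⟩,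
  ⟨315, 846915776, 951853382, 1243559432, 593883102, 946147062, 706683336652, 1359915384019⟩,
  ⟨315, 854769433, 962725518, 1249663344, 590037145, 956950185, 722475038242, 1379574957637⟩,
  ⟨315, 862661513, 973710664, 1255757313, 586064981, 967865061, 738741956578, 1399752627802⟩,
  ⟨315, 870591954, 984810295, 1261841098, 581967978, 978893130, 755502792069, 1420466809921⟩,
  ⟨315, 878560689, 996025913, 1267914455, 577747546, 990035863, 772777130766, 1441736661438⟩,
  ⟨315, 886567654, 1007359042, 1273977145, 573405140, 1001294752, 790585499589, 1463582117267⟩,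
  ⟨315, 894612778, 1018811231, 1280028925, 568942255, 1012671309, 808949415153, 1486023929692⟩,
  ⟨315, 902695995, 1030384054, 1286069557, 564360430, 1024167073, 827891440019, 1509083697450⟩,
  ⟨315, 910817231, 1042079113, 1292098799, 559661243, 1035783612, 847435234895, 1532783904574⟩,
  ⟨315, 918976415, 1053898032, 1298116412, 554846314, 1047522511, 867605629185, 1557147966681⟩,
  ⟨315, 927173473, 1065842465, 1304122158, 549917305, 1059385388, 888428679012, 1582200263384⟩,
  ⟨315, 935408329, 1077914089, 1310115798, 544875915, 1071373880, 909931736747, 1607966184759⟩,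
  ⟨315, 943680906, 1090114610, 1316097093, 539723883, 1083489652, 932143527608, 1634472180630⟩,
  ⟨315, 951991126, 1102445761, 1322065807, 534462989, 1095734396, 955094231419, 1661745810155⟩,
  ⟨315, 960338908, 1114909304, 1328021701, 529095046, 1108109834, 978815547636, 1689815772163⟩,
  ⟨315, 968724172, 1127507025, 1333964541, 523621909, 1120617707, 1003340808466, 1718711985388⟩,
  ⟨315, 977146834, 1140240744, 1339894088, 518045467, 1133259792, 1028705053754, 1748465627509⟩,
  ⟨315, 985606809, 1153112304, 1345810109, 512367646, 1146037884, 1054945138882, 1779109191389⟩,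
  ⟨315, 994104012, 1166123583, 1351712367, 506590407, 1158953816, 1082099840414, 1810676557451⟩,
  ⟨315, 1002638355, 1179276484, 1357600629, 500715745, 1172009442, 1110209966980, 1843203043997⟩,
  ⟨315, 1011209750, 1192572942, 1363474661, 494745689, 1185206647, 1139318475224, 1876725474269⟩,
  ⟨315, 1019818106, 1206014923, 1369334229, 488682304, 1198547347, 1169470606734, 1911282257994⟩,
  ⟨315, 1028463331, 1219604422, 1375179100, 482527682, 1212033486, 1200714011653, 1946913445489⟩,
  ⟨315, 1037145331, 1233343467, 1381009043, 476283951, 1225667036, 1233098915900, 1983660834100⟩,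
  ⟨315, 1045864013, 1247234117, 1386823826, 469953269, 1239450004, 1266678237441, 2021567999703⟩,
  ⟨315, 1054619279, 1261278462, 1392623219, 463537822, 1253384422, 1301507795339, 2060680438694⟩,
  ⟨314, 1063397048, 1275455962, 1398397821, 457050207, 1267475345, 1324801534086, 2080931063366⟩,
  ⟨314, 1072197049, 1289768018, 1404147481, 450493045, 1281673544, 1361829875836, 2122064941528⟩,
  ⟨314, 1081033107, 1304239213, 1409881163, 443858339, 1296028481, 1400271844646, 2164531091361⟩,
  ⟨314, 1089905122, 1318871750, 1415598642, 437148365, 1310542301, 1440195296293, 2208382448790⟩,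
  ⟨314, 1098812992, 1333667866, 1421299692, 430365427, 1325217172, 1481671893343, 2253674298270⟩,
  ⟨314, 1107756612, 1348629831, 1426984088, 423511855, 1340055303, 1524777296721, 2300464321905⟩,
  ⟨314, 1116735877, 1363759950, 1432651606, 416589999, 1355058931, 1569591460993, 2348812772139⟩,
  ⟨314, 1125750680, 1379060563, 1438302022, 409602236, 1370230328, 1616198878609, 2398782562817⟩,
  ⟨314, 1134800914, 1394534048, 1443935113, 402550964, 1385571799, 1664688885839, 2450439419303⟩,
  ⟨314, 1143886468, 1410182815, 1449550656, 395438600, 1401085684, 1715155935635, 2503851971703⟩,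
  ⟨314, 1153007233, 1426009314, 1455148431, 388267585, 1416774357, 1767699958002, 2559091932217⟩,
  ⟨314, 1162163095, 1442016030, 1460728216, 381040378, 1432640229, 1822426680533, 2616234215029⟩,
  ⟨314, 1171353941, 1458205488, 1466289791, 373759456, 1448685743, 1879448041476, 2675357132999⟩,
  ⟨314, 1180579656, 1474580247, 1471832937, 366427314, 1464913381, 1938882514643, 2736542472050⟩,
  ⟨314, 1189840124, 1491142909, 1477357435, 359046465, 1481325660, 2000855624025, 2799875770334⟩,
  ⟨314, 1199135226, 1507896112, 1482863067, 351619436, 1497925133, 2065500325579, 2865446406695⟩,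
  ⟨314, 1208464844, 1524842535, 1488349615, 344148770, 1514714395, 2132957520089, 2933347821878⟩,
  ⟨314, 1217828857, 1541984896, 1493816863, 336637024, 1531696069, 2203376602459, 3003677744571⟩,
  ⟨314, 1227227143, 1559325955, 1499264596, 329086767, 1548872828, 2276915952075, 3076538323192⟩,
  ⟨314, 1236659579, 1576868510, 1504692599, 321500582, 1566247376, 2353743572791, 3152036396763⟩,
  ⟨314, 1246126040, 1594615405, 1510100656, 313881060, 1583822454, 2434037751881, 3230283748453⟩,
  ⟨314, 1255626401, 1612569522, 1515488556, 306230804, 1601600850, 2517987663060, 3311397244664⟩,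
  ⟨314, 1265160534, 1630733789, 1520856085, 298552427, 1619585389, 2605794167508, 3395499182138⟩,
  ⟨314, 1274728310, 1649111175, 1526203031, 290848548, 1637778936, 2697670561105, 3482717503799⟩,
  ⟨314, 1284329600, 1667704693, 1531529184, 283121795, 1656184393, 2793843430077, 3573186096196⟩,
  ⟨314, 1293964273, 1686517401, 1536834333, 275374799, 1674804707, 2894553525878, 3667045064295⟩,
  ⟨314, 1303632195, 1705552402, 1542118269, 267610200, 1693642873, 3000056709374, 3764441015264⟩,
  ⟨314, 1313333234, 1724812843, 1547380784, 259830640, 1712701917, 3110625042546, 3865527447765⟩,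
  ⟨314, 1323067253, 1744301919, 1552621670, 252038764, 1731984913, 3226547838769, 3970465037396⟩,
  ⟨314, 1332834116, 1764022870, 1557840720, 244237219, 1751494981, 3348132822206, 4079421968342⟩,
  ⟨314, 1342633686, 1783978984, 1563037728, 236428655, 1771235284, 3475707444594, 4192574357774⟩,
  ⟨314, 1352465823, 1804173595, 1568212489, 228615719, 1791209021, 3609620240672, 4310106644412⟩,
  ⟨314, 1362330388, 1824610089, 1573364800, 220801060, 1811419450, 3750242240807, 4432211955455⟩,
  ⟨314, 1372227238, 1845291897, 1578494456, 212987323, 1831869863, 3897968555906, 4559092573355⟩,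
  ⟨314, 1382156230, 1866222501, 1583601255, 205177151, 1852563599, 4053220063852, 4690960389074⟩,
  ⟨314, 1392117221, 1887405435, 1588684996, 197373183, 1873504053, 4216445175063, 4828037355787⟩,
  ⟨314, 1402110065, 1908844281, 1593745479, 189578052, 1894694655, 4388121799651, 4970556028162⟩,
  ⟨314, 1412134615, 1930542673, 1598782504, 181794388, 1916138891, 4568759356529, 5118760038778⟩,
  ⟨314, 1422190724, 1952504299, 1603795871, 174024809, 1937840288, 4758901069759, 5272904722794⟩,
  ⟨314, 1432278242, 1974732896, 1608785383, 166271931, 1959802426, 4959126284102, 5433257631673⟩,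
  ⟨314, 1442397018, 1997232259, 1613750844, 158538356, 1982028935, 5170053069335, 5600099192717⟩,
  ⟨314, 1452546901, 2020006233, 1618692057, 150826678, 2004626392, 5310868242192, 5704903734358⟩,
  ⟨314, 1462727739, 2043058720, 1623608828, 143139481, 2027514502, 5444526884635, 5802412848460⟩,
  ⟨314, 1472939377, 2066393675, 1628500963, 135479336, 2050683154, 5581998723148, 5901950136349⟩,
  ⟨314, 1483181659, 2090015111, 1633368267, 127848800, 2074136342, 5723405843324, 6003563430092⟩,
  ⟨314, 1493454430, 2113927098, 1638210551, 120250419, 2097878104, 5868874722959, 6107301868142⟩,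
  ⟨314, 1503757531, 2138133760, 1643027622, 112686721, 2121912542, 6018536111537, 6213215729656⟩,
  ⟨314, 1514090804, 2162639283, 1647819290, 105160220, 2146243809, 6172525434749, 6321356644241⟩,
  ⟨314, 1524454088, 2187447909, 1652585367, 97673413, 2170876121, 6330982786319, 6431777484523⟩,
  ⟨314, 1534847222, 2212563941, 1657325665, 90228778, 2195813757, 6494053136713, 6544532436423⟩,
  ⟨314, 1545270044, 2237991740, 1662039995, 82828777, 2221061045, 6661886591242, 6659677099066⟩,
  ⟨314, 1555722389, 2263735731, 1666728174, 75475848, 2246622381, 6834638526602, 6777268456079⟩,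
  ⟨314, 1566204094, 2289800397, 1671390015, 68172414, 2272502221, 7012469716753, 6897364893974⟩,
  ⟨314, 1576714992, 2316190286, 1676025335, 60920871, 2298705082, 7195546656982, 7020026307713⟩,
  ⟨314, 1587254917, 2342910008, 1680633950, 53723597, 2325235544, 7384041652327, 7145314064291⟩,
  ⟨314, 1597823699, 2369964236, 1685215680, 46582944, 2352098249, 7578133156860, 7273291117701⟩,
  ⟨314, 1608421169, 2397357708, 1689770343, 39501240, 2379297904, 7778005850402, 7404021959922⟩,
  ⟨314, 1619047157, 2425095227, 1694297760, 32480789, 2406839284, 7983850969782, 7537572718960⟩,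
  ⟨314, 1629701491, 2453181664, 1698797752, 25523869, 2434727225, 8195866550142, 7674011211295⟩,
  ⟨314, 1640383999, 2481621953, 1703270141, 18632730, 2462966632, 8414257597121, 7813406925447⟩,
  ⟨314, 1651094506, 2510421099, 1707714752, 11809595, 2491562474, 8639236470787, 7955831148454⟩,
  ⟨314, 1661832838, 2539584172, 1712131409, 5056659, 2520519791, 8871022978758, 8101356901207⟩]

def tab3 : List Bx := [
  ⟨446, 1674865231, 2575371135, 1717438774, 3018705, 2547912756, 26591125201725, 23950573607488⟩,
  ⟨446, 1690212373, 2618075720, 1723614981, 12356351, 2590189712, 27620803694806, 24581523404144⟩,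
  ⟨446, 1705614351, 2661552869, 1729733526, 21536813, 2633231845, 28695583771694, 25232255510579⟩,
  ⟨446, 1721070646, 2705818095, 1735793922, 30554233, 2677054528, 29817641694394, 25903454396073⟩,
  ⟨446, 1736580740, 2750887207, 1741795688, 39402888, 2721673421, 30989265405269, 26595829312935⟩,
  ⟨446, 1752144106, 2796776319, 1747738346, 48077192, 2767104496, 32212859708894, 27310114770338⟩,
  ⟨446, 1767760215, 2843501851, 1753621422, 56571708, 2813364019, 33490953055905, 28047071844234⟩,
  ⟨446, 1783428533, 2891080534, 1759444449, 64881144, 2860468574, 34826203354659, 28807488651998⟩,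
  ⟨446, 1799148524, 2939529416, 1765206964, 73000361, 2908435049, 36221405728694, 29592181953023⟩,
  ⟨446, 1814919644, 2988865868, 1770908508, 80924377, 2957280659, 37679498651957, 30401997501917⟩,
  ⟨446, 1830741349, 3039107585, 1776548627, 88648368, 3007022941, 39203572022043, 31237811406333⟩,
  ⟨446, 1846613088, 3090272597, 1782126874, 96167676, 3057679762, 40796875244453, 32100531251770⟩,
  ⟨446, 1862534307, 3142379267, 1787642803, 103477808, 3109269320, 42462825049057, 32991096972475⟩,
  ⟨446, 1878504449, 3195446303, 1793095977, 110574441, 3161810155, 44205014916490, 33910482261299⟩,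
  ⟨446, 1894522951, 3249492757, 1798485962, 117453425, 3215321149, 46027223789594, 34859695523132⟩,
  ⟨446, 1910589249, 3304538035, 1803812328, 124110788, 3269821531, 47933426117870, 35839781269850⟩,
  ⟨446, 1926702773, 3360601900, 1809074653, 130542736, 3325330892, 49927801781501, 36851821152057⟩,
  ⟨446, 1942862949, 3417704475, 1814272518, 136745655, 3381869178, 52014746857674, 37896935350070⟩,
  ⟨446, 1959069202, 3475866254, 1819405509, 142716119, 3439456693, 54198885735610, 38976284322296⟩,
  ⟨446, 1975320950, 3535108103, 1824473218, 148450884, 3498114128, 56485081220897, 40091069223618⟩,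
  ⟨446, 1991617609, 3595451264, 1829475242, 153946898, 3557862536, 58878448780210, 41242534292580⟩,
  ⟨446, 2007958591, 3656917366, 1834411183, 159201300, 3618723355, 61384368770517, 42431967847622⟩,
  ⟨446, 2024343307, 3719528424, 1839280649, 164211420, 3680718406, 64008500642978, 43660704002972⟩,
  ⟨446, 2040771159, 3783306849, 1844083253, 168974784, 3743869909, 66756796556666, 44930123815470⟩,
  ⟨446, 2057241552, 3848275453, 1848818612, 173489114, 3808200471, 69635518046734, 46241657640021⟩,
  ⟨446, 2073753882, 3914457450, 1853486350, 177752329, 3873733110, 72651250296719, 47596785896066⟩,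
  ⟨446, 2090307546, 3981876467, 1858086097, 181762546, 3940491246, 75810920482036, 48997041556790⟩,
  ⟨446, 2106901935, 4050556546, 1862617485, 185518085, 4008498718, 79121813902595, 50444011279248⟩,
  ⟨446, 2123536438, 4120522153, 1867080156, 189017463, 4077779777, 82591594318942, 51939337926473⟩,
  ⟨446, 2140210440, 4191798177, 1871473754, 192259401, 4148359107, 86228320808132, 53484721410781⟩,
  ⟨446, 2156923323, 4264409943, 1875797929, 195242822, 4220261811, 90040471096503, 55081921890713⟩,
  ⟨446, 2173674467, 4338383214, 1880052339, 197966850, 4293513441, 94036960489982, 56732760595123⟩,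
  ⟨445, 2190444406, 4413658921, 1884231994, 200428198, 4368158021, 97552000015092, 58040458975483⟩,
  ⟨445, 2207232389, 4490258923, 1888336797, 202627271, 4444013923, 101905500273795, 59788250141707⟩,
  ⟨445, 2224056592, 4568293849, 1892371155, 204566714, 4521291585, 106470497187727, 61594858009376⟩,
  ⟨445, 2240916386, 4647791081, 1896334748, 206246462, 4600018161, 111257746591444, 63462342837581⟩,
  ⟨445, 2257811140, 4728778463, 1900227262, 207666651, 4680221267, 116278557283514, 65392835965367⟩,
  ⟨445, 2274740220, 4811284303, 1904048391, 208827619, 4761928972, 121544820623233, 67388542728552⟩,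
  ⟨445, 2291702989, 4895337383, 1907797831, 209729900, 4845169824, 127069036789345, 69451743762036⟩,
  ⟨445, 2308698807, 4980966962, 1911475285, 210374228, 4929972842, 132864348044027, 71584798353778⟩,
  ⟨445, 2325727034, 5068202781, 1915080464, 210761533, 5016367531, 138944569340200, 73790146313560⟩,
  ⟨445, 2342787024, 5157075069, 1918613081, 210892944, 5104383873, 145324222739832, 76070310998137⟩,
  ⟨445, 2359878131, 5247614548, 1922072858, 210769782, 5194052342, 152018572990475, 78427901882384⟩,
  ⟨445, 2376999704, 5339852438, 1925459521, 210393561, 5285403908, 159043663577164, 80865617084505⟩,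
  ⟨445, 2394151093, 5433820461, 1928772801, 209765989, 5378470046, 166416354390419, 83386245799098⟩,
  ⟨445, 2411331642, 5529550851, 1932012438, 208888960, 5473282733, 174154365001327, 85992672061427⟩,
  ⟨445, 2428540695, 5627076350, 1935178174, 207764560, 5569874448, 182276314912523, 88687877144614⟩,
  ⟨445, 2445777593, 5726430223, 1938269761, 206395057, 5668278209, 190801766311099, 91474941841971⟩,
  ⟨445, 2463041676, 5827646254, 1941286952, 204782906, 5768527522, 199751274533833, 94357051270132⟩,
  ⟨445, 2480332280, 5930758759, 1944229510, 202930739, 5870656452, 209146430582338, 97337495786267⟩,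
  ⟨445, 2497648739, 6035802582, 1947097202, 200841370, 5974699563, 219009918276338, 100419676622899⟩,
  ⟨445, 2514990387, 6142813108, 1949889801, 198517788, 6080691983, 229365558749542, 103607106444547⟩,
  ⟨445, 2532356554, 6251826262, 1952607088, 195963153, 6188669360, 240238374065523, 106903415419609⟩,
  ⟨445, 2549746569, 6362878514, 1955248847, 193180798, 6298667895, 251654636944511, 110312352388083⟩,
  ⟨445, 2567159759, 6476006887, 1957814869, 190174222, 6410724324, 263641938429762, 113837790646623⟩,
  ⟨445, 2584595449, 6591248956, 1960304952, 186947088, 6524875948, 276229242728530, 117483729167462⟩,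
  ⟨445, 2602052961, 6708642856, 1962718899, 183503219, 6641160625, 289446956392015, 121254297580377⟩,
  ⟨445, 2619531619, 6828227285, 1965056519, 179846597, 6759616763, 303326997757888, 125153760284821⟩,
  ⟨445, 2637030740, 6950041506, 1967317628, 175981355, 6880283357, 317902860550011, 129186518142993⟩,
  ⟨445, 2654549645, 7074125353, 1969502048, 171911779, 7003199934, 333209701802881, 133357116433682⟩,
  ⟨445, 2672087649, 7200519235, 1971609606, 167642300, 7128406624, 349284402820889, 137670244337550⟩,
  ⟨445, 2689644067, 7329264135, 1973640136, 163177491, 7255944121, 366165657786760, 142130741346170⟩,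
  ⟨445, 2707218214, 7460401619, 1975593477, 158522065, 7385853703, 383894055479113, 146743601020554⟩,
  ⟨445, 2724809402, 7593973834, 1977469475, 153680868, 7518177219, 402512168055309, 151513975642388⟩,
  ⟨445, 2742416941, 7730023515, 1979267983, 148658877, 7652957102, 422064640683896, 156447180304653⟩,
  ⟨445, 2760040142, 7868593985, 1980988859, 143461195, 7790236400, 442598275866933, 161548694967960⟩,
  ⟨445, 2777678312, 8009729159, 1982631967, 138093047, 7930058709, 464162150974875, 166824173961867⟩,
  ⟨445, 2795330759, 8153473543, 1984197177, 132559777, 8072468249, 486807697164798, 172279444825031⟩,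
  ⟨445, 2812996790, 8299872243, 1985684367, 126866838, 8217509821, 510588821928134, 177920517128145⟩,
  ⟨445, 2830675709, 8448970959, 1987093419, 121019795, 8365228820, 535562009206731, 183753585079568⟩,
  ⟨445, 2848366821, 8600815990, 1988424222, 115024316, 8515671258, 561786428967951, 189785031264108⟩,
  ⟨445, 2866069428, 8755454239, 1989676672, 108886167, 8668883733, 589324066890338, 196021434303886⟩,
  ⟨445, 2883782833, 8912933207, 1990850670, 102611209, 8824913428, 618239841944306, 202469572766140⟩,
  ⟨445, 2901506337, 9073300998, 1991946125, 96205393, 8983808170, 648601717478683, 209136426519298⟩,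
  ⟨445, 2919239241, 9236606322, 1992962949, 89674753, 9145616342, 680480859327279, 216029188197181⟩,
  ⟨445, 2936980844, 9402898488, 1993901063, 83025406, 9310386957, 713951746876661, 223155262410666⟩,
  ⟨445, 2954730446, 9572227412, 1994760394, 76263540, 9478169634, 749092321939016, 230522273051798⟩,
  ⟨445, 2972487345, 9744643612, 1995540874, 69395415, 9649014586, 785984135347583, 238138068891365⟩,
  ⟨445, 2990250839, 9920198208, 1996242443, 62427356, 9822972625, 824712496618441, 246010728525060⟩,
  ⟨445, 3008020226, 10098942923, 1996865045, 55365747, 10000095182, 865366618714689, 254148563916434⟩,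
  ⟨445, 3025794803, 10280930079, 1997408632, 48217027, 10180434263, 908039795347829, 262560128974331⟩,
  ⟨445, 3043573865, 10466212599, 1997873162, 40987683, 10364042487, 952829551221279, 271254222058346⟩,
  ⟨445, 3061356710, 10654844002, 1998258599, 33684248, 10550973095, 999837802041568, 280239889522545⟩,
  ⟨445, 3079142634, 10846878403, 1998564913, 26313295, 10741279889, 1049171058659333, 289526436749478⟩,
  ⟨445, 3096930931, 11042370507, 1998792080, 18881428, 10935017277, 1100940583212258, 299123428856209⟩,
  ⟨445, 3114720898, 11241375610, 1998940085, 11395282, 11132240269, 1155262579766280, 309040696858146⟩,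
  ⟨445, 3132511830, 11443949596, 1999008915, 3861516, 11333004430, 1212258399618958, 319288346354544⟩]

def jL (c0 c1 x a : ℕ) : ℕ := 2 * c0 * x * 1000000000000000000 * a / (c1 * c1 + (x+1)*(x+1)) ^ 2
def jH (c0 c1 x b : ℕ) : ℕ := 2 * c1 * (x+1) * 1000000000000000000 * b / (c0 * c0 + x*x) ^ 2 + 1
def sLo (v : ℕ) : ℕ := v - (v ^ 3 / 6000000000000000000 + 1)
def sHi (v : ℕ) : ℕ := v - v ^ 3 / 6000000000000000000 + (v ^ 5 / 120000000000000000000000000000000000000 + 1)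
def eR (p q rho : ℕ) : ℕ := p * 1000000000000000000000000000000000000 / (10000 * rho^2) + q * 1000000000000000000 / (10000 * rho) + 2
def pLo (X s0 s1 a : ℕ) : ℕ := 2 * X * s0 * (2000000000000000000 + X*X - s1*s1) * a / ((X+1)*(X+1) + s1*s1)^2
def pHi (X s0 s1 b : ℕ) : ℕ := 2 * (X+1) * s1 * (2000000000000000000 + (X+1)*(X+1) - s0*s0) * b / (X*X + s0*s0)^2 + 1

def rho (B : Bx) (s0 : ℕ) : ℕ := B.s * B.s + (s0 - 9202 * B.r) * (s0 - 9202 * B.r)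
def c0m (B : Bx) (h0 : ℕ) : ℕ := h0 * (1999999999 - B.f) / 1000000
def c1m (B : Bx) (h1 : ℕ) : ℕ := h1 * (2000000000 - B.f) / 1000000 + 1
def c0p (B : Bx) (h0 : ℕ) : ℕ := h0 * (2000000000 + B.f) / 1000000
def c1p (B : Bx) (h1 : ℕ) : ℕ := h1 * (2000000001 + B.f) / 1000000 + 1

def bE (B : Bx) (h0 : ℕ) : ℕ := eR B.p B.q (rho B (sLo (h0 * B.f / 1000000)))
def bPL (B : Bx) (h0 h1 : ℕ) : ℕ := pLo B.X (sLo (h0 * B.f / 1000000)) (sHi (h1 * (B.f + 1) / 1000000 + 1)) (2 * B.r * B.z)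
def bPH (B : Bx) (h0 h1 : ℕ) : ℕ := pHi B.X (sLo (h0 * B.f / 1000000)) (sHi (h1 * (B.f + 1) / 1000000 + 1)) (2 * B.r * (B.z + 1))
def bmL (B : Bx) (h0 h1 : ℕ) : ℕ := jL (c0m B h0) (c1m B h1) B.x (2 * B.r * B.z)
def bmH (B : Bx) (h0 h1 : ℕ) : ℕ := jH (c0m B h0) (c1m B h1) B.x (2 * B.r * (B.z+1))
def bpL (B : Bx) (h0 h1 : ℕ) : ℕ := jL (c0p B h0) (c1p B h1) B.x (2 * B.r * B.z)
def bpH (B : Bx) (h0 h1 : ℕ) : ℕ := jH (c0p B h0) (c1p B h1) B.x (2 * B.r * (B.z+1))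

def sumB (g : Bx → ℕ) : List Bx → ℕ
  | [] => 0
  | B :: l => g B + sumB g l


/-- transcendental part of the row check; `sg` is true when `f > 0` -/
def rowV (sg : Bool) (M : ℕ) (B : Bx) (sn oc eN b : ℕ) : Bool :=
  Nat.ble (B.x * 10^27 + 6 * 10^18 + sn * eN) (M * 10^31) &&
  Nat.ble (M * 10^31 + 6 * 10^18) ((B.x+1) * 10^27 + sn * eN) &&
  Nat.ble (B.z * (5 * 10^35) + 7 * 10^27 + eN * (5 * 10^26)) (5 * 10^44 + oc * eN * (5 * 10^8) + M * sn * eN) &&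
  Nat.ble (5 * 10^44 + oc * eN * (5 * 10^8) + M * sn * eN + 7 * 10^27) ((B.z + 1) * (5 * 10^35) + eN * (5 * 10^26)) &&
  (match sg with
   | true =>
     Nat.ble (B.f * (5 * 314159265358979323847 * 10^25) + 7 * 10^38 + 20 * sn^3 + 6 * sn * b * 10^18) (15 * sn * 10^36) &&
     Nat.ble (15 * sn * 10^36 + 7 * 10^38) ((B.f + 1) * (5 * 314159265358979323846 * 10^25) + 20 * sn^3 + 6 * sn * b * 10^18)
   | false =>
     Nat.ble (B.f * (5 * 314159265358979323847 * 10^25) + 7 * 10^38 + 15 * sn * 10^36) (20 * sn^3 + 6 * sn * b * 10^18) &&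
     Nat.ble (20 * sn^3 + 6 * sn * b * 10^18 + 7 * 10^38) ((B.f + 1) * (5 * 314159265358979323846 * 10^25) + 15 * sn * 10^36))

def rowX (B : Bx) (zh : ℕ) : Bool :=
  Nat.ble (B.X * 10^9 + 220) (q1 zh (10^18) + q3 zh (10^18)) &&
  Nat.ble (q1 zh (10^18) + q3 zh (10^18) + 220) ((B.X + 1) * 10^9) && Nat.ble zh (35 * 10^17)

def rowT (sg : Bool) (M : ℕ) (B : Bx) (a0 a1 a2 a3 bm eN : ℕ) : Bool :=
  Nat.ble a3 a1 && Nat.ble (a1 + a3) (a0 + a2) && Nat.ble a0 (10^18 + a2) &&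
  rowV sg M B (a1 - a3) (10^18 + a2 - a0) eN (bm + bm * (a0 + a2 - (a1 + a3))^8 / 10^144) &&
  rowX B ((M * 10^31 - (a1 - a3) * eN) / 10^18)

def expN (M D : ℕ) : ℕ := q0 M D + q2 M D - (q1 M D + q3 M D)
def expC (M D : ℕ) : Bool := Nat.ble (q1 M D + q3 M D) (q0 M D + q2 M D)

def bZ (B : Bx) : ℕ := B.z + 1 + 10100 * B.r
def bC0 (B : Bx) : ℕ := 1000000000 + (match Nat.ble B.X 2000000000 with
  | true => (B.X+1)^2 / 2000000000 + 1
  | false => B.X + 1)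
def bD (B : Bx) : ℕ := bZ B * B.r * 10000 / 1000000000 + 1
def bC (B : Bx) : ℕ := bC0 B + 2 * bC0 B * bD B / 1000000000 + 1
def rQ (Z C : ℕ) : ℕ := (10100 * Z^2 + 18685 * 10^18 + 37500 * Z * 10^9) * (C^2 + 10^18)
def rowR (B : Bx) (Z C : ℕ) : Bool :=
  Nat.ble ((rQ Z C * 10^18 + 1000 * Z * (100 * Z^2 + 85 * 10^18) * C * (C^2 + 5 * 10^18)) * B.r^3) (B.p * 150 * 10^54) &&
  Nat.ble ((4040 * C * 10^27 + rQ Z C) * B.r^3) (6 * B.q * 10^36)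
def rowS (B : Bx) : Bool := Nat.ble (B.s + (bC0 B * bD B / 1000000000 + 1)) B.X && Nat.ble 1 B.s && Nat.ble (bD B) 500000000

def rowOK (sg : Bool) (M : ℕ) (B : Bx) : Bool :=
  expC (M * M + 40000000000 - 400000 * M) 10000000000 &&
  expC (M * M) 100000000000000 && rowS B && rowR B (bZ B) (bC B) && Nat.ble M 314159 && Nat.ble B.r M &&
  rowT sg M B (q0 M 100000) (q1 M 100000) (q2 M 100000) (q3 M 100000)
    (expN (M * M + 40000000000 - 400000 * M) 10000000000) (expN (M * M) 100000000000000)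

def rowsOK (sg : Bool) : ℕ → List Bx → Bool
  | _, [] => true
  | a, B :: l => rowOK sg (a + B.r) B && rowsOK sg (a + 2 * B.r) l
def endp : ℕ → List Bx → ℕ
  | a, [] => a
  | a, B :: l => endp (a + 2 * B.r) l


lemma expN_spec (M D : ℕ) (hD : 0 < D) (h4 : (M:ℝ)/D ≤ 4) (hc : expC M D = true) :
    |Real.exp (-((M:ℝ)/D)) - (expN M D : ℝ)/10^18| ≤ 3/10^18 := by
  have h := abs_le.1 (tay_expn (t := (M:ℝ)/D) (by positivity) h4)
  obtain ⟨a0, b0⟩ := q0_spec M D hD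
  obtain ⟨a1, b1⟩ := q1_spec M D hD
  obtain ⟨a2, b2⟩ := q2_spec M D hD
  obtain ⟨a3, b3⟩ := q3_spec M D hD
  unfold expC at hc
  have hc := Nat.le_of_ble_eq_true hc
  unfold expN teps at *
  rw [Nat.cast_sub hc]; push_cast
  rw [abs_le]
  constructor <;> linarith [h.1, h.2]

lemma mul_err {a b a' b' A B δ ε : ℝ} (ha : |a - a'| ≤ δ) (hb : |b - b'| ≤ ε) (hA : |a| ≤ A) (hB : |b'| ≤ B) :
    |a * b - a' * b'| ≤ A * ε + B * δ := by
  have : a * b - a' * b' = a * (b - b') + (a - a') * b' := by ring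
  rw [this]
  refine (abs_add_le _ _).trans ?_
  rw [abs_mul, abs_mul]
  have h1 : |a| * |b - b'| ≤ A * ε := mul_le_mul hA hb (abs_nonneg _) ((abs_nonneg _).trans hA)
  have h2 : |a - a'| * |b'| ≤ δ * B := mul_le_mul ha hB (abs_nonneg _) ((abs_nonneg _).trans ha)
  linarith

lemma pow8_err {a a' δ : ℝ} (h : |a - a'| ≤ δ) (h0 : 0 ≤ a) (h1 : a ≤ 1) (h0' : 0 ≤ a') (h1' : a' ≤ 1.0001) :
    |a^8 - a'^8| ≤ 8.1 * δ := by
  have h2 := mul_err h h (A := 1) (B := 1.0001) (by rw [abs_of_nonneg h0]; exact h1) (by rw [abs_of_nonneg h0']; exact h1')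
  have e2 : a * a ≤ 1 := by nlinarith
  have e2' : a' * a' ≤ 1.00021 := by nlinarith
  have h4 := mul_err h2 h2 (A := 1) (B := 1.00021) (by rw [abs_of_nonneg (by positivity)]; exact e2) (by rw [abs_of_nonneg (by positivity)]; exact e2')
  have e4 : a * a * (a * a) ≤ 1 := by nlinarith [mul_nonneg h0 h0]
  have e4' : a' * a' * (a' * a') ≤ 1.0005 := by nlinarith [mul_nonneg h0' h0']
  have h8 := mul_err h4 h4 (A := 1) (B := 1.0005) (by rw [abs_of_nonneg (by positivity)]; exact e4) (by rw [abs_of_nonneg (by positivity)]; exact e4')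
  have d0 : 0 ≤ δ := (abs_nonneg _).trans h
  rw [show a^8 = a * a * (a * a) * (a * a * (a * a)) by ring, show a'^8 = a' * a' * (a' * a') * (a' * a' * (a' * a')) by ring]
  linarith

structure RowT (ς : ℝ) (M : ℕ) (B : Bx) : Prop where
  x0 : (B.x:ℝ)/10^9 ≤ z₁ ((M:ℝ)/10^5)
  x1 : z₁ ((M:ℝ)/10^5) ≤ ((B.x:ℝ)+1)/10^9
  X0 : (B.X:ℝ)/10^9 ≤ Real.sinh (z₁ ((M:ℝ)/10^5))
  X1 : Real.sinh (z₁ ((M:ℝ)/10^5)) ≤ ((B.X:ℝ)+1)/10^9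
  z0 : (B.z:ℝ)/10^9 ≤ dz ((M:ℝ)/10^5)
  z1 : dz ((M:ℝ)/10^5) ≤ ((B.z:ℝ)+1)/10^9
  f0 : (B.f:ℝ)/10^9 ≤ ς * ff ((M:ℝ)/10^5)
  f1 : ς * ff ((M:ℝ)/10^5) ≤ ((B.f:ℝ)+1)/10^9

lemma sinh_lip {a b : ℝ} (ha : |a| ≤ 3.6) (hb : |b| ≤ 3.6) : |Real.sinh a - Real.sinh b| ≤ 30 * |a - b| := by
  have hc : ∀ x ∈ Set.Icc (-3.6:ℝ) 3.6, ‖Real.cosh x‖ ≤ 30 := by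
    intro x hx
    rw [Real.norm_eq_abs, abs_of_pos (Real.cosh_pos x)]
    have h1 : Real.cosh x ≤ Real.cosh 3.6 := by
      rw [Real.cosh_le_cosh, abs_le, abs_of_pos (by norm_num : (0:ℝ) < 3.6)]
      exact ⟨hx.1, hx.2⟩
    have h2 : Real.cosh 3.6 ≤ Real.exp 3.6 := by
      rw [Real.cosh_eq]; have := Real.exp_le_exp.2 (by norm_num : -(3.6:ℝ) ≤ 3.6); linarith
    have h3 : Real.exp 3.6 ≤ Real.exp 1 ^ (3:ℕ) * Real.exp 0.6 := by
      rw [← Real.exp_nat_mul, ← Real.exp_add]; norm_num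
    have h4 := Real.exp_one_lt_d9
    have h5 : Real.exp 0.6 ≤ 1.9 := by
      rw [← Real.le_log_iff_exp_le (by norm_num)] 
      have := Real.exp_bound' (x := (0.6:ℝ)) (by norm_num) (by norm_num) (n := 5) (by norm_num)
      rw [Real.le_log_iff_exp_le (by norm_num)]
      refine this.trans ?_
      norm_num [Finset.sum_range_succ, Nat.factorial]
    have h6 : Real.cosh 3.6 ≤ 38.2 := by
      have : Real.exp 1 ^ 3 ≤ 2.7182818286^3 := by gcongr
      nlinarith [Real.exp_pos 1, Real.exp_pos 0.6]
    have h7 : Real.cosh 3.6 ≤ 30 := by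
      rw [Real.cosh_eq] at h6 ⊢
      have e1 : Real.exp 1 ^ 3 ≤ 2.7182818286^3 := by gcongr
      have e2 : Real.exp (-3.6) ≤ 1 := Real.exp_le_one_iff.2 (by norm_num)
      have e3 : Real.exp 3.6 ≤ 38.3 := by nlinarith [Real.exp_pos 1, Real.exp_pos 0.6]
      linarith
    linarith
  have := Convex.norm_image_sub_le_of_norm_hasDerivWithin_le (f := Real.sinh) (f' := Real.cosh) (s := Set.Icc (-3.6:ℝ) 3.6)
    (fun x _ => (Real.hasDerivAt_sinh x).hasDerivWithinAt) hc (convex_Icc _ _) (x := b) (y := a) (abs_le.1 hb) (abs_le.1 ha)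
  simpa [Real.norm_eq_abs] using this


lemma rv_x {β s e σ ε x : ℝ} (hse : |s * e - σ * ε| ≤ 6/10^18)
    (g1 : x/10^9 + 6/10^18 + σ * ε ≤ β) (g2 : β + 6/10^18 ≤ (x+1)/10^9 + σ * ε) :
    x/10^9 ≤ β - s * e ∧ β - s * e ≤ (x+1)/10^9 := by
  rw [abs_le] at hse
  constructor <;> linarith [hse.1, hse.2]

lemma rv_z {β s e o c σ ε ω z : ℝ} (hc : c = 1 - o) (b0 : 0 ≤ β) (b4 : β ≤ 3.15) (he : |e - ε| ≤ 3/10^18) (hse : |s * e - σ * ε| ≤ 6/10^18)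
    (hoe : |o * e - ω * ε| ≤ 9/10^18)
    (g3 : z/10^9 + 14/10^18 + ε ≤ 1 + ω * ε + β/5000 * (σ * ε)) (g4 : 1 + ω * ε + β/5000 * (σ * ε) + 14/10^18 ≤ (z+1)/10^9 + ε) :
    z/10^9 ≤ 1 - (c - 1/5000 * β * s) * e ∧ 1 - (c - 1/5000 * β * s) * e ≤ (z+1)/10^9 := by
  rw [abs_le] at hse he hoe
  have hdz : 1 - (c - 1/5000 * β * s) * e = 1 - e + o * e + β/5000 * (s * e) := by rw [hc]; ring
  have k1 : β/5000 * (s * e - σ * ε) ≤ 1/10^18 := by nlinarith [hse.2]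
  have k2 : -(1/10^18) ≤ β/5000 * (s * e - σ * ε) := by nlinarith [hse.1]
  rw [hdz]
  constructor <;> linarith [hse.1, hse.2, he.1, he.2, hoe.1, hoe.2]

lemma rv_g {s b σ τ : ℝ} (hs : |s - σ| ≤ 2/10^18) (hb : |b - τ| ≤ 40/10^18) (s0 : 0 ≤ s) (s1 : s ≤ 1) (σ0 : 0 ≤ σ) (σ1 : σ ≤ 1.0001)
   (b2 : b ≤ 2) (τ0 : 0 ≤ τ) :
   |(15 * s - 20 * (s * s * s) - 6 * (s * b)) - (15 * σ - 20 * σ^3 - 6 * (σ * τ))| ≤ 700/10^18 := by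
  have hss := mul_err hs hs (A := 1) (B := 1.0001) (by rw [abs_of_nonneg s0]; exact s1) (by rw [abs_of_nonneg σ0]; exact σ1)
  have hsss := mul_err hss hs (A := 1) (B := 1.0001) (by rw [abs_of_nonneg (by positivity)]; nlinarith) (by rw [abs_of_nonneg σ0]; exact σ1)
  have hsb := mul_err hs hb (A := 1) (B := 2.01) (by rw [abs_of_nonneg s0]; exact s1) (by
    have := abs_le.1 hb
    rw [abs_of_nonneg τ0]; linarith [this.1])
  have e : σ^3 = σ * σ * σ := by ring
  rw [e]
  rw [abs_le] at *
  constructor <;> linarith [hs.1, hs.2, hsb.1, hsb.2, hsss.1, hsss.2]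

lemma rv_f {β ς f G : ℝ} (hG : |15 * gg β - G| ≤ 700/10^18) (hς : |ς| ≤ 1) (f0 : 0 ≤ f)
    (h1 : f/10^9 * (5 * 3.14159265358979323847) + 700/10^18 ≤ ς * G)
    (h2 : ς * G + 700/10^18 ≤ (f+1)/10^9 * (5 * 3.14159265358979323846)) :
    f/10^9 ≤ ς * ff β ∧ ς * ff β ≤ (f+1)/10^9 := by
  have hpi0 : (3.14159265358979323846:ℝ) < π := Real.pi_gt_d20
  have hpi1 : π < (3.14159265358979323847:ℝ) := Real.pi_lt_d20
  have k : |ς * (15 * gg β) - ς * G| ≤ 700/10^18 := by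
    rw [← mul_sub, abs_mul]; nlinarith [abs_nonneg ς, abs_nonneg (15 * gg β - G)]
  rw [abs_le] at k
  have : ς * ff β = ς * (15 * gg β) / (5 * π) := by unfold ff; field_simp; ring
  rw [this, le_div_iff₀ (by positivity), div_le_iff₀ (by positivity)]
  constructor
  · have : f/10^9 * (5 * π) ≤ f/10^9 * (5 * 3.14159265358979323847) := by gcongr
    linarith [k.1]
  · have : (f+1)/10^9 * (5 * 3.14159265358979323846) ≤ (f+1)/10^9 * (5 * π) := by gcongr
    linarith [k.2]

/-- cast a Boolean comparison to the reals -/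
lemma ble_cast {a b : ℕ} (h : Nat.ble a b = true) : (a:ℝ) ≤ (b:ℝ) := Nat.cast_le.2 (Nat.le_of_ble_eq_true h)

lemma rv_X {zt : ℝ} {zh X : ℕ} (hz : |zt - (zh:ℝ)/10^18| ≤ 7/10^18) (h : Nat.ble (X * 10^9 + 220) (q1 zh (10^18) + q3 zh (10^18)) = true)
    (h' : Nat.ble (q1 zh (10^18) + q3 zh (10^18) + 220) ((X + 1) * 10^9) = true) (hh : Nat.ble zh (35 * 10^17) = true) :
    (X:ℝ)/10^9 ≤ Real.sinh zt ∧ Real.sinh zt ≤ ((X:ℝ)+1)/10^9 := by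
  have d5 := ble_cast h
  have d6 := ble_cast h'
  have d7 := ble_cast hh
  push_cast at d5 d6 d7
  have zh0 : (0:ℝ) ≤ (zh:ℝ)/10^18 := by positivity
  have zh1 : (zh:ℝ)/10^18 ≤ 3.5 := by rw [div_le_iff₀ (by norm_num)]; linarith
  have L := sinh_lip (a := zt) (b := (zh:ℝ)/10^18) (by rw [abs_le] at hz ⊢; constructor <;> linarith [hz.1, hz.2])
    (by rw [abs_of_nonneg zh0]; linarith)
  have TS := abs_le.1 (tay_sinh zh0 (by linarith))
  obtain ⟨A1, B1⟩ := q1_spec zh (10^18) (by norm_num)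
  obtain ⟨A3, B3⟩ := q3_spec zh (10^18) (by norm_num)
  rw [show ((10^18:ℕ):ℝ) = 10^18 by norm_num] at A1 B1 A3 B3
  have L' := abs_le.1 (L.trans (mul_le_mul_of_nonneg_left hz (by norm_num)))
  unfold teps at TS
  constructor
  · linarith [L'.1, TS.1]
  · linarith [L'.2, TS.2]

lemma rv_b {β : ℝ} (b0 : 0 ≤ β) {bm en : ℕ} (hbm : |bu 2 β - (bm:ℝ)/10^18| ≤ 3/10^18) (hen : |Real.exp (-β) - (en:ℝ)/10^18| ≤ 3/10^18) :
    |(bu (-2) β + bu 2 β) - ((bm + bm * en^8 / 10^144 : ℕ):ℝ)/10^18| ≤ 40/10^18 := by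
  have hen0 := Real.exp_pos (-β)
  have hen1 : Real.exp (-β) ≤ 1 := Real.exp_le_one_iff.2 (by linarith)
  have hB0 := bu_pos 2 β
  have hB1 := bu_le 2 β
  have p4 : (0:ℝ) ≤ (en:ℝ)/10^18 := by positivity
  have up4 : (en:ℝ)/10^18 ≤ 1.0001 := by linarith [(abs_le.1 hen).1]
  have e8 := pow8_err hen hen0.le hen1 p4 up4
  have hbp := mul_err hbm e8 (A := 1) (B := 1.001) (by rw [abs_of_pos hB0]; exact hB1) (by
    rw [abs_of_nonneg (by positivity)]
    calc ((en:ℝ)/10^18)^8 ≤ 1.0001^8 := by gcongr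
      _ ≤ 1.001 := by norm_num)
  have ebp : bu 2 β * Real.exp (-β)^8 = bu (-2) β := by
    unfold bu; rw [← Real.exp_nat_mul, ← Real.exp_add]; congr 1; push_cast; ring
  rw [ebp] at hbp
  obtain ⟨f1, f2⟩ := div_bd (bm * en^8) (10^144) (by norm_num)
  have fe : ((bm * en^8 : ℕ):ℝ)/((10^144:ℕ):ℝ) = 10^18 * ((bm:ℝ)/10^18 * ((en:ℝ)/10^18)^8) := by
    push_cast; field_simp; norm_num
  rw [fe] at f1 f2
  generalize bm * en^8 / 10^144 = bp at *
  generalize (bm:ℝ)/10^18 * ((en:ℝ)/10^18)^8 = w at *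
  push_cast
  rw [abs_le] at hbp hbm ⊢
  constructor <;> linarith [hbp.1, hbp.2, hbm.1, hbm.2]

lemma rowV_cast {sg : Bool} {M : ℕ} {B : Bx} {sn oc eN b : ℕ} {β σ ω ε τ : ℝ} (h : rowV sg M B sn oc eN b = true)
    (hβ : (M:ℝ) = β * 10^5) (hσ : (sn:ℝ) = σ * 10^18) (hω : (oc:ℝ) = ω * 10^18) (hε : (eN:ℝ) = ε * 10^18) (hτ : (b:ℝ) = τ * 10^18) :
    ((B.x:ℝ)/10^9 + 6/10^18 + σ * ε ≤ β) ∧ (β + 6/10^18 ≤ ((B.x:ℝ)+1)/10^9 + σ * ε) ∧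
    ((B.z:ℝ)/10^9 + 14/10^18 + ε ≤ 1 + ω * ε + β/5000 * (σ * ε)) ∧ (1 + ω * ε + β/5000 * (σ * ε) + 14/10^18 ≤ ((B.z:ℝ)+1)/10^9 + ε) ∧
    ((B.f:ℝ)/10^9 * (5 * 3.14159265358979323847) + 700/10^18 ≤ (if sg then 1 else -1) * (15 * σ - 20 * σ^3 - 6 * (σ * τ))) ∧
    ((if sg then 1 else -1) * (15 * σ - 20 * σ^3 - 6 * (σ * τ)) + 700/10^18 ≤ ((B.f:ℝ)+1)/10^9 * (5 * 3.14159265358979323846)) := by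
  unfold rowV at h
  simp only [Bool.and_eq_true] at h
  obtain ⟨⟨⟨⟨g1, g2⟩, g3⟩, g4⟩, g5⟩ := h
  have g1 := ble_cast g1
  have g2 := ble_cast g2
  have g3 := ble_cast g3
  have g4 := ble_cast g4
  push_cast at g1 g2 g3 g4
  rw [hβ, hσ, hε] at g1 g2 g3 g4
  rw [hω] at g3 g4
  refine ⟨?_, ?_, ?_, ?_, ?_⟩
  · clear g2 g3 g4 g5; ring_nf at g1 ⊢; linarith
  · clear g1 g3 g4 g5; ring_nf at g2 ⊢; linarith
  · clear g1 g2 g4 g5; ring_nf at g3 ⊢; linarith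
  · clear g1 g2 g3 g5; ring_nf at g4 ⊢; linarith
  · clear g1 g2 g3 g4
    cases sg <;> simp only [Bool.and_eq_true] at g5 <;> obtain ⟨g5, g6⟩ := g5 <;>
        have g5 := ble_cast g5 <;> have g6 := ble_cast g6 <;>
        push_cast at g5 g6 <;> rw [hσ, hτ] at g5 g6 <;> simp only [if_true, if_false, Bool.false_eq_true] <;>
        ring_nf at g5 g6 ⊢ <;> constructor <;> linarith

lemma row_sound {sg : Bool} {M : ℕ} {B : Bx} (h : rowOK sg M B = true) :
    RowT (if sg then 1 else -1) M B ∧ rowS B = true ∧ rowR B (bZ B) (bC B) = true ∧ M ≤ 314159 ∧ B.r ≤ M := by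
  unfold rowOK at h
  simp only [Bool.and_eq_true] at h
  obtain ⟨⟨⟨⟨⟨⟨c1, c2⟩, c3⟩, c4⟩, c5⟩, c6⟩, c7⟩ := h
  have hM := Nat.le_of_ble_eq_true c5
  have hMr : (M:ℝ) ≤ 314159 := by exact_mod_cast hM
  have hM0 : (0:ℝ) ≤ M := Nat.cast_nonneg M
  refine ⟨?_, c3, c4, hM, Nat.le_of_ble_eq_true c6⟩
  unfold rowT rowX at c7
  simp only [Bool.and_eq_true] at c7
  obtain ⟨⟨⟨⟨d1, d2⟩, d3⟩, d4⟩, ⟨d5, d6⟩, d7⟩ := c7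
  have d1 := Nat.le_of_ble_eq_true d1
  have d2 := Nat.le_of_ble_eq_true d2
  have d3 := Nat.le_of_ble_eq_true d3
  set β : ℝ := (M:ℝ)/10^5 with hβ
  have b0 : 0 ≤ β := by positivity
  have b4 : β ≤ 3.15 := by rw [hβ, div_le_iff₀ (by norm_num)]; linarith
  have hMβ : (M:ℝ) = β * 10^5 := by rw [hβ]; field_simp
  have T : 4 * 100000 * M ≤ M * M + 40000000000 + 0 := by
    zify; nlinarith [sq_nonneg ((M:ℤ) - 200000)]
  have T' : 400000 * M ≤ M * M + 40000000000 := by omega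
  -- trig values
  obtain ⟨A0, B0⟩ := q0_spec M 100000 (by norm_num)
  obtain ⟨A1, B1⟩ := q1_spec M 100000 (by norm_num)
  obtain ⟨A2, B2⟩ := q2_spec M 100000 (by norm_num)
  obtain ⟨A3, B3⟩ := q3_spec M 100000 (by norm_num)
  have hβ' : (M:ℝ)/((100000:ℕ):ℝ) = β := by rw [hβ]; norm_num
  rw [hβ'] at A0 B0 A1 B1 A2 B2 A3 B3
  obtain ⟨tc, ts⟩ := tay_trig b0 (by linarith)
  have te := tay_expn b0 (by linarith)
  have E1 := expN_spec (M * M + 40000000000 - 400000 * M) 10000000000 (by norm_num) (by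
    rw [Nat.cast_sub T', div_le_iff₀ (by norm_num)]; push_cast; nlinarith) c1
  have E2 := expN_spec (M*M) 100000000000000 (by norm_num) (by
    rw [div_le_iff₀ (by norm_num)]; push_cast; nlinarith) c2
  have e1 : Real.exp (-(((M * M + 40000000000 - 400000 * M : ℕ):ℝ)/((10000000000:ℕ):ℝ))) = bu 2 β := by
    unfold bu; congr 1; rw [Nat.cast_sub T']; push_cast; rw [hMβ]; ring
  have e2 : Real.exp (-(((M * M : ℕ):ℝ)/((100000000000000:ℕ):ℝ))) = ee β := by
    unfold ee; congr 1; rw [Nat.cast_mul, hMβ]; push_cast; ring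
  rw [e1] at E1; rw [e2] at E2
  generalize q0 M 100000 = a0 at *
  generalize q1 M 100000 = a1 at *
  generalize q2 M 100000 = a2 at *
  generalize q3 M 100000 = a3 at *
  generalize expN (M * M + 40000000000 - 400000 * M) 10000000000 = bm at *
  generalize expN (M * M) 100000000000000 = eN at *
  have hs : |Real.sin β - ((a1 - a3 : ℕ):ℝ)/10^18| ≤ 2/10^18 := by
    rw [Nat.cast_sub d1]; rw [abs_le] at ts ⊢; unfold teps at ts
    constructor <;> linarith [ts.1, ts.2]
  have ho : |(1 - Real.cos β) - ((10^18 + a2 - a0 : ℕ):ℝ)/10^18| ≤ 2/10^18 := by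
    rw [Nat.cast_sub d3]; rw [abs_le] at tc ⊢; unfold teps at tc; push_cast
    constructor <;> linarith [tc.1, tc.2]
  have hen : |Real.exp (-β) - ((a0 + a2 - (a1 + a3) : ℕ):ℝ)/10^18| ≤ 3/10^18 := by
    rw [Nat.cast_sub d2]; rw [abs_le] at te ⊢; unfold teps at te; push_cast
    constructor <;> linarith [te.1, te.2]
  generalize a1 - a3 = sn at *
  generalize 10^18 + a2 - a0 = oc at *
  generalize a0 + a2 - (a1 + a3) = en at *
  have hbm := E1
  clear A0 B0 A1 B1 A2 B2 A3 B3 tc ts te d1 d2 d3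
  have hzeta : (0:ℝ) ≤ (sn:ℝ)/10^18 ∧ (0:ℝ) ≤ (eN:ℝ)/10^18 ∧ (0:ℝ) ≤ (bm:ℝ)/10^18 ∧ (0:ℝ) ≤ (en:ℝ)/10^18 ∧ (0:ℝ) ≤ (oc:ℝ)/10^18:=
    ⟨by positivity, by positivity, by positivity, by positivity, by positivity⟩
  obtain ⟨p1, p2, p3, p4, p5⟩ := hzeta
  have hen0 := Real.exp_pos (-β)
  have hen1 : Real.exp (-β) ≤ 1 := Real.exp_le_one_iff.2 (by linarith)
  have hE0 := ee_pos β
  have hE1 := ee_le β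
  have hB0 := bu_pos 2 β
  have hB1 := bu_le 2 β
  have hs1 := Real.sin_le_one β
  have hs0 : 0 ≤ Real.sin β := Real.sin_nonneg_of_nonneg_of_le_pi b0 (by
    have := Real.pi_gt_d6; rw [hβ, div_le_iff₀ (by norm_num)]; nlinarith)
  have hc1 := Real.cos_le_one β
  have hc0 := Real.neg_one_le_cos β
  have up1 : (sn:ℝ)/10^18 ≤ 1.0001 := by linarith [(abs_le.1 hs).1]
  have up2 : (eN:ℝ)/10^18 ≤ 1.0001 := by linarith [(abs_le.1 E2).1]
  have up3 : (bm:ℝ)/10^18 ≤ 1.0001 := by linarith [(abs_le.1 hbm).1]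
  have up4 : (en:ℝ)/10^18 ≤ 1.0001 := by linarith [(abs_le.1 hen).1]
  have hb := rv_b b0 hbm hen
  have hse := mul_err hs E2 (A := 1) (B := 1.0001) (by rw [abs_of_nonneg hs0]; exact hs1) (by rw [abs_of_nonneg p2]; exact up2)
  have hoe := mul_err ho E2 (A := 2) (B := 1.0001) (by rw [abs_le]; constructor <;> linarith) (by rw [abs_of_nonneg p2]; exact up2)
  have hse' := hse.trans (by norm_num : _ ≤ (6:ℝ)/10^18)
  have hoe' := hoe.trans (by norm_num : _ ≤ (9:ℝ)/10^18)
  obtain ⟨g1, g2, g3, g4, g5, g6⟩ := rowV_cast (β := β) (σ := (sn:ℝ)/10^18) (ω := (oc:ℝ)/10^18) (ε := (eN:ℝ)/10^18)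
    (τ := ((bm + bm * en^8 / 10^144 : ℕ):ℝ)/10^18) d4 hMβ (by field_simp) (by field_simp) (by field_simp) (by field_simp)
  obtain ⟨X0, X1⟩ := rv_x hse' g1 g2
  obtain ⟨Z0, Z1⟩ := rv_z (c := Real.cos β) (o := 1 - Real.cos β) (by ring) b0 b4 E2 hse' hoe' g3 g4
  have hgg : 15 * gg β = 15 * Real.sin β - 20 * (Real.sin β * Real.sin β * Real.sin β) - 6 * (Real.sin β * (bu (-2) β + bu 2 β)) := by
    unfold gg; rw [Real.sin_three_mul]; ring
  have G := rv_g hs hb hs0 hs1 p1 up1 (by linarith [bu_le (-2) β]) (by positivity)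
  rw [← hgg] at G
  obtain ⟨F0, F1⟩ := rv_f G (ς := if sg then 1 else -1) (by cases sg <;> simp) (Nat.cast_nonneg _) g5 g6
  have hz1 : z₁ β = β - Real.sin β * ee β := rfl
  have hsub : sn * eN ≤ M * 10^31 := by
    have : ((sn * eN : ℕ):ℝ) ≤ ((M * 10^31 : ℕ):ℝ) := by
      have e : ((sn:ℝ)/10^18) * ((eN:ℝ)/10^18) = (sn:ℝ) * eN / 10^36 := by ring
      rw [e] at g1
      have e2 : (sn:ℝ) * eN / 10^36 ≤ β := by
        have : (0:ℝ) ≤ (B.x:ℝ)/10^9 := by positivity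
        linarith
      rw [div_le_iff₀ (by norm_num)] at e2
      push_cast; rw [hMβ]; linarith
    exact_mod_cast this
  obtain ⟨u1, u2⟩ := div_bd (M * 10^31 - sn * eN) (10^18) (by norm_num)
  have ue : ((M * 10^31 - sn * eN : ℕ):ℝ)/((10^18:ℕ):ℝ) = 10^18 * (β - (sn:ℝ)/10^18 * ((eN:ℝ)/10^18)) := by
    rw [Nat.cast_sub hsub]; push_cast; rw [hMβ]; ring
  rw [ue] at u1 u2
  obtain ⟨S0, S1⟩ := rv_X (zt := z₁ β) (X := B.X) (by
    rw [hz1]; rw [abs_le] at hse' ⊢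
    constructor <;> linarith [hse'.1, hse'.2]) d5 d6 d7
  rw [hz1] at S0 S1
  constructor <;> rw [← hβ] <;> assumption


lemma mvt_bd {f f' : ℝ → ℝ} {m r C β : ℝ} (hf : ∀ x, HasDerivAt f (f' x) x)
    (hC : ∀ x ∈ Set.Icc (m-r) (m+r), |f' x| ≤ C) (hr : 0 ≤ r) (hb : β ∈ Set.Icc (m-r) (m+r)) :
    |f β - f m| ≤ C * r := by
  have hm : m ∈ Set.Icc (m-r) (m+r) := ⟨by linarith, by linarith⟩
  have hC0 : 0 ≤ C := (abs_nonneg _).trans (hC m hm)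
  have := (convex_Icc (m-r) (m+r)).norm_image_sub_le_of_norm_hasDerivWithin_le
    (f := f) (f' := f') (C := C) (fun x hx => (hf x).hasDerivWithinAt) (fun x hx => hC x hx) hm hb
  rw [Real.norm_eq_abs, Real.norm_eq_abs] at this
  refine this.trans (mul_le_mul_of_nonneg_left ?_ hC0)
  rw [abs_le]; constructor <;> linarith [hb.1, hb.2]

lemma cosh_le_a (x : ℝ) : Real.cosh x ≤ 1 + Real.sinh x ^ 2 / 2 := by
  have h := Real.cosh_sq x
  nlinarith [sq_nonneg (Real.sinh x ^ 2), Real.cosh_pos x, sq_nonneg (Real.sinh x)]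

lemma cosh_le_b {x : ℝ} (hx : 0 ≤ x) : Real.cosh x ≤ 1 + Real.sinh x := by
  have h := Real.cosh_sub_sinh x
  have : Real.exp (-x) ≤ 1 := Real.exp_le_one_iff.2 (by linarith)
  linarith

lemma cosh_shift {x y d : ℝ} (hxy : |y - x| ≤ d) (hd : d ≤ 1/2) (hx : 0 ≤ x) : Real.cosh y ≤ Real.cosh x * (1 + 2 * d) := by
  have hd0 : 0 ≤ d := (abs_nonneg _).trans hxy
  have h1 : Real.cosh y = Real.cosh x * Real.cosh (y-x) + Real.sinh x * Real.sinh (y - x) := by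
    rw [← Real.cosh_add]; ring_nf
  have h2 : Real.cosh (y-x) ≤ Real.cosh d := Real.cosh_le_cosh.2 (hxy.trans (le_abs_self d))
  have h3 : Real.sinh (y-x) ≤ Real.sinh d := Real.sinh_le_sinh.2 ((le_abs_self _).trans hxy)
  have h4 : Real.sinh x ≤ Real.cosh x := (Real.sinh_lt_cosh x).le
  have h5 : 0 ≤ Real.sinh x := Real.sinh_nonneg_iff.2 hx
  have h6 : Real.cosh d + Real.sinh d ≤ 1 + 2 * d := by
    rw [Real.cosh_add_sinh]
    have := Real.abs_exp_sub_one_sub_id_le (x := d) (by rw [abs_of_nonneg hd0]; linarith)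
    nlinarith [(abs_le.1 this).2]
  have h7 : 0 ≤ Real.sinh d := Real.sinh_nonneg_iff.2 hd0
  have h8 := Real.cosh_pos x
  calc Real.cosh y ≤ Real.cosh x * Real.cosh d + Real.sinh x * Real.sinh d := by
        rw [h1]; gcongr
    _ ≤ Real.cosh x * Real.cosh d + Real.cosh x * Real.sinh d := by gcongr
    _ ≤ _ := by rw [← mul_add]; gcongr

lemma sinh_shift {x y d : ℝ} (hxy : |y - x| ≤ d) (hy : 0 ≤ y) (hx : 0 ≤ x) :
    Real.sinh x - Real.cosh x * d ≤ Real.sinh y := by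
  have hd0 : 0 ≤ d := (abs_nonneg _).trans hxy
  rcases le_total x y with h | h
  · have := Real.sinh_le_sinh.2 h
    nlinarith [Real.cosh_pos x]
  · have h1 := (convex_Icc y x).norm_image_sub_le_of_norm_hasDerivWithin_le
      (f := Real.sinh) (f' := Real.cosh) (C := Real.cosh x) (fun t _ => (Real.hasDerivAt_sinh t).hasDerivWithinAt)
      (fun t ht => by
        rw [Real.norm_eq_abs, abs_of_pos (Real.cosh_pos t), Real.cosh_le_cosh,
          abs_of_nonneg (hy.trans ht.1), abs_of_nonneg hx]; exact ht.2) ⟨h, le_rfl⟩ ⟨le_rfl, h⟩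
    rw [Real.norm_eq_abs, Real.norm_eq_abs] at h1
    have h2 : Real.cosh x * |y - x| ≤ Real.cosh x * d := by gcongr
    linarith [(abs_le.1 (h1.trans h2)).1]

lemma z1_nonneg {β : ℝ} (h : 0 ≤ β) : 0 ≤ z₁ β := by
  have h1 : Real.sin β ≤ β := Real.sin_le h
  have h2 := ee_le β
  have h3 := ee_pos β
  show 0 ≤ β - Real.sin β * ee β
  nlinarith

lemma z1_pos {β : ℝ} (h : 0 < β) : 0 < z₁ β := by
  have h1 : Real.sin β < β := Real.sin_lt h
  have h2 := ee_le β
  have h3 := ee_pos β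
  show 0 < β - Real.sin β * ee β
  nlinarith

structure BoxT (M : ℕ) (B : Bx) : Prop where
  dzle : ∀ β ∈ Set.Icc ((M:ℝ)/10^5 - (B.r:ℝ)/10^5) ((M:ℝ)/10^5 + (B.r:ℝ)/10^5), dz β ≤ (bZ B:ℝ)/10^9
  dx : ∀ β ∈ Set.Icc ((M:ℝ)/10^5 - (B.r:ℝ)/10^5) ((M:ℝ)/10^5 + (B.r:ℝ)/10^5), |z₁ β - z₁ ((M:ℝ)/10^5)| ≤ (bD B:ℝ)/10^9
  ch : ∀ β ∈ Set.Icc ((M:ℝ)/10^5 - (B.r:ℝ)/10^5) ((M:ℝ)/10^5 + (B.r:ℝ)/10^5), Real.cosh (z₁ β) ≤ (bC B:ℝ)/10^9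
  sh : ∀ β ∈ Set.Icc ((M:ℝ)/10^5 - (B.r:ℝ)/10^5) ((M:ℝ)/10^5 + (B.r:ℝ)/10^5), (B.s:ℝ)/10^9 ≤ Real.sinh (z₁ β)
  fd : ∀ β ∈ Set.Icc ((M:ℝ)/10^5 - (B.r:ℝ)/10^5) ((M:ℝ)/10^5 + (B.r:ℝ)/10^5), |ff β - ff ((M:ℝ)/10^5)| ≤ 1.42 * ((B.r:ℝ)/10^5)

lemma bC0_spec (B : Bx) {x : ℝ} (hx : 0 ≤ x) (hX : Real.sinh x ≤ ((B.X:ℝ)+1)/10^9) : Real.cosh x ≤ (bC0 B:ℝ)/10^9 := by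
  have hs : 0 ≤ Real.sinh x := Real.sinh_nonneg_iff.2 hx
  unfold bC0
  split
  · have h1 := cosh_le_a x
    obtain ⟨_, h2⟩ := div_bd ((B.X+1)^2) 2000000000 (by norm_num)
    push_cast at h2 ⊢
    have h3 : Real.sinh x ^ 2 ≤ (((B.X:ℝ)+1)/10^9)^2 := by gcongr
    rw [le_div_iff₀ (by norm_num)]
    have h4 : (((B.X:ℝ)+1)/10^9)^2 = ((B.X:ℝ)+1)^2/2000000000 * (2/10^9) := by ring
    rw [h4] at h3
    linarith
  · have h1 := cosh_le_b hx
    push_cast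
    rw [le_div_iff₀ (by norm_num)] at hX ⊢
    linarith

lemma boxT {ς : ℝ} {M : ℕ} {B : Bx} (H : RowT ς M B) (hS : rowS B = true) (hM : M + B.r ≤ 314159) (hr : B.r ≤ M) :
    BoxT M B := by
  unfold rowS at hS
  simp only [Bool.and_eq_true] at hS
  obtain ⟨⟨s1, s2⟩, s3⟩ := hS
  have s1 := ble_cast s1
  have s3 := ble_cast s3
  have hM' : (M:ℝ) + B.r ≤ 314159 := by exact_mod_cast hM
  have hr' : (B.r:ℝ) ≤ M := by exact_mod_cast hr
  obtain ⟨x0, x1, X0, X1, z0, z1, f0, f1⟩ := H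
  set m : ℝ := (M:ℝ)/10^5
  set r : ℝ := (B.r:ℝ)/10^5 with hrr
  have hr0 : 0 ≤ r := by positivity
  have hm0 : 0 ≤ m := by positivity
  have hI : ∀ x ∈ Set.Icc (m-r) (m+r), 0 ≤ x ∧ x ≤ 3.15 ∧ x ≤ π := by
    intro x hx
    have a1 : m + r ≤ 3.14159 := by
      show (M:ℝ)/10^5 + (B.r:ℝ)/10^5 ≤ _
      rw [← add_div, div_le_iff₀ (by norm_num)]; linarith
    have a2 : 0 ≤ m - r := by
      show 0 ≤ (M:ℝ)/10^5 - (B.r:ℝ)/10^5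
      rw [← sub_div]; exact div_nonneg (by linarith) (by norm_num)
    have := Real.pi_gt_d6
    exact ⟨a2.trans hx.1, by linarith [hx.2], by linarith [hx.2]⟩
  have hdz : ∀ β ∈ Set.Icc (m-r) (m+r), dz β ≤ (bZ B:ℝ)/10^9 := by
    intro β hβ
    have h1 := mvt_bd (C := 1.01) dz_deriv (fun x hx => (dz_abs_le (hI x hx).1 (hI x hx).2.1).1) hr0 hβ
    have h2 := (abs_le.1 h1).2
    unfold bZ; push_cast
    have : (B.r:ℝ) = r * 10^5 := by rw [hrr]; field_simp
    rw [le_div_iff₀ (by norm_num)] at z1 ⊢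
    rw [this]; linarith
  have hdx : ∀ β ∈ Set.Icc (m-r) (m+r), |z₁ β - z₁ m| ≤ (bD B:ℝ)/10^9 := by
    intro β hβ
    have h1 := mvt_bd (C := (bZ B:ℝ)/10^9) z1_deriv (fun x hx => by
      rw [abs_of_nonneg (dz_nonneg (hI x hx).1 (hI x hx).2.2)]; exact hdz x hx) hr0 hβ
    refine h1.trans ?_
    obtain ⟨_, h2⟩ := div_bd (bZ B * B.r * 10000) 1000000000 (by norm_num)
    unfold bD; push_cast at h2 ⊢
    have : (bZ B:ℝ)/10^9 * r = (bZ B * B.r * 10000 / 1000000000 : ℝ)/10^9 := by rw [hrr]; ring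
    rw [this]
    gcongr
  have hxm := z1_nonneg hm0
  have hc0 := bC0_spec B hxm X1
  have hD : (bD B:ℝ)/10^9 ≤ 1/2 := by
    rw [div_le_iff₀ (by norm_num)]; push_cast at s3; linarith
  have hD0 : 0 ≤ (bD B:ℝ)/10^9 := by positivity
  refine ⟨hdz, hdx, ?_, ?_, ?_⟩
  · intro β hβ
    have h1 := cosh_shift (hdx β hβ) hD hxm
    refine h1.trans ((mul_le_mul_of_nonneg_right hc0 (by linarith)).trans ?_)
    obtain ⟨_, h2⟩ := div_bd (2 * bC0 B * bD B) 1000000000 (by norm_num)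
    unfold bC; push_cast at h2 ⊢
    have : (bC0 B:ℝ)/10^9 * (1 + 2 * ((bD B:ℝ)/10^9)) = (bC0 B + 2 * bC0 B * bD B / 1000000000 : ℝ)/10^9 := by ring
    rw [this]; gcongr ?_ / _; linarith
  · intro β hβ
    have h1 := sinh_shift (hdx β hβ) (z1_nonneg (hI β hβ).1) hxm
    refine le_trans ?_ h1
    obtain ⟨_, h2⟩ := div_bd (bC0 B * bD B) 1000000000 (by norm_num)
    push_cast at h2 s1
    have h3 : Real.cosh (z₁ m) * ((bD B:ℝ)/10^9) ≤ (bC0 B * bD B / 1000000000 : ℝ)/10^9 := by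
      refine (mul_le_mul_of_nonneg_right hc0 hD0).trans (le_of_eq ?_); ring
    have h4 : (bC0 B * bD B / 1000000000 : ℝ)/10^9 ≤ ((B.X:ℝ) - B.s)/10^9 := by gcongr; linarith
    rw [sub_div] at h4
    linarith
  · intro β hβ
    exact mvt_bd (C := 1.42) ff_deriv (fun x hx => df_bd (hI x hx).1) hr0 hβ


lemma natsub_le {a b : ℕ} {t : ℝ} (h : (a:ℝ) - b ≤ t) (ht : 0 ≤ t) : ((a - b : ℕ):ℝ) ≤ t := by
  rcases le_total b a with h1 | h1
  · rw [Nat.cast_sub h1]; exact h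
  · rw [Nat.sub_eq_zero_of_le h1]; simpa using ht
lemma le_natsub {a b : ℕ} {t : ℝ} (h : t ≤ (a:ℝ) - b) : t ≤ ((a - b : ℕ):ℝ) := by
  rcases le_total b a with h1 | h1
  · rw [Nat.cast_sub h1]; exact h
  · rw [Nat.sub_eq_zero_of_le h1]
    have : (a:ℝ) ≤ b := by exact_mod_cast h1
    push_cast; linarith

lemma cos_le_four {x : ℝ} (hx : 0 ≤ x) : Real.cos x ≤ 1 - x^2/2 + x^4/24 := by
  have h : MonotoneOn (fun t : ℝ => 1 - t^2/2 + t^4/24 - Real.cos t) (Set.Ici 0) := by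
    apply monotoneOn_of_deriv_nonneg (convex_Ici 0)
    · fun_prop
    · fun_prop
    · intro t ht
      rw [interior_Ici] at ht
      have e : HasDerivAt (fun t : ℝ => 1 - t^2/2 + t^4/24 - Real.cos t) (Real.sin t - (t - t^3/6)) t := by
        have := (((hasDerivAt_const t (1:ℝ)).sub ((hasDerivAt_pow 2 t).div_const 2)).add ((hasDerivAt_pow 4 t).div_const 24)).sub (Real.hasDerivAt_cos t)
        refine this.congr_deriv ?_; norm_num <;> ring
      rw [e.deriv]
      linarith [Real.sin_ge_sub_cube (le_of_lt ht)]
  have := h (Set.mem_Ici.2 le_rfl) (Set.mem_Ici.2 hx) hx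
  norm_num at this; linarith

lemma sin_le_five {x : ℝ} (hx : 0 ≤ x) : Real.sin x ≤ x - x^3/6 + x^5/120 := by
  have h : MonotoneOn (fun t : ℝ => t - t^3/6 + t^5/120 - Real.sin t) (Set.Ici 0) := by
    apply monotoneOn_of_deriv_nonneg (convex_Ici 0)
    · fun_prop
    · fun_prop
    · intro t ht
      rw [interior_Ici] at ht
      have e : HasDerivAt (fun t : ℝ => t - t^3/6 + t^5/120 - Real.sin t) ((1 - t^2/2 + t^4/24) - Real.cos t) t := by
        have := (((hasDerivAt_id t).sub ((hasDerivAt_pow 3 t).div_const 6)).add ((hasDerivAt_pow 5 t).div_const 120)).sub (Real.hasDerivAt_sin t)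
        refine this.congr_deriv ?_; norm_num <;> ring
      rw [e.deriv]
      linarith [cos_le_four (le_of_lt ht)]
  have := h (Set.mem_Ici.2 le_rfl) (Set.mem_Ici.2 hx) hx
  norm_num at this; linarith

lemma sLo_spec {v0 : ℕ} {v : ℝ} (h0 : (v0:ℝ)/10^9 ≤ v) (h1 : v ≤ 1) : (sLo v0:ℝ)/10^9 ≤ Real.sin v := by
  have hp : (0:ℝ) ≤ (v0:ℝ)/10^9 := by positivity
  have a1 : Real.sin ((v0:ℝ)/10^9) ≤ Real.sin v := by
    apply Real.sin_le_sin_of_le_of_le_pi_div_two <;> linarith [Real.pi_gt_d6]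
  have a2 := Real.sin_ge_sub_cube hp
  have a3 : 0 ≤ Real.sin v := Real.sin_nonneg_of_nonneg_of_le_pi (hp.trans h0) (by linarith [Real.pi_gt_d6])
  rw [div_le_iff₀ (by norm_num)]
  unfold sLo
  apply natsub_le _ (by positivity)
  obtain ⟨_, d⟩ := div_bd (v0^3) 6000000000000000000 (by norm_num)
  push_cast at d ⊢
  have e : ((v0:ℝ)/10^9)^3/6 = (v0:ℝ)^3/6000000000000000000/10^9 := by ring
  rw [e] at a2
  have := a2.trans a1
  rw [← sub_div, div_le_iff₀ (by norm_num)] at this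
  linarith

lemma sHi_spec {v1 : ℕ} {v : ℝ} (h0 : 0 ≤ v) (h : v ≤ (v1:ℝ)/10^9) (h1 : (v1:ℝ)/10^9 ≤ 1) : Real.sin v ≤ (sHi v1:ℝ)/10^9 := by
  have a1 : Real.sin v ≤ Real.sin ((v1:ℝ)/10^9) := by
    apply Real.sin_le_sin_of_le_of_le_pi_div_two <;> linarith [Real.pi_gt_d6]
  have a2 := sin_le_five (h0.trans h)
  rw [le_div_iff₀ (by norm_num)]
  unfold sHi
  obtain ⟨d, _⟩ := div_bd (v1^3) 6000000000000000000 (by norm_num)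
  obtain ⟨_, d2⟩ := div_bd (v1^5) 120000000000000000000000000000000000000 (by norm_num)
  have e := le_natsub (a := v1) (b := v1 ^ 3 / 6000000000000000000) le_rfl
  rw [Nat.cast_add, Nat.cast_add]
  push_cast at d d2 e ⊢
  have e1 : ((v1:ℝ)/10^9)^3/6 = (v1:ℝ)^3/6000000000000000000/10^9 := by ring
  have e2 : ((v1:ℝ)/10^9)^5/120 = (v1:ℝ)^5/120000000000000000000000000000000000000/10^9 := by ring
  rw [e1, e2] at a2
  have := a1.trans a2
  rw [← sub_div, ← add_div, le_div_iff₀ (by norm_num)] at this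
  linarith

lemma jL_spec {c0 c1 x0 a : ℕ} {c x w : ℝ} (hc : 0 < c) (h0 : (c0:ℝ)/10^9 ≤ c) (h1 : c ≤ (c1:ℝ)/10^9)
    (k0 : (x0:ℝ)/10^9 ≤ x) (k1 : x ≤ ((x0:ℝ)+1)/10^9) (ha : (a:ℝ)/10^14 ≤ w) :
    (jL c0 c1 x0 a:ℝ)/10^14 ≤ w * JJ c x := by
  have hx : 0 ≤ x := le_trans (by positivity) k0
  have hw : 0 ≤ w := le_trans (by positivity) ha
  have hc1 : 0 < (c1:ℝ)/10^9 := hc.trans_le h1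
  have hc1' : 0 < (c1:ℝ) := by by_contra hh; push Not at hh; linarith [div_nonpos_of_nonpos_of_nonneg hh (by norm_num : (0:ℝ) ≤ 10^9)]
  obtain ⟨d, _⟩ := div_bd (2 * c0 * x0 * 1000000000000000000 * a) ((c1 * c1 + (x0+1)*(x0+1)) ^ 2) (by positivity)
  unfold jL JJ
  push_cast at d ⊢
  calc _ ≤ (2 * (c0:ℝ) * x0 * 1000000000000000000 * a / ((c1 * c1 + (x0+1)*(x0+1)) ^ 2)) / 10^14 := by gcongr
    _ = (a:ℝ)/10^14 * (2 * ((c0:ℝ)/10^9) * ((x0:ℝ)/10^9) / (((c1:ℝ)/10^9)^2 + (((x0:ℝ)+1)/10^9)^2)^2) := by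
      field_simp <;> norm_num <;> ring
    _ ≤ _ := by gcongr

lemma jH_spec {c0 c1 x0 b : ℕ} {c x w : ℝ} (hc : 0 < c0) (h0 : (c0:ℝ)/10^9 ≤ c) (h1 : c ≤ (c1:ℝ)/10^9)
    (k0 : (x0:ℝ)/10^9 ≤ x) (k1 : x ≤ ((x0:ℝ)+1)/10^9) (hw : 0 ≤ w) (hb : w ≤ (b:ℝ)/10^14) :
    w * JJ c x ≤ (jH c0 c1 x0 b:ℝ)/10^14 := by
  have hx : 0 ≤ x := le_trans (by positivity) k0
  have hc0 : (0:ℝ) < c0 := by exact_mod_cast hc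
  have hcc : 0 < c := lt_of_lt_of_le (by positivity) h0
  obtain ⟨_, d⟩ := div_bd (2 * c1 * (x0+1) * 1000000000000000000 * b) ((c0 * c0 + x0*x0) ^ 2) (by positivity)
  unfold jH JJ
  push_cast at d ⊢
  refine ge_iff_le.1 ?_
  calc _ ≥ (2 * (c1:ℝ) * (x0+1) * 1000000000000000000 * b / ((c0 * c0 + x0*x0) ^ 2)) / 10^14 := by
        show _ ≤ _
        gcongr
    _ = (b:ℝ)/10^14 * (2 * ((c1:ℝ)/10^9) * (((x0:ℝ)+1)/10^9) / (((c0:ℝ)/10^9)^2 + ((x0:ℝ)/10^9)^2)^2) := by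
      field_simp <;> norm_num <;> ring
    _ ≥ _ := by
        show _ ≤ _
        gcongr

lemma pLo_spec {X s0 s1 a : ℕ} {x v w : ℝ} (hX : 0 < X) (k0 : (X:ℝ)/10^9 ≤ Real.sinh x) (k1 : Real.sinh x ≤ ((X:ℝ)+1)/10^9)
    (h0 : (s0:ℝ)/10^9 ≤ Real.sin v) (h1 : Real.sin v ≤ (s1:ℝ)/10^9) (ha : (a:ℝ)/10^14 ≤ w) :
    (pLo X s0 s1 a:ℝ)/10^14 ≤ w * pp x v := by
  have hX0 : (0:ℝ) < X := by exact_mod_cast hX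
  have hx : 0 < Real.sinh x := lt_of_lt_of_le (by positivity) k0
  have hs : 0 ≤ Real.sin v := le_trans (by positivity) h0
  have hw : 0 ≤ w := le_trans (by positivity) ha
  have hv := Real.sin_le_one v
  obtain ⟨d, _⟩ := div_bd (2 * X * s0 * (2000000000000000000 + X*X - s1*s1) * a) (((X+1)*(X+1) + s1*s1)^2) (by positivity)
  unfold pLo pp
  push_cast at d ⊢
  have q0 : 0 ≤ 2 + Real.sinh x ^ 2 - Real.sin v ^ 2 := by nlinarith
  have q : ((2000000000000000000 + X*X - s1*s1 : ℕ):ℝ)/10^18 ≤ 2 + Real.sinh x ^ 2 - Real.sin v ^ 2 := by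
    rw [div_le_iff₀ (by norm_num)]
    refine natsub_le ?_ (by positivity)
    have e1 : ((X:ℝ)/10^9)^2 ≤ Real.sinh x ^ 2 := by gcongr
    have e2 : Real.sin v ^ 2 ≤ ((s1:ℝ)/10^9)^2 := by gcongr
    rw [div_pow, div_le_iff₀ (by norm_num)] at e1
    rw [div_pow, le_div_iff₀ (by norm_num)] at e2
    push_cast; linarith
  generalize (2000000000000000000 + X*X - s1*s1 : ℕ) = N at *
  calc _ ≤ (2 * (X:ℝ) * s0 * N * a / (((X+1)*(X+1) + s1*s1)^2)) / 10^14 := by gcongr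
    _ = (a:ℝ)/10^14 * (2 * ((X:ℝ)/10^9) * ((s0:ℝ)/10^9) * ((N:ℝ)/10^18) / ((((X:ℝ)+1)/10^9)^2 + ((s1:ℝ)/10^9)^2)^2) := by
      field_simp <;> norm_num <;> ring
    _ ≤ _ := by gcongr

lemma pHi_spec {X s0 s1 b : ℕ} {x v w : ℝ} (hX : 0 < X) (k0 : (X:ℝ)/10^9 ≤ Real.sinh x) (k1 : Real.sinh x ≤ ((X:ℝ)+1)/10^9)
    (h0 : (s0:ℝ)/10^9 ≤ Real.sin v) (h1 : Real.sin v ≤ (s1:ℝ)/10^9) (hw : 0 ≤ w) (hb : w ≤ (b:ℝ)/10^14) :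
    w * pp x v ≤ (pHi X s0 s1 b:ℝ)/10^14 := by
  have hX0 : (0:ℝ) < X := by exact_mod_cast hX
  have hx : 0 < Real.sinh x := lt_of_lt_of_le (by positivity) k0
  have hs : 0 ≤ Real.sin v := le_trans (by positivity) h0
  have hv := Real.sin_le_one v
  obtain ⟨_, d⟩ := div_bd (2 * (X+1) * s1 * (2000000000000000000 + (X+1)*(X+1) - s0*s0) * b) ((X*X + s0*s0)^2) (by positivity)
  unfold pHi pp
  push_cast at d ⊢
  have q0 : 0 ≤ 2 + Real.sinh x ^ 2 - Real.sin v ^ 2 := by nlinarith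
  have q : 2 + Real.sinh x ^ 2 - Real.sin v ^ 2 ≤ ((2000000000000000000 + (X+1)*(X+1) - s0*s0 : ℕ):ℝ)/10^18 := by
    rw [le_div_iff₀ (by norm_num)]
    refine le_natsub ?_
    have e1 : Real.sinh x ^ 2 ≤ (((X:ℝ)+1)/10^9)^2 := by gcongr
    have e2 : ((s0:ℝ)/10^9)^2 ≤ Real.sin v ^ 2 := by gcongr
    rw [div_pow, le_div_iff₀ (by norm_num)] at e1
    rw [div_pow, div_le_iff₀ (by norm_num)] at e2
    push_cast; linarith
  generalize (2000000000000000000 + (X+1)*(X+1) - s0*s0 : ℕ) = N at *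
  refine ge_iff_le.1 ?_
  calc _ ≥ (2 * ((X:ℝ)+1) * s1 * N * b / ((X*X + s0*s0)^2)) / 10^14 := by
        show _ ≤ _
        gcongr
    _ = (b:ℝ)/10^14 * (2 * (((X:ℝ)+1)/10^9) * ((s1:ℝ)/10^9) * ((N:ℝ)/10^18) / (((X:ℝ)/10^9)^2 + ((s0:ℝ)/10^9)^2)^2) := by
      field_simp <;> norm_num <;> ring
    _ ≥ _ := by
        show _ ≤ _
        gcongr

lemma eR_spec {p q rh : ℕ} {A4 A2 r3 : ℝ} (h : 0 < rh) (hp : A4 * r3 ≤ (p:ℝ)/10^18) (hq : A2 * r3 ≤ (q:ℝ)/10^18) :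
    (A4 / ((rh:ℝ)/10^18)^2 + A2 / ((rh:ℝ)/10^18)) * r3 ≤ (eR p q rh:ℝ)/10^14 := by
  have hr : (0:ℝ) < rh := by exact_mod_cast h
  obtain ⟨_, d1⟩ := div_bd (p * 1000000000000000000000000000000000000) (10000 * rh^2) (by positivity)
  obtain ⟨_, d2⟩ := div_bd (q * 1000000000000000000) (10000 * rh) (by positivity)
  unfold eR
  push_cast at d1 d2 ⊢
  have e : (A4 / ((rh:ℝ)/10^18)^2 + A2 / ((rh:ℝ)/10^18)) * r3 = (A4 * r3) / ((rh:ℝ)/10^18)^2 + (A2 * r3) / ((rh:ℝ)/10^18) := by ring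
  rw [e]
  calc _ ≤ ((p:ℝ)/10^18) / ((rh:ℝ)/10^18)^2 + ((q:ℝ)/10^18) / ((rh:ℝ)/10^18) := by gcongr
    _ = (p * 1000000000000000000000000000000000000 / (10000 * rh^2) + q * 1000000000000000000 / (10000 * rh) : ℝ)/10^14 := by
      field_simp <;> norm_num <;> ring
    _ ≤ _ := by gcongr ?_ / _; linarith


def bp (sg sp : Bool) (h0 h1 : ℕ) (B : Bx) : ℕ := match sg, sp with
  | true, true => bPL B h0 h1 + bmL B h0 h1
  | true, false => bPL B h0 h1 + bpL B h0 h1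
  | false, true => bpL B h0 h1
  | false, false => bmL B h0 h1
def bn (sg sp : Bool) (h0 h1 : ℕ) (B : Bx) : ℕ := match sg, sp with
  | true, true => bE B h0 + bpH B h0 h1
  | true, false => bE B h0 + bmH B h0 h1
  | false, true => bPH B h0 h1 + (bE B h0 + bmH B h0 h1)
  | false, false => bPH B h0 h1 + (bE B h0 + bpH B h0 h1)

def sgn (b : Bool) : ℝ := if b then 1 else -1

lemma bf_le {ς : ℝ} {M : ℕ} {B : Bx} (H : RowT ς M B) (hς : |ς| = 1) : (B.f:ℝ) ≤ 710000000 := by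
  have h1 := ff_bd (α := (M:ℝ)/10^5) (by positivity)
  have h2 : |ς * ff ((M:ℝ)/10^5)| ≤ 0.71 := by rw [abs_mul, hς, one_mul]; exact h1
  have h3 := H.f0.trans ((le_abs_self _).trans h2)
  rw [div_le_iff₀ (by norm_num)] at h3
  linarith

structure HT (h : ℝ) (h0 h1 : ℕ) : Prop where
  l : (h0:ℝ)/10^6 ≤ h
  u : h ≤ (h1:ℝ)/10^6
  a : 250000 ≤ h0
  b : h1 ≤ 648000

lemma prod_bd {h F : ℝ} {h0 h1 f0 f1 : ℕ} (hl : (h0:ℝ)/10^6 ≤ h) (hu : h ≤ (h1:ℝ)/10^6)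
    (fl : (f0:ℝ)/10^9 ≤ F) (fu : F ≤ (f1:ℝ)/10^9) :
    ((h0 * f0 / 1000000 : ℕ):ℝ)/10^9 ≤ h * F ∧ h * F ≤ ((h1 * f1 / 1000000 + 1 : ℕ):ℝ)/10^9 := by
  have p0 : 0 ≤ h := le_trans (by positivity) hl
  have p1 : 0 ≤ F := le_trans (by positivity) fl
  obtain ⟨d1, _⟩ := div_bd (h0 * f0) 1000000 (by norm_num)
  obtain ⟨_, d2⟩ := div_bd (h1 * f1) 1000000 (by norm_num)
  push_cast at d1 d2 ⊢
  constructor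
  · calc _ ≤ ((h0:ℝ) * f0 / 1000000)/10^9 := by gcongr
      _ = ((h0:ℝ)/10^6) * ((f0:ℝ)/10^9) := by ring
      _ ≤ _ := by gcongr
  · calc h * F ≤ ((h1:ℝ)/10^6) * ((f1:ℝ)/10^9) := by gcongr
      _ = ((h1:ℝ) * f1 / 1000000)/10^9 := by ring
      _ ≤ _ := by gcongr

structure ParT (ς h : ℝ) (h0 h1 M : ℕ) (B : Bx) : Prop where
  pl : (bPL B h0 h1 : ℝ)/10^14 ≤ 2 * ((B.r:ℝ)/10^5) * dz ((M:ℝ)/10^5) * pp (z₁ ((M:ℝ)/10^5)) (h * (ς * ff ((M:ℝ)/10^5)))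
  pu : 2 * ((B.r:ℝ)/10^5) * dz ((M:ℝ)/10^5) * pp (z₁ ((M:ℝ)/10^5)) (h * (ς * ff ((M:ℝ)/10^5))) ≤ (bPH B h0 h1 : ℝ)/10^14
  ml : (bmL B h0 h1 : ℝ)/10^14 ≤ 2 * ((B.r:ℝ)/10^5) * dz ((M:ℝ)/10^5) * JJ (2 * h - h * (ς * ff ((M:ℝ)/10^5))) (z₁ ((M:ℝ)/10^5))
  mu : 2 * ((B.r:ℝ)/10^5) * dz ((M:ℝ)/10^5) * JJ (2 * h - h * (ς * ff ((M:ℝ)/10^5))) (z₁ ((M:ℝ)/10^5)) ≤ (bmH B h0 h1 : ℝ)/10^14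
  ql : (bpL B h0 h1 : ℝ)/10^14 ≤ 2 * ((B.r:ℝ)/10^5) * dz ((M:ℝ)/10^5) * JJ (2 * h + h * (ς * ff ((M:ℝ)/10^5))) (z₁ ((M:ℝ)/10^5))
  qu : 2 * ((B.r:ℝ)/10^5) * dz ((M:ℝ)/10^5) * JJ (2 * h + h * (ς * ff ((M:ℝ)/10^5))) (z₁ ((M:ℝ)/10^5)) ≤ (bpH B h0 h1 : ℝ)/10^14
  sl : (sLo (h0 * B.f / 1000000):ℝ)/10^9 ≤ Real.sin (h * (ς * ff ((M:ℝ)/10^5)))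

lemma parT {ς h : ℝ} {h0 h1 M : ℕ} {B : Bx} (H : RowT ς M B) (hς : |ς| = 1) (T : HT h h0 h1)
    (hX : 0 < B.X) (hM : M ≤ 314159) : ParT ς h h0 h1 M B := by
  have hf := bf_le H hς
  have hfn : B.f ≤ 710000000 := by exact_mod_cast hf
  obtain ⟨x0, x1, X0, X1, z0, z1, f0, f1⟩ := H
  obtain ⟨hl, hu, ha, hb⟩ := T
  have hb' : (h1:ℝ) ≤ 648000 := by exact_mod_cast hb
  have ha' : (250000:ℝ) ≤ h0 := by exact_mod_cast ha
  have h0p : 0 < h := lt_of_lt_of_le (by positivity) hl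
  have hM' : (M:ℝ)/10^5 ≤ π := by
    have : (M:ℝ) ≤ 314159 := by exact_mod_cast hM
    have := Real.pi_gt_d6
    rw [div_le_iff₀ (by norm_num)]; linarith
  have hdz := dz_nonneg (β := (M:ℝ)/10^5) (by positivity) hM'
  set m : ℝ := (M:ℝ)/10^5
  set F : ℝ := ς * ff m
  set w : ℝ := 2 * ((B.r:ℝ)/10^5) * dz m with hw
  have hw0 : 0 ≤ w := by positivity
  have hwl : ((2 * B.r * B.z : ℕ):ℝ)/10^14 ≤ w := by
    rw [hw]; push_cast
    calc _ = 2 * ((B.r:ℝ)/10^5) * ((B.z:ℝ)/10^9) := by ring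
      _ ≤ _ := by gcongr
  have hwu : w ≤ ((2 * B.r * (B.z + 1) : ℕ):ℝ)/10^14 := by
    rw [hw]; push_cast
    calc _ ≤ 2 * ((B.r:ℝ)/10^5) * (((B.z:ℝ)+1)/10^9) := by gcongr
      _ = _ := by ring
  obtain ⟨v0, v1⟩ := prod_bd (f1 := B.f + 1) hl hu f0 (by push_cast; exact f1)
  have hF0 : 0 ≤ F := le_trans (by positivity) f0
  have hF1 : F ≤ 0.71 + 1/10^9 := f1.trans (by rw [div_le_iff₀ (by norm_num)]; linarith)
  have hv0 : 0 ≤ h * F := by positivity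
  have hh : h ≤ 0.648 := hu.trans (by rw [div_le_iff₀ (by norm_num)]; linarith)
  have hv1 : h * F ≤ 1 := by nlinarith
  have hv2 : ((h1 * (B.f+1) / 1000000 + 1 : ℕ):ℝ)/10^9 ≤ 1 := by
    obtain ⟨d, _⟩ := div_bd (h1 * (B.f+1)) 1000000 (by norm_num)
    rw [div_le_iff₀ (by norm_num)]; push_cast at d ⊢
    have : (h1:ℝ) * (B.f+1) ≤ 648000 * 710000001 := by
      gcongr; linarith
    have e : (h1:ℝ) * (B.f+1)/1000000 ≤ 648000 * 710000001 / 1000000 := by gcongr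
    norm_num at e
    linarith
  have s0 := sLo_spec v0 hv1
  have s1 := sHi_spec hv0 v1 hv2
  have em : 2 * h - h * F = h * (2 - F) := by ring
  have ep : 2 * h + h * F = h * (2 + F) := by ring
  obtain ⟨m0, m1⟩ := prod_bd (F := 2 - F) (f0 := 1999999999 - B.f) (f1 := 2000000000 - B.f) hl hu
    (by rw [Nat.cast_sub (by omega)]; rw [div_le_iff₀ (by norm_num)]; rw [le_div_iff₀ (by norm_num)] at f1; push_cast; linarith)
    (by rw [Nat.cast_sub (by omega)]; rw [le_div_iff₀ (by norm_num)]; rw [div_le_iff₀ (by norm_num)] at f0; push_cast; linarith)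
  obtain ⟨n0, n1⟩ := prod_bd (F := 2 + F) (f0 := 2000000000 + B.f) (f1 := 2000000001 + B.f) hl hu
    (by rw [div_le_iff₀ (by norm_num)] at f0 ⊢; push_cast; linarith)
    (by rw [le_div_iff₀ (by norm_num)] at f1 ⊢; push_cast; linarith)
  have cm : 0 < h * (2 - F) := mul_pos h0p (by linarith)
  have cp : 0 < h * (2 + F) := mul_pos h0p (by linarith)
  have cmn : 0 < h0 * (1999999999 - B.f) / 1000000 := by
    apply Nat.div_pos _ (by norm_num)
    calc 1000000 ≤ 250000 * 4 := by norm_num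
      _ ≤ h0 * (1999999999 - B.f) := Nat.mul_le_mul ha (by omega)
  have cpn : 0 < h0 * (2000000000 + B.f) / 1000000 := by
    apply Nat.div_pos _ (by norm_num)
    calc 1000000 ≤ 250000 * 4 := by norm_num
      _ ≤ h0 * (2000000000 + B.f) := Nat.mul_le_mul ha (by omega)
  refine ⟨?_, ?_, ?_, ?_, ?_, ?_, s0⟩
  · exact pLo_spec hX X0 X1 s0 s1 hwl
  · exact pHi_spec hX X0 X1 s0 s1 hw0 hwu
  · rw [em]; exact jL_spec cm m0 m1 x0 x1 hwl
  · rw [em]; exact jH_spec cmn m0 m1 x0 x1 hw0 hwu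
  · rw [ep]; exact jL_spec cp n0 n1 x0 x1 hwl
  · rw [ep]; exact jH_spec cpn n0 n1 x0 x1 hw0 hwu

lemma pp_neg (x v : ℝ) : pp x (-v) = - pp x v := by
  unfold pp; rw [Real.sin_neg]; ring

lemma par_sum {sg sp : Bool} {h : ℝ} {h0 h1 M : ℕ} {B : Bx} (P : ParT (sgn sg) h h0 h1 M B) :
    (bp sg sp h0 h1 B:ℝ)/10^14 + (bE B h0:ℝ)/10^14 - (bn sg sp h0 h1 B:ℝ)/10^14
      ≤ 2 * ((B.r:ℝ)/10^5) * Fs h (sgn sp) ((M:ℝ)/10^5) := by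
  obtain ⟨pl, pu, ml, mu, ql, qu, _⟩ := P
  unfold Fs
  cases sg <;> cases sp <;> simp only [sgn, bp, bn, if_true, if_false, Bool.false_eq_true, one_mul, neg_mul, mul_neg, pp_neg, Nat.cast_add, sub_neg_eq_add, ← sub_eq_add_neg, add_div] at pl pu ml mu ql qu ⊢ <;>
    linarith

lemma bE_spec {sg : Bool} {h : ℝ} {h0 h1 M : ℕ} {B : Bx} (H : RowT (sgn sg) M B) (P : ParT (sgn sg) h h0 h1 M B)
    (T : HT h h0 h1) (hR : rowR B (bZ B) (bC B) = true) (hS : rowS B = true) (hM : M + B.r ≤ 314159) (hr : B.r ≤ M) (sp : Bool) :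
    2 * ((B.r:ℝ)/10^5) * Fs h (sgn sp) ((M:ℝ)/10^5) - (bE B h0:ℝ)/10^14 - 58/h^4 * (((B.r:ℝ)/10^5)^3/3)
     ≤ ∫ β in ((M:ℝ)/10^5 - (B.r:ℝ)/10^5)..((M:ℝ)/10^5 + (B.r:ℝ)/10^5), Fs h (sgn sp) β := by
  have X := boxT H hS hM hr
  have hM' : (M:ℝ) + B.r ≤ 314159 := by exact_mod_cast hM
  have hr' : (B.r:ℝ) ≤ M := by exact_mod_cast hr
  obtain ⟨hl, hu, ha, hb⟩ := T
  have hb' : (h1:ℝ) ≤ 648000 := by exact_mod_cast hb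
  have h0p : 0 < h := lt_of_lt_of_le (by have : (250000:ℝ) ≤ h0 := by exact_mod_cast ha
                                         positivity) hl
  have hh : h ≤ 0.648 := hu.trans (by rw [div_le_iff₀ (by norm_num)]; linarith)
  unfold rowS at hS
  simp only [Bool.and_eq_true] at hS
  obtain ⟨⟨s1, s2⟩, s3⟩ := hS
  have s2 := Nat.le_of_ble_eq_true s2
  set s0 := sLo (h0 * B.f / 1000000) with hs0
  have hrho : 0 < rho B s0 := by unfold rho; positivity
  have key := box_lower (h := h) (σ := sgn sp) (m := (M:ℝ)/10^5) (r := (B.r:ℝ)/10^5) (Z1 := (bZ B:ℝ)/10^9) (C := (bC B:ℝ)/10^9)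
    (ρ := (rho B s0:ℝ)/10^18) (by positivity)
    (by rw [← sub_div]; exact div_nonneg (by linarith) (by norm_num))
    (by rw [← add_div]; have := Real.pi_gt_d6; rw [div_le_iff₀ (by norm_num)]; linarith) h0p hh
    (by cases sp <;> simp [sgn]) X.dzle X.ch (by positivity) (by
      intro β hβ
      have a1 := X.sh β hβ
      have a2 := X.fd β hβ
      have a3 := P.sl
      rw [← hs0] at a3
      have a4 : (((s0 - 9202 * B.r : ℕ):ℝ)/10^9) ≤ |Real.sin (h * ff β)| := by
        rw [div_le_iff₀ (by norm_num)]
        refine natsub_le ?_ (by positivity)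
        have b1 : |Real.sin (h * (sgn sg * ff ((M:ℝ)/10^5)))| = |Real.sin (h * ff ((M:ℝ)/10^5))| := by
          cases sg <;> simp [sgn]
        have b2 := a3.trans (le_abs_self _)
        rw [b1] at b2
        have b3 : |Real.sin (h * ff β) - Real.sin (h * ff ((M:ℝ)/10^5))| ≤ |h * ff β - h * ff ((M:ℝ)/10^5)| :=
          Real.abs_sin_sub_sin_le _ _
        rw [← mul_sub, abs_mul, abs_of_pos h0p] at b3
        have b4 : h * |ff β - ff ((M:ℝ)/10^5)| ≤ 0.648 * (1.42 * ((B.r:ℝ)/10^5)) := by gcongr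
        have b5 := abs_sub_abs_le_abs_sub (Real.sin (h * ff ((M:ℝ)/10^5))) (Real.sin (h * ff β))
        rw [abs_sub_comm] at b5
        have b6 : (0:ℝ) ≤ B.r := by positivity
        rw [div_le_iff₀ (by norm_num)] at b2
        push_cast
        linarith
      have a5 : (((s0 - 9202 * B.r : ℕ):ℝ)/10^9)^2 ≤ Real.sin (h * ff β)^2 := by
        rw [← sq_abs (Real.sin _)]; gcongr
      have a6 : ((B.s:ℝ)/10^9)^2 ≤ Real.sinh (z₁ β)^2 := by gcongr
      refine le_trans (le_of_eq ?_) (add_le_add a6 a5)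
      unfold rho; push_cast; ring)
  unfold rowR rQ at hR
  rw [Bool.and_eq_true] at hR
  obtain ⟨r1, r2⟩ := hR
  have r1 := ble_cast r1
  have r2 := ble_cast r2
  push_cast at r1 r2
  have e := eR_spec (p := B.p) (q := B.q) (A4 := a4 ((bZ B:ℝ)/10^9) ((bC B:ℝ)/10^9)) (A2 := a2 ((bZ B:ℝ)/10^9) ((bC B:ℝ)/10^9))
    (r3 := ((B.r:ℝ)/10^5)^3/3) hrho (by
      rw [le_div_iff₀ (by norm_num)]
      unfold a4 qN
      clear key r2
      have : (B.p:ℝ) = (B.p * 150 * 10^54)/(150*10^54) := by field_simp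
      rw [this, le_div_iff₀ (by norm_num)]
      refine le_trans (le_of_eq ?_) (r1.trans (le_of_eq ?_)) <;> ring) (by
      rw [le_div_iff₀ (by norm_num)]
      unfold a2 qN
      clear key r1
      have : (B.q:ℝ) = (6 * B.q * 10^36)/(6*10^36) := by field_simp
      rw [this, le_div_iff₀ (by norm_num)]
      refine le_trans (le_of_eq ?_) (r2.trans (le_of_eq ?_)) <;> ring)
  have hbe : bE B h0 = eR B.p B.q (rho B s0) := rfl
  rw [hbe]
  refine le_trans ?_ key
  rw [mul_div_assoc, add_mul]
  linarith


lemma z1_cont : Continuous z₁ := by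
  apply continuous_iff_continuousAt.2; intro β; exact (z1_deriv β).continuousAt
lemma dz_cont : Continuous dz := by
  apply continuous_iff_continuousAt.2; intro β; exact (dz_deriv β).continuousAt
lemma ff_cont : Continuous ff := by
  apply continuous_iff_continuousAt.2; intro β; exact (ff_deriv β).continuousAt
lemma df_cont : Continuous df := by
  apply continuous_iff_continuousAt.2; intro β; exact (df_deriv β).continuousAt

lemma Fs_cont (h σ : ℝ) : ContinuousOn (Fs h σ) (Set.Ioi 0) := by
  have c1 := z1_cont; have c2 := dz_cont; have c3 := ff_cont
  unfold Fs pp JJ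
  refine ContinuousOn.mul c2.continuousOn (ContinuousOn.add (ContinuousOn.div (by fun_prop) (by fun_prop) ?_)
    (ContinuousOn.mul continuousOn_const (ContinuousOn.sub (ContinuousOn.div (by fun_prop) (by fun_prop) ?_) (ContinuousOn.div (by fun_prop) (by fun_prop) ?_))))
  · intro β hβ
    have := z1_pos hβ
    have := Real.sinh_pos_iff.2 this
    positivity
  · intro β hβ
    have := z1_pos hβ
    positivity
  · intro β hβ
    have := z1_pos hβ
    positivity

lemma endp_ge : ∀ (l : List Bx) (a : ℕ), a ≤ endp a l
  | [], a => le_rfl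
  | B :: l, a => by
    have := endp_ge l (a + 2 * B.r)
    show a ≤ endp (a + 2 * B.r) l
    omega

def BoxP (sg : Bool) (M : ℕ) (B : Bx) : Prop :=
  RowT (sgn sg) M B ∧ rowS B = true ∧ rowR B (bZ B) (bC B) = true ∧ M + B.r ≤ 314159 ∧ B.r ≤ M

lemma rows_cons {sg : Bool} {a : ℕ} {B : Bx} {l : List Bx} (h : rowsOK sg a (B :: l) = true) (he : endp a (B :: l) ≤ 314159) :
    BoxP sg (a + B.r) B ∧ rowsOK sg (a + 2 * B.r) l = true := by
  unfold rowsOK at h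
  rw [Bool.and_eq_true] at h
  obtain ⟨h1, h2⟩ := h
  obtain ⟨r1, r2, r3, r4, r5⟩ := row_sound h1
  have := endp_ge l (a + 2 * B.r)
  have he' : endp (a + 2 * B.r) l ≤ 314159 := he
  exact ⟨⟨r1, r2, r3, by omega, r5⟩, h2⟩

lemma list_gen {F : ℝ → ℝ} (hF : ContinuousOn F (Set.Ioi 0)) {g : Bx → ℝ} {sg : Bool}
    (hbox : ∀ M B, BoxP sg M B → g B ≤ ∫ β in ((M:ℝ)/10^5 - (B.r:ℝ)/10^5)..((M:ℝ)/10^5 + (B.r:ℝ)/10^5), F β) :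
    ∀ (l : List Bx) (a : ℕ), 0 < a → rowsOK sg a l = true → endp a l ≤ 314159 →
      (l.map g).sum ≤ ∫ β in ((a:ℝ)/10^5)..((endp a l:ℝ)/10^5), F β
  | [], a, _, _, _ => by simp [endp]
  | B :: l, a, ha, h, he => by
    obtain ⟨h1, h2⟩ := rows_cons h he
    have ih := list_gen hF hbox l (a + 2 * B.r) (by omega) h2 he
    have hb := hbox _ _ h1
    have e1 : ((a + B.r : ℕ):ℝ)/10^5 - (B.r:ℝ)/10^5 = (a:ℝ)/10^5 := by push_cast; ring
    have e2 : ((a + B.r : ℕ):ℝ)/10^5 + (B.r:ℝ)/10^5 = ((a + 2 * B.r : ℕ):ℝ)/10^5 := by push_cast; ring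
    rw [e1, e2] at hb
    have e3 : endp a (B :: l) = endp (a + 2 * B.r) l := rfl
    rw [e3, List.map_cons, List.sum_cons]
    have a0 : (0:ℝ) < (a:ℝ)/10^5 := by have : (0:ℝ) < a := by exact_mod_cast ha
                                       positivity
    have a1 : (a:ℝ)/10^5 ≤ ((a + 2 * B.r : ℕ):ℝ)/10^5 := by push_cast; gcongr; linarith [show (0:ℝ) ≤ B.r from by positivity]
    have a2 : ((a + 2 * B.r : ℕ):ℝ)/10^5 ≤ (endp (a + 2 * B.r) l:ℝ)/10^5 := by
      gcongr; exact endp_ge _ _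
    rw [← intervalIntegral.integral_add_adjacent_intervals (b := ((a + 2 * B.r : ℕ):ℝ)/10^5)]
    · exact add_le_add hb ih
    · apply ContinuousOn.intervalIntegrable
      apply hF.mono; rw [Set.uIcc_of_le a1]; intro x hx; exact lt_of_lt_of_le a0 hx.1
    · apply ContinuousOn.intervalIntegrable
      apply hF.mono; rw [Set.uIcc_of_le a2]; intro x hx; exact lt_of_lt_of_le (a0.trans_le a1) hx.1

lemma list_cover {sg : Bool} {β : ℝ} : ∀ (l : List Bx) (a : ℕ), rowsOK sg a l = true → endp a l ≤ 314159 →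
    (a:ℝ)/10^5 ≤ β → β < (endp a l:ℝ)/10^5 → ∃ M, ∃ B ∈ l, BoxP sg M B ∧ β ∈ Set.Icc ((M:ℝ)/10^5 - (B.r:ℝ)/10^5) ((M:ℝ)/10^5 + (B.r:ℝ)/10^5)
  | [], a, _, _, h1, h2 => absurd (h1.trans_lt h2) (lt_irrefl _)
  | B :: l, a, h, he, k1, k2 => by
    obtain ⟨h1, h2⟩ := rows_cons h he
    have e2 : ((a + B.r : ℕ):ℝ)/10^5 + (B.r:ℝ)/10^5 = ((a + 2 * B.r : ℕ):ℝ)/10^5 := by push_cast; ring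
    rcases le_total β (((a + 2 * B.r : ℕ):ℝ)/10^5) with q | q
    · refine ⟨_, B, List.mem_cons_self, h1, ?_, by rw [e2]; exact q⟩
      refine le_trans (le_of_eq ?_) k1
      push_cast; ring
    · obtain ⟨M, B', hB, hh⟩ := list_cover l (a + 2 * B.r) h2 he q k2
      exact ⟨M, B', List.mem_cons_of_mem _ hB, hh⟩

lemma sumB_cast (p n t : Bx → ℕ) (u c : ℝ) : ∀ l : List Bx, (l.map (fun B => (p B:ℝ)/u - (n B:ℝ)/u - c * (t B:ℝ))).sum
    = (sumB p l:ℝ)/u - (sumB n l:ℝ)/u - c * (sumB t l:ℝ)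
  | [] => by simp [sumB]
  | B :: l => by
    rw [List.map_cons, List.sum_cons, sumB_cast p n t u c l]; simp only [sumB]; push_cast; ring

/-- lower bound of the integral over a table -/
lemma slice_lower {sg sp : Bool} {h : ℝ} {h0 h1 : ℕ} (T : HT h h0 h1) (l : List Bx) (a : ℕ) (ha : 0 < a)
    (hl : rowsOK sg a l = true) (he : endp a l ≤ 314159) :
    (sumB (bp sg sp h0 h1) l:ℝ)/10^14 - (sumB (bn sg sp h0 h1) l:ℝ)/10^14 - 58/h^4/(3*10^15) * (sumB (fun B => B.r^3) l:ℝ)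
     ≤ ∫ β in ((a:ℝ)/10^5)..((endp a l:ℝ)/10^5), Fs h (sgn sp) β := by
  rw [← sumB_cast]
  apply list_gen (Fs_cont h _) (sg := sg) _ l a ha hl he
  rintro M B ⟨r1, r2, r3, r4, r5⟩
  have hX : 0 < B.X := by
    unfold rowS at r2
    simp only [Bool.and_eq_true] at r2
    have := Nat.le_of_ble_eq_true r2.1.1
    omega
  have P := parT r1 (by cases sg <;> simp [sgn]) T hX (by omega)
  have k1 := par_sum (sp := sp) P
  have k2 := bE_spec r1 P T r3 r2 r4 r5 sp
  have e : 58/h^4 * (((B.r:ℝ)/10^5)^3/3) = 58/h^4/(3*10^15) * ((B.r^3 : ℕ):ℝ) := by push_cast; ring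
  rw [e] at k2
  linarith

def gB (B : Bx) : ℕ := 2 * B.r * bZ B * (B.f + 1 + 14200 * B.r)
def g4 (B : Bx) : ℕ := 2 * B.r * bZ B * (B.f + 1 + 14200 * B.r) * (B.x + 1 + bD B)^4

lemma int_upper {F : ℝ → ℝ} (hF : Continuous F) {m r C : ℝ} (hr : 0 ≤ r) (h : ∀ β ∈ Set.Icc (m-r) (m+r), F β ≤ C) :
    - (2 * r * C) ≤ ∫ β in (m-r)..(m+r), - F β := by
  have h1 : ∫ β in (m-r)..(m+r), F β ≤ ∫ β in (m-r)..(m+r), C := by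
    apply intervalIntegral.integral_mono_on (by linarith) (hF.intervalIntegrable _ _) (by simp)
    exact h
  rw [intervalIntegral.integral_neg]
  rw [intervalIntegral.integral_const, smul_eq_mul] at h1
  linarith

lemma box_ff {sg : Bool} {M : ℕ} {B : Bx} (P : BoxP sg M B) {β : ℝ}
    (hβ : β ∈ Set.Icc ((M:ℝ)/10^5 - (B.r:ℝ)/10^5) ((M:ℝ)/10^5 + (B.r:ℝ)/10^5)) :
    |ff β| ≤ ((B.f + 1 + 14200 * B.r : ℕ):ℝ)/10^9 ∧ ((B.f:ℝ) - 14200 * B.r)/10^9 ≤ sgn sg * ff β ∧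
    0 ≤ z₁ β ∧ z₁ β ≤ ((B.x + 1 + bD B : ℕ):ℝ)/10^9 ∧ dz β ≤ (bZ B:ℝ)/10^9 ∧ 0 ≤ dz β := by
  obtain ⟨r1, r2, r3, r4, r5⟩ := P
  have X := boxT r1 r2 r4 r5
  have hM' : (M:ℝ) + B.r ≤ 314159 := by exact_mod_cast r4
  have hr' : (B.r:ℝ) ≤ M := by exact_mod_cast r5
  have b0 : 0 ≤ β := le_trans (by rw [← sub_div]; exact div_nonneg (by linarith) (by norm_num)) hβ.1
  have b1 : β ≤ π := hβ.2.trans (by rw [← add_div]; have := Real.pi_gt_d6; rw [div_le_iff₀ (by norm_num)]; linarith)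
  have a1 := abs_le.1 (X.fd β hβ)
  have a2 := abs_le.1 (X.dx β hβ)
  have f0 := r1.f0; have f1 := r1.f1; have x1 := r1.x1
  have B0 : (0:ℝ) ≤ B.f := by positivity
  have B1 : (0:ℝ) ≤ B.r := by positivity
  refine ⟨?_, ?_, z1_nonneg b0, ?_, X.dzle β hβ, dz_nonneg b0 b1⟩
  · rw [le_div_iff₀ (by norm_num)]
    rw [div_le_iff₀ (by norm_num)] at f0
    rw [le_div_iff₀ (by norm_num)] at f1
    have : (10:ℝ)^9 = |(10:ℝ)^9| := by rw [abs_of_nonneg]; positivity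
    rw [this, ← abs_mul, abs_le]; push_cast
    cases sg <;> simp only [sgn, if_true, if_false, Bool.false_eq_true] at f0 f1 <;> constructor <;> linarith
  · rw [div_le_iff₀ (by norm_num)] at f0 ⊢
    cases sg <;> simp only [sgn, if_true, if_false, Bool.false_eq_true] at f0 ⊢ <;> linarith
  · push_cast at x1 ⊢
    rw [add_div]; linarith

lemma gB_lower {sg : Bool} (l : List Bx) (a : ℕ) (ha : 0 < a)
    (hl : rowsOK sg a l = true) (he : endp a l ≤ 314159) :
    ∫ β in ((a:ℝ)/10^5)..((endp a l:ℝ)/10^5), dz β * |ff β| ≤ (sumB gB l:ℝ)/10^23 := by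
  have c2 := dz_cont; have c3 := ff_cont
  have c : Continuous (fun β => dz β * |ff β|) := by fun_prop
  have := list_gen (F := fun β => - (dz β * |ff β|)) c.neg.continuousOn (sg := sg) (g := fun B => ((0:ℕ):ℝ)/10^23 - (gB B:ℝ)/10^23 - 0 * ((0:ℕ):ℝ)) (by
    rintro M B P
    refine le_trans (le_of_eq ?_) (int_upper c (m := (M:ℝ)/10^5) (r := (B.r:ℝ)/10^5) (C := (bZ B:ℝ)/10^9 * (((B.f + 1 + 14200 * B.r : ℕ):ℝ)/10^9)) (by positivity) ?_)
    · unfold gB; push_cast; ring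
    · intro β hβ
      obtain ⟨k1, k2, k3, k4, k5, k6⟩ := box_ff P hβ
      gcongr) l a ha hl he
  rw [sumB_cast, intervalIntegral.integral_neg] at this
  have z : ∀ l : List Bx, sumB (fun _ => 0) l = 0 := by intro l; induction l <;> simp_all [sumB]
  rw [z] at this
  norm_num at this ⊢
  linarith

lemma g4_lower {sg : Bool} (l : List Bx) (a : ℕ) (ha : 0 < a)
    (hl : rowsOK sg a l = true) (he : endp a l ≤ 314159) :
    ∫ β in ((a:ℝ)/10^5)..((endp a l:ℝ)/10^5), dz β * |ff β| * z₁ β ^ 4 ≤ (sumB g4 l:ℝ)/10^59 := by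
  have c2 := dz_cont; have c3 := ff_cont; have c1 := z1_cont
  have c : Continuous (fun β => dz β * |ff β| * z₁ β ^ 4) := by fun_prop
  have := list_gen (F := fun β => - (dz β * |ff β| * z₁ β ^ 4)) c.neg.continuousOn (sg := sg) (g := fun B => ((0:ℕ):ℝ)/10^59 - (g4 B:ℝ)/10^59 - 0 * ((0:ℕ):ℝ)) (by
    rintro M B P
    refine le_trans (le_of_eq ?_) (int_upper c (m := (M:ℝ)/10^5) (r := (B.r:ℝ)/10^5) (C := (bZ B:ℝ)/10^9 * (((B.f + 1 + 14200 * B.r : ℕ):ℝ)/10^9) * (((B.x + 1 + bD B : ℕ):ℝ)/10^9)^4) (by positivity) ?_)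
    · unfold g4; push_cast; ring
    · intro β hβ
      obtain ⟨k1, k2, k3, k4, k5, k6⟩ := box_ff P hβ
      gcongr) l a ha hl he
  rw [sumB_cast, intervalIntegral.integral_neg] at this
  have z : ∀ l : List Bx, sumB (fun _ => 0) l = 0 := by intro l; induction l <;> simp_all [sumB]
  rw [z] at this
  norm_num at this ⊢
  linarith

set_option maxRecDepth 100000
lemma tab1_ok : rowsOK true 10000 tab1 = true ∧ endp 10000 tab1 = 94062 := by decide +kernel
lemma tab2_ok : rowsOK false 94062 tab2 = true ∧ endp 94062 tab2 = 236656 := by decide +kernel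
lemma tab3_ok : rowsOK true 236656 tab3 = true ∧ endp 236656 tab3 = 314150 := by decide +kernel

set_option maxRecDepth 100000

def cst (sp : Bool) : ℕ := match sp with
  | true => 8116420
  | false => 52660940
def sliceOK (sp : Bool) (h0 h1 : ℕ) : Bool :=
  Nat.ble (sumB (bn true sp h0 h1) tab1 + sumB (bn false sp h0 h1) tab2 + sumB (bn true sp h0 h1) tab3
    + (58 * 12526239221 * 10^23 / (3 * h0^4) + 1) + (38 * 10^25 / (16641 * h0^2) + 1) + 2 * h1 * cst sp * 10^0 + 1)
    (sumB (bp true sp h0 h1) tab1 + sumB (bp false sp h0 h1) tab2 + sumB (bp true sp h0 h1) tab3)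
def chainOK (sp : Bool) : List ℕ → Bool
  | [] => true
  | [_] => true
  | a :: b :: l => sliceOK sp b a && Nat.ble 250000 b && Nat.ble a 648000 && chainOK sp (b :: l)

def chain1 : List ℕ := [648000, 647755, 647402, 646969, 646344, 645442, 644335]
def chain2 : List ℕ := [644335, 642737, 640429, 637596, 633503, 627589, 620326, 609832]
def chain3 : List ℕ := [609832, 594669, 576046, 549136, 510252, 454066, 372878, 273160, 250000]
def chain4 : List ℕ := [648000, 638553, 624781, 604702, 575428, 532748, 470522, 379798, 260752, 250000]

lemma chain1_ok : chainOK true chain1 = true := by decide +kernel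
lemma chain2_ok : chainOK true chain2 = true := by decide +kernel
lemma chain3_ok : chainOK true chain3 = true := by decide +kernel
lemma chain4_ok : chainOK false chain4 = true := by decide +kernel

lemma r3_ok : sumB (fun B => B.r^3) tab1 + sumB (fun B => B.r^3) tab2 + sumB (fun B => B.r^3) tab3 = 12526239221 := by decide +kernel
lemma pos_ok : sumB gB tab1 + sumB gB tab3 ≤ 2359 * 10^19 := by decide +kernel
lemma neg_ok : sumB gB tab2 ≤ 6132 * 10^19 := by decide +kernel
lemma neg4_ok : sumB g4 tab2 ≤ 5361 * 10^55 := by decide +kernel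
lemma sign_ok : (tab2.all (fun B => Nat.ble (14200 * B.r) B.f)) = true := by decide +kernel


lemma ff_ge {α : ℝ} (h : 0 ≤ α) (s0 : 0 ≤ Real.sin α) (s1 : Real.sin α ≤ 0.1) : 0.5 * Real.sin α ≤ ff α := by
  have e : ff α = 3/π * (Real.sin α * (1 - 4/3 * Real.sin α ^ 2 - 2/5 * (bu (-2) α + bu 2 α))) := by
    unfold ff gg; rw [Real.sin_three_mul]; ring
  have h1 := far0 α h
  have h2 := bu_le 2 α
  have h3 : 0.57 ≤ 1 - 4/3 * Real.sin α ^ 2 - 2/5 * (bu (-2) α + bu 2 α) := by nlinarith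
  have h4 : 0.95 ≤ 3/π := by
    rw [le_div_iff₀ Real.pi_pos]; linarith [Real.pi_lt_d2]
  rw [e]
  calc 0.5 * Real.sin α ≤ 0.95 * (Real.sin α * 0.57) := by nlinarith
    _ ≤ _ := by gcongr

lemma dz_small {β : ℝ} (h0 : 0 ≤ β) (h1 : β ≤ 0.1) : dz β ≤ 0.51 * β^2 := by
  have c := Real.one_sub_sq_div_two_le_cos (x := β)
  have e : 1 - β^2/10000 ≤ ee β := by
    have := Real.add_one_le_exp (-(1/10000) * β^2)
    unfold ee; linarith
  have e1 := ee_le β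
  have s := Real.sin_le h0
  have s0 : 0 ≤ Real.sin β := Real.sin_nonneg_of_nonneg_of_le_pi h0 (by linarith [Real.pi_gt_three])
  have hs : β * Real.sin β * ee β ≤ β^2 := by
    have : β * Real.sin β ≤ β * β := by gcongr
    have := ee_pos β
    nlinarith [mul_nonneg h0 s0]
  have hc : (1 - β^2/2) * (1 - β^2/10000) ≤ Real.cos β * ee β := by
    have : β^2 ≤ 0.01 := by nlinarith
    apply mul_le_mul c e (by nlinarith) (by nlinarith)
  unfold dz
  nlinarith [sq_nonneg (β^2)]

lemma JJ_bd {c x d : ℝ} (hd : 0 < d) (hc : d ≤ c) (hx : 0 ≤ x) : 0 ≤ JJ c x ∧ JJ c x ≤ 1/d^2 := by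
  have hc0 : 0 < c := hd.trans_le hc
  unfold JJ
  refine ⟨by positivity, ?_⟩
  rw [div_le_div_iff₀ (by positivity) (by positivity)]
  have h1 : 2 * c * x ≤ c^2 + x^2 := by nlinarith [sq_nonneg (c - x)]
  have h2 : d^2 ≤ c^2 + x^2 := by nlinarith
  rw [one_mul, sq (c^2 + x^2)]
  exact mul_le_mul h1 h2 (by positivity) (by positivity)

lemma JJd_bd {h β σ : ℝ} (h0 : 0 < h) (hb : 0 ≤ β) (hσ : |σ| ≤ 1) :
    |σ * (JJ (2*h - h * ff β) (z₁ β) - JJ (2*h + h * ff β) (z₁ β))| ≤ 1/(1.29*h)^2 := by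
  have f := abs_le.1 (ff_bd hb)
  have x := z1_nonneg hb
  obtain ⟨a1, a2⟩ := JJ_bd (c := 2*h - h * ff β) (d := 1.29*h) (by positivity) (by nlinarith) x
  obtain ⟨b1, b2⟩ := JJ_bd (c := 2*h + h * ff β) (d := 1.29*h) (by positivity) (by nlinarith) x
  rw [abs_mul]
  have : |JJ (2*h - h * ff β) (z₁ β) - JJ (2*h + h * ff β) (z₁ β)| ≤ 1/(1.29*h)^2 := by
    rw [abs_le]; constructor <;> linarith
  nlinarith [abs_nonneg σ, abs_nonneg (JJ (2*h - h * ff β) (z₁ β) - JJ (2*h + h * ff β) (z₁ β))]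

lemma sin_v {h β : ℝ} (h0 : 0 < h) (hh : h ≤ 0.648) (hb : 0 ≤ β) (s0 : 0 ≤ Real.sin β) (s1 : Real.sin β ≤ 0.1) :
    0 ≤ Real.sin (h * ff β) ∧ 0.4 * h * Real.sin β ≤ Real.sin (h * ff β) := by
  have f := ff_ge hb s0 s1
  have f1 := (abs_le.1 (ff_bd hb)).2
  have v0 : 0 ≤ h * ff β := mul_nonneg h0.le (by linarith)
  have v1 : h * ff β ≤ 0.5 := by nlinarith
  have := Real.sin_ge_sub_cube v0
  have k : 0.8 * (h * ff β) ≤ Real.sin (h * ff β) := by nlinarith [sq_nonneg (h * ff β)]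
  have k2 : h * (0.5 * Real.sin β) ≤ h * ff β := by gcongr
  exact ⟨by linarith, by linarith⟩

lemma pp_nonneg {x v : ℝ} (hx : 0 ≤ x) (hv : 0 ≤ Real.sin v) : 0 ≤ pp x v := by
  unfold pp
  have := Real.sinh_nonneg_iff.2 hx
  have h1 := Real.sin_le_one v
  have : 0 ≤ 2 + Real.sinh x ^ 2 - Real.sin v ^ 2 := by nlinarith
  positivity

lemma pp_le {x v : ℝ} (hx : 0 ≤ x) (hv : 0 < Real.sin v) : pp x v ≤ (2 + Real.sinh x ^ 2) / Real.sin v ^ 2 := by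
  unfold pp
  have hs := Real.sinh_nonneg_iff.2 hx
  set a := Real.sinh x
  set b := Real.sin v
  rw [div_le_div_iff₀ (by positivity) (by positivity)]
  have h1 : 2 * a * b ≤ a^2 + b^2 := by nlinarith [sq_nonneg (a - b)]
  have h2 : 2 * a * b * b^2 ≤ (a^2 + b^2) * (a^2+b^2) := mul_le_mul h1 (by nlinarith) (by positivity) (by positivity)
  have h3 : 2 * a * b * (2 + a^2 - b^2) ≤ 2 * a * b * (2 + a^2) := by gcongr; nlinarith
  calc _ ≤ 2 * a * b * (2 + a^2) * b^2 := by gcongr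
    _ = (2 + a^2) * (2 * a * b * b^2) := by ring
    _ ≤ (2 + a^2) * ((a^2 + b^2) * (a^2+b^2)) := by gcongr
    _ = _ := by ring

lemma sinh_one_le {x : ℝ} (h0 : 0 ≤ x) (h1 : x ≤ 0.5) : Real.sinh x ≤ 1 := by
  rw [Real.sinh_eq]
  have a := Real.abs_exp_sub_one_sub_id_le (x := x) (by rw [abs_of_nonneg h0]; linarith)
  have b := Real.exp_pos (-x)
  have := (abs_le.1 a).2
  nlinarith

lemma sin_lin {β : ℝ} (h0 : 0 ≤ β) (h1 : β ≤ 0.1) : 0.9 * β ≤ Real.sin β ∧ Real.sin β ≤ 0.1 := by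
  have := Real.sin_ge_sub_cube h0
  have := Real.sin_le h0
  constructor
  · nlinarith [sq_nonneg β]
  · linarith

/-- boundedness near zero -/
lemma Fs_bd {h σ β : ℝ} (h0 : 0 < h) (hh : h ≤ 0.648) (hσ : |σ| ≤ 1) (b0 : 0 < β) (b1 : β ≤ 0.1) :
    |Fs h σ β| ≤ 20/h^2 + 2.01 * (1/(1.29*h)^2) := by
  obtain ⟨l0, l1⟩ := sin_lin b0.le b1
  have s0 : 0 ≤ Real.sin β := by linarith
  obtain ⟨k0, k1⟩ := sin_v h0 hh b0.le s0 l1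
  have j := JJd_bd h0 b0.le hσ
  have x0 := z1_nonneg b0.le
  have x1 : z₁ β ≤ 0.5 := by
    show β - Real.sin β * ee β ≤ _
    have := ee_pos β; nlinarith
  have d0 := dz_nonneg b0.le (by linarith [Real.pi_gt_three])
  have d1 := dz_small b0.le b1
  have d2 := dz_le b0.le (by linarith)
  have sv : 0 < 0.36 * h * β := by positivity
  have svl : 0.36 * h * β ≤ Real.sin (h * ff β) := by
    refine le_trans ?_ k1
    have : h * (0.9 * β) ≤ h * Real.sin β := by gcongr
    linarith
  have p0 := pp_nonneg x0 k0
  have p1 := pp_le x0 (sv.trans_le svl)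
  have p2 : pp (z₁ β) (h * ff β) ≤ 3 / (0.36 * h * β)^2 := by
    refine p1.trans ?_
    have := sinh_one_le x0 x1
    have := Real.sinh_nonneg_iff.2 x0
    gcongr
    nlinarith
  have p3 : dz β * pp (z₁ β) (h * ff β) ≤ 20 / h^2 := by
    calc _ ≤ (0.51 * β^2) * (3 / (0.36 * h * β)^2) := by gcongr
      _ = (0.51 * 3 / 0.36^2) / h^2 := by field_simp
      _ ≤ _ := by gcongr; norm_num
  unfold Fs
  rw [mul_add]
  refine (abs_add_le _ _).trans (add_le_add ?_ ?_)
  · rw [abs_of_nonneg (by positivity)]; exact p3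
  · rw [abs_mul, abs_of_nonneg d0]; gcongr

lemma Fs_int0 {h σ : ℝ} (h0 : 0 < h) (hh : h ≤ 0.648) (hσ : |σ| ≤ 1) : IntervalIntegrable (Fs h σ) volume 0 0.1 := by
  rw [intervalIntegrable_iff_integrableOn_Ioc_of_le (by norm_num)]
  have : IsFiniteMeasure (volume.restrict (Set.Ioc (0:ℝ) 0.1)) := ⟨by simp⟩
  refine Integrable.of_bound (C := 20/h^2 + 2.01 * (1/(1.29*h)^2)) ?_ ?_
  · exact ((Fs_cont h σ).mono (fun x hx => hx.1)).aestronglyMeasurable measurableSet_Ioc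
  · rw [ae_restrict_iff' measurableSet_Ioc]
    exact Filter.Eventually.of_forall (fun β hβ => Fs_bd h0 hh hσ hβ.1 hβ.2)

lemma Fs_int1 {h σ a b : ℝ} (ha : 0 < a) (hb : a ≤ b) : IntervalIntegrable (Fs h σ) volume a b := by
  apply ContinuousOn.intervalIntegrable
  apply (Fs_cont h σ).mono; rw [Set.uIcc_of_le hb]; intro x hx; exact lt_of_lt_of_le ha hx.1

lemma Fs_end {h σ β : ℝ} (h0 : 0 < h) (hh : h ≤ 0.648) (hσ : |σ| ≤ 1) (hb : 0 ≤ β) (hb1 : β ≤ π) (s1 : Real.sin β ≤ 0.1) :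
    - (1/(1.29*h)^2 * dz β) ≤ Fs h σ β := by
  have s0 : 0 ≤ Real.sin β := Real.sin_nonneg_of_nonneg_of_le_pi hb hb1
  obtain ⟨k0, k1⟩ := sin_v h0 hh hb s0 s1
  have j := (abs_le.1 (JJd_bd h0 hb hσ)).1
  have p0 := pp_nonneg (z1_nonneg hb) k0
  have d0 := dz_nonneg hb hb1
  unfold Fs
  nlinarith

lemma int_dz (a b : ℝ) : ∫ β in a..b, dz β = z₁ b - z₁ a :=
  intervalIntegral.integral_eq_sub_of_hasDerivAt (fun x _ => z1_deriv x) (dz_cont.intervalIntegrable _ _)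

lemma dz_end : (∫ β in (0:ℝ)..0.1, dz β) + ∫ β in (3.1415:ℝ)..π, dz β ≤ 0.00038 := by
  have h1 : ∫ β in (3.1415:ℝ)..π, dz β ≤ ∫ β in (3.1415:ℝ)..π, (2.01:ℝ) := by
    apply intervalIntegral.integral_mono_on (by linarith [Real.pi_gt_d6]) (dz_cont.intervalIntegrable _ _) (by simp)
    intro x hx
    exact dz_le (by linarith [hx.1]) (by linarith [hx.2, Real.pi_lt_d2])
  rw [intervalIntegral.integral_const, smul_eq_mul] at h1
  have h2 : z₁ 0 = 0 := by simp [z₁]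
  have s := Real.sin_ge_sub_cube (x := 0.1) (by norm_num)
  have e : 1 - 0.1^2/10000 ≤ ee 0.1 := by
    have := Real.add_one_le_exp (-(1/10000) * (0.1:ℝ)^2)
    unfold ee; linarith
  have h3 : z₁ 0.1 ≤ 0.00017 := by
    show 0.1 - Real.sin 0.1 * ee 0.1 ≤ _
    have : (0.1 - 0.1^3/6) * (1 - 0.1^2/10000) ≤ Real.sin 0.1 * ee 0.1 := mul_le_mul s e (by norm_num) (le_trans (by norm_num) s)
    norm_num at this ⊢
    linarith
  rw [int_dz, h2]
  linarith [Real.pi_lt_d6]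

lemma sin_end {β : ℝ} (h : 3.1415 ≤ β) (h1 : β ≤ π) : Real.sin β ≤ 0.1 := by
  rw [← Real.sin_pi_sub]
  have := Real.sin_le (x := π - β) (by linarith)
  linarith [Real.pi_lt_d6]

lemma Fs_split {h : ℝ} (sp : Bool) (h0 : 0 < h) (hh : h ≤ 0.648) :
    (∫ β in ((10000:ℕ):ℝ)/10^5..((94062:ℕ):ℝ)/10^5, Fs h (sgn sp) β) + (∫ β in ((94062:ℕ):ℝ)/10^5..((236656:ℕ):ℝ)/10^5, Fs h (sgn sp) β)
     + (∫ β in ((236656:ℕ):ℝ)/10^5..((314150:ℕ):ℝ)/10^5, Fs h (sgn sp) β) - 0.00038 * (1/(1.29*h)^2) ≤ ∫ β in (0:ℝ)..π, Fs h (sgn sp) β := by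
  have hσ : |sgn sp| ≤ 1 := by cases sp <;> simp [sgn]
  have hp := Real.pi_gt_d6
  have hp2 := Real.pi_lt_d2
  have c1 : ((10000:ℕ):ℝ)/10^5 = 0.1 := by norm_num
  have c2 : ((314150:ℕ):ℝ)/10^5 = 3.1415 := by norm_num
  rw [c1, c2]
  rw [intervalIntegral.integral_add_adjacent_intervals (Fs_int1 (by norm_num) (by norm_num)) (Fs_int1 (by norm_num) (by norm_num)),
    intervalIntegral.integral_add_adjacent_intervals (Fs_int1 (by norm_num) (by norm_num)) (Fs_int1 (by norm_num) (by norm_num))]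
  rw [← intervalIntegral.integral_add_adjacent_intervals (a := 0) (b := 0.1) (c := π) (Fs_int0 h0 hh hσ) (Fs_int1 (by norm_num) (by linarith)),
    ← intervalIntegral.integral_add_adjacent_intervals (a := 0.1) (b := 3.1415) (c := π) (Fs_int1 (by norm_num) (by norm_num)) (Fs_int1 (by norm_num) (by linarith))]
  have d : Continuous (fun β => - (1/(1.29*h)^2 * dz β)) := by have := dz_cont; fun_prop
  have e1 : ∫ β in (0:ℝ)..0.1, - (1/(1.29*h)^2 * dz β) ≤ ∫ β in (0:ℝ)..0.1, Fs h (sgn sp) β := by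
    apply intervalIntegral.integral_mono_on_of_le_Ioo (by norm_num) (d.intervalIntegrable _ _) (Fs_int0 h0 hh hσ)
    intro x hx
    exact Fs_end h0 hh hσ hx.1.le (by linarith [hx.2]) (sin_lin hx.1.le hx.2.le).2
  have e2 : ∫ β in (3.1415:ℝ)..π, - (1/(1.29*h)^2 * dz β) ≤ ∫ β in (3.1415:ℝ)..π, Fs h (sgn sp) β := by
    apply intervalIntegral.integral_mono_on (by linarith) (d.intervalIntegrable _ _) (Fs_int1 (by norm_num) (by linarith))
    intro x hx
    exact Fs_end h0 hh hσ (by linarith [hx.1]) hx.2 (sin_end hx.1 hx.2)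
  rw [intervalIntegral.integral_neg, intervalIntegral.integral_const_mul] at e1 e2
  have := dz_end
  have q : 0 ≤ 1/(1.29*h)^2 := by positivity
  nlinarith

lemma slice_sound {sp : Bool} {h : ℝ} {h0 h1 : ℕ} (T : HT h h0 h1) (hs : sliceOK sp h0 h1 = true) :
    2 * h * ((cst sp:ℝ)/10^8) < ∫ β in (0:ℝ)..π, Fs h (sgn sp) β := by
  have l1 := slice_lower (sp := sp) T tab1 10000 (by norm_num) tab1_ok.1 (by rw [tab1_ok.2]; norm_num)
  have l2 := slice_lower (sp := sp) T tab2 94062 (by norm_num) tab2_ok.1 (by rw [tab2_ok.2]; norm_num)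
  have l3 := slice_lower (sp := sp) T tab3 236656 (by norm_num) tab3_ok.1 (by rw [tab3_ok.2]; norm_num)
  rw [tab1_ok.2] at l1
  rw [tab2_ok.2] at l2
  rw [tab3_ok.2] at l3
  obtain ⟨hl, hu, ha, hb⟩ := T
  have hb' : (h1:ℝ) ≤ 648000 := by exact_mod_cast hb
  have ha' : (250000:ℝ) ≤ h0 := by exact_mod_cast ha
  have h0p : 0 < h := lt_of_lt_of_le (by positivity) hl
  have hh : h ≤ 0.648 := hu.trans (by rw [div_le_iff₀ (by norm_num)]; linarith)
  refine lt_of_lt_of_le ?_ (Fs_split sp h0p hh)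
  have r3 : ((sumB (fun B => B.r^3) tab1 : ℕ):ℝ) + ((sumB (fun B => B.r^3) tab2 : ℕ):ℝ) + ((sumB (fun B => B.r^3) tab3 : ℕ):ℝ) = 12526239221 := by
    exact_mod_cast r3_ok
  unfold sliceOK at hs
  have hs := ble_cast hs
  obtain ⟨_, t1⟩ := div_bd (58 * 12526239221 * 10^23) (3 * h0^4) (by positivity)
  obtain ⟨_, t2⟩ := div_bd (38 * 10^25) (16641 * h0^2) (by positivity)
  generalize 58 * 12526239221 * 10^23 / (3 * h0^4) = N1 at *
  generalize 38 * 10^25 / (16641 * h0^2) = N2 at *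
  generalize (sumB (fun B => B.r^3) tab1 : ℕ) = R1 at *
  generalize (sumB (fun B => B.r^3) tab2 : ℕ) = R2 at *
  generalize (sumB (fun B => B.r^3) tab3 : ℕ) = R3 at *
  generalize sumB (bp true sp h0 h1) tab1 = P1 at *
  generalize sumB (bp false sp h0 h1) tab2 = P2 at *
  generalize sumB (bp true sp h0 h1) tab3 = P3 at *
  generalize sumB (bn true sp h0 h1) tab1 = n1 at *
  generalize sumB (bn false sp h0 h1) tab2 = n2 at *
  generalize sumB (bn true sp h0 h1) tab3 = n3 at *
  generalize cst sp = c at *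
  push_cast at hs t1 t2
  have b1 : 58/h^4/(3*10^15) * 12526239221 ≤ ((N1:ℝ)+1)/10^14 := by
    rw [le_div_iff₀ (by norm_num)]
    refine le_trans ?_ t1
    calc _ ≤ 58/((h0:ℝ)/10^6)^4/(3*10^15) * 12526239221 * 10^14 := by gcongr
      _ = _ := by field_simp; norm_num
  have b2 : 0.00038 * (1/(1.29*h)^2) ≤ ((N2:ℝ)+1)/10^14 := by
    rw [le_div_iff₀ (by norm_num)]
    refine le_trans ?_ t2
    calc _ ≤ 0.00038 * (1/(1.29*((h0:ℝ)/10^6))^2) * 10^14 := by gcongr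
      _ = _ := by field_simp; norm_num
  have b3 : 2 * h * ((c:ℝ)/10^8) ≤ (2 * h1 * c)/10^14 := by
    calc _ ≤ 2 * ((h1:ℝ)/10^6) * ((c:ℝ)/10^8) := by gcongr
      _ = _ := by ring
  have r3' : 58/h^4/(3*10^15) * (R1:ℝ) + 58/h^4/(3*10^15) * (R2:ℝ) + 58/h^4/(3*10^15) * (R3:ℝ) = 58/h^4/(3*10^15) * 12526239221 := by
    rw [← r3]; ring
  have hs' : ((n1:ℝ) + n2 + n3 + (N1 + 1) + (N2 + 1) + 2 * h1 * c + 1)/10^14 ≤ (P1 + P2 + P3)/10^14 := by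
    apply div_le_div_of_nonneg_right _ (by norm_num)
    linarith
  simp only [add_div] at hs' b1 b2
  have : (0:ℝ) < 1/10^14 := by norm_num
  linarith

lemma chainOK_cons (sp : Bool) (a b : ℕ) (l : List ℕ) :
    chainOK sp (a :: b :: l) = (sliceOK sp b a && Nat.ble 250000 b && Nat.ble a 648000 && chainOK sp (b :: l)) := by
  rw [chainOK]

lemma chain_sound {sp : Bool} {h : ℝ} (L : List ℕ) : ∀ (a : ℕ), chainOK sp (a :: L) = true → h ≤ (a:ℝ)/10^6 →
    ((L.getLastD a : ℕ):ℝ)/10^6 < h → 2 * h * ((cst sp:ℝ)/10^8) < ∫ β in (0:ℝ)..π, Fs h (sgn sp) β := by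
  induction L with
  | nil => intro a _ h1 h2; exact absurd (h1.trans_lt h2) (lt_irrefl _)
  | cons b L ih =>
    intro a hc h1 h2
    rw [chainOK_cons] at hc
    have c4 := (Bool.and_eq_true _ _ ▸ hc).2
    have hc := (Bool.and_eq_true _ _ ▸ hc).1
    have c3 := (Bool.and_eq_true _ _ ▸ hc).2
    have hc := (Bool.and_eq_true _ _ ▸ hc).1
    have c2 := (Bool.and_eq_true _ _ ▸ hc).2
    have c1 := (Bool.and_eq_true _ _ ▸ hc).1
    rcases le_total ((b:ℝ)/10^6) h with q | q
    · exact slice_sound ⟨q, h1, Nat.le_of_ble_eq_true c2, Nat.le_of_ble_eq_true c3⟩ c1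
    · exact ih b c4 q (by rwa [List.getLastD_cons] at h2)

theorem A_plus {h : ℝ} (h0 : 0.25 < h) (hh : h < 0.648) : 2 * h * 0.0811642 < ∫ β in (0:ℝ)..π, Fs h 1 β := by
  have e1 : sgn true = 1 := by simp [sgn]
  have e2 : (cst true:ℝ)/10^8 = 0.0811642 := by simp only [cst]; norm_num
  rw [← e1, ← e2]
  rcases lt_or_ge (0.644335) h with q | q
  · exact chain_sound _ _ chain1_ok (by norm_num; linarith) (by simp; norm_num at q ⊢; linarith)
  · rcases lt_or_ge (0.609832) h with q' | q'
    · exact chain_sound _ _ chain2_ok (by norm_num at q ⊢; linarith) (by simp; norm_num at q' ⊢; linarith)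
    · exact chain_sound _ _ chain3_ok (by norm_num at q' ⊢; linarith) (by simp; norm_num at h0 ⊢; linarith)

theorem A_minus {h : ℝ} (h0 : 0.25 < h) (hh : h < 0.648) : 2 * h * 0.5266094 < ∫ β in (0:ℝ)..π, Fs h (-1) β := by
  have e1 : sgn false = -1 := by simp [sgn]
  have e2 : (cst false:ℝ)/10^8 = 0.5266094 := by simp only [cst]; norm_num
  rw [← e1, ← e2]
  exact chain_sound _ _ chain4_ok (by norm_num; linarith) (by simp; norm_num at h0 ⊢; linarith)


lemma cos_ge_six {x : ℝ} (hx : 0 ≤ x) : 1 - x^2/2 + x^4/24 - x^6/720 ≤ Real.cos x := by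
  have h : MonotoneOn (fun t : ℝ => Real.cos t - (1 - t^2/2 + t^4/24 - t^6/720)) (Set.Ici 0) := by
    apply monotoneOn_of_hasDerivWithinAt_nonneg (f' := fun t => -Real.sin t - (0 - 2*t/2 + 4*t^3/24 - 6*t^5/720)) (convex_Ici 0)
    · fun_prop
    · intro t ht
      apply HasDerivAt.hasDerivWithinAt
      have h2 := (hasDerivAt_pow 2 t).div_const 2
      have h4 := (hasDerivAt_pow 4 t).div_const 24
      have h6 := (hasDerivAt_pow 6 t).div_const 720
      refine ((Real.hasDerivAt_cos t).sub ((((hasDerivAt_const t (1:ℝ)).sub h2).add h4).sub h6)).congr_deriv ?_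
      norm_num
    · intro t ht
      rw [interior_Ici] at ht
      have := sin_le_five (le_of_lt ht)
      linarith
  have := h (Set.mem_Ici.2 le_rfl) (Set.mem_Ici.2 hx) hx
  simp at this
  linarith

lemma sinh_le_mul_cosh {x : ℝ} (hx : 0 ≤ x) : Real.sinh x ≤ x * Real.cosh x := by
  have h : MonotoneOn (fun t : ℝ => t * Real.cosh t - Real.sinh t) (Set.Ici 0) := by
    apply monotoneOn_of_hasDerivWithinAt_nonneg (f' := fun t => t * Real.sinh t) (convex_Ici 0)
    · fun_prop
    · intro t ht
      apply HasDerivAt.hasDerivWithinAt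
      refine (((hasDerivAt_id t).mul (Real.hasDerivAt_cosh t)).sub (Real.hasDerivAt_sinh t)).congr_deriv ?_
      simp
    · intro t ht
      rw [interior_Ici] at ht
      exact mul_nonneg (le_of_lt ht) (Real.sinh_nonneg_iff.2 (le_of_lt ht))
  have := h (Set.mem_Ici.2 le_rfl) (Set.mem_Ici.2 hx) hx
  simp at this
  linarith

lemma sinh_le_cusa {x : ℝ} (hx : 0 ≤ x) : Real.sinh x ≤ x * (2 + Real.cosh x) / 3 := by
  have h : MonotoneOn (fun t : ℝ => t * (2 + Real.cosh t) / 3 - Real.sinh t) (Set.Ici 0) := by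
    apply monotoneOn_of_hasDerivWithinAt_nonneg (f' := fun t => (2 - 2 * Real.cosh t + t * Real.sinh t) / 3) (convex_Ici 0)
    · fun_prop
    · intro t ht
      apply HasDerivAt.hasDerivWithinAt
      refine ((((hasDerivAt_id t).mul ((Real.hasDerivAt_cosh t).const_add 2)).div_const 3).sub (Real.hasDerivAt_sinh t)).congr_deriv ?_
      simp; ring
    · intro t ht
      rw [interior_Ici] at ht
      have ht : 0 < t := ht
      have k := sinh_le_mul_cosh (x := t/2) (by positivity)
      have s := Real.sinh_nonneg_iff.2 (show 0 ≤ t/2 by positivity)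
      have e : t = 2 * (t/2) := by ring
      have e1 : Real.cosh t = Real.cosh (t/2)^2 + Real.sinh (t/2)^2 := by rw [← Real.cosh_two_mul, ← e]
      have e2 : Real.sinh t = 2 * Real.sinh (t/2) * Real.cosh (t/2) := by rw [← Real.sinh_two_mul, ← e]
      have e3 := Real.cosh_sq (t/2)
      show 0 ≤ (2 - 2 * Real.cosh t + t * Real.sinh t) / 3
      rw [e1, e2, e3]
      nlinarith
  have := h (Set.mem_Ici.2 le_rfl) (Set.mem_Ici.2 hx) hx
  simp at this
  linarith

noncomputable def WW (h K y : ℝ) : ℝ :=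
  (2 * y * Real.cosh (y * (π / 2 - h)) ^ 2 - 2 * Real.cosh (y * (π / 2 - h)) * Real.sinh (y * h) / Real.tan h / Real.cosh (y * π / 2))
    / (Real.sinh (π * y) + K * Real.sinh (2 * h * y))
noncomputable def DD (h K y : ℝ) : ℝ := WW h K y - y * Real.exp (-(2 * h * y))
noncomputable def GG (h y : ℝ) : ℝ := 2 * Real.cosh (y * (π / 2 - h)) * Real.sinh (y * h) / Real.cosh (y * π / 2)
noncomputable def MM (h y : ℝ) : ℝ := y * (1 + Real.exp (-(π * y)) * Real.cosh (2 * h * y)) - GG h y / Real.tan h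

lemma den_pos {h K y : ℝ} (h0 : 0 < h) (hh : h ≤ 0.648) (hK : |K| < 1) (hy : 0 < y) :
    0 < Real.sinh (π * y) ∧ 0 ≤ Real.sinh (2 * h * y) ∧ 2 * Real.sinh (2 * h * y) ≤ Real.sinh (π * y)
    ∧ 0 < Real.sinh (π * y) + K * Real.sinh (2 * h * y) := by
  have p := Real.pi_gt_three
  have a1 : 0 < Real.sinh (π * y) := Real.sinh_pos_iff.2 (by positivity)
  have a2 : 0 ≤ Real.sinh (2 * h * y) := Real.sinh_nonneg_iff.2 (by positivity)
  have a3 : 2 * Real.sinh (2 * h * y) ≤ Real.sinh (π * y) := by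
    calc _ ≤ 2 * Real.sinh (2 * h * y) * Real.cosh (2 * h * y) := by
          nlinarith [Real.one_le_cosh (2 * h * y)]
      _ = Real.sinh (2 * (2 * h * y)) := by rw [Real.sinh_two_mul]
      _ ≤ _ := Real.sinh_le_sinh.2 (by nlinarith)
  refine ⟨a1, a2, a3, ?_⟩
  have := (abs_lt.1 hK).1
  nlinarith

lemma DD_eq {h K y : ℝ} (h0 : 0 < h) (hh : h ≤ 0.648) (hK : |K| < 1) (hy : 0 < y) :
    DD h K y = (MM h y - K * (y * (1 - Real.exp (-(4 * h * y))) / 2)) / (Real.sinh (π * y) + K * Real.sinh (2 * h * y)) := by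
  obtain ⟨a1, a2, a3, a4⟩ := den_pos h0 hh hK hy
  rw [eq_div_iff a4.ne']
  unfold DD WW
  rw [sub_mul, div_mul_cancel₀ _ a4.ne']
  have hc := (Real.cosh_pos (y * π / 2)).ne'
  have e1 : 2 * Real.cosh (y * (π / 2 - h)) * Real.sinh (y * h) / Real.tan h / Real.cosh (y * π / 2) = GG h y / Real.tan h := by
    unfold GG; rw [div_right_comm]
  rw [e1]
  unfold MM
  have e2 : 2 * y * Real.cosh (y * (π / 2 - h)) ^ 2 = y * (1 + Real.cosh (π * y - 2 * h * y)) := by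
    have : π * y - 2 * h * y = 2 * (y * (π / 2 - h)) := by ring
    rw [this, Real.cosh_two_mul, Real.sinh_sq]; ring
  rw [e2]
  have e3 : Real.exp (-(π * y)) * Real.cosh (2 * h * y) = Real.cosh (π * y - 2 * h * y) - Real.exp (-(2 * h * y)) * Real.sinh (π * y) := by
    simp only [Real.cosh_eq, Real.sinh_eq]
    rw [show π * y - 2 * h * y = π * y + -(2 * h * y) by ring, neg_add, neg_neg, Real.exp_add, Real.exp_add]
    ring
  have e4 : Real.exp (-(2 * h * y)) * Real.sinh (2 * h * y) = (1 - Real.exp (-(4 * h * y))) / 2 := by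
    rw [Real.sinh_eq, mul_div_assoc', mul_sub, ← Real.exp_add, ← Real.exp_add]
    congr 2
    · simp
    · congr 1; ring
  rw [e3]
  linear_combination (-K * y) * e4

lemma GG_le {h y : ℝ} (h0 : 0 < h) (hh : h ≤ 0.648) (hy : 0 < y) : GG h y ≤ 2 * (h * y) := by
  have p := Real.pi_gt_three
  unfold GG
  rw [div_le_iff₀ (Real.cosh_pos _)]
  have e : y * π / 2 = y * (π/2 - h) + y * h := by ring
  rw [e, Real.cosh_add]
  have s : 0 ≤ Real.sinh (y * h) := Real.sinh_nonneg_iff.2 (by positivity)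
  have s2 : 0 ≤ Real.sinh (y * (π/2 - h)) := Real.sinh_nonneg_iff.2 (mul_nonneg hy.le (by linarith))
  have t : Real.sinh (y * h) ≤ y * h * Real.cosh (y * h) := sinh_le_mul_cosh (by positivity)
  have c := Real.cosh_pos (y * (π/2 - h))
  have k1 : Real.cosh (y * (π/2 - h)) * Real.sinh (y * h) ≤ Real.cosh (y * (π/2 - h)) * (y * h * Real.cosh (y * h)) := by gcongr
  have k2 : 0 ≤ h * y * (Real.sinh (y * (π/2 - h)) * Real.sinh (y * h)) := by positivity
  linarith

lemma GG_ge {h y : ℝ} (h0 : 0 < h) (hh : h ≤ 0.648) (hy : 0 < y) : 1 - Real.exp (-(2 * h * y)) ≤ GG h y := by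
  have s : 0 ≤ Real.sinh (y * h) := Real.sinh_nonneg_iff.2 (by positivity)
  unfold GG
  rw [le_div_iff₀ (Real.cosh_pos _)]
  have e : 1 - Real.exp (-(2 * h * y)) = 2 * Real.sinh (y * h) * Real.exp (-(y * h)) := by
    rw [Real.sinh_eq, mul_div_cancel₀ _ (by norm_num), sub_mul, ← Real.exp_add, ← Real.exp_add]
    congr 1
    · simp
    · congr 1; ring
  have k : Real.exp (-(y * h)) * Real.cosh (y * π / 2) ≤ Real.cosh (y * (π/2 - h)) := by
    rw [Real.cosh_eq, Real.cosh_eq, mul_div_assoc', mul_add, ← Real.exp_add, ← Real.exp_add]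
    have e1 : -(y * h) + y * π / 2 = y * (π/2 - h) := by ring
    rw [e1]
    have : Real.exp (-(y * h) + -(y * π / 2)) ≤ Real.exp (-(y * (π/2 - h))) := Real.exp_le_exp.2 (by nlinarith [mul_pos hy h0])
    linarith
  rw [e]
  nlinarith

lemma tan_bd {h : ℝ} (h0 : 0 < h) (hh : h ≤ 0.648) : 0 < Real.tan h ∧ h ≤ Real.tan h ∧ 0.8559 * Real.tan h ≤ h := by
  have p := Real.pi_gt_three
  have h1 : h < π/2 := by linarith
  have c := Real.cos_pos_of_mem_Ioo ⟨by linarith, h1⟩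
  refine ⟨Real.tan_pos_of_pos_of_lt_pi_div_two h0 h1, Real.le_tan h0.le h1, ?_⟩
  rw [Real.tan_eq_sin_div_cos, mul_div_assoc', div_le_iff₀ c]
  have s := sin_le_five h0.le
  have k := cos_ge_six h0.le
  have hq : h^2 ≤ 0.419904 := by nlinarith
  have q : 0.8559 * (1 - h^2/6 + h^4/120) ≤ 1 - h^2/2 + h^4/24 - h^6/720 := by
    have e4 : h^4 = (h^2)^2 := by ring
    have e6 : h^6 = (h^2)^3 := by ring
    rw [e4, e6]
    have hq1 : 0 ≤ h^2 := sq_nonneg h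
    generalize h^2 = q at *
    have hq0 : 0 ≤ 0.419904 - q := by linarith
    nlinarith [mul_nonneg hq0 hq0, mul_nonneg (mul_nonneg hq0 hq0) hq0, hq1, mul_nonneg hq1 hq0]
  calc _ ≤ 0.8559 * (h - h^3/6 + h^5/120) := by gcongr
    _ = h * (0.8559 * (1 - h^2/6 + h^4/120)) := by ring
    _ ≤ h * (1 - h^2/2 + h^4/24 - h^6/720) := by gcongr
    _ ≤ _ := by gcongr

lemma MM_ge {h y : ℝ} (h0 : 0 < h) (hh : h ≤ 0.648) (hy : 0 < y) : -y ≤ MM h y := by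
  obtain ⟨t0, t1, _⟩ := tan_bd h0 hh
  have g : GG h y / Real.tan h ≤ 2 * y := by
    rw [div_le_iff₀ t0]
    have := GG_le h0 hh hy
    nlinarith
  unfold MM
  have : 0 < Real.exp (-(π * y)) * Real.cosh (2 * h * y) := mul_pos (Real.exp_pos _) (Real.cosh_pos _)
  nlinarith

lemma cot_ge {h y : ℝ} (h0 : 0 < h) (hh : h ≤ 0.648) (hy : 0 < y) :
    0.8559 / h * (1 - Real.exp (-(2 * h * y))) ≤ GG h y / Real.tan h := by
  obtain ⟨t0, _, t2⟩ := tan_bd h0 hh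
  have e : Real.exp (-(2 * h * y)) ≤ 1 := Real.exp_le_one_iff.2 (by have := mul_pos h0 hy; linarith)
  have g := GG_ge h0 hh hy
  have c : 0.8559 / h ≤ 1 / Real.tan h := by rw [div_le_div_iff₀ h0 t0]; linarith
  calc _ ≤ 1 / Real.tan h * (1 - Real.exp (-(2 * h * y))) := by gcongr
    _ ≤ 1 / Real.tan h * GG h y := by gcongr
    _ = _ := by ring

lemma MM_le {h y : ℝ} (h0 : 0 < h) (hh : h ≤ 0.648) (hy : 0 < y) : MM h y ≤ y := by
  have p := Real.pi_gt_three
  have c := cot_ge h0 hh hy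
  have hu : 0 < 2 * h * y := by positivity
  have k : Real.exp (-(π * y)) * Real.cosh (2 * h * y) ≤ Real.exp (-(2 * h * y)) := by
    have : Real.cosh (2 * h * y) ≤ Real.exp (2 * h * y) := by
      rw [Real.cosh_eq]; have := Real.exp_le_exp.2 (show -(2 * h * y) ≤ 2 * h * y by linarith); linarith
    calc _ ≤ Real.exp (-(π * y)) * Real.exp (2 * h * y) := by gcongr
      _ = Real.exp (-(π * y) + 2 * h * y) := by rw [Real.exp_add]
      _ ≤ _ := Real.exp_le_exp.2 (by nlinarith)
  have e : 2 * h * y * Real.exp (-(2 * h * y)) ≤ 1 - Real.exp (-(2 * h * y)) := by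
    have := Real.add_one_le_exp (2 * h * y)
    have h1 := Real.exp_pos (-(2 * h * y))
    have h2 : Real.exp (2 * h * y) * Real.exp (-(2 * h * y)) = 1 := by rw [← Real.exp_add]; simp
    nlinarith
  have e2 : y * Real.exp (-(2 * h * y)) ≤ 0.8559 / h * (1 - Real.exp (-(2 * h * y))) := by
    calc y * Real.exp (-(2 * h * y)) ≤ 0.8559 / h * (2 * h * y * Real.exp (-(2 * h * y))) := by
          rw [show 0.8559 / h * (2 * h * y * Real.exp (-(2 * h * y))) = 1.7118 * (y * Real.exp (-(2 * h * y))) by field_simp; norm_num]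
          have : 0 < y * Real.exp (-(2 * h * y)) := by positivity
          linarith
      _ ≤ _ := by gcongr
  unfold MM
  nlinarith


lemma exp_chord {c θ : ℝ} (h0 : 0 ≤ θ) (h1 : θ ≤ 1) : Real.exp (-(c * θ)) ≤ 1 + (Real.exp (-c) - 1) * θ := by
  have := convexOn_exp.2 (Set.mem_univ (0:ℝ)) (Set.mem_univ (-c)) (sub_nonneg.2 h1) h0 (by ring)
  simp only [smul_eq_mul, mul_zero, zero_add, Real.exp_zero, mul_one] at this
  rw [show -(c * θ) = θ * -c by ring]
  linarith

lemma exp_grid {c a θ : ℝ} (i : ℕ) (hc : Real.exp (-c) ≤ a) (h0 : 0 ≤ θ) (h1 : θ ≤ 1) :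
    Real.exp (-(c * (i + θ))) ≤ a^i * (1 + (a - 1) * θ) := by
  have e : Real.exp (-(c * (i + θ))) = Real.exp (-c)^i * Real.exp (-(c * θ)) := by
    rw [← Real.exp_nat_mul, ← Real.exp_add]; congr 1; ring
  rw [e]
  have k := exp_chord (c := c) h0 h1
  have p := Real.exp_pos (-c)
  have : Real.exp (-(c * θ)) ≤ 1 + (a - 1) * θ := by nlinarith
  have := pow_nonneg (p.le.trans hc) i
  gcongr

lemma exp_neg_le {c a : ℝ} (hc : 0 ≤ c) (ha : 0 < a) (h : 1 ≤ a * (1 + c + c^2/2 + c^3/6 + c^4/24 + c^5/120)) : Real.exp (-c) ≤ a := by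
  have k := Real.sum_le_exp_of_nonneg hc 6
  simp [Finset.sum_range_succ, Nat.factorial] at k
  rw [Real.exp_neg, inv_le_comm₀ (Real.exp_pos _) ha]
  refine le_trans ?_ k
  rw [inv_le_iff_one_le_mul₀ ha]
  linarith

lemma M_num {y : ℝ} (hy : 0 ≤ y) : y + y * (Real.exp (-(1.8455 * y)) + Real.exp (-(4.4375 * y))) / 2 - 1.3208 * (1 - Real.exp (-(1.296 * y))) ≤ 0.22 * y^2 + 0.045 := by
  have a1 : Real.exp (-0.3691) ≤ 0.69140 := exp_neg_le (by norm_num) (by norm_num) (by norm_num)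
  have b1 : Real.exp (-0.8875) ≤ 0.4120 := exp_neg_le (by norm_num) (by norm_num) (by norm_num)
  have c1 : Real.exp (-0.2592) ≤ 0.77172 := exp_neg_le (by norm_num) (by norm_num) (by norm_num)
  rcases le_or_gt 2.4 y with q | q
  · have e : ∀ c : ℝ, 0 ≤ c → Real.exp (-(5 * c * y)) ≤ Real.exp (-(c * ((12:ℕ) + 0))) := fun c hc => 
      Real.exp_le_exp.2 (by push_cast; nlinarith)
    have a2 := (e 0.3691 (by norm_num)).trans (exp_grid 12 a1 le_rfl zero_le_one)
    have b2 := (e 0.8875 (by norm_num)).trans (exp_grid 12 b1 le_rfl zero_le_one)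
    have c2 := (e 0.2592 (by norm_num)).trans (exp_grid 12 c1 le_rfl zero_le_one)
    norm_num at a2 b2 c2 ⊢
    nlinarith [sq_nonneg (y - 2.287)]
  · have fl := Nat.floor_le (show 0 ≤ 5 * y by positivity)
    have fl2 := Nat.lt_floor_add_one (5 * y)
    have hi : ⌊5 * y⌋₊ < 12 := by rw [Nat.floor_lt (by positivity)]; norm_num; norm_num at q; linarith
    generalize ⌊5 * y⌋₊ = i at *
    obtain ⟨θ, rfl⟩ : ∃ θ : ℝ, y = (i + θ)/5 := ⟨5 * y - i, by ring⟩
    have t0 : 0 ≤ θ := by linarith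
    have t1 : θ ≤ 1 := by linarith
    have a2 := exp_grid i a1 t0 t1
    have b2 := exp_grid i b1 t0 t1
    have c2 := exp_grid i c1 t0 t1
    rw [show 0.3691 * ((i:ℝ) + θ) = 1.8455 * ((i + θ)/5) by ring] at a2
    rw [show 0.8875 * ((i:ℝ) + θ) = 4.4375 * ((i + θ)/5) by ring] at b2
    rw [show 0.2592 * ((i:ℝ) + θ) = 1.296 * ((i + θ)/5) by ring] at c2
    generalize Real.exp (-(1.8455 * (((i:ℝ) + θ)/5))) = A at *
    generalize Real.exp (-(4.4375 * (((i:ℝ) + θ)/5))) = B at *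
    generalize Real.exp (-(1.296 * (((i:ℝ) + θ)/5))) = C at *
    have k : (((i:ℝ) + θ)/5) * (A + B)/2 ≤ (((i:ℝ) + θ)/5) * (0.69140^i * (1 + (0.69140 - 1) * θ) + 0.4120^i * (1 + (0.4120 - 1) * θ)) / 2 := by
      have := add_le_add a2 b2
      gcongr
    have tt := mul_nonneg t0 (sub_nonneg.2 t1)
    clear a2 b2 a1 b1 c1 fl fl2 hy q
    interval_cases i <;> norm_num at k c2 ⊢ <;> nlinarith [sq_nonneg (θ - 1/2)]

lemma MM_le2 {h y : ℝ} (h0 : 0 < h) (hh : h ≤ 0.648) (hy : 0 < y) : MM h y ≤ 0.22 * y^2 + 0.045 := by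
  have p := Real.pi_gt_d6
  have c := cot_ge h0 hh hy
  refine le_trans ?_ (M_num hy.le)
  have e1 : 1.3208 * (1 - Real.exp (-(1.296 * y))) ≤ 0.8559 / h * (1 - Real.exp (-(2 * h * y))) := by
    have k := exp_chord (c := 1.296 * y) (θ := h / 0.648) (by positivity) (by rw [div_le_one (by norm_num)]; exact hh)
    rw [show 1.296 * y * (h / 0.648) = 2 * h * y by ring] at k
    have e : Real.exp (-(1.296 * y)) ≤ 1 := Real.exp_le_one_iff.2 (by linarith)
    calc _ ≤ (0.8559/0.648) * (1 - Real.exp (-(1.296 * y))) := by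
          apply mul_le_mul_of_nonneg_right (by norm_num) (by linarith)
      _ = 0.8559 / h * ((1 - Real.exp (-(1.296 * y))) * (h/0.648)) := by field_simp
      _ ≤ _ := by gcongr; linarith
  have e2 : Real.exp (-(π * y)) * Real.cosh (2 * h * y) ≤ (Real.exp (-(1.8455 * y)) + Real.exp (-(4.4375 * y))) / 2 := by
    calc _ ≤ Real.exp (-(π * y)) * Real.cosh (1.296 * y) := by
          gcongr
          rw [Real.cosh_le_cosh, abs_of_nonneg (by positivity), abs_of_nonneg (by positivity)]
          nlinarith
      _ = (Real.exp (-(π * y) + 1.296 * y) + Real.exp (-(π * y) + -(1.296 * y))) / 2 := by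
          rw [Real.exp_add, Real.exp_add, Real.cosh_eq]; ring
      _ ≤ _ := by
          have : Real.exp (-(π * y) + 1.296 * y) ≤ Real.exp (-(1.8455 * y)) := Real.exp_le_exp.2 (by nlinarith)
          have : Real.exp (-(π * y) + -(1.296 * y)) ≤ Real.exp (-(4.4375 * y)) := Real.exp_le_exp.2 (by nlinarith)
          linarith
  have e3 : y * (Real.exp (-(π * y)) * Real.cosh (2 * h * y)) ≤ y * ((Real.exp (-(1.8455 * y)) + Real.exp (-(4.4375 * y))) / 2) := by gcongr
  unfold MM
  linarith

lemma DD_neg_bd {h K y : ℝ} (h0 : 0 < h) (hh : h ≤ 0.648) (hK : |K| < 1) (hy : 0 < y) : |DD h K y| ≤ 3 * y / Real.sinh (π * y) := by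
  obtain ⟨a1, a2, a3, a4⟩ := den_pos h0 hh hK hy
  obtain ⟨k1, k2⟩ := abs_lt.1 hK
  have m1 := MM_ge h0 hh hy
  have m2 := MM_le h0 hh hy
  rw [DD_eq h0 hh hK hy, abs_div, abs_of_pos a4, div_le_div_iff₀ a4 a1]
  have e : Real.exp (-(4 * h * y)) ≤ 1 := Real.exp_le_one_iff.2 (by have := mul_pos h0 hy; linarith)
  have e0 := Real.exp_pos (-(4 * h * y))
  have z0 : 0 ≤ y * (1 - Real.exp (-(4 * h * y))) / 2 := by apply div_nonneg (mul_nonneg hy.le (by linarith)) (by norm_num)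
  have z1 : y * (1 - Real.exp (-(4 * h * y))) / 2 ≤ y/2 := by nlinarith
  have n : |MM h y - K * (y * (1 - Real.exp (-(4 * h * y))) / 2)| ≤ 1.5 * y := by
    rw [abs_le]; constructor <;> nlinarith
  have d : Real.sinh (π * y) / 2 ≤ Real.sinh (π * y) + K * Real.sinh (2 * h * y) := by nlinarith
  calc _ ≤ 1.5 * y * Real.sinh (π * y) := by gcongr
    _ = 3 * y * (Real.sinh (π * y)/2) := by ring
    _ ≤ _ := by gcongr

lemma DD_pos_bd {h K y : ℝ} (h0 : 0 < h) (hh : h ≤ 0.648) (hK0 : 0 ≤ K) (hK : K < 1) (hy : 0 < y) :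
    |DD h K y| ≤ 1.5 * y / Real.sinh (π * y) ∧ DD h K y ≤ (0.22 * y^2 + 0.045) / Real.sinh (π * y) := by
  have hK' : |K| < 1 := by rw [abs_of_nonneg hK0]; exact hK
  obtain ⟨a1, a2, a3, a4⟩ := den_pos h0 hh hK' hy
  have m1 := MM_ge h0 hh hy
  have m2 := MM_le h0 hh hy
  have m3 := MM_le2 h0 hh hy
  have e : Real.exp (-(4 * h * y)) ≤ 1 := Real.exp_le_one_iff.2 (by have := mul_pos h0 hy; linarith)
  have e0 := Real.exp_pos (-(4 * h * y))
  have z0 : 0 ≤ y * (1 - Real.exp (-(4 * h * y))) / 2 := by apply div_nonneg (mul_nonneg hy.le (by linarith)) (by norm_num)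
  have z1 : y * (1 - Real.exp (-(4 * h * y))) / 2 ≤ y/2 := by nlinarith
  have d : Real.sinh (π * y) ≤ Real.sinh (π * y) + K * Real.sinh (2 * h * y) := by nlinarith
  rw [DD_eq h0 hh hK' hy]
  constructor
  · rw [abs_div, abs_of_pos a4]
    have n : |MM h y - K * (y * (1 - Real.exp (-(4 * h * y))) / 2)| ≤ 1.5 * y := by
      rw [abs_le]; constructor <;> nlinarith
    gcongr
  · have n : MM h y - K * (y * (1 - Real.exp (-(4 * h * y))) / 2) ≤ 0.22 * y^2 + 0.045 := by nlinarith
    calc _ ≤ (0.22 * y^2 + 0.045) / (Real.sinh (π * y) + K * Real.sinh (2 * h * y)) := by gcongr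
      _ ≤ _ := by gcongr


noncomputable def EE (c : ℝ) (n : ℕ) (y : ℝ) : ℝ := y^n * Real.exp (-(c * y))

lemma EE_val {c : ℝ} (hc : 0 < c) (n : ℕ) : ∫ y in Set.Ioi (0:ℝ), EE c n y = n.factorial / c^(n+1) := by
  have := Real.integral_rpow_mul_exp_neg_mul_Ioi (a := n + 1) (r := c) (by positivity) hc
  rw [Real.Gamma_nat_eq_factorial] at this
  simp only [add_sub_cancel_right, Real.rpow_natCast] at this
  unfold EE
  rw [this]
  have e : (1/c)^((n:ℝ)+1) = (1/c)^(n+1) := by exact_mod_cast Real.rpow_natCast (1/c) (n+1)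
  rw [e, one_div, inv_pow]; field_simp

lemma EE_int {c : ℝ} (hc : 0 < c) (n : ℕ) : IntegrableOn (EE c n) (Set.Ioi 0) := by
  by_contra hn
  have h1 := EE_val hc n
  rw [integral_undef hn] at h1
  have : 0 < (n.factorial:ℝ) / c^(n+1) := by positivity
  linarith

/-- triple of exponentials -/
noncomputable def TT (c : ℝ) (n : ℕ) (y : ℝ) : ℝ := 2/3 * EE c n y + (1/6 * EE (c - 0.4601) n y + 1/6 * EE (c + 0.4601) n y)

lemma TT_int {c : ℝ} (hc : 0.4601 < c) (n : ℕ) : IntegrableOn (TT c n) (Set.Ioi 0) := by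
  have a1 := EE_int (c := c) (by linarith) n
  have a2 := EE_int (c := c - 0.4601) (by linarith) n
  have a3 := EE_int (c := c + 0.4601) (by linarith) n
  exact (a1.const_mul _).add ((a2.const_mul _).add (a3.const_mul _))

lemma TT_val {c : ℝ} (hc : 0.4601 < c) (n : ℕ) : ∫ y in Set.Ioi (0:ℝ), TT c n y =
    n.factorial * (2/3/c^(n+1) + (1/6/(c-0.4601)^(n+1) + 1/6/(c+0.4601)^(n+1))) := by
  have a1 := EE_int (c := c) (by linarith) n
  have a2 := EE_int (c := c - 0.4601) (by linarith) n
  have a3 := EE_int (c := c + 0.4601) (by linarith) n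
  have b2 : Integrable (fun y => 1/6 * EE (c - 0.4601) n y) (volume.restrict (Set.Ioi 0)) := a2.const_mul _
  have b3 : Integrable (fun y => 1/6 * EE (c + 0.4601) n y) (volume.restrict (Set.Ioi 0)) := a3.const_mul _
  have b23 : Integrable (fun y => 1/6 * EE (c - 0.4601) n y + 1/6 * EE (c + 0.4601) n y) (volume.restrict (Set.Ioi 0)) := b2.add b3
  unfold TT
  rw [integral_add (a1.const_mul _) b23, integral_add b2 b3, integral_const_mul, integral_const_mul, integral_const_mul,
    EE_val (by linarith), EE_val (by linarith), EE_val (by linarith)]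
  ring

lemma TT_eq (c : ℝ) (n : ℕ) (y : ℝ) : TT c n y = y^n * ((2 + Real.cosh (0.4601 * y))/3) * Real.exp (-(c * y)) := by
  unfold TT EE
  rw [Real.cosh_eq, show -((c - 0.4601) * y) = -(c * y) + 0.4601 * y by ring, show -((c + 0.4601) * y) = -(c * y) + -(0.4601 * y) by ring,
    Real.exp_add, Real.exp_add]
  ring

noncomputable def Mo (n : ℕ) (y : ℝ) : ℝ := 2 * TT 3.1415 (n+1) y + (2 * TT 9.4245 (n+1) y + 1/3.1415 * TT 9.4245 n y)

lemma Mo_int (n : ℕ) : IntegrableOn (Mo n) (Set.Ioi 0) := by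
  have a1 := TT_int (c := 3.1415) (by norm_num) (n+1)
  have a2 := TT_int (c := 9.4245) (by norm_num) (n+1)
  have a3 := TT_int (c := 9.4245) (by norm_num) n
  exact (a1.const_mul _).add ((a2.const_mul _).add (a3.const_mul _))

lemma Mo_val (n : ℕ) : ∫ y in Set.Ioi (0:ℝ), Mo n y =
    2 * ((n+1).factorial * (2/3/3.1415^(n+1+1) + (1/6/(3.1415-0.4601)^(n+1+1) + 1/6/(3.1415+0.4601)^(n+1+1))))
    + (2 * ((n+1).factorial * (2/3/9.4245^(n+1+1) + (1/6/(9.4245-0.4601)^(n+1+1) + 1/6/(9.4245+0.4601)^(n+1+1))))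
      + 1/3.1415 * (n.factorial * (2/3/9.4245^(n+1) + (1/6/(9.4245-0.4601)^(n+1) + 1/6/(9.4245+0.4601)^(n+1))))) := by
  have a1 := TT_int (c := 3.1415) (by norm_num) (n+1)
  have a2 := TT_int (c := 9.4245) (by norm_num) (n+1)
  have a3 := TT_int (c := 9.4245) (by norm_num) n
  have b2 : Integrable (fun y => 2 * TT 9.4245 (n+1) y) (volume.restrict (Set.Ioi 0)) := a2.const_mul _
  have b3 : Integrable (fun y => 1/3.1415 * TT 9.4245 n y) (volume.restrict (Set.Ioi 0)) := a3.const_mul _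
  have b23 : Integrable (fun y => 2 * TT 9.4245 (n+1) y + 1/3.1415 * TT 9.4245 n y) (volume.restrict (Set.Ioi 0)) := b2.add b3
  unfold Mo
  rw [integral_add (a1.const_mul _) b23, integral_add b2 b3, integral_const_mul, integral_const_mul, integral_const_mul,
    TT_val (by norm_num), TT_val (by norm_num), TT_val (by norm_num)]

lemma mom1 : ∫ y in Set.Ioi (0:ℝ), Mo 0 y ≤ 0.26355 := by
  rw [Mo_val]; norm_num [Nat.factorial]
lemma mom2 : ∫ y in Set.Ioi (0:ℝ), Mo 1 y ≤ 0.14327 := by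
  rw [Mo_val]; norm_num [Nat.factorial]
lemma mom3 : ∫ y in Set.Ioi (0:ℝ), Mo 2 y ≤ 0.13502 := by
  rw [Mo_val]; norm_num [Nat.factorial]
lemma mom6 : ∫ y in Set.Ioi (0:ℝ), Mo 5 y ≤ 0.58955 := by
  rw [Mo_val]; norm_num [Nat.factorial]

lemma inv_sinh {y : ℝ} (hy : 0 < y) : 1 / Real.sinh (π * y) ≤
    2 * Real.exp (-(3.1415 * y)) + (2 + 1/(3.1415 * y)) * Real.exp (-(9.4245 * y)) := by
  have p := Real.pi_gt_d6
  have s1 : Real.sinh (3.1415 * y) ≤ Real.sinh (π * y) := Real.sinh_le_sinh.2 (by nlinarith)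
  have s0 : 0 < Real.sinh (3.1415 * y) := Real.sinh_pos_iff.2 (by positivity)
  refine (one_div_le_one_div_of_le s0 s1).trans ?_
  rw [show (9.4245:ℝ) * y = 3 * (3.1415 * y) by ring]
  have hx : 0 < 3.1415 * y := by positivity
  generalize 3.1415 * y = x at *
  rw [div_le_iff₀ s0, Real.sinh_eq]
  have e := Real.add_one_le_exp (2 * x)
  have e2 : Real.exp (2 * x) = Real.exp x ^ 2 := by rw [← Real.exp_nat_mul]; norm_num
  have e3 : Real.exp (-(3 * x)) = Real.exp (-x) ^ 3 := by rw [← Real.exp_nat_mul]; congr 1; push_cast; ring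
  rw [e3, Real.exp_neg]
  rw [e2] at e
  have ep := Real.exp_pos x
  generalize Real.exp x = E at *
  have : (2 * E⁻¹ + (2 + 1/x) * E⁻¹^3) * ((E - E⁻¹)/2) = 1 + ((E^2 - 1) / x - 2) / (2 * E^4) := by
    field_simp; ring
  rw [this]
  have : 2 ≤ (E^2 - 1) / x := by rw [le_div_iff₀ hx]; linarith
  have : 0 ≤ ((E^2 - 1) / x - 2) / (2 * E^4) := div_nonneg (by linarith) (by positivity)
  linarith

lemma Mo_ge (n : ℕ) {y : ℝ} (hy : 0 < y) : y^(n+1) * ((2 + Real.cosh (0.4601 * y))/3) / Real.sinh (π * y) ≤ Mo n y := by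
  have k := inv_sinh hy
  have c := Real.cosh_pos (0.4601 * y)
  unfold Mo
  rw [TT_eq, TT_eq, TT_eq]
  calc _ = y^(n+1) * ((2 + Real.cosh (0.4601 * y))/3) * (1 / Real.sinh (π * y)) := by ring
    _ ≤ y^(n+1) * ((2 + Real.cosh (0.4601 * y))/3) * (2 * Real.exp (-(3.1415 * y)) + (2 + 1/(3.1415 * y)) * Real.exp (-(9.4245 * y))) := by
        gcongr
    _ = _ := by
        rw [pow_succ]; field_simp

/-- sinh bound times weight -/
lemma sinh_v {h f y : ℝ} (h0 : 0 < h) (hh : h ≤ 0.648) (hf : |f| ≤ 0.71) (hy : 0 < y) :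
    |Real.sinh (y * (h * f))| ≤ h * |f| * (y * ((2 + Real.cosh (0.4601 * y))/3)) := by
  rw [Real.abs_sinh, abs_mul, abs_mul, abs_of_pos hy, abs_of_pos h0]
  have f0 := abs_nonneg f
  have k := sinh_le_cusa (x := y * (h * |f|)) (by positivity)
  have c : Real.cosh (y * (h * |f|)) ≤ Real.cosh (0.4601 * y) := by
    have i1 : 0 ≤ y * (h * |f|) := by positivity
    have i2 : 0 ≤ 0.4601 * y := by positivity
    rw [Real.cosh_le_cosh, abs_of_nonneg i1, abs_of_nonneg i2]
    have : h * |f| ≤ 0.4601 := by nlinarith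
    nlinarith
  refine k.trans ?_
  calc _ ≤ y * (h * |f|) * (2 + Real.cosh (0.4601 * y)) / 3 := by gcongr
    _ = _ := by ring

lemma ysin_int {c x : ℝ} (hc : 0 < c) : IntegrableOn (fun y => y * Real.exp (-(c * y)) * Real.sin (y * x)) (Set.Ioi 0) ∧
    ∫ y in Set.Ioi (0:ℝ), y * Real.exp (-(c * y)) * Real.sin (y * x) = JJ c x := by
  have hInt : IntegrableOn (fun y => y * Real.exp (-(c * y)) * Real.sin (y * x)) (Set.Ioi 0) := by
    have := EE_int hc 1
    refine Integrable.mono this (by apply Continuous.aestronglyMeasurable; fun_prop) ?_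
    refine Filter.Eventually.of_forall (fun y => ?_)
    simp only [EE, pow_one, norm_mul]
    exact mul_le_of_le_one_right (by positivity) (Real.abs_sin_le_one _)
  refine ⟨hInt, ?_⟩
  have q : 0 < c^2 + x^2 := by positivity
  have ex : ∀ y : ℝ, HasDerivAt (fun y => Real.exp (-(c * y))) (Real.exp (-(c * y)) * -(c * 1)) y := fun y =>
    (((hasDerivAt_id y).const_mul c).neg).exp
  have sx : ∀ y : ℝ, HasDerivAt (fun y => Real.sin (y * x)) (Real.cos (y * x) * (1 * x)) y := fun y =>
    ((hasDerivAt_id y).mul_const x).sin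
  have cx : ∀ y : ℝ, HasDerivAt (fun y => Real.cos (y * x)) (-Real.sin (y * x) * (1 * x)) y := fun y =>
    ((hasDerivAt_id y).mul_const x).cos
  have l1 : ∀ a b y : ℝ, HasDerivAt (fun y => y * a + b) (1 * a) y := fun a b y => ((hasDerivAt_id y).mul_const a).add_const b
  let F : ℝ → ℝ := fun y => Real.exp (-(c * y)) * ((y * (c/(c^2+x^2)) + (c^2-x^2)/(c^2+x^2)^2) * Real.sin (y * x) + (y * (x/(c^2+x^2)) + 2*c*x/(c^2+x^2)^2) * Real.cos (y * x))
  have hF : ∀ y : ℝ, HasDerivAt (fun y => - F y) (y * Real.exp (-(c * y)) * Real.sin (y * x)) y := by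
    intro y
    refine ((ex y).mul (((l1 (c/(c^2+x^2)) ((c^2-x^2)/(c^2+x^2)^2) y).mul (sx y)).add ((l1 (x/(c^2+x^2)) (2*c*x/(c^2+x^2)^2) y).mul (cx y)))).neg.congr_deriv ?_
    simp only [Pi.add_apply, Pi.mul_apply]
    field_simp
    ring
  have t1 : Filter.Tendsto (fun y : ℝ => y * Real.exp (-c * y)) Filter.atTop (nhds 0) := by
    have := tendsto_rpow_mul_exp_neg_mul_atTop_nhds_zero 1 c hc
    simpa using this
  have t0 : Filter.Tendsto (fun y : ℝ => Real.exp (-c * y)) Filter.atTop (nhds 0) := by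
    have := tendsto_rpow_mul_exp_neg_mul_atTop_nhds_zero 0 c hc
    simpa using this
  have tF : Filter.Tendsto (fun y => - F y) Filter.atTop (nhds 0) := by
    have g := ((t1.mul_const (|c/(c^2+x^2)| + |x/(c^2+x^2)|)).add (t0.mul_const (|(c^2-x^2)/(c^2+x^2)^2| + |2*c*x/(c^2+x^2)^2|)))
    rw [zero_mul, zero_mul, zero_add] at g
    refine squeeze_zero_norm' ?_ g
    filter_upwards [Filter.eventually_ge_atTop 0] with y hy
    rw [norm_neg, Real.norm_eq_abs]
    show |Real.exp (-(c * y)) * _| ≤ _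
    rw [abs_mul, abs_of_pos (Real.exp_pos _), neg_mul]
    have s := Real.abs_sin_le_one (y * x)
    have co := Real.abs_cos_le_one (y * x)
    have b1 : |(y * (c/(c^2+x^2)) + (c^2-x^2)/(c^2+x^2)^2) * Real.sin (y * x)| ≤ y * |c/(c^2+x^2)| + |(c^2-x^2)/(c^2+x^2)^2| := by
      rw [abs_mul]
      refine (mul_le_of_le_one_right (abs_nonneg _) s).trans ((abs_add_le _ _).trans ?_)
      rw [abs_mul, abs_of_nonneg hy]
    have b2 : |(y * (x/(c^2+x^2)) + 2*c*x/(c^2+x^2)^2) * Real.cos (y * x)| ≤ y * |x/(c^2+x^2)| + |2*c*x/(c^2+x^2)^2| := by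
      rw [abs_mul]
      refine (mul_le_of_le_one_right (abs_nonneg _) co).trans ((abs_add_le _ _).trans ?_)
      rw [abs_mul, abs_of_nonneg hy]
    have e0 := Real.exp_pos (-(c * y))
    calc _ ≤ Real.exp (-(c * y)) * ((y * |c/(c^2+x^2)| + |(c^2-x^2)/(c^2+x^2)^2|) + (y * |x/(c^2+x^2)| + |2*c*x/(c^2+x^2)^2|)) := by
          gcongr
          exact (abs_add_le _ _).trans (add_le_add b1 b2)
      _ = _ := by ring
  rw [integral_Ioi_of_hasDerivAt_of_tendsto' (fun y _ => hF y) hInt tF]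
  simp [F, JJ]


lemma WW_meas (h K : ℝ) : Measurable (WW h K) := by
  unfold WW
  apply Measurable.div
  · apply Continuous.measurable; 
    apply Continuous.sub
    · fun_prop
    · apply Continuous.div
      · fun_prop
      · fun_prop
      · intro y; exact (Real.cosh_pos _).ne'
  · apply Continuous.measurable; fun_prop

lemma DD_meas (h K : ℝ) : Measurable (DD h K) := by
  unfold DD
  exact (WW_meas h K).sub (by apply Continuous.measurable; fun_prop)

noncomputable def PhiI (h K x f y : ℝ) : ℝ := DD h K y * (Real.sin (y * x) * Real.sinh (y * (h * f)))

lemma PhiI_bd {h K x f y C : ℝ} (h0 : 0 < h) (hh : h ≤ 0.648) (hf : |f| ≤ 0.71) (hy : 0 < y) (hC : 0 ≤ C)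
    (hD : |DD h K y| ≤ C * y / Real.sinh (π * y)) : |PhiI h K x f y| ≤ C * h * |f| * Mo 1 y := by
  have s : 0 < Real.sinh (π * y) := Real.sinh_pos_iff.2 (by positivity)
  have v := sinh_v h0 hh hf hy
  have m := Mo_ge 1 hy
  have c := Real.cosh_pos (0.4601 * y)
  unfold PhiI
  rw [abs_mul, abs_mul]
  calc _ ≤ C * y / Real.sinh (π * y) * (1 * (h * |f| * (y * ((2 + Real.cosh (0.4601 * y))/3)))) := by
        gcongr; exact Real.abs_sin_le_one _
    _ = C * h * |f| * (y^(1+1) * ((2 + Real.cosh (0.4601 * y))/3) / Real.sinh (π * y)) := by ring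
    _ ≤ _ := by gcongr

lemma PhiI_int {h K x f : ℝ} (h0 : 0 < h) (hh : h ≤ 0.648) (hK : |K| < 1) (hf : |f| ≤ 0.71) : IntegrableOn (PhiI h K x f) (Set.Ioi 0) := by
  have g : IntegrableOn (fun y => 3 * h * |f| * Mo 1 y) (Set.Ioi 0) := (Mo_int 1).const_mul _
  refine Integrable.mono' g ?_ ?_
  · unfold PhiI
    exact ((DD_meas h K).mul (by apply Continuous.measurable; fun_prop)).aestronglyMeasurable
  · rw [ae_restrict_iff' measurableSet_Ioi]
    exact Filter.Eventually.of_forall (fun y hy => PhiI_bd h0 hh hf hy (by norm_num) (DD_neg_bd h0 hh hK hy))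

lemma Phi_gen {h K x f C : ℝ} (h0 : 0 < h) (hh : h ≤ 0.648) (hf : |f| ≤ 0.71) (hC : 0 ≤ C)
    (hD : ∀ y, 0 < y → |DD h K y| ≤ C * y / Real.sinh (π * y)) : |∫ y in Set.Ioi (0:ℝ), PhiI h K x f y| ≤ h * |f| * (C * 0.14327) := by
  have g : IntegrableOn (fun y => C * h * |f| * Mo 1 y) (Set.Ioi 0) := (Mo_int 1).const_mul _
  have k : ‖∫ y in Set.Ioi (0:ℝ), PhiI h K x f y‖ ≤ ∫ y in Set.Ioi (0:ℝ), C * h * |f| * Mo 1 y := by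
    apply norm_integral_le_of_norm_le g
    rw [ae_restrict_iff' measurableSet_Ioi]
    exact Filter.Eventually.of_forall (fun y hy => PhiI_bd h0 hh hf hy hC (hD y hy))
  rw [integral_const_mul] at k
  refine k.trans ?_
  have m := mom2
  have : 0 ≤ C * h * |f| := by positivity
  nlinarith

lemma Phi_neg {h K x f : ℝ} (h0 : 0 < h) (hh : h ≤ 0.648) (hK : |K| < 1) (hf : |f| ≤ 0.71) : 
    |∫ y in Set.Ioi (0:ℝ), PhiI h K x f y| ≤ h * |f| * 0.62 := by
  refine (Phi_gen h0 hh hf (by norm_num) (fun y hy => DD_neg_bd h0 hh hK hy)).trans ?_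
  gcongr; norm_num

lemma Phi_pos {h K x f : ℝ} (h0 : 0 < h) (hh : h ≤ 0.648) (hK0 : 0 ≤ K) (hK : K < 1) (hf : |f| ≤ 0.71) : 
    |∫ y in Set.Ioi (0:ℝ), PhiI h K x f y| ≤ h * |f| * 0.2150 := by
  refine (Phi_gen h0 hh hf (by norm_num) (fun y hy => (DD_pos_bd h0 hh hK0 hK hy).1)).trans ?_
  gcongr; norm_num

lemma Phi_pos2_pt {h K x f y : ℝ} (h0 : 0 < h) (hh : h ≤ 0.648) (hK0 : 0 ≤ K) (hK : K < 1) (hf : |f| ≤ 0.71) (hx : 0 ≤ x) (f0 : f ≤ 0) (hy : 0 < y) :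
    - (h * |f| * (0.22 * Mo 2 y + (0.045 * Mo 0 y + 1.5 * x^4 / π^4 * Mo 5 y))) ≤ PhiI h K x f y := by
  obtain ⟨d1, d2⟩ := DD_pos_bd h0 hh hK0 hK hy
  have s : 0 < Real.sinh (π * y) := Real.sinh_pos_iff.2 (by positivity)
  have v := sinh_v h0 hh hf hy
  have m2 := Mo_ge 2 hy
  have m0 := Mo_ge 0 hy
  have m5 := Mo_ge 5 hy
  have c := Real.cosh_pos (0.4601 * y)
  have vs : Real.sinh (y * (h * f)) ≤ 0 := Real.sinh_nonpos_iff.2 (mul_nonpos_of_nonneg_of_nonpos hy.le (mul_nonpos_of_nonneg_of_nonpos h0.le f0))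
  have key : DD h K y * Real.sin (y * x) ≤ (0.22 * y^2 + 0.045) / Real.sinh (π * y) + 1.5 * y / Real.sinh (π * y) * (y * x / π)^4 := by
    have q1 : 0 ≤ (0.22 * y^2 + 0.045) / Real.sinh (π * y) := by positivity
    have q2 : 0 ≤ 1.5 * y / Real.sinh (π * y) * (y * x / π)^4 := by positivity
    rcases le_or_gt 0 (Real.sin (y * x)) with r | r
    · have := Real.sin_le_one (y * x)
      have : DD h K y * Real.sin (y * x) ≤ (0.22 * y^2 + 0.045) / Real.sinh (π * y) * 1 := 
        (mul_le_mul_of_nonneg_right d2 r).trans (by gcongr)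
      linarith
    · have t : 1 ≤ y * x / π := by
        rw [le_div_iff₀ Real.pi_pos, one_mul]
        by_contra hc
        push Not at hc
        exact absurd (Real.sin_nonneg_of_nonneg_of_le_pi (by positivity) hc.le) (not_le.2 r)
      have t4 : 1 ≤ (y * x / π)^4 := one_le_pow₀ t
      have : DD h K y * Real.sin (y * x) ≤ 1.5 * y / Real.sinh (π * y) * (y * x / π)^4 := by
        calc _ ≤ |DD h K y * Real.sin (y * x)| := le_abs_self _
          _ = |DD h K y| * |Real.sin (y * x)| := abs_mul _ _
          _ ≤ 1.5 * y / Real.sinh (π * y) * (y * x / π)^4 := by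
            gcongr; exact (Real.abs_sin_le_one _).trans t4
      linarith
  have e : PhiI h K x f y = - (DD h K y * Real.sin (y * x) * |Real.sinh (y * (h * f))|) := by
    unfold PhiI; rw [abs_of_nonpos vs]; ring
  rw [e]
  apply neg_le_neg
  calc _ ≤ ((0.22 * y^2 + 0.045) / Real.sinh (π * y) + 1.5 * y / Real.sinh (π * y) * (y * x / π)^4) * (h * |f| * (y * ((2 + Real.cosh (0.4601 * y))/3))) := by
        gcongr
    _ = h * |f| * (0.22 * (y^(2+1) * ((2 + Real.cosh (0.4601 * y))/3) / Real.sinh (π * y)) + (0.045 * (y^(0+1) * ((2 + Real.cosh (0.4601 * y))/3) / Real.sinh (π * y))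
        + 1.5 * x^4 / π^4 * (y^(5+1) * ((2 + Real.cosh (0.4601 * y))/3) / Real.sinh (π * y)))) := by
        have := Real.pi_pos
        generalize Real.cosh (0.4601 * y) = cc at *
        generalize Real.sinh (π * y) = ss at *
        field_simp
        ring
    _ ≤ _ := by gcongr

lemma Phi_pos2 {h K x f : ℝ} (h0 : 0 < h) (hh : h ≤ 0.648) (hK0 : 0 ≤ K) (hK : K < 1) (hf : |f| ≤ 0.71) (hx : 0 ≤ x) (f0 : f ≤ 0) :
    - (h * |f| * (0.0416 + 0.0091 * x^4)) ≤ ∫ y in Set.Ioi (0:ℝ), PhiI h K x f y := by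
  have g0 : IntegrableOn (fun y => 0.045 * Mo 0 y) (Set.Ioi 0) := (Mo_int 0).const_mul _
  have g2 : IntegrableOn (fun y => 0.22 * Mo 2 y) (Set.Ioi 0) := (Mo_int 2).const_mul _
  have g5 : IntegrableOn (fun y => 1.5 * x^4 / π^4 * Mo 5 y) (Set.Ioi 0) := (Mo_int 5).const_mul _
  have g05 : IntegrableOn (fun y => 0.045 * Mo 0 y + 1.5 * x^4 / π^4 * Mo 5 y) (Set.Ioi 0) := g0.add g5
  have gg : IntegrableOn (fun y => - (h * |f| * (0.22 * Mo 2 y + (0.045 * Mo 0 y + 1.5 * x^4 / π^4 * Mo 5 y)))) (Set.Ioi 0) :=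
    ((g2.add g05).const_mul _).neg
  have hK' : |K| < 1 := by rw [abs_of_nonneg hK0]; exact hK
  have k := setIntegral_mono_on gg (PhiI_int (x := x) h0 hh hK' hf) measurableSet_Ioi (fun y hy => Phi_pos2_pt h0 hh hK0 hK hf hx f0 hy)
  refine le_trans ?_ k
  rw [integral_neg, integral_const_mul, integral_add g2 g05, integral_add g0 g5, integral_const_mul, integral_const_mul, integral_const_mul]
  apply neg_le_neg
  have m2 := mom3
  have m0 := mom1
  have m5 := mom6
  have p := Real.pi_gt_d6
  have p4 : 97.4 ≤ π^4 := le_trans (by norm_num) (pow_le_pow_left₀ (by norm_num) p.le 4)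
  have c5 : 1.5 * x^4 / π^4 ≤ 1.5 * x^4 / 97.4 := by gcongr
  have x4 : 0 ≤ x^4 := by positivity
  have m5' : 0 ≤ ∫ y in Set.Ioi (0:ℝ), Mo 5 y := by
    rw [Mo_val]; positivity
  have t : 1.5 * x^4 / π^4 * (∫ y in Set.Ioi (0:ℝ), Mo 5 y) ≤ 1.5 * x^4 / 97.4 * 0.58955 := by gcongr
  apply mul_le_mul_of_nonneg_left _ (by positivity)
  have : 1.5 * x^4 / 97.4 * 0.58955 ≤ 0.0091 * x^4 := by
    rw [show 1.5 * x^4 / 97.4 * 0.58955 = (1.5 * 0.58955 / 97.4) * x^4 by ring]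
    gcongr; norm_num
  linarith

noncomputable def Psi (h K x f : ℝ) : ℝ := ∫ y in Set.Ioi (0:ℝ), WW h K y * (Real.sin (y * x) * Real.sinh (y * (h * f)))

lemma Psi_eq {h K x f : ℝ} (h0 : 0 < h) (hh : h ≤ 0.648) (hK : |K| < 1) (hf : |f| ≤ 0.71) :
    2 * Psi h K x f = JJ (2*h - h*f) x - JJ (2*h + h*f) x + 2 * ∫ y in Set.Ioi (0:ℝ), PhiI h K x f y := by
  obtain ⟨f1, f2⟩ := abs_le.1 hf
  obtain ⟨a1, a2⟩ := ysin_int (c := 2*h - h*f) (x := x) (by nlinarith)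
  obtain ⟨b1, b2⟩ := ysin_int (c := 2*h + h*f) (x := x) (by nlinarith)
  have p := PhiI_int (x := x) h0 hh hK hf
  rw [← a2, ← b2, ← integral_sub a1 b1]
  have e : ∀ y, WW h K y * (Real.sin (y * x) * Real.sinh (y * (h * f))) = 
    1/2 * (y * Real.exp (-((2*h - h*f) * y)) * Real.sin (y * x) - y * Real.exp (-((2*h + h*f) * y)) * Real.sin (y * x)) + PhiI h K x f y := by
    intro y
    unfold PhiI DD
    rw [show -((2*h - h*f) * y) = -(2*h*y) + y * (h * f) by ring, show -((2*h + h*f) * y) = -(2*h*y) + -(y * (h * f)) by ring, Real.exp_add, Real.exp_add, Real.sinh_eq]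
    ring
  unfold Psi
  simp_rw [e]
  have ab : Integrable (fun y => 1/2 * (y * Real.exp (-((2*h - h*f) * y)) * Real.sin (y * x) - y * Real.exp (-((2*h + h*f) * y)) * Real.sin (y * x))) (volume.restrict (Set.Ioi 0)) := (a1.sub b1).const_mul _
  rw [integral_add ab p, integral_const_mul]
  ring


lemma gW_int {h K : ℝ} (h0 : 0 < h) (hh : h ≤ 0.648) (hK : |K| < 1) :
    IntegrableOn (fun y => |WW h K y| * Real.cosh (y * (0.71 * h))) (Set.Ioi 0) := by
  have g : IntegrableOn (fun y => EE (1.29 * h) 1 y + 9 * Mo 0 y) (Set.Ioi 0) := (EE_int (by positivity) 1).add ((Mo_int 0).const_mul _)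
  refine Integrable.mono' g ?_ ?_
  · have a : Measurable (fun y => |WW h K y|) := (WW_meas h K).abs
    exact (a.mul (by apply Continuous.measurable; fun_prop)).aestronglyMeasurable
  · rw [ae_restrict_iff' measurableSet_Ioi]
    refine Filter.Eventually.of_forall (fun y hy => ?_)
    have hy : 0 < y := hy
    have s : 0 < Real.sinh (π * y) := Real.sinh_pos_iff.2 (by positivity)
    have d := DD_neg_bd h0 hh hK hy
    have c0 := Real.cosh_pos (y * (0.71 * h))
    rw [Real.norm_eq_abs, abs_of_nonneg (by positivity)]
    have w : |WW h K y| ≤ y * Real.exp (-(2 * h * y)) + 3 * y / Real.sinh (π * y) := by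
      have e : WW h K y = y * Real.exp (-(2 * h * y)) + DD h K y := by unfold DD; ring
      rw [e]
      refine (abs_add_le _ _).trans (add_le_add (le_of_eq (abs_of_nonneg (by positivity))) d)
    have k1 : Real.cosh (y * (0.71 * h)) ≤ Real.exp (y * (0.71 * h)) := by
      have : 0 ≤ y * (0.71 * h) := by positivity
      rw [Real.cosh_eq]; have := Real.exp_le_exp.2 (show -(y * (0.71 * h)) ≤ y * (0.71 * h) by linarith); linarith
    have k2 : Real.cosh (y * (0.71 * h)) ≤ 2 + Real.cosh (0.4601 * y) := by
      have : Real.cosh (y * (0.71 * h)) ≤ Real.cosh (0.4601 * y) := by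
        have i1 : 0 ≤ y * (0.71 * h) := by positivity
        have i2 : 0 ≤ 0.4601 * y := by positivity
        rw [Real.cosh_le_cosh, abs_of_nonneg i1, abs_of_nonneg i2]
        nlinarith
      linarith
    have m := Mo_ge 0 hy
    calc |WW h K y| * Real.cosh (y * (0.71 * h)) ≤ (y * Real.exp (-(2 * h * y)) + 3 * y / Real.sinh (π * y)) * Real.cosh (y * (0.71 * h)) := by gcongr
      _ = y * Real.exp (-(2 * h * y)) * Real.cosh (y * (0.71 * h)) + 3 * y / Real.sinh (π * y) * Real.cosh (y * (0.71 * h)) := by ring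
      _ ≤ y * Real.exp (-(2 * h * y)) * Real.exp (y * (0.71 * h)) + 3 * y / Real.sinh (π * y) * (2 + Real.cosh (0.4601 * y)) := by gcongr
      _ = EE (1.29 * h) 1 y + 9 * (y^(0+1) * ((2 + Real.cosh (0.4601 * y))/3) / Real.sinh (π * y)) := by
          unfold EE
          rw [mul_assoc y, ← Real.exp_add, show -(2 * h * y) + y * (0.71 * h) = -(1.29 * h * y) by ring]
          ring
      _ ≤ _ := by gcongr

lemma z2_deriv_in {h γ : ℝ} (hγ : |γ| < π) : deriv (z₂ h) γ = h * df γ := by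
  have e : z₂ h =ᶠ[nhds γ] fun α => h * ff α := by
    have : ∀ᶠ α in nhds γ, |α| < π := (continuous_abs.tendsto γ).eventually (gt_mem_nhds hγ)
    filter_upwards [this] with α hα
    exact z2_eq hα.le
  rw [e.deriv_eq]
  exact ((ff_deriv γ).const_mul h).deriv

lemma z2_deriv_out {h γ : ℝ} (hγ : π < γ) : deriv (z₂ h) γ = 0 := by
  have e : z₂ h =ᶠ[nhds γ] fun _ => (0:ℝ) := by
    filter_upwards [lt_mem_nhds hγ] with α hα
    unfold z₂
    rw [if_neg]
    rw [not_le]; exact hα.trans_le (le_abs_self α)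
  rw [e.deriv_eq]; simp

lemma z2_zero {h γ : ℝ} (hγ : π < γ) : z₂ h γ = 0 := by
  unfold z₂
  rw [if_neg]
  rw [not_le]; exact hγ.trans_le (le_abs_self γ)

lemma z2_deriv_bd {h : ℝ} (h0 : 0 < h) : ∃ M, 0 ≤ M ∧ ∀ γ, 0 < γ → |deriv (z₂ h) γ| ≤ M := by
  refine ⟨1.42 * h + |deriv (z₂ h) π|, by positivity, fun γ hγ => ?_⟩
  rcases lt_trichotomy γ π with q | q | q
  · rw [z2_deriv_in (by rw [abs_of_pos hγ]; exact q), abs_mul, abs_of_pos h0]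
    have := df_bd hγ.le
    have := abs_nonneg (deriv (z₂ h) π)
    nlinarith
  · rw [q]; have : 0 < 1.42 * h := by positivity
    linarith
  · rw [z2_deriv_out q, abs_zero]; positivity

lemma z2_meas (h : ℝ) : Measurable (z₂ h) := by
  unfold z₂
  apply Measurable.ite
  · exact measurableSet_le (by fun_prop) (by fun_prop)
  · apply Continuous.measurable; fun_prop
  · fun_prop

lemma z2_abs {h γ : ℝ} (h0 : 0 < h) (hγ : 0 < γ) : |z₂ h γ| ≤ 0.71 * h := by
  rcases le_or_gt γ π with q | q
  · rw [z2_eq (by rw [abs_of_pos hγ]; exact q), abs_mul, abs_of_pos h0]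
    have := ff_bd hγ.le
    nlinarith
  · rw [z2_zero q]; simp; positivity

/-- integrand of the double integral -/
lemma integrand_eq (h K y γ d v : ℝ) :
    d * Real.cos (z₁ γ * y) /
          ((Real.sinh (π * y) + K * Real.sinh (2 * h * y)) *
            Real.cosh (y * π / 2)) *
        (2 * y * Real.cosh (y * π / 2 - y * h) * Real.cosh (y * π / 2) -
          2 * Real.sinh (y * h) / Real.tan h) *
        Real.cosh (y * v) * Real.cosh (y * (π / 2 - h))
    = WW h K y * (d * Real.cos (z₁ γ * y) * Real.cosh (y * v)) := by
  unfold WW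
  have hc := (Real.cosh_pos (y * π / 2)).ne'
  rw [show y * π / 2 - y * h = y * (π / 2 - h) by ring]
  generalize Real.cosh (y * π / 2) = c at *
  generalize Real.sinh (π * y) + K * Real.sinh (2 * h * y) = D
  generalize Real.tan h = T
  simp only [div_eq_mul_inv, mul_inv]
  generalize D⁻¹ = D'
  generalize T⁻¹ = T'
  field_simp

lemma by_parts {h y : ℝ} (hy : 0 < y) : ∫ γ in (0:ℝ)..π, h * df γ * Real.cos (z₁ γ * y) * Real.cosh (y * (h * ff γ)) =
    ∫ γ in (0:ℝ)..π, dz γ * (Real.sin (y * z₁ γ) * Real.sinh (y * (h * ff γ))) := by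
  have c1 := z1_cont
  have c2 := dz_cont
  have c3 := ff_cont
  have c4 := df_cont
  rw [← sub_eq_zero, ← intervalIntegral.integral_sub (by apply Continuous.intervalIntegrable; fun_prop) (by apply Continuous.intervalIntegrable; fun_prop)]
  have D : ∀ γ ∈ Set.uIcc 0 π, HasDerivAt (fun γ => Real.cos (y * z₁ γ) * Real.sinh (y * (h * ff γ)) / y)
      (h * df γ * Real.cos (z₁ γ * y) * Real.cosh (y * (h * ff γ)) - dz γ * (Real.sin (y * z₁ γ) * Real.sinh (y * (h * ff γ)))) γ := by
    intro γ _
    have a := ((z1_deriv γ).const_mul y).cos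
    have b := (((ff_deriv γ).const_mul h).const_mul y).sinh
    refine ((a.mul b).div_const y).congr_deriv ?_
    rw [mul_comm (z₁ γ) y]
    field_simp
    ring
  rw [intervalIntegral.integral_eq_sub_of_hasDerivAt D (by apply Continuous.intervalIntegrable; fun_prop)]
  have e0 : ff 0 = 0 := by simp [ff, gg]
  have e1 : ff π = 0 := by
    unfold ff gg
    have : Real.sin (3 * π) = 0 := by exact_mod_cast Real.sin_nat_mul_pi 3
    simp [this]
  rw [e0, e1]; simp

lemma F1_int {h K : ℝ} (h0 : 0 < h) (hh : h ≤ 0.648) (hK : |K| < 1) :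
    IntegrableOn (fun p : ℝ × ℝ => WW h K p.1 * (deriv (z₂ h) p.2 * Real.cos (z₁ p.2 * p.1) * Real.cosh (p.1 * z₂ h p.2)))
      (Set.Ioi (0:ℝ) ×ˢ Set.Ioi (0:ℝ)) (volume.prod volume) := by
  obtain ⟨M, hM0, hM⟩ := z2_deriv_bd (h := h) h0
  have i1 : Integrable (Set.indicator (Set.Ioc 0 π) (fun _ => M)) (volume.restrict (Set.Ioi (0:ℝ))) := by
    apply Integrable.restrict
    rw [integrable_indicator_iff measurableSet_Ioc]
    simp
  have g := (gW_int h0 hh hK).mul_prod i1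
  rw [Measure.prod_restrict] at g
  refine Integrable.mono' g ?_ ?_
  · have m1 := WW_meas h K
    have m2 := z2_meas h
    have m3 := measurable_deriv (z₂ h)
    have m4 := z1_cont.measurable
    have m5 := Real.continuous_cosh.measurable
    have m6 := Real.continuous_cos.measurable
    apply Measurable.aestronglyMeasurable
    apply (m1.comp measurable_fst).mul
    apply Measurable.mul
    · apply (m3.comp measurable_snd).mul
      exact m6.comp ((m4.comp measurable_snd).mul measurable_fst)
    · exact m5.comp (measurable_fst.mul (m2.comp measurable_snd))
  · rw [ae_restrict_iff' (measurableSet_Ioi.prod measurableSet_Ioi)]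
    refine Filter.Eventually.of_forall (fun p hp => ?_)
    obtain ⟨hy, hγ⟩ := hp
    have hy : 0 < p.1 := hy
    have hγ : 0 < p.2 := hγ
    have c0 := Real.cosh_pos (p.1 * z₂ h p.2)
    rw [norm_mul, norm_mul, norm_mul, Real.norm_eq_abs, Real.norm_eq_abs, Real.norm_eq_abs, Real.norm_eq_abs, abs_of_pos c0, mul_assoc |WW h K p.1| (Real.cosh (p.1 * (0.71 * h)))]
    apply mul_le_mul_of_nonneg_left _ (abs_nonneg _)
    have c1 : Real.cosh (p.1 * z₂ h p.2) ≤ Real.cosh (p.1 * (0.71 * h)) := by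
      rw [Real.cosh_le_cosh, abs_mul, abs_mul, abs_of_pos hy, abs_of_pos (show 0 < 0.71 * h by positivity)]
      exact mul_le_mul_of_nonneg_left (z2_abs h0 hγ) hy.le
    rcases le_or_gt p.2 π with q | q
    · rw [Set.indicator_of_mem (show p.2 ∈ Set.Ioc 0 π from ⟨hγ, q⟩)]
      calc _ ≤ M * 1 * Real.cosh (p.1 * (0.71 * h)) := by
            gcongr
            · exact hM _ hγ
            · exact Real.abs_cos_le_one _
        _ = _ := by ring
    · rw [z2_deriv_out q, Set.indicator_of_notMem (fun hc => absurd hc.2 (not_le.2 q))]; simp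

lemma F2_int {h K : ℝ} (h0 : 0 < h) (hh : h ≤ 0.648) (hK : |K| < 1) :
    Integrable (fun p : ℝ × ℝ => dz p.2 * (WW h K p.1 * (Real.sin (p.1 * z₁ p.2) * Real.sinh (p.1 * (h * ff p.2)))))
      ((volume.restrict (Set.Ioi (0:ℝ))).prod (volume.restrict (Set.Ioc (0:ℝ) π))) := by
  have i1 : Integrable (fun _ : ℝ => (2.01:ℝ)) (volume.restrict (Set.Ioc (0:ℝ) π)) := by
    have : IsFiniteMeasure (volume.restrict (Set.Ioc (0:ℝ) π)) := ⟨by simp⟩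
    exact integrable_const _
  have g := (gW_int h0 hh hK).mul_prod i1
  rw [Measure.prod_restrict] at g ⊢
  refine Integrable.mono' g ?_ ?_
  · have m1 := WW_meas h K
    have c1 := z1_cont
    have c2 := dz_cont
    have c3 := ff_cont
    apply Measurable.aestronglyMeasurable
    apply (c2.measurable.comp measurable_snd).mul
    apply (m1.comp measurable_fst).mul
    apply Continuous.measurable
    fun_prop
  · rw [ae_restrict_iff' (measurableSet_Ioi.prod measurableSet_Ioc)]
    refine Filter.Eventually.of_forall (fun p hp => ?_)
    obtain ⟨hy, hγ⟩ := hp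
    have hy : 0 < p.1 := hy
    have d0 := dz_nonneg hγ.1.le hγ.2
    have d1 := dz_le hγ.1.le (by linarith [hγ.2, Real.pi_lt_d2])
    have s : |Real.sinh (p.1 * (h * ff p.2))| ≤ Real.cosh (p.1 * (0.71 * h)) := by
      rw [Real.abs_sinh]
      refine (Real.sinh_lt_cosh _).le.trans ?_
      rw [Real.cosh_le_cosh, abs_abs, abs_mul, abs_mul, abs_mul, abs_of_pos hy, abs_of_pos h0, abs_of_pos (show 0 < 0.71 * h by positivity)]
      have := ff_bd hγ.1.le
      have : h * |ff p.2| ≤ 0.71 * h := by nlinarith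
      exact mul_le_mul_of_nonneg_left this hy.le
    rw [norm_mul, norm_mul, norm_mul, Real.norm_eq_abs, Real.norm_eq_abs, Real.norm_eq_abs, Real.norm_eq_abs, abs_of_nonneg d0]
    calc _ ≤ 2.01 * (|WW h K p.1| * (1 * Real.cosh (p.1 * (0.71 * h)))) := by
          gcongr; exact Real.abs_sin_le_one _
      _ = _ := by ring

lemma Psi_int {h K : ℝ} (h0 : 0 < h) (hh : h ≤ 0.648) (hK : |K| < 1) :
    IntervalIntegrable (fun γ => dz γ * Psi h K (z₁ γ) (ff γ)) volume 0 π := by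
  rw [intervalIntegrable_iff_integrableOn_Ioc_of_le Real.pi_pos.le]
  have := (F2_int h0 hh hK).integral_prod_right
  simp only [integral_const_mul] at this
  exact this

lemma I2_eq {h K : ℝ} (h0 : 0 < h) (hh : h ≤ 0.648) (hK : |K| < 1) :
    I₂ h K = 4 * deriv (z₂ h) 0 * K * ∫ γ in (0:ℝ)..π, dz γ * Psi h K (z₁ γ) (ff γ) := by
  unfold I₂
  congr 1
  simp_rw [integrand_eq]
  rw [Measure.volume_eq_prod, setIntegral_prod _ (F1_int h0 hh hK)]
  have e1 : ∀ y ∈ Set.Ioi (0:ℝ), (∫ γ in Set.Ioi (0:ℝ), WW h K y * (deriv (z₂ h) γ * Real.cos (z₁ γ * y) * Real.cosh (y * z₂ h γ)))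
     = ∫ γ in Set.Ioc (0:ℝ) π, dz γ * (WW h K y * (Real.sin (y * z₁ γ) * Real.sinh (y * (h * ff γ)))) := by
    intro y hy
    rw [integral_const_mul]
    have s1 : ∫ γ in Set.Ioi (0:ℝ), deriv (z₂ h) γ * Real.cos (z₁ γ * y) * Real.cosh (y * z₂ h γ)
        = ∫ γ in Set.Ioo (0:ℝ) π, h * df γ * Real.cos (z₁ γ * y) * Real.cosh (y * (h * ff γ)) := by
      rw [setIntegral_eq_of_subset_of_forall_diff_eq_zero (s := Set.Ioc 0 π) measurableSet_Ioi (fun x hx => hx.1), integral_Ioc_eq_integral_Ioo]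
      · apply setIntegral_congr_fun measurableSet_Ioo
        intro γ hγ
        have : |γ| < π := by rw [abs_of_pos hγ.1]; exact hγ.2
        simp only [z2_deriv_in this, z2_eq this.le]
      · intro γ hγ
        have : π < γ := by
          by_contra hc; exact hγ.2 ⟨hγ.1, not_lt.1 hc⟩
        rw [z2_deriv_out this]; simp
    rw [s1, ← integral_Ioc_eq_integral_Ioo, ← intervalIntegral.integral_of_le Real.pi_pos.le, by_parts hy,
      ← intervalIntegral.integral_of_le Real.pi_pos.le, ← intervalIntegral.integral_const_mul]
    congr 1; ext γ; ring
  rw [setIntegral_congr_fun measurableSet_Ioi e1, integral_integral_swap (F2_int h0 hh hK), intervalIntegral.integral_of_le Real.pi_pos.le]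
  simp only [integral_const_mul]
  rfl


lemma I1_eq {h : ℝ} (h0 : 0 < h) :
    I₁ h = 2 * deriv (z₂ h) 0 * ∫ β in (0:ℝ)..π, Fs h 0 β := by
  unfold I₁
  congr 1
  rw [setIntegral_eq_of_subset_of_forall_diff_eq_zero (s := Set.Ioc 0 π) measurableSet_Ioi (fun x hx => hx.1),
    intervalIntegral.integral_of_le Real.pi_pos.le]
  · apply setIntegral_congr_fun measurableSet_Ioc
    intro β hβ
    have hb : |β| ≤ π := by rw [abs_of_pos hβ.1]; exact hβ.2
    simp only [z2_eq hb, (z1_deriv β).deriv, Fs, pp]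
    have x0 := Real.sinh_pos_iff.2 (z1_pos hβ.1)
    have q1 := Real.cosh_sq (z₁ β)
    have q2 := Real.sin_sq_add_cos_sq (h * ff β)
    have C1 : 1 < Real.cosh (z₁ β) := Real.one_lt_cosh.2 (z1_pos hβ.1).ne'
    have c1 := Real.cos_le_one (h * ff β)
    have c2 := Real.neg_one_le_cos (h * ff β)
    generalize Real.sinh (z₁ β) = S at *
    generalize Real.cosh (z₁ β) = C at *
    generalize Real.sin (h * ff β) = s at *
    generalize Real.cos (h * ff β) = c at *
    have d1 : C - c ≠ 0 := by linarith
    have d2 : C + c ≠ 0 := by linarith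
    have e : S^2 + s^2 = (C - c) * (C + c) := by linarith [show (C - c) * (C + c) = C^2 - c^2 by ring]
    have e2 : 2 + S^2 - s^2 = C^2 + c^2 := by linarith
    rw [e, e2]
    field_simp
    ring
  · intro γ hγ
    have : π < γ := by
      by_contra hc; exact hγ.2 ⟨hγ.1, not_lt.1 hc⟩
    rw [z2_zero this]; simp

lemma z2_deriv0 {h : ℝ} (h0 : 0 < h) : 0 < deriv (z₂ h) 0 := by
  rw [z2_deriv_in (by simp [Real.pi_pos])]
  apply mul_pos h0
  have e : bu 2 0 = bu (-2) 0 := by unfold bu; norm_num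
  have := far0 0 le_rfl
  unfold df b1
  rw [e]
  simp only [mul_zero, Real.cos_zero, Real.sin_zero]
  have := Real.pi_pos
  apply mul_pos (by positivity)
  linarith

noncomputable def Er (h K γ : ℝ) : ℝ := 2 * (dz γ * Psi h K (z₁ γ) (ff γ)) - Fs h 1 γ + Fs h 0 γ

lemma Fs_int {h σ : ℝ} (h0 : 0 < h) (hh : h ≤ 0.648) (hσ : |σ| ≤ 1) : IntervalIntegrable (Fs h σ) volume 0 π :=
  (Fs_int0 h0 hh hσ).trans (Fs_int1 (by norm_num) (by linarith [Real.pi_gt_three]))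

lemma Er_int {h K : ℝ} (h0 : 0 < h) (hh : h ≤ 0.648) (hK : |K| < 1) : IntervalIntegrable (Er h K) volume 0 π :=
  (((Psi_int h0 hh hK).const_mul 2).sub (Fs_int h0 hh (by norm_num))).add (Fs_int h0 hh (by norm_num))

lemma Er_eq {h K γ : ℝ} (h0 : 0 < h) (hh : h ≤ 0.648) (hK : |K| < 1) (hγ : 0 ≤ γ) :
    Er h K γ = dz γ * (2 * ∫ y in Set.Ioi (0:ℝ), PhiI h K (z₁ γ) (ff γ) y) := by
  have := Psi_eq (x := z₁ γ) h0 hh hK (ff_bd hγ)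
  unfold Er Fs
  linear_combination dz γ * this

lemma Psi_total {h K : ℝ} (h0 : 0 < h) (hh : h ≤ 0.648) (hK : |K| < 1) :
    2 * ∫ γ in (0:ℝ)..π, dz γ * Psi h K (z₁ γ) (ff γ) =
    (∫ γ in (0:ℝ)..π, Er h K γ) + (∫ γ in (0:ℝ)..π, Fs h 1 γ) - ∫ γ in (0:ℝ)..π, Fs h 0 γ := by
  have a1 := (Psi_int h0 hh hK).const_mul 2
  have a2 : IntervalIntegrable (Fs h 1) volume 0 π := Fs_int h0 hh (by norm_num)
  have a3 : IntervalIntegrable (Fs h 0) volume 0 π := Fs_int h0 hh (by norm_num)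
  unfold Er
  rw [intervalIntegral.integral_add (a1.sub a2) a3, intervalIntegral.integral_sub a1 a2, intervalIntegral.integral_const_mul]
  ring

lemma Fs_avg {h : ℝ} (h0 : 0 < h) (hh : h ≤ 0.648) :
    2 * ∫ γ in (0:ℝ)..π, Fs h 0 γ = (∫ γ in (0:ℝ)..π, Fs h 1 γ) + ∫ γ in (0:ℝ)..π, Fs h (-1) γ := by
  have a2 : IntervalIntegrable (Fs h 1) volume 0 π := Fs_int h0 hh (by norm_num)
  have a3 : IntervalIntegrable (Fs h (-1)) volume 0 π := Fs_int h0 hh (by norm_num)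
  rw [← intervalIntegral.integral_add a2 a3, ← intervalIntegral.integral_const_mul]
  congr 1; ext γ; unfold Fs; ring

lemma dzff_cont : Continuous (fun β => dz β * |ff β|) := by
  have c2 := dz_cont; have c3 := ff_cont; fun_prop

lemma pos_bd : (∫ β in (0:ℝ)..0.1, dz β * |ff β|) + (∫ β in (0.1:ℝ)..0.94062, dz β * |ff β|) + (∫ β in (2.36656:ℝ)..3.1415, dz β * |ff β|)
    + (∫ β in (3.1415:ℝ)..π, dz β * |ff β|) ≤ 0.2361698 := by
  have hp := Real.pi_gt_d6
  have t1 := gB_lower tab1 10000 (by norm_num) tab1_ok.1 (by rw [tab1_ok.2]; norm_num)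
  have t3 := gB_lower tab3 236656 (by norm_num) tab3_ok.1 (by rw [tab3_ok.2]; norm_num)
  rw [tab1_ok.2] at t1
  rw [tab3_ok.2] at t3
  have u : ((sumB gB tab1 : ℕ):ℝ) + (sumB gB tab3 : ℕ) ≤ 2359 * 10^19 := by exact_mod_cast pos_ok
  rw [show ((10000:ℕ):ℝ)/10^5 = 0.1 by norm_num, show ((94062:ℕ):ℝ)/10^5 = 0.94062 by norm_num] at t1
  rw [show ((236656:ℕ):ℝ)/10^5 = 2.36656 by norm_num, show ((314150:ℕ):ℝ)/10^5 = 3.1415 by norm_num] at t3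
  have d : Continuous (fun β => 0.71 * dz β) := by have := dz_cont; fun_prop
  have pt : ∀ x, 0 ≤ x → x ≤ π → dz x * |ff x| ≤ 0.71 * dz x := by
    intro x a b
    have := dz_nonneg a b
    have := ff_bd a
    nlinarith
  have e1 : ∫ β in (0:ℝ)..0.1, dz β * |ff β| ≤ ∫ β in (0:ℝ)..0.1, 0.71 * dz β :=
    intervalIntegral.integral_mono_on (by norm_num) (dzff_cont.intervalIntegrable _ _) (d.intervalIntegrable _ _)
      (fun x hx => pt x hx.1 (by linarith [hx.2]))
  have e2 : ∫ β in (3.1415:ℝ)..π, dz β * |ff β| ≤ ∫ β in (3.1415:ℝ)..π, 0.71 * dz β :=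
    intervalIntegral.integral_mono_on (by linarith) (dzff_cont.intervalIntegrable _ _) (d.intervalIntegrable _ _)
      (fun x hx => pt x (by linarith [hx.1]) hx.2)
  rw [intervalIntegral.integral_const_mul] at e1 e2
  have e := dz_end
  have t : ((sumB gB tab1 : ℕ):ℝ)/10^23 + ((sumB gB tab3 : ℕ):ℝ)/10^23 ≤ 0.2359 := by
    rw [← add_div, div_le_iff₀ (by norm_num)]; linarith
  linarith

lemma neg_bd : (∫ β in (0.94062:ℝ)..2.36656, dz β * |ff β|) ≤ 0.6132 := by
  have t1 := gB_lower tab2 94062 (by norm_num) tab2_ok.1 (by rw [tab2_ok.2]; norm_num)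
  rw [tab2_ok.2, show ((236656:ℕ):ℝ)/10^5 = 2.36656 by norm_num, show ((94062:ℕ):ℝ)/10^5 = 0.94062 by norm_num] at t1
  have u : ((sumB gB tab2 : ℕ):ℝ) ≤ 6132 * 10^19 := by exact_mod_cast neg_ok
  refine t1.trans ?_
  rw [div_le_iff₀ (by norm_num)]; linarith

lemma neg4_bd : (∫ β in (0.94062:ℝ)..2.36656, dz β * |ff β| * z₁ β ^ 4) ≤ 0.5361 := by
  have t1 := g4_lower tab2 94062 (by norm_num) tab2_ok.1 (by rw [tab2_ok.2]; norm_num)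
  rw [tab2_ok.2, show ((236656:ℕ):ℝ)/10^5 = 2.36656 by norm_num, show ((94062:ℕ):ℝ)/10^5 = 0.94062 by norm_num] at t1
  have u : ((sumB g4 tab2 : ℕ):ℝ) ≤ 5361 * 10^55 := by exact_mod_cast neg4_ok
  refine t1.trans ?_
  rw [div_le_iff₀ (by norm_num)]; linarith

lemma ff_nonpos {β : ℝ} (h1 : 0.94062 ≤ β) (h2 : β < 2.36656) : ff β ≤ 0 := by
  obtain ⟨M, B, hB, P, hβ⟩ := list_cover (β := β) tab2 94062 tab2_ok.1 (by rw [tab2_ok.2]; norm_num)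
    (by norm_num at h1 ⊢; linarith) (by rw [tab2_ok.2]; norm_num at h2 ⊢; linarith)
  have s := List.all_eq_true.1 sign_ok B hB
  have s := Nat.le_of_ble_eq_true s
  have s : 14200 * (B.r:ℝ) ≤ B.f := by exact_mod_cast s
  have k := (box_ff P hβ).2.1
  have q : 0 ≤ ((B.f:ℝ) - 14200 * B.r)/10^9 := div_nonneg (by linarith) (by norm_num)
  have k := q.trans k
  simp [sgn] at k
  linarith

lemma Er_abs {h K : ℝ} (h0 : 0 < h) (hh : h ≤ 0.648) (hK : |K| < 1) {γ : ℝ} (g0 : 0 ≤ γ) (g1 : γ ≤ π) :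
    Er h K γ ≤ 2 * h * 0.62 * (dz γ * |ff γ|) := by
  rw [Er_eq h0 hh hK g0]
  have d := dz_nonneg g0 g1
  have p := (abs_le.1 (Phi_neg (x := z₁ γ) h0 hh hK (ff_bd g0))).2
  have := mul_le_mul_of_nonneg_left p d
  linarith

lemma Er_low1 {h K : ℝ} (h0 : 0 < h) (hh : h ≤ 0.648) (hK0 : 0 ≤ K) (hK : K < 1) {γ : ℝ} (g0 : 0 ≤ γ) (g1 : γ ≤ π) :
    -(2 * h * 0.2150) * (dz γ * |ff γ|) ≤ Er h K γ := by
  rw [Er_eq h0 hh (by rw [abs_of_nonneg hK0]; exact hK) g0]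
  have d := dz_nonneg g0 g1
  have p := (abs_le.1 (Phi_pos (x := z₁ γ) h0 hh hK0 hK (ff_bd g0))).1
  have := mul_le_mul_of_nonneg_left p d
  linarith

lemma Er_low2 {h K : ℝ} (h0 : 0 < h) (hh : h ≤ 0.648) (hK0 : 0 ≤ K) (hK : K < 1) {γ : ℝ} (g0 : 0 ≤ γ) (g1 : γ ≤ π) (f0 : ff γ ≤ 0) :
    -(2 * h * 0.0416) * (dz γ * |ff γ|) + -(2 * h * 0.0091) * (dz γ * |ff γ| * z₁ γ ^ 4) ≤ Er h K γ := by
  rw [Er_eq h0 hh (by rw [abs_of_nonneg hK0]; exact hK) g0]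
  have d := dz_nonneg g0 g1
  have p := Phi_pos2 (x := z₁ γ) h0 hh hK0 hK (ff_bd g0) (z1_nonneg g0) f0
  have := mul_le_mul_of_nonneg_left p d
  linarith

lemma split5 {F : ℝ → ℝ} (hF : IntervalIntegrable F volume 0 π) :
    (∫ β in (0:ℝ)..π, F β) = (∫ β in (0:ℝ)..0.1, F β) + (∫ β in (0.1:ℝ)..0.94062, F β) + (∫ β in (0.94062:ℝ)..2.36656, F β)
      + (∫ β in (2.36656:ℝ)..3.1415, F β) + (∫ β in (3.1415:ℝ)..π, F β) := by
  have hp := Real.pi_gt_d6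
  have i : ∀ a b : ℝ, 0 ≤ a → a ≤ b → b ≤ π → IntervalIntegrable F volume a b := fun a b ha hab hb =>
    hF.mono_set (by rw [Set.uIcc_of_le hab, Set.uIcc_of_le Real.pi_pos.le]; exact Set.Icc_subset_Icc ha hb)
  rw [intervalIntegral.integral_add_adjacent_intervals (i _ _ (by norm_num) (by norm_num) (by linarith)) (i _ _ (by norm_num) (by norm_num) (by linarith)),
    intervalIntegral.integral_add_adjacent_intervals (i _ _ (by norm_num) (by norm_num) (by linarith)) (i _ _ (by norm_num) (by norm_num) (by linarith)),
    intervalIntegral.integral_add_adjacent_intervals (i _ _ (by norm_num) (by norm_num) (by linarith)) (i _ _ (by norm_num) (by norm_num) (by linarith)),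
    intervalIntegral.integral_add_adjacent_intervals (i _ _ (by norm_num) (by linarith) (by linarith)) (i _ _ (by norm_num) (by linarith) (by linarith))]

lemma Er_upper {h K : ℝ} (h0 : 0 < h) (hh : h ≤ 0.648) (hK : |K| < 1) :
    ∫ γ in (0:ℝ)..π, Er h K γ ≤ 2 * h * 0.5266094 := by
  have m := intervalIntegral.integral_mono_on Real.pi_pos.le (Er_int h0 hh hK)
    ((dzff_cont.intervalIntegrable 0 π).const_mul (2 * h * 0.62)) (fun x hx => Er_abs h0 hh hK hx.1 hx.2)
  rw [intervalIntegral.integral_const_mul, split5 (dzff_cont.intervalIntegrable 0 π)] at m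
  have a := pos_bd
  have b := neg_bd
  nlinarith

lemma Er_lower {h K : ℝ} (h0 : 0 < h) (hh : h ≤ 0.648) (hK0 : 0 ≤ K) (hK : K < 1) :
    -(2 * h * 0.0811642) ≤ ∫ γ in (0:ℝ)..π, Er h K γ := by
  have hp := Real.pi_gt_d6
  have hK' : |K| < 1 := by rw [abs_of_nonneg hK0]; exact hK
  have hF := Er_int h0 hh hK'
  rw [split5 hF]
  have i : ∀ a b : ℝ, 0 ≤ a → a ≤ b → b ≤ π → IntervalIntegrable (Er h K) volume a b := fun a b ha hab hb =>
    hF.mono_set (by rw [Set.uIcc_of_le hab, Set.uIcc_of_le Real.pi_pos.le]; exact Set.Icc_subset_Icc ha hb)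
  have r1 : ∀ a b : ℝ, 0 ≤ a → a ≤ b → b ≤ π → -(2 * h * 0.2150) * (∫ β in a..b, dz β * |ff β|) ≤ ∫ β in a..b, Er h K β := by
    intro a b ha hab hb
    rw [← intervalIntegral.integral_const_mul]
    exact intervalIntegral.integral_mono_on hab ((dzff_cont.intervalIntegrable _ _).const_mul _) (i a b ha hab hb)
      (fun x hx => Er_low1 h0 hh hK0 hK (ha.trans hx.1) (hx.2.trans hb))
  have c4 : Continuous (fun β => dz β * |ff β| * z₁ β ^ 4) := dzff_cont.mul (z1_cont.pow 4)
  have r2 : -(2 * h * 0.0416) * (∫ β in (0.94062:ℝ)..2.36656, dz β * |ff β|) + -(2 * h * 0.0091) * (∫ β in (0.94062:ℝ)..2.36656, dz β * |ff β| * z₁ β ^ 4)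
      ≤ ∫ β in (0.94062:ℝ)..2.36656, Er h K β := by
    have j1 := (dzff_cont.intervalIntegrable (μ := volume) 0.94062 2.36656).const_mul (-(2 * h * 0.0416))
    have j2 := (c4.intervalIntegrable (μ := volume) 0.94062 2.36656).const_mul (-(2 * h * 0.0091))
    rw [← intervalIntegral.integral_const_mul, ← intervalIntegral.integral_const_mul, ← intervalIntegral.integral_add j1 j2]
    refine intervalIntegral.integral_mono_on_of_le_Ioo (by norm_num) (j1.add j2) (i _ _ (by norm_num) (by norm_num) (by linarith)) ?_
    intro x hx
    exact Er_low2 h0 hh hK0 hK (by linarith [hx.1]) (by linarith [hx.2]) (ff_nonpos hx.1.le hx.2)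
  have q1 := r1 0 0.1 (by norm_num) (by norm_num) (by linarith)
  have q2 := r1 0.1 0.94062 (by norm_num) (by norm_num) (by linarith)
  have q3 := r1 2.36656 3.1415 (by norm_num) (by norm_num) (by linarith)
  have q4 := r1 3.1415 π (by norm_num) (by linarith) le_rfl
  have b1 := mul_le_mul_of_nonneg_left pos_bd (show 0 ≤ 2 * h * 0.2150 by positivity)
  have b2 := mul_le_mul_of_nonneg_left neg_bd (show 0 ≤ 2 * h * 0.0416 by positivity)
  have b3 := mul_le_mul_of_nonneg_left neg4_bd (show 0 ≤ 2 * h * 0.0091 by positivity)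
  clear r1 i hF
  linarith

/-- For every height `0.25 < h₂ < 0.648` of the permeability jump and every `K ∈ (-1,1)`,
`I₁(h₂) + I₂(h₂,K) > 0`: the curve does not undergo a short-time stability shift,
independently of the permeability jump `K`. -/
theorem inhomogeneous_muskat_no_shift_for_all_K :
    ∀ h₂ : ℝ, 0.25 < h₂ → h₂ < 0.648 →
      ∀ K : ℝ, -1 < K → K < 1 → 0 < I₁ h₂ + I₂ h₂ K := by
  intro h l u K k1 k2
  have h0 : 0 < h := by linarith
  have hK : |K| < 1 := abs_lt.2 ⟨k1, k2⟩
  rw [I1_eq h0, I2_eq h0 u.le hK]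
  have c := z2_deriv0 h0
  have e := Psi_total h0 u.le hK
  have f := Fs_avg h0 u.le
  have a1 := A_plus l u
  have a2 := A_minus l u
  have b2 := Er_upper h0 u.le hK
  have b1 := fun t => Er_lower h0 u.le (K := K) t k2
  generalize (∫ γ in (0:ℝ)..π, dz γ * Psi h K (z₁ γ) (ff γ)) = P at *
  generalize (∫ γ in (0:ℝ)..π, Er h K γ) = E at *
  generalize (∫ γ in (0:ℝ)..π, Fs h 0 γ) = A at *
  generalize (∫ γ in (0:ℝ)..π, Fs h 1 γ) = X at *
  generalize (∫ γ in (0:ℝ)..π, Fs h (-1) γ) = Y at *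
  have A0 : 0 < A := by linarith
  suffices s : 0 < A + K * (2 * P) by
    have := mul_pos c s
    linarith
  rw [e]
  rcases le_total 0 K with t | t
  · have b := b1 t
    have : 0 < X + E := by linarith
    have t1 := mul_pos (sub_pos.2 k2) A0
    have t2 := mul_nonneg t this.le
    linarith
  · have : 0 < Y - E := by linarith
    have t1 := mul_pos (show 0 < 1 + K by linarith) A0
    have t2 := mul_nonneg (neg_nonneg.2 t) this.le
    have : K * Y = K * (2 * A - X) := by rw [f]; ring
    linarith
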